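/- For any constants a, b > 0 with a + b < 1/2 and any constant C₀ > 0, there exist ε > 0, C > 0 and N such that the following holds for all n ≥ N. Let d = (d_1,…,d_n) be a graphical degree sequence satisfying δ ≤ C₀ n^{1/2+ε} and min{d̄, n − d̄ − 1} ≥ n/(3a log n), and let H be a graph on vertex set {1,…,n} with m ≤ C₀ n^{1+2ε} edges and degree sequence h = (h_1,…,h_n) with max_j h_j ≤ C₀ n^{1/2+ε} and δ³ μ₃ / (λ³ n²) ≤ C₀ n^{−b}. Then the expected number of copies of H in G ∼ 𝒢_d equals (n!/|Aut(H)|) λ^m exp( (1−λ)/(4λ) (μ₁² + 2μ₁ − 2μ₂) − (R/(2λ²n)) (μ₁² + μ₁ − μ₂) − ((1−λ²)/(6λ²n)) μ₃ − ((1−λ)/(λn²)) Σ_{jk ∈ E(H)} h_j h_k + E ) for some real E with |E| ≤ C n^{−b}. -/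

import Mathlib

open scoped BigOperators Classical

namespace Stmt9

/-- The degree of vertex `j` in the graph `G`. -/
noncomputable def deg {n : ℕ} (G : SimpleGraph (Fin n)) (j : Fin n) : ℕ :=
  (Finset.univ.filter (fun k => G.Adj j k)).card

/-- The set of simple graphs on `{1,…,n}` with degree sequence `d`. -/
noncomputable def degFinset (n : ℕ) (d : Fin n → ℕ) : Finset (SimpleGraph (Fin n)) :=
  Finset.univ.filter (fun G => ∀ j, deg G j = d j)

/-- The average degree `d̄`. -/
noncomputable def dbar (n : ℕ) (d : Fin n → ℕ) : ℝ := (∑ j, (d j : ℝ)) / n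

/-- The edge density `λ = d̄ / (n-1)`. -/
noncomputable def lam (n : ℕ) (d : Fin n → ℕ) : ℝ := dbar n d / ((n : ℝ) - 1)

/-- `R = (1/n) Σ_j (d_j - d̄)²`. -/
noncomputable def Rpar (n : ℕ) (d : Fin n → ℕ) : ℝ :=
  (∑ j, ((d j : ℝ) - dbar n d) ^ 2) / n

/-- `δ = max_j |d_j - d̄|`. -/
noncomputable def deltaPar (n : ℕ) (d : Fin n → ℕ) : ℝ :=
  ⨆ j : Fin n, |(d j : ℝ) - dbar n d|

/-- The number of automorphisms of `H`: permutations of the vertices preserving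
the edge set. -/
noncomputable def autCard {k : ℕ} (H : SimpleGraph (Fin k)) : ℕ :=
  (Finset.univ.filter
    (fun π : Equiv.Perm (Fin k) => ∀ i j, H.Adj (π i) (π j) ↔ H.Adj i j)).card

/-- The number of copies of `H` in `G`: spanning subgraphs of `G` isomorphic to `H`. -/
noncomputable def copyCount {n : ℕ} (H G : SimpleGraph (Fin n)) : ℕ :=
  (Finset.univ.filter
    (fun K : SimpleGraph (Fin n) => K ≤ G ∧ Nonempty (K ≃g H))).card

/-- The expected number of copies of `H` in a uniformly random graph with degree
sequence `d`. -/
noncomputable def expCopies (n : ℕ) (d : Fin n → ℕ) (H : SimpleGraph (Fin n)) : ℝ :=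
  (∑ G ∈ degFinset n d, (copyCount H G : ℝ)) / ((degFinset n d).card : ℝ)

/-- `μ_t = (1/n) Σ_j h_j^t` for the degree sequence `h` of `H`. -/
noncomputable def mu (n : ℕ) (H : SimpleGraph (Fin n)) (t : ℕ) : ℝ :=
  (∑ j, (deg H j : ℝ) ^ t) / n

/-- Real-valued adjacency indicator. -/
noncomputable def ad {n : ℕ} (G : SimpleGraph (Fin n)) (u v : Fin n) : ℝ :=
  if G.Adj u v then 1 else 0

/-- Average of `f` over a finite family of graphs. -/
noncomputable def Ex {n : ℕ} (K : Finset (SimpleGraph (Fin n)))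
    (f : SimpleGraph (Fin n) → ℝ) : ℝ := (∑ G ∈ K, f G) / (K.card : ℝ)

/-- The graphs of `𝒢` that contain `H` and avoid `Q`. -/
noncomputable def fam {n : ℕ} (𝒢 : Finset (SimpleGraph (Fin n))) (H Q : SimpleGraph (Fin n)) :
    Finset (SimpleGraph (Fin n)) :=
  𝒢.filter (fun G => (∀ u v, H.Adj u v → G.Adj u v) ∧ ∀ u v, Q.Adj u v → ¬ G.Adj u v)

section Basic
variable {n : ℕ} {G H Q : SimpleGraph (Fin n)} {K 𝒢 : Finset (SimpleGraph (Fin n))}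
  {f g : SimpleGraph (Fin n) → ℝ}

lemma ad_comm (G : SimpleGraph (Fin n)) (u v : Fin n) : ad G u v = ad G v u := by
  simp [ad, G.adj_comm]

lemma ad_nonneg (G : SimpleGraph (Fin n)) (u v : Fin n) : 0 ≤ ad G u v := by
  unfold ad; split_ifs <;> norm_num

lemma ad_le_one (G : SimpleGraph (Fin n)) (u v : Fin n) : ad G u v ≤ 1 := by
  unfold ad; split_ifs <;> norm_num

lemma ad_self (G : SimpleGraph (Fin n)) (u : Fin n) : ad G u u = 0 := by simp [ad]

lemma ad_of_adj {u v : Fin n} (h : G.Adj u v) : ad G u v = 1 := by simp [ad, h]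

lemma ad_of_not_adj {u v : Fin n} (h : ¬ G.Adj u v) : ad G u v = 0 := by simp [ad, h]

lemma ad_eq_zero_or_one (G : SimpleGraph (Fin n)) (u v : Fin n) : ad G u v = 0 ∨ ad G u v = 1 := by
  unfold ad; split_ifs <;> simp

lemma deg_eq_sum (G : SimpleGraph (Fin n)) (v : Fin n) : (deg G v : ℝ) = ∑ w, ad G v w := by
  simp [deg, ad, Finset.sum_boole]

lemma Ex_congr (h : ∀ G ∈ K, f G = g G) : Ex K f = Ex K g := by
  unfold Ex; rw [Finset.sum_congr rfl h]

lemma Ex_add (K : Finset (SimpleGraph (Fin n))) (f g : SimpleGraph (Fin n) → ℝ) :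
    Ex K (fun G => f G + g G) = Ex K f + Ex K g := by
  simp [Ex, Finset.sum_add_distrib, add_div]

lemma Ex_sub (K : Finset (SimpleGraph (Fin n))) (f g : SimpleGraph (Fin n) → ℝ) :
    Ex K (fun G => f G - g G) = Ex K f - Ex K g := by
  simp [Ex, Finset.sum_sub_distrib, sub_div]

lemma Ex_mul (K : Finset (SimpleGraph (Fin n))) (c : ℝ) (f : SimpleGraph (Fin n) → ℝ) :
    Ex K (fun G => c * f G) = c * Ex K f := by
  simp [Ex, ← Finset.mul_sum, mul_div_assoc]

lemma Ex_sum {ι : Type*} (s : Finset ι) (K : Finset (SimpleGraph (Fin n)))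
    (f : ι → SimpleGraph (Fin n) → ℝ) :
    Ex K (fun G => ∑ i ∈ s, f i G) = ∑ i ∈ s, Ex K (f i) := by
  unfold Ex; rw [Finset.sum_comm, Finset.sum_div]

lemma Ex_const (hK : K.Nonempty) (c : ℝ) : Ex K (fun _ => c) = c := by
  have : (K.card : ℝ) ≠ 0 := by exact_mod_cast hK.card_ne_zero
  simp [Ex]; field_simp

lemma Ex_mono (h : ∀ G ∈ K, f G ≤ g G) : Ex K f ≤ Ex K g :=
  div_le_div_of_nonneg_right (Finset.sum_le_sum h) (by positivity)

lemma Ex_nonneg (h : ∀ G ∈ K, 0 ≤ f G) : 0 ≤ Ex K f :=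
  div_nonneg (Finset.sum_nonneg h) (by positivity)

lemma abs_Ex_le (K : Finset (SimpleGraph (Fin n))) (f : SimpleGraph (Fin n) → ℝ) :
    |Ex K f| ≤ Ex K (fun G => |f G|) := by
  unfold Ex; rw [abs_div, Nat.abs_cast]
  exact div_le_div_of_nonneg_right (Finset.abs_sum_le_sum_abs _ _) (by positivity)

lemma Ex_le_const (hK : K.Nonempty) {c : ℝ} (h : ∀ G ∈ K, f G ≤ c) : Ex K f ≤ c :=
  (Ex_mono h).trans (Ex_const hK c).le

lemma abs_Ex_le_of (h : ∀ G ∈ K, |f G| ≤ g G) : |Ex K f| ≤ Ex K g :=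
  (abs_Ex_le K f).trans (Ex_mono h)

lemma mem_fam : G ∈ fam 𝒢 H Q ↔ G ∈ 𝒢 ∧ (∀ u v, H.Adj u v → G.Adj u v) ∧
    ∀ u v, Q.Adj u v → ¬ G.Adj u v := by simp [fam]

lemma fam_sup_edge {j v : Fin n} (hjv : j ≠ v) :
    fam 𝒢 (H ⊔ SimpleGraph.edge j v) Q = (fam 𝒢 H Q).filter (fun G => G.Adj j v) := by
  ext G
  simp only [mem_fam, Finset.mem_filter, SimpleGraph.sup_adj, SimpleGraph.edge_adj]
  constructor
  · rintro ⟨h1, h2, h3⟩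
    exact ⟨⟨h1, fun u w h => h2 u w (Or.inl h), h3⟩, h2 j v (Or.inr ⟨by simp, hjv⟩)⟩
  · rintro ⟨⟨h1, h2, h3⟩, h4⟩
    refine ⟨h1, ?_, h3⟩
    rintro u w (h | ⟨⟨rfl, rfl⟩ | ⟨rfl, rfl⟩, -⟩)
    · exact h2 u w h
    · exact h4
    · exact h4.symm

lemma fam_edge_sup {j v : Fin n} (hjv : j ≠ v) :
    fam 𝒢 H (Q ⊔ SimpleGraph.edge j v) = (fam 𝒢 H Q).filter (fun G => ¬ G.Adj j v) := by
  ext G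
  simp only [mem_fam, Finset.mem_filter, SimpleGraph.sup_adj, SimpleGraph.edge_adj]
  constructor
  · rintro ⟨h1, h2, h3⟩
    exact ⟨⟨h1, h2, fun u w h => h3 u w (Or.inl h)⟩, h3 j v (Or.inr ⟨by simp, hjv⟩)⟩
  · rintro ⟨⟨h1, h2, h3⟩, h4⟩
    refine ⟨h1, h2, ?_⟩
    rintro u w (h | ⟨⟨rfl, rfl⟩ | ⟨rfl, rfl⟩, -⟩)
    · exact h3 u w h
    · exact h4
    · exact fun h => h4 h.symm

lemma Ex_ad_mul {j v : Fin n} (hjv : j ≠ v) (f : SimpleGraph (Fin n) → ℝ) :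
    Ex (fam 𝒢 H Q) (fun G => ad G j v * f G) =
      Ex (fam 𝒢 H Q) (fun G => ad G j v) * Ex (fam 𝒢 (H ⊔ SimpleGraph.edge j v) Q) f := by
  rw [fam_sup_edge hjv]
  set K := fam 𝒢 H Q
  unfold Ex
  have h1 : ∑ G ∈ K, ad G j v * f G = ∑ G ∈ K.filter (fun G => G.Adj j v), f G := by
    rw [Finset.sum_filter]
    exact Finset.sum_congr rfl fun G _ => by unfold ad; split_ifs <;> simp
  have h2 : ∑ G ∈ K, ad G j v = ((K.filter (fun G => G.Adj j v)).card : ℝ) := by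
    unfold ad; rw [Finset.sum_boole]
  rw [h1, h2]
  by_cases h : ((K.filter (fun G => G.Adj j v)).card : ℝ) = 0
  · have h0 : K.filter (fun G => G.Adj j v) = ∅ := by
      rw [← Finset.card_eq_zero]; exact_mod_cast h
    simp [h0]
  · field_simp

lemma Ex_nad_mul {j v : Fin n} (hjv : j ≠ v) (f : SimpleGraph (Fin n) → ℝ) :
    Ex (fam 𝒢 H Q) (fun G => (1 - ad G j v) * f G) =
      Ex (fam 𝒢 H Q) (fun G => 1 - ad G j v) * Ex (fam 𝒢 H (Q ⊔ SimpleGraph.edge j v)) f := by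
  rw [fam_edge_sup hjv]
  set K := fam 𝒢 H Q
  unfold Ex
  have h1 : ∑ G ∈ K, (1 - ad G j v) * f G = ∑ G ∈ K.filter (fun G => ¬ G.Adj j v), f G := by
    rw [Finset.sum_filter]
    exact Finset.sum_congr rfl fun G _ => by unfold ad; split_ifs <;> simp_all
  have h2 : ∑ G ∈ K, (1 - ad G j v) = ((K.filter (fun G => ¬ G.Adj j v)).card : ℝ) := by
    rw [← Finset.sum_boole]
    exact Finset.sum_congr rfl fun G _ => by unfold ad; split_ifs <;> simp_all
  rw [h1, h2]
  by_cases h : ((K.filter (fun G => ¬ G.Adj j v)).card : ℝ) = 0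
  · have h0 : K.filter (fun G => ¬ G.Adj j v) = ∅ := by
      rw [← Finset.card_eq_zero]; exact_mod_cast h
    rw [h0]; simp
  · field_simp

lemma card_fam_sup_edge (hK : (fam 𝒢 H Q).Nonempty) {j v : Fin n} (hjv : j ≠ v) :
    ((fam 𝒢 (H ⊔ SimpleGraph.edge j v) Q).card : ℝ) =
      Ex (fam 𝒢 H Q) (fun G => ad G j v) * ((fam 𝒢 H Q).card : ℝ) := by
  have : ((fam 𝒢 H Q).card : ℝ) ≠ 0 := by exact_mod_cast hK.card_ne_zero
  rw [fam_sup_edge hjv]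
  unfold Ex ad
  rw [Finset.sum_boole]; field_simp

lemma card_fam_edge_sup (hK : (fam 𝒢 H Q).Nonempty) {j v : Fin n} (hjv : j ≠ v) :
    ((fam 𝒢 H (Q ⊔ SimpleGraph.edge j v)).card : ℝ) =
      (1 - Ex (fam 𝒢 H Q) (fun G => ad G j v)) * ((fam 𝒢 H Q).card : ℝ) := by
  have h0 : ((fam 𝒢 H Q).card : ℝ) ≠ 0 := by exact_mod_cast hK.card_ne_zero
  have h := Finset.card_filter_add_card_filter_not (s := fam 𝒢 H Q) (fun G => G.Adj j v)
  have h2 : (((fam 𝒢 H Q).filter (fun G => G.Adj j v)).card : ℝ) +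
      (((fam 𝒢 H Q).filter (fun G => ¬ G.Adj j v)).card : ℝ) = ((fam 𝒢 H Q).card : ℝ) := by
    exact_mod_cast h
  have h3 := card_fam_sup_edge hK hjv
  rw [fam_sup_edge hjv] at h3
  rw [fam_edge_sup hjv]; linarith

lemma Ex_one_sub_ad (hK : K.Nonempty) (j v : Fin n) :
    Ex K (fun G => 1 - ad G j v) = 1 - Ex K (fun G => ad G j v) := by
  rw [Ex_sub, Ex_const hK]

end Basic

section Toggle
variable {n : ℕ}

/-- Toggle the pairs `jw` and `lw` for all `w ∈ T`. -/
def tog (j l : Fin n) (T : Finset (Fin n)) (G : SimpleGraph (Fin n)) : SimpleGraph (Fin n) where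
  Adj u w := u ≠ w ∧
    ((((u = j ∨ u = l) ∧ w ∈ T) ∨ ((w = j ∨ w = l) ∧ u ∈ T)) ↔ ¬ G.Adj u w)
  symm := ⟨fun u w h => ⟨h.1.symm, by rw [G.adj_comm w u, ← h.2]; tauto⟩⟩
  loopless := ⟨by simp⟩

variable {j l : Fin n} {T : Finset (Fin n)} {G : SimpleGraph (Fin n)}

lemma tog_adj_left (hj : j ∉ T) (w : Fin n) :
    (tog j l T G).Adj j w ↔ (w ∈ T ↔ ¬ G.Adj j w) := by
  unfold tog
  by_cases hw : j = w
  · subst hw; simp [hj]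
  · simp [hj, hw]

lemma tog_adj_right (hl : l ∉ T) (w : Fin n) :
    (tog j l T G).Adj l w ↔ (w ∈ T ↔ ¬ G.Adj l w) := by
  unfold tog
  by_cases hw : l = w
  · subst hw; simp [hl]
  · simp [hl, hw]

lemma tog_adj_other {u w : Fin n} (h1 : u ≠ j) (h2 : u ≠ l) (h3 : w ≠ j) (h4 : w ≠ l) :
    (tog j l T G).Adj u w ↔ G.Adj u w := by
  unfold tog
  simp only [h1, h2, h3, h4, false_or, false_and, false_iff, not_not]
  exact ⟨fun h => h.2, fun h => ⟨h.ne, h⟩⟩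

lemma tog_tog (hj : j ∉ T) (hl : l ∉ T) : tog j l T (tog j l T G) = G := by
  ext u w
  by_cases h1 : u = j
  · subst h1; rw [tog_adj_left hj, tog_adj_left hj]; tauto
  by_cases h2 : u = l
  · subst h2; rw [tog_adj_right hl, tog_adj_right hl]; tauto
  by_cases h3 : w = j
  · subst h3
    rw [SimpleGraph.adj_comm, tog_adj_left hj, tog_adj_left hj, G.adj_comm]; tauto
  by_cases h4 : w = l
  · subst h4
    rw [SimpleGraph.adj_comm, tog_adj_right hl, tog_adj_right hl, G.adj_comm]; tauto
  rw [tog_adj_other h1 h2 h3 h4, tog_adj_other h1 h2 h3 h4]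

/-- Vertices `w ≠ j, l` for which `jw` and `lw` are not edges of `U`. -/
noncomputable def Fr (j l : Fin n) (U : SimpleGraph (Fin n)) : Finset (Fin n) :=
  Finset.univ.filter (fun w => w ≠ j ∧ w ≠ l ∧ ¬ U.Adj j w ∧ ¬ U.Adj l w)

/-- Free vertices at which the rows of `j` and `l` differ. -/
noncomputable def Sd (j l : Fin n) (F : Finset (Fin n)) (G : SimpleGraph (Fin n)) :
    Finset (Fin n) := F.filter (fun w => G.Adj j w ↔ ¬ G.Adj l w)

/-- Members of `Sd` adjacent to `j`. -/
noncomputable def Xd (j l : Fin n) (F : Finset (Fin n)) (G : SimpleGraph (Fin n)) :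
    Finset (Fin n) := (Sd j l F G).filter (fun w => G.Adj j w)

variable {F : Finset (Fin n)}

lemma Xd_subset : Xd j l F G ⊆ Sd j l F G := Finset.filter_subset _ _

lemma Sd_subset : Sd j l F G ⊆ F := Finset.filter_subset _ _

lemma Sd_tog (hj : j ∉ T) (hl : l ∉ T) : Sd j l F (tog j l T G) = Sd j l F G := by
  unfold Sd
  refine Finset.filter_congr fun w _ => ?_
  rw [tog_adj_left hj, tog_adj_right hl]; tauto

lemma Xd_tog (hj : j ∉ T) (hl : l ∉ T) (hT : T ⊆ Sd j l F G) :
    Xd j l F (tog j l T G) = symmDiff (Xd j l F G) T := by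
  ext w
  simp only [Xd, Sd_tog hj hl, Finset.mem_filter, tog_adj_left hj, Finset.mem_symmDiff]
  have := @hT w
  tauto

lemma card_Xd_real : ((Xd j l F G).card : ℝ) = ∑ w ∈ Sd j l F G, ad G j w := by
  simp [Xd, ad, Finset.sum_boole]

lemma card_Sd_sub_Xd_real :
    ((Sd j l F G).card : ℝ) - (Xd j l F G).card = ∑ w ∈ Sd j l F G, ad G l w := by
  rw [card_Xd_real, Finset.card_eq_sum_ones]
  push_cast
  rw [← Finset.sum_sub_distrib]
  refine Finset.sum_congr rfl fun w hw => ?_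
  have := (Finset.mem_filter.1 hw).2
  unfold ad; by_cases h : G.Adj j w <;> simp_all

lemma two_card_Xd_sub (j l : Fin n) (F : Finset (Fin n)) (G : SimpleGraph (Fin n)) :
    2 * ((Xd j l F G).card : ℝ) - (Sd j l F G).card = ∑ w ∈ F, (ad G j w - ad G l w) := by
  have h1 := @card_Xd_real n j l G F
  have h2 := @card_Sd_sub_Xd_real n j l G F
  have h3 : ∑ w ∈ F, (ad G j w - ad G l w) = ∑ w ∈ Sd j l F G, (ad G j w - ad G l w) := by
    unfold Sd
    rw [Finset.sum_filter]
    refine Finset.sum_congr rfl fun w _ => ?_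
    unfold ad; by_cases h : G.Adj j w <;> by_cases h' : G.Adj l w <;> simp_all
  rw [h3, Finset.sum_sub_distrib]; linarith

lemma deg_tog_left (hjF : j ∉ F) (hlF : l ∉ F) (hT : T ⊆ Sd j l F G) :
    (deg (tog j l T G) j : ℤ) - deg G j =
      ((symmDiff (Xd j l F G) T).card : ℤ) - (Xd j l F G).card := by
  have hj : j ∉ T := fun h => hjF (Sd_subset (hT h))
  have hl : l ∉ T := fun h => hlF (Sd_subset (hT h))
  have e : ((deg (tog j l T G) j : ℝ)) - deg G j =
      ((symmDiff (Xd j l F G) T).card : ℝ) - (Xd j l F G).card := by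
    rw [← Xd_tog hj hl hT, card_Xd_real, card_Xd_real, Sd_tog hj hl, deg_eq_sum, deg_eq_sum,
      ← Finset.sum_sub_distrib, ← Finset.sum_sub_distrib]
    refine (Finset.sum_subset (Finset.subset_univ _) fun w _ hw => ?_).symm
    have hwT : w ∉ T := fun h => hw (hT h)
    simp [ad, tog_adj_left hj, hwT]
  exact_mod_cast e

lemma deg_tog_right (hjF : j ∉ F) (hlF : l ∉ F) (hT : T ⊆ Sd j l F G) :
    (deg (tog j l T G) l : ℤ) - deg G l =
      ((Xd j l F G).card : ℤ) - (symmDiff (Xd j l F G) T).card := by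
  have hj : j ∉ T := fun h => hjF (Sd_subset (hT h))
  have hl : l ∉ T := fun h => hlF (Sd_subset (hT h))
  have e : ((deg (tog j l T G) l : ℝ)) - deg G l =
      ((Xd j l F G).card : ℝ) - (symmDiff (Xd j l F G) T).card := by
    have h1 := @card_Sd_sub_Xd_real n j l G F
    have h2 := @card_Sd_sub_Xd_real n j l (tog j l T G) F
    rw [Sd_tog hj hl, Xd_tog hj hl hT] at h2
    have h3 : ((deg (tog j l T G) l : ℝ)) - deg G l =
        ∑ w ∈ Sd j l F G, ad (tog j l T G) l w - ∑ w ∈ Sd j l F G, ad G l w := by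
      rw [deg_eq_sum, deg_eq_sum, ← Finset.sum_sub_distrib, ← Finset.sum_sub_distrib]
      refine (Finset.sum_subset (Finset.subset_univ _) fun w _ hw => ?_).symm
      have hwT : w ∉ T := fun h => hw (hT h)
      simp [ad, tog_adj_right hl, hwT]
    rw [h3]; linarith
  exact_mod_cast e

lemma deg_tog_other (hjl : j ≠ l) (hjF : j ∉ F) (hlF : l ∉ F) (hT : T ⊆ Sd j l F G) {v : Fin n}
    (hvj : v ≠ j) (hvl : v ≠ l) : deg (tog j l T G) v = deg G v := by
  have hj : j ∉ T := fun h => hjF (Sd_subset (hT h))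
  have hl : l ∉ T := fun h => hlF (Sd_subset (hT h))
  have e : (deg (tog j l T G) v : ℝ) = deg G v := by
    rw [deg_eq_sum, deg_eq_sum, ← sub_eq_zero, ← Finset.sum_sub_distrib]
    have h1 : ∑ w, (ad (tog j l T G) v w - ad G v w) =
        ∑ w ∈ ({j, l} : Finset (Fin n)), (ad (tog j l T G) v w - ad G v w) := by
      refine (Finset.sum_subset (Finset.subset_univ _) fun w _ hw => ?_).symm
      simp only [Finset.mem_insert, Finset.mem_singleton, not_or] at hw
      simp [ad, tog_adj_other hvj hvl hw.1 hw.2]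
    rw [h1, Finset.sum_pair hjl]
    by_cases hv : v ∈ T
    · have := (Finset.mem_filter.1 (hT hv)).2
      unfold ad
      rw [SimpleGraph.adj_comm _ v j, tog_adj_left hj, SimpleGraph.adj_comm _ v l,
        tog_adj_right hl, G.adj_comm v j, G.adj_comm v l]
      by_cases h : G.Adj j v <;> simp_all
    · unfold ad
      rw [SimpleGraph.adj_comm _ v j, tog_adj_left hj, SimpleGraph.adj_comm _ v l,
        tog_adj_right hl, G.adj_comm v j, G.adj_comm v l]
      simp [hv]
  exact_mod_cast e

/-- Subsets of `Sd` whose toggling gives `j` exactly `k` neighbours in `Sd`. -/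
noncomputable def TS (j l : Fin n) (F : Finset (Fin n)) (G : SimpleGraph (Fin n)) (k : ℤ) :
    Finset (Finset (Fin n)) :=
  (Sd j l F G).powerset.filter (fun T => ((symmDiff (Xd j l F G) T).card : ℤ) = k)

/-- Binomial coefficient with integer lower index. -/
def bin (s : ℕ) (k : ℤ) : ℕ := if 0 ≤ k then s.choose k.toNat else 0

lemma sum_TS (k : ℕ) (f : Finset (Fin n) → ℝ) :
    ∑ T ∈ TS j l F G k, f (symmDiff (Xd j l F G) T) =
      ∑ B ∈ (Sd j l F G).powersetCard k, f B := by
  have hs : ∀ T ⊆ Sd j l F G, symmDiff (Xd j l F G) T ⊆ Sd j l F G := by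
    intro T hT w hw
    rcases Finset.mem_symmDiff.1 hw with h | h
    · exact Xd_subset h.1
    · exact hT h.1
  refine Finset.sum_nbij' (fun T => symmDiff (Xd j l F G) T) (fun B => symmDiff (Xd j l F G) B)
    ?_ ?_ ?_ ?_ ?_
  · intro T hT
    simp only [TS, Finset.mem_filter, Finset.mem_powerset] at hT
    exact Finset.mem_powersetCard.2 ⟨hs T hT.1, by exact_mod_cast hT.2⟩
  · intro B hB
    have := Finset.mem_powersetCard.1 hB
    simp only [TS, Finset.mem_filter, Finset.mem_powerset]
    exact ⟨hs B this.1, by simp [this.2]⟩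
  · intro T _; simp
  · intro T _; simp
  · intro T _; rfl

lemma card_TS (k : ℤ) : (TS j l F G k).card = bin (Sd j l F G).card k := by
  unfold bin
  split_ifs with h
  · obtain ⟨k, rfl⟩ := Int.eq_ofNat_of_zero_le h
    have := sum_TS (j := j) (l := l) (F := F) (G := G) k (fun _ => 1)
    simp only [Finset.sum_const, nsmul_eq_mul, mul_one, Finset.card_powersetCard] at this
    exact_mod_cast this
  · rw [Finset.card_eq_zero, Finset.eq_empty_iff_forall_notMem]
    intro T hT
    have := (Finset.mem_filter.1 hT).2
    omega

/-- `𝒢` is closed under graphs whose degree sequence is a permutation of that of a member. -/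
def Clos (𝒢 : Finset (SimpleGraph (Fin n))) : Prop :=
  ∀ G ∈ 𝒢, ∀ (G' : SimpleGraph (Fin n)) (σ : Equiv.Perm (Fin n)),
    (∀ v, deg G' v = deg G (σ v)) → G' ∈ 𝒢

variable {𝒢 : Finset (SimpleGraph (Fin n))} {H Q : SimpleGraph (Fin n)}

lemma left_notMem_Fr (j l : Fin n) (U : SimpleGraph (Fin n)) : j ∉ Fr j l U := by simp [Fr]
lemma right_notMem_Fr (j l : Fin n) (U : SimpleGraph (Fin n)) : l ∉ Fr j l U := by simp [Fr]

lemma tog_mem_fam (h𝒢 : Clos 𝒢) (hjl : j ≠ l) (hG : G ∈ fam 𝒢 H Q)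
    (hT : T ⊆ Sd j l (Fr j l (H ⊔ Q)) G)
    (hk : ((symmDiff (Xd j l (Fr j l (H ⊔ Q)) G) T).card : ℤ) =
        (Xd j l (Fr j l (H ⊔ Q)) G).card ∨
      ((symmDiff (Xd j l (Fr j l (H ⊔ Q)) G) T).card : ℤ) =
        (Xd j l (Fr j l (H ⊔ Q)) G).card - ((deg G j : ℤ) - deg G l)) :
    tog j l T G ∈ fam 𝒢 H Q := by
  set F := Fr j l (H ⊔ Q) with hF
  have hjF : j ∉ F := left_notMem_Fr j l _
  have hlF : l ∉ F := right_notMem_Fr j l _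
  have hj : j ∉ T := fun h => hjF (Sd_subset (hT h))
  have hl : l ∉ T := fun h => hlF (Sd_subset (hT h))
  have hTF : ∀ w ∈ T, ¬ H.Adj j w ∧ ¬ H.Adj l w ∧ ¬ Q.Adj j w ∧ ¬ Q.Adj l w := by
    intro w hw
    have := Sd_subset (hT hw)
    rw [hF] at this
    simp only [Fr, Finset.mem_filter, SimpleGraph.sup_adj] at this
    tauto
  have d1 := deg_tog_left hjF hlF hT
  have d2 := deg_tog_right hjF hlF hT
  have d3 := @deg_tog_other n j l T G F hjl hjF hlF hT
  rw [mem_fam] at hG ⊢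
  have key : ∀ u w, ((H.Adj u w ∨ Q.Adj u w) → ((tog j l T G).Adj u w ↔ G.Adj u w)) := by
    intro u w h
    by_cases h1 : u = j
    · subst h1; rw [tog_adj_left hj]; have := hTF w; tauto
    by_cases h2 : u = l
    · subst h2; rw [tog_adj_right hl]; have := hTF w; tauto
    by_cases h3 : w = j
    · subst h3
      rw [SimpleGraph.adj_comm, tog_adj_left hj, G.adj_comm u w]
      rw [H.adj_comm, Q.adj_comm] at h
      have := hTF u; tauto
    by_cases h4 : w = l
    · subst h4
      rw [SimpleGraph.adj_comm, tog_adj_right hl, G.adj_comm u w]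
      rw [H.adj_comm, Q.adj_comm] at h
      have := hTF u; tauto
    exact tog_adj_other h1 h2 h3 h4
  refine ⟨?_, fun u w h => (key u w (Or.inl h)).2 (hG.2.1 u w h),
    fun u w h => fun h' => hG.2.2 u w h ((key u w (Or.inr h)).1 h')⟩
  rcases hk with hk | hk
  · refine h𝒢 G hG.1 _ 1 fun v => ?_
    rw [Equiv.Perm.one_apply]
    by_cases h1 : v = j
    · subst h1; omega
    by_cases h2 : v = l
    · subst h2; omega
    exact d3 h1 h2
  · refine h𝒢 G hG.1 _ (Equiv.swap j l) fun v => ?_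
    by_cases h1 : v = j
    · subst h1; rw [Equiv.swap_apply_left]; omega
    by_cases h2 : v = l
    · subst h2; rw [Equiv.swap_apply_right]; omega
    rw [Equiv.swap_apply_of_ne_of_ne h1 h2]
    exact d3 h1 h2

/-- Double counting over pairs of a graph and an admissible toggle; `c = 0` preserves the degrees
of `j` and `l`, `c = 1` exchanges them. -/
lemma sum_toggle (h𝒢 : Clos 𝒢) (hjl : j ≠ l) {c : ℤ} (hc : c = 0 ∨ c = 1)
    (Φ : SimpleGraph (Fin n) → Finset (Fin n) → ℝ) :
    ∑ G ∈ fam 𝒢 H Q, ∑ T ∈ TS j l (Fr j l (H ⊔ Q)) G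
        ((Xd j l (Fr j l (H ⊔ Q)) G).card - c * ((deg G j : ℤ) - deg G l)), Φ G T =
    ∑ G ∈ fam 𝒢 H Q, ∑ T ∈ TS j l (Fr j l (H ⊔ Q)) G
        ((Xd j l (Fr j l (H ⊔ Q)) G).card - c * ((deg G j : ℤ) - deg G l)), Φ (tog j l T G) T := by
  set F := Fr j l (H ⊔ Q) with hF
  have hjF : j ∉ F := left_notMem_Fr j l _
  have hlF : l ∉ F := right_notMem_Fr j l _
  rw [Finset.sum_sigma', Finset.sum_sigma']
  have main : ∀ p : (Σ _ : SimpleGraph (Fin n), Finset (Fin n)),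
      p ∈ (fam 𝒢 H Q).sigma (fun G => TS j l F G
        ((Xd j l F G).card - c * ((deg G j : ℤ) - deg G l))) →
      (⟨tog j l p.2 p.1, p.2⟩ : (Σ _ : SimpleGraph (Fin n), Finset (Fin n))) ∈
        (fam 𝒢 H Q).sigma (fun G => TS j l F G
        ((Xd j l F G).card - c * ((deg G j : ℤ) - deg G l))) ∧ j ∉ p.2 ∧ l ∉ p.2 := by
    rintro ⟨G, T⟩ h
    simp only [Finset.mem_sigma, TS, Finset.mem_filter, Finset.mem_powerset] at h ⊢
    obtain ⟨hG, hT, hk⟩ := h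
    have hj : j ∉ T := fun h => hjF (Sd_subset (hT h))
    have hl : l ∉ T := fun h => hlF (Sd_subset (hT h))
    refine ⟨⟨tog_mem_fam h𝒢 hjl hG hT ?_, ?_, ?_⟩, hj, hl⟩
    · rcases hc with rfl | rfl
      · left; linarith
      · right; linarith
    · rw [Sd_tog hj hl]; exact hT
    · rw [Xd_tog hj hl hT, symmDiff_symmDiff_cancel_right]
      have d1 := deg_tog_left hjF hlF hT
      have d2 := deg_tog_right hjF hlF hT
      rcases hc with rfl | rfl <;> linarith
  refine Finset.sum_nbij' (fun p => ⟨tog j l p.2 p.1, p.2⟩) (fun p => ⟨tog j l p.2 p.1, p.2⟩)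
    (fun p hp => (main p hp).1) (fun p hp => (main p hp).1) ?_ ?_ ?_
  · rintro ⟨G, T⟩ hp
    have := main _ hp
    simp only [tog_tog this.2.1 this.2.2]
  · rintro ⟨G, T⟩ hp
    have := main _ hp
    simp only [tog_tog this.2.1 this.2.2]
  · rintro ⟨G, T⟩ hp
    have := main _ hp
    simp only [tog_tog this.2.1 this.2.2]

end Toggle

section Tail

lemma binomial_mode_step_up {s x k : ℕ} (hxs : x ≤ s) (hk : k < x) :
    s.choose k * x ^ k * (s - x) ^ (s - k) ≤
      s.choose (k + 1) * x ^ (k + 1) * (s - x) ^ (s - (k + 1)) := by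
  have e : s - k = (s - (k + 1)) + 1 := by omega
  have h1 := Nat.choose_succ_right_eq s k
  have h2 : (k + 1) * (s - x) ≤ (s - k) * x := by
    obtain ⟨y, rfl⟩ := Nat.exists_eq_add_of_le hxs
    obtain ⟨i, rfl⟩ := Nat.exists_eq_add_of_lt hk
    have : k + i + 1 + y - k = i + 1 + y := by omega
    rw [this, Nat.add_sub_cancel_left]; nlinarith
  refine Nat.le_of_mul_le_mul_right ?_ (Nat.succ_pos k)
  calc s.choose k * x ^ k * (s - x) ^ (s - k) * (k + 1)
      = s.choose k * x ^ k * (s - x) ^ (s - (k + 1)) * ((k + 1) * (s - x)) := by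
        rw [e, pow_succ]; ring
    _ ≤ s.choose k * x ^ k * (s - x) ^ (s - (k + 1)) * ((s - k) * x) :=
        Nat.mul_le_mul_left _ h2
    _ = (s.choose k * (s - k)) * x ^ (k + 1) * (s - x) ^ (s - (k + 1)) := by ring
    _ = _ := by rw [← h1, Nat.succ_eq_add_one]; ring

lemma binomial_mode_step_down {s x k : ℕ} (hk : x ≤ k) (hks : k < s) :
    s.choose (k + 1) * x ^ (k + 1) * (s - x) ^ (s - (k + 1)) ≤
      s.choose k * x ^ k * (s - x) ^ (s - k) := by
  have e : s - k = (s - (k + 1)) + 1 := by omega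
  have h1 := Nat.choose_succ_right_eq s k
  have h2 : (s - k) * x ≤ (k + 1) * (s - x) := by
    obtain ⟨i, rfl⟩ := Nat.exists_eq_add_of_le hk
    obtain ⟨y, rfl⟩ := Nat.exists_eq_add_of_lt hks
    have : x + i + y + 1 - (x + i) = y + 1 := by omega
    have h' : x + i + y + 1 - x = i + y + 1 := by omega
    rw [this, h']; nlinarith
  refine Nat.le_of_mul_le_mul_right ?_ (Nat.succ_pos k)
  calc s.choose (k + 1) * x ^ (k + 1) * (s - x) ^ (s - (k + 1)) * (k + 1)
      = (s.choose (k + 1) * (k + 1)) * x ^ (k + 1) * (s - x) ^ (s - (k + 1)) := by ring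
    _ = s.choose k * x ^ k * (s - x) ^ (s - (k + 1)) * ((s - k) * x) := by rw [h1]; ring
    _ ≤ s.choose k * x ^ k * (s - x) ^ (s - (k + 1)) * ((k + 1) * (s - x)) :=
        Nat.mul_le_mul_left _ h2
    _ = _ := by rw [e, pow_succ]; simp only [Nat.succ_eq_add_one]; ring

lemma binomial_mode {s x k : ℕ} (hxs : x ≤ s) (hks : k ≤ s) :
    s.choose k * x ^ k * (s - x) ^ (s - k) ≤ s.choose x * x ^ x * (s - x) ^ (s - x) := by
  rcases le_total k x with h | h
  · induction h using Nat.decreasingInduction with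
    | self => exact le_rfl
    | of_succ k hk ih => exact (binomial_mode_step_up hxs hk).trans (ih (by omega))
  · induction k, h using Nat.le_induction with
    | base => exact le_rfl
    | succ k hk ih => exact (binomial_mode_step_down hk (by omega)).trans (ih (by omega))

lemma binomial_mode_lower {s x : ℕ} (hxs : x ≤ s) :
    s ^ s ≤ (s + 1) * (s.choose x * x ^ x * (s - x) ^ (s - x)) := by
  have h : (x + (s - x)) ^ s = _ := add_pow x (s - x) s
  rw [Nat.add_sub_cancel' hxs] at h
  rw [h]
  calc _ ≤ ∑ k ∈ Finset.range (s + 1), s.choose x * x ^ x * (s - x) ^ (s - x) := by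
        refine Finset.sum_le_sum fun k hk => ?_
        have := binomial_mode (k := k) hxs (by simp at hk; omega)
        calc _ = s.choose k * x ^ k * (s - x) ^ (s - k) := by simp only [Nat.cast_id]; ring
          _ ≤ _ := this
    _ = _ := by simp

lemma one_add_mul_exp_sub_le {q φ : ℝ} (hq : 0 ≤ q) (hφ : |φ| ≤ 1) :
    (1 - q) + q * Real.exp φ ≤ Real.exp (q * (φ + φ ^ 2)) := by
  have h := Real.abs_exp_sub_one_sub_id_le hφ
  have h2 : Real.exp φ ≤ 1 + φ + φ ^ 2 := by linarith [(abs_le.1 h).2]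
  have h3 := Real.add_one_le_exp (q * (φ + φ ^ 2))
  nlinarith

variable {α : Type*} [DecidableEq α]

lemma sum_exp_powersetCard_le {S U : Finset α} (hU : U ⊆ S) {x : ℕ} (hx : x ≤ S.card) {φ : ℝ}
    (hφ : |φ| ≤ 1) :
    ∑ B ∈ S.powersetCard x, Real.exp (φ * ((B ∩ U).card : ℝ)) ≤
      (S.card + 1) * S.card.choose x *
        Real.exp ((U.card : ℝ) * ((x : ℝ) / S.card) * (φ + φ ^ 2)) := by
  rcases Nat.eq_zero_or_pos S.card with h0 | hpos
  · have hS : S = ∅ := Finset.card_eq_zero.1 h0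
    subst hS
    have hU' : U = ∅ := Finset.subset_empty.1 hU
    have hx' : x = 0 := by simpa using hx
    subst hU'; subst hx'; simp
  set s := S.card with hs
  have hsr : (0 : ℝ) < s := by exact_mod_cast hpos
  set q : ℝ := (x : ℝ) / s with hq
  have hq0 : 0 ≤ q := by positivity
  have hq1 : q ≤ 1 := by rw [hq, div_le_one hsr]; exact_mod_cast hx
  have hprod : ∏ u ∈ S, ((1 - q) + q * Real.exp (φ * (if u ∈ U then 1 else 0))) ≤
      Real.exp ((U.card : ℝ) * q * (φ + φ ^ 2)) := by
    calc _ ≤ ∏ u ∈ S, Real.exp ((if u ∈ U then 1 else 0) * (q * (φ + φ ^ 2))) := by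
          refine Finset.prod_le_prod (fun u _ => ?_) (fun u _ => ?_)
          · have := Real.exp_pos (φ * (if u ∈ U then 1 else 0)); nlinarith
          · split_ifs
            · simpa using one_add_mul_exp_sub_le hq0 hφ
            · simp
      _ = _ := by
          rw [← Real.exp_sum, ← Finset.sum_mul, Finset.sum_boole]
          congr 1
          have : S.filter (fun u => u ∈ U) = U := by
            rw [Finset.filter_mem_eq_inter]; exact Finset.inter_eq_right.2 hU
          rw [this]; ring
  have hexp : ∑ B ∈ S.powersetCard x,
      (q ^ x * (1 - q) ^ (s - x)) * Real.exp (φ * ((B ∩ U).card : ℝ)) ≤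
      ∏ u ∈ S, ((1 - q) + q * Real.exp (φ * (if u ∈ U then 1 else 0))) := by
    rw [Finset.prod_congr rfl (fun u _ => add_comm _ _), Finset.prod_add]
    calc _ ≤ ∑ B ∈ S.powersetCard x, (∏ u ∈ B, q * Real.exp (φ * (if u ∈ U then 1 else 0))) *
            ∏ u ∈ S \ B, (1 - q) := by
          refine Finset.sum_le_sum fun B hB => le_of_eq ?_
          obtain ⟨hB1, hB2⟩ := Finset.mem_powersetCard.1 hB
          rw [Finset.prod_mul_distrib, Finset.prod_const, Finset.prod_const,
            Finset.card_sdiff_of_subset hB1, hB2, ← Real.exp_sum, ← Finset.mul_sum,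
            Finset.sum_boole, Finset.filter_mem_eq_inter]
          ring
      _ ≤ _ := by
          refine Finset.sum_le_sum_of_subset_of_nonneg ?_ fun B _ _ => ?_
          · intro B hB; exact Finset.mem_powerset.2 (Finset.mem_powersetCard.1 hB).1
          · refine mul_nonneg (Finset.prod_nonneg fun u _ => by positivity)
              (Finset.prod_nonneg fun u _ => by linarith)
  rw [← Finset.mul_sum] at hexp
  have hmode : 1 ≤ (s + 1) * s.choose x * (q ^ x * (1 - q) ^ (s - x)) := by
    have h := binomial_mode_lower hx
    have h' : ((s : ℝ)) ^ s ≤ (s + 1) * (s.choose x * (x : ℝ) ^ x * ((s : ℝ) - x) ^ (s - x)) := by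
      have : ((s ^ s : ℕ) : ℝ) ≤ (((s + 1) * (s.choose x * x ^ x * (s - x) ^ (s - x)) : ℕ) : ℝ) := by
        exact_mod_cast h
      push_cast [Nat.cast_sub hx] at this
      exact this
    have e1 : (1 - q) = ((s : ℝ) - x) / s := by rw [hq]; field_simp
    rw [e1, hq, div_pow, div_pow, div_mul_div_comm, ← pow_add, Nat.add_sub_cancel' hx,
      ← mul_div_assoc, le_div_iff₀ (by positivity)]
    linarith
  have hE : 0 ≤ ∑ B ∈ S.powersetCard x, Real.exp (φ * ((B ∩ U).card : ℝ)) :=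
    Finset.sum_nonneg fun _ _ => (Real.exp_pos _).le
  calc _ ≤ ((s + 1) * s.choose x * (q ^ x * (1 - q) ^ (s - x))) *
        ∑ B ∈ S.powersetCard x, Real.exp (φ * ((B ∩ U).card : ℝ)) := le_mul_of_one_le_left hE hmode
    _ = ((s + 1) * s.choose x) * ((q ^ x * (1 - q) ^ (s - x)) *
        ∑ B ∈ S.powersetCard x, Real.exp (φ * ((B ∩ U).card : ℝ))) := by ring
    _ ≤ ((s + 1) * s.choose x) * Real.exp ((U.card : ℝ) * q * (φ + φ ^ 2)) := by
        gcongr; exact hexp.trans hprod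

/-- Hypergeometric tail bound. -/
lemma card_tail_le {S U : Finset α} (hU : U ⊆ S) {x : ℕ} (hx : x ≤ S.card) {t N : ℝ}
    (hN : (S.card : ℝ) ≤ N) (hN0 : 0 < N) (ht : 0 ≤ t) (htN : t ≤ N) :
    (((S.powersetCard x).filter (fun B => 2 * t + |2 * (x : ℝ) - S.card| <
      |2 * ((B ∩ U).card : ℝ) - U.card|)).card : ℝ) ≤
      2 * (S.card + 1) * Real.exp (-(t ^ 2 / (4 * N))) * S.card.choose x := by
  set q : ℝ := (x : ℝ) / S.card with hq
  have hm : (U.card : ℝ) ≤ S.card := by exact_mod_cast Finset.card_le_card hU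
  have hq0 : 0 ≤ q := by positivity
  have hq1 : q ≤ 1 := by
    rw [hq]; exact div_le_one_of_le₀ (by exact_mod_cast hx) (by positivity)
  have hmid : |(U.card : ℝ) * (2 * q - 1)| ≤ |2 * (x : ℝ) - S.card| := by
    rcases Nat.eq_zero_or_pos S.card with h0 | hpos
    · have : (U.card : ℝ) = 0 := by
        have : U.card = 0 := Nat.le_zero.1 (h0 ▸ Finset.card_le_card hU)
        exact_mod_cast this
      rw [this]; simp
    · have hsr : (0 : ℝ) < S.card := by exact_mod_cast hpos
      have : 2 * (x : ℝ) - S.card = S.card * (2 * q - 1) := by rw [hq]; field_simp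
      rw [this, abs_mul, abs_mul, Nat.abs_cast, Nat.abs_cast]
      gcongr
  set φ : ℝ := t / (2 * N) with hφ
  have hφ0 : 0 ≤ φ := by positivity
  have hφ1 : φ ≤ 1 := by rw [hφ, div_le_one (by positivity)]; linarith
  have hmq : (U.card : ℝ) * q ≤ N := by nlinarith
  have hφt : φ * t = t ^ 2 / (2 * N) := by rw [hφ]; ring
  have hφN : N * φ ^ 2 = t ^ 2 / (4 * N) := by rw [hφ]; field_simp; ring
  have hhalf : t ^ 2 / (2 * N) = 2 * (t ^ 2 / (4 * N)) := by field_simp; ring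
  have hpt : ∀ B : Finset α, (2 * t + |2 * (x : ℝ) - S.card| <
      |2 * ((B ∩ U).card : ℝ) - U.card|) →
      1 ≤ Real.exp (-(φ * (U.card * q)) - φ * t) * Real.exp (φ * (B ∩ U).card) +
        Real.exp (φ * (U.card * q) - φ * t) * Real.exp (-φ * (B ∩ U).card) := by
    intro B hB
    have h1 : t < |((B ∩ U).card : ℝ) - U.card * q| := by
      have e : 2 * ((B ∩ U).card : ℝ) - U.card =
        2 * (((B ∩ U).card : ℝ) - U.card * q) + U.card * (2 * q - 1) := by ring
      rw [e] at hB
      have h2 := abs_add_le (2 * (((B ∩ U).card : ℝ) - U.card * q)) (U.card * (2 * q - 1))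
      rw [abs_mul, abs_two] at h2
      linarith
    rw [← Real.exp_add, ← Real.exp_add]
    rcases lt_abs.1 h1 with h | h
    · have : 1 ≤ Real.exp (-(φ * (U.card * q)) - φ * t + φ * (B ∩ U).card) :=
        Real.one_le_exp (by nlinarith)
      linarith [Real.exp_pos (φ * (U.card * q) - φ * t + -φ * (B ∩ U).card)]
    · have : 1 ≤ Real.exp (φ * (U.card * q) - φ * t + -φ * (B ∩ U).card) :=
        Real.one_le_exp (by nlinarith)
      linarith [Real.exp_pos (-(φ * (U.card * q)) - φ * t + φ * (B ∩ U).card)]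
  have hA := sum_exp_powersetCard_le hU hx (φ := φ) (by rw [abs_of_nonneg hφ0]; exact hφ1)
  have hB := sum_exp_powersetCard_le hU hx (φ := -φ) (by rw [abs_neg, abs_of_nonneg hφ0]; exact hφ1)
  rw [← hq] at hA hB
  have hc : (0 : ℝ) ≤ (S.card + 1) * S.card.choose x := by positivity
  calc _ = ∑ B ∈ (S.powersetCard x).filter (fun B => 2 * t + |2 * (x : ℝ) - S.card| <
          |2 * ((B ∩ U).card : ℝ) - U.card|), (1 : ℝ) := by simp
    _ ≤ ∑ B ∈ (S.powersetCard x).filter (fun B => 2 * t + |2 * (x : ℝ) - S.card| <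
          |2 * ((B ∩ U).card : ℝ) - U.card|),
        (Real.exp (-(φ * (U.card * q)) - φ * t) * Real.exp (φ * (B ∩ U).card) +
        Real.exp (φ * (U.card * q) - φ * t) * Real.exp (-φ * (B ∩ U).card)) :=
        Finset.sum_le_sum fun B hB => hpt B (Finset.mem_filter.1 hB).2
    _ ≤ ∑ B ∈ S.powersetCard x,
        (Real.exp (-(φ * (U.card * q)) - φ * t) * Real.exp (φ * (B ∩ U).card) +
        Real.exp (φ * (U.card * q) - φ * t) * Real.exp (-φ * (B ∩ U).card)) :=
        Finset.sum_le_sum_of_subset_of_nonneg (Finset.filter_subset _ _) fun _ _ _ => by positivity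
    _ ≤ Real.exp (-(φ * (U.card * q)) - φ * t) * ((S.card + 1) * S.card.choose x *
          Real.exp ((U.card : ℝ) * q * (φ + φ ^ 2))) +
        Real.exp (φ * (U.card * q) - φ * t) * ((S.card + 1) * S.card.choose x *
          Real.exp ((U.card : ℝ) * q * (-φ + (-φ) ^ 2))) := by
        rw [Finset.sum_add_distrib, ← Finset.mul_sum, ← Finset.mul_sum]
        gcongr
    _ = (S.card + 1) * S.card.choose x * (2 * Real.exp ((U.card : ℝ) * q * φ ^ 2 - φ * t)) := by
        have e1 : Real.exp (-(φ * (U.card * q)) - φ * t) *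
            Real.exp ((U.card : ℝ) * q * (φ + φ ^ 2)) =
            Real.exp ((U.card : ℝ) * q * φ ^ 2 - φ * t) := by
          rw [← Real.exp_add]; congr 1; ring
        have e2 : Real.exp (φ * (U.card * q) - φ * t) *
            Real.exp ((U.card : ℝ) * q * (-φ + (-φ) ^ 2)) =
            Real.exp ((U.card : ℝ) * q * φ ^ 2 - φ * t) := by
          rw [← Real.exp_add]; congr 1; ring
        linear_combination ((S.card : ℝ) + 1) * S.card.choose x * (e1 + e2)
    _ ≤ (S.card + 1) * S.card.choose x * (2 * Real.exp (-(t ^ 2 / (4 * N)))) := by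
        gcongr
        have : (U.card : ℝ) * q * φ ^ 2 ≤ N * φ ^ 2 := by gcongr
        linarith
    _ = _ := by ring

end Tail

section Resample
variable {n : ℕ} {j l : Fin n} {𝒢 : Finset (SimpleGraph (Fin n))} {H Q : SimpleGraph (Fin n)}

lemma bin_natCast (s k : ℕ) : bin s (k : ℤ) = s.choose k := by simp [bin]

lemma resample_same (h𝒢 : Clos 𝒢) (hjl : j ≠ l)
    (f : SimpleGraph (Fin n) → Finset (Fin n) → ℝ)
    (hf : ∀ G T B, T ⊆ Sd j l (Fr j l (H ⊔ Q)) G → f (tog j l T G) B = f G B) :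
    Ex (fam 𝒢 H Q) (fun G => f G (Xd j l (Fr j l (H ⊔ Q)) G)) =
    Ex (fam 𝒢 H Q) (fun G => (∑ B ∈ (Sd j l (Fr j l (H ⊔ Q)) G).powersetCard
      (Xd j l (Fr j l (H ⊔ Q)) G).card, f G B) /
        ((Sd j l (Fr j l (H ⊔ Q)) G).card.choose (Xd j l (Fr j l (H ⊔ Q)) G).card : ℝ)) := by
  set F := Fr j l (H ⊔ Q) with hF
  have hjF : j ∉ F := left_notMem_Fr j l _
  have hlF : l ∉ F := right_notMem_Fr j l _
  have key := sum_toggle (H := H) (Q := Q) h𝒢 hjl (c := 0) (Or.inl rfl)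
    (fun G _ => f G (Xd j l F G) / ((Sd j l F G).card.choose (Xd j l F G).card : ℝ))
  simp only [zero_mul, sub_zero, ← hF] at key
  unfold Ex
  congr 1
  have hch : ∀ G, ((Sd j l F G).card.choose (Xd j l F G).card : ℝ) ≠ 0 := fun G => by
    exact_mod_cast (Nat.choose_pos (Finset.card_le_card Xd_subset)).ne'
  have e1 : ∀ G, ∑ T ∈ TS j l F G ((Xd j l F G).card : ℤ),
      f G (Xd j l F G) / ((Sd j l F G).card.choose (Xd j l F G).card : ℝ) = f G (Xd j l F G) := by
    intro G
    rw [Finset.sum_const, card_TS, bin_natCast, nsmul_eq_mul]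
    field_simp [hch G]
  simp only [e1] at key
  rw [key]
  refine Finset.sum_congr rfl fun G _ => ?_
  beta_reduce
  rw [← sum_TS, Finset.sum_div]
  refine Finset.sum_congr rfl fun T hT => ?_
  obtain ⟨hT, hk⟩ := Finset.mem_filter.1 hT
  rw [Finset.mem_powerset] at hT
  have hj : j ∉ T := fun h => hjF (Sd_subset (hT h))
  have hl : l ∉ T := fun h => hlF (Sd_subset (hT h))
  rw [hf G T _ hT, Sd_tog hj hl, Xd_tog hj hl hT]
  have : (symmDiff (Xd j l F G) T).card = (Xd j l F G).card := by exact_mod_cast hk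
  rw [this]

lemma sum_mem_powersetCard {α : Type*} [DecidableEq α] {S : Finset α} {v : α} (hv : v ∈ S) {x : ℕ}
    (hx : x ≤ S.card) :
    ∑ B ∈ S.powersetCard x, ((2 : ℝ) * (if v ∈ B then 1 else 0) - 1) =
      (2 * x - S.card) / S.card * S.card.choose x := by
  have h1 : (S.powersetCard x).filter (fun B => v ∉ B) = (S.erase v).powersetCard x := by
    ext B
    simp only [Finset.mem_filter, Finset.mem_powersetCard, Finset.subset_erase]
    tauto
  have h2 : ∑ B ∈ S.powersetCard x, (if v ∈ B then (1 : ℝ) else 0) =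
      S.card.choose x - (S.card - 1).choose x := by
    have : ∑ B ∈ S.powersetCard x, (if v ∈ B then (1 : ℝ) else 0) =
        ∑ B ∈ S.powersetCard x, ((1 : ℝ) - if v ∉ B then 1 else 0) :=
      Finset.sum_congr rfl fun B _ => by split_ifs <;> simp_all
    rw [this, Finset.sum_sub_distrib, Finset.sum_boole, h1, Finset.card_powersetCard,
      Finset.card_erase_of_mem hv]
    simp
  obtain ⟨s, hs⟩ : ∃ s, S.card = s + 1 := ⟨S.card - 1, by
    have := Finset.card_pos.2 ⟨v, hv⟩; omega⟩
  rw [Finset.sum_sub_distrib, ← Finset.mul_sum, h2, Finset.sum_const, Finset.card_powersetCard, hs]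
  rw [hs] at hx
  have h3 := Nat.choose_mul_succ_eq s x
  have h4 : (s.choose x : ℝ) * (s + 1) = (s + 1).choose x * (s + 1 - x) := by
    have : ((s.choose x * (s + 1) : ℕ) : ℝ) = (((s + 1).choose x * (s + 1 - x) : ℕ) : ℝ) := by
      exact_mod_cast h3
    push_cast [Nat.cast_sub hx] at this
    exact this
  simp only [nsmul_eq_mul, mul_one, Nat.add_sub_cancel]
  push_cast
  field_simp
  linear_combination (-2) * h4

/-- Indicator of a proposition as a real number. -/
noncomputable def ind (P : Prop) : ℝ := if P then 1 else 0

lemma ind_nonneg (P : Prop) : 0 ≤ ind P := by unfold ind; split_ifs <;> norm_num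
lemma ind_le_one (P : Prop) : ind P ≤ 1 := by unfold ind; split_ifs <;> norm_num

lemma resample_vertex (h𝒢 : Clos 𝒢) (hjl : j ≠ l) (v : Fin n) (ψ : SimpleGraph (Fin n) → ℝ)
    (hψ : ∀ G T, T ⊆ Sd j l (Fr j l (H ⊔ Q)) G → ψ (tog j l T G) = ψ G) :
    Ex (fam 𝒢 H Q) (fun G => ψ G * (ind (v ∈ Sd j l (Fr j l (H ⊔ Q)) G) *
      (ad G j v - ad G l v))) =
    Ex (fam 𝒢 H Q) (fun G => ψ G * (ind (v ∈ Sd j l (Fr j l (H ⊔ Q)) G) *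
      ((2 * (Xd j l (Fr j l (H ⊔ Q)) G).card - (Sd j l (Fr j l (H ⊔ Q)) G).card) /
        (Sd j l (Fr j l (H ⊔ Q)) G).card))) := by
  set F := Fr j l (H ⊔ Q) with hF
  have hjF : j ∉ F := left_notMem_Fr j l _
  have hlF : l ∉ F := right_notMem_Fr j l _
  have key := resample_same (H := H) (Q := Q) h𝒢 hjl
    (fun G B => ψ G * ind (v ∈ Sd j l F G) * (2 * (if v ∈ B then 1 else 0) - 1)) (by
      intro G T B hT
      have hj : j ∉ T := fun h => hjF (Sd_subset (hT h))
      have hl : l ∉ T := fun h => hlF (Sd_subset (hT h))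
      simp only [hψ G T hT, Sd_tog hj hl])
  rw [← hF] at key
  refine Eq.trans (Ex_congr fun G _ => ?_) (key.trans (Ex_congr fun G _ => ?_))
  · by_cases hv : v ∈ Sd j l F G
    · have h1 := (Finset.mem_filter.1 hv).2
      have h2 : v ∈ Xd j l F G ↔ G.Adj j v := by simp [Xd, hv]
      simp only [h2, ind, hv, if_true, ad]
      by_cases h : G.Adj j v <;> simp_all; norm_num
    · simp [ind, hv]
  · rw [← Finset.mul_sum]
    by_cases hv : v ∈ Sd j l F G
    · have hx := Finset.card_le_card (Xd_subset (j := j) (l := l) (F := F) (G := G))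
      rw [sum_mem_powersetCard hv hx]
      have : ((Sd j l F G).card.choose (Xd j l F G).card : ℝ) ≠ 0 := by
        exact_mod_cast (Nat.choose_pos hx).ne'
      field_simp
    · simp [ind, hv]

lemma resample_swap (h𝒢 : Clos 𝒢) (hjl : j ≠ l) (ψ : SimpleGraph (Fin n) → ℝ)
    (hψ : ∀ G T, T ⊆ Sd j l (Fr j l (H ⊔ Q)) G →
      (((symmDiff (Xd j l (Fr j l (H ⊔ Q)) G) T).card : ℤ) =
        (Xd j l (Fr j l (H ⊔ Q)) G).card - ((deg G j : ℤ) - deg G l)) → ψ (tog j l T G) = ψ G) :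
    Ex (fam 𝒢 H Q) (fun G => ψ G * ((deg G j : ℝ) - deg G l)) =
    Ex (fam 𝒢 H Q) (fun G => ψ G * (((deg G j : ℝ) - deg G l) *
      (((bin (Sd j l (Fr j l (H ⊔ Q)) G).card (Xd j l (Fr j l (H ⊔ Q)) G).card : ℝ) -
        bin (Sd j l (Fr j l (H ⊔ Q)) G).card
          ((Xd j l (Fr j l (H ⊔ Q)) G).card - ((deg G j : ℤ) - deg G l))) /
      ((bin (Sd j l (Fr j l (H ⊔ Q)) G).card (Xd j l (Fr j l (H ⊔ Q)) G).card : ℝ) +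
        bin (Sd j l (Fr j l (H ⊔ Q)) G).card
          ((Xd j l (Fr j l (H ⊔ Q)) G).card - ((deg G j : ℤ) - deg G l)))))) := by
  set F := Fr j l (H ⊔ Q) with hF
  have hjF : j ∉ F := left_notMem_Fr j l _
  have hlF : l ∉ F := right_notMem_Fr j l _
  set A : SimpleGraph (Fin n) → ℝ := fun G => bin (Sd j l F G).card (Xd j l F G).card with hA
  set B : SimpleGraph (Fin n) → ℝ := fun G => bin (Sd j l F G).card
    ((Xd j l F G).card - ((deg G j : ℤ) - deg G l)) with hB
  have hA0 : ∀ G, 0 < A G := fun G => by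
    simp only [hA, bin_natCast]
    exact_mod_cast Nat.choose_pos (Finset.card_le_card Xd_subset)
  have hB0 : ∀ G, 0 ≤ B G := fun G => Nat.cast_nonneg _
  have key := sum_toggle (H := H) (Q := Q) h𝒢 hjl (c := 1) (Or.inr rfl)
    (fun G _ => ψ G * ((deg G j : ℝ) - deg G l) / (A G + B G))
  simp only [one_mul, ← hF] at key
  have e1 : ∀ G, ∑ T ∈ TS j l F G ((Xd j l F G).card - ((deg G j : ℤ) - deg G l)),
      ψ G * ((deg G j : ℝ) - deg G l) / (A G + B G) =
      ψ G * (((deg G j : ℝ) - deg G l) * (B G / (A G + B G))) := by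
    intro G
    rw [Finset.sum_const, card_TS, nsmul_eq_mul]
    simp only [hB]; ring
  have e2 : ∀ G, ∑ T ∈ TS j l F G ((Xd j l F G).card - ((deg G j : ℤ) - deg G l)),
      ψ (tog j l T G) * ((deg (tog j l T G) j : ℝ) - deg (tog j l T G) l) /
        (A (tog j l T G) + B (tog j l T G)) =
      -(ψ G * (((deg G j : ℝ) - deg G l) * (B G / (A G + B G)))) := by
    intro G
    rw [← e1, ← Finset.sum_neg_distrib]
    refine Finset.sum_congr rfl fun T hT => ?_
    obtain ⟨hT, hk⟩ := Finset.mem_filter.1 hT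
    rw [Finset.mem_powerset] at hT
    have hj : j ∉ T := fun h => hjF (Sd_subset (hT h))
    have hl : l ∉ T := fun h => hlF (Sd_subset (hT h))
    have d1 := deg_tog_left hjF hlF hT
    have d2 := deg_tog_right hjF hlF hT
    have hz : (deg (tog j l T G) j : ℤ) - deg (tog j l T G) l =
      -((deg G j : ℤ) - deg G l) := by linarith
    have hz' : (deg (tog j l T G) j : ℝ) - deg (tog j l T G) l =
      -((deg G j : ℝ) - deg G l) := by exact_mod_cast hz
    have hA' : A (tog j l T G) = B G := by
      simp only [hA, hB, Sd_tog hj hl, Xd_tog hj hl hT, hk]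
    have hB' : B (tog j l T G) = A G := by
      simp only [hA, hB, Sd_tog hj hl, Xd_tog hj hl hT, hk, hz]
      congr 2; ring
    rw [hψ G T hT hk, hz', hA', hB', add_comm (B G)]; ring
  simp only [e1, e2, Finset.sum_neg_distrib] at key
  have hzero : ∑ G ∈ fam 𝒢 H Q, ψ G * (((deg G j : ℝ) - deg G l) * (B G / (A G + B G))) = 0 := by
    linarith
  unfold Ex
  congr 1
  rw [← sub_eq_zero, ← Finset.sum_sub_distrib]
  rw [← mul_eq_zero_of_right 2 hzero, Finset.mul_sum]
  refine Finset.sum_congr rfl fun G _ => ?_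
  have := hA0 G
  have := hB0 G
  have : A G + B G ≠ 0 := by positivity
  change ψ G * ((deg G j : ℝ) - deg G l) -
    ψ G * (((deg G j : ℝ) - deg G l) * ((A G - B G) / (A G + B G))) = _
  field_simp
  ring

/-- Conditionally on everything outside the rows of `j` and `l`, the codegree difference of `j` and
`l` with respect to a third vertex is concentrated. -/
lemma resample_tail (h𝒢 : Clos 𝒢) (hjl : j ≠ l) {w : Fin n} (hwj : w ≠ j) (hwl : w ≠ l) {t : ℝ}
    (ht : 0 ≤ t) (htn : t ≤ n) :
    Ex (fam 𝒢 H Q) (fun G => ind (2 * t + |2 * ((Xd j l (Fr j l (H ⊔ Q)) G).card : ℝ) -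
        (Sd j l (Fr j l (H ⊔ Q)) G).card| <
      |∑ u ∈ Fr j l (H ⊔ Q), ad G w u * (ad G j u - ad G l u)|)) ≤
      2 * (n + 1) * Real.exp (-(t ^ 2 / (4 * n))) := by
  set F := Fr j l (H ⊔ Q) with hF
  have hjF : j ∉ F := left_notMem_Fr j l _
  have hlF : l ∉ F := right_notMem_Fr j l _
  have hn : 0 < (n : ℝ) := by exact_mod_cast (Fin.pos j)
  set U : SimpleGraph (Fin n) → Finset (Fin n) := fun G =>
    (Sd j l F G).filter (fun u => G.Adj w u) with hU
  have key := resample_same (H := H) (Q := Q) h𝒢 hjl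
    (fun G B => ind (2 * t + |2 * (B.card : ℝ) - (Sd j l F G).card| <
      |2 * ((B ∩ U G).card : ℝ) - (U G).card|)) (by
      intro G T B hT
      have hj : j ∉ T := fun h => hjF (Sd_subset (hT h))
      have hl : l ∉ T := fun h => hlF (Sd_subset (hT h))
      have hU' : U (tog j l T G) = U G := by
        simp only [hU, Sd_tog hj hl]
        refine Finset.filter_congr fun u hu => ?_
        refine tog_adj_other hwj hwl ?_ ?_
        · rintro rfl; exact hjF (Sd_subset hu)
        · rintro rfl; exact hlF (Sd_subset hu)
      simp only [Sd_tog hj hl, hU'])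
  rw [← hF] at key
  have e : Ex (fam 𝒢 H Q) (fun G => ind (2 * t + |2 * ((Xd j l F G).card : ℝ) -
        (Sd j l F G).card| <
      |∑ u ∈ F, ad G w u * (ad G j u - ad G l u)|)) =
      Ex (fam 𝒢 H Q) (fun G => ind (2 * t + |2 * ((Xd j l F G).card : ℝ) - (Sd j l F G).card| <
      |2 * ((Xd j l F G ∩ U G).card : ℝ) - (U G).card|)) := by
    refine Ex_congr fun G _ => ?_
    have : ∑ u ∈ F, ad G w u * (ad G j u - ad G l u) =
        2 * ((Xd j l F G ∩ U G).card : ℝ) - (U G).card := by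
      have i1 : Xd j l F G ∩ U G = F.filter (fun u => (G.Adj j u ↔ ¬ G.Adj l u) ∧ G.Adj j u ∧
          G.Adj w u) := by
        ext u; simp only [Xd, hU, Sd, Finset.mem_inter, Finset.mem_filter]; tauto
      have i2 : U G = F.filter (fun u => (G.Adj j u ↔ ¬ G.Adj l u) ∧ G.Adj w u) := by
        ext u; simp only [hU, Sd, Finset.mem_filter]; tauto
      rw [i1, i2, Finset.natCast_card_filter, Finset.natCast_card_filter, Finset.mul_sum, ← Finset.sum_sub_distrib]
      apply Finset.sum_congr rfl
      intro u _
      unfold ad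
      by_cases h1 : G.Adj j u <;> by_cases h2 : G.Adj l u <;> by_cases h3 : G.Adj w u <;>
        simp [h1, h2, h3] <;> norm_num
    rw [this]
  rw [e, key]
  rcases (fam 𝒢 H Q).eq_empty_or_nonempty with h0 | h0
  · rw [h0]; simp only [Ex, Finset.sum_empty, zero_div]; positivity
  refine Ex_le_const h0 fun G _ => ?_
  have hx := Finset.card_le_card (Xd_subset (j := j) (l := l) (F := F) (G := G))
  have hsn : ((Sd j l F G).card : ℝ) ≤ n := by
    have := Finset.card_le_univ (Sd j l F G)
    rw [Fintype.card_fin] at this; exact_mod_cast this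
  have hch : (0 : ℝ) < ((Sd j l F G).card.choose (Xd j l F G).card : ℝ) := by
    exact_mod_cast Nat.choose_pos hx
  rw [div_le_iff₀ hch]
  have tail := card_tail_le (Finset.filter_subset (fun u => G.Adj w u) (Sd j l F G)) hx hsn hn ht htn
  have hsum : ∑ B ∈ (Sd j l F G).powersetCard (Xd j l F G).card,
      ind (2 * t + |2 * (B.card : ℝ) - (Sd j l F G).card| <
        |2 * ((B ∩ U G).card : ℝ) - (U G).card|) =
      (((Sd j l F G).powersetCard (Xd j l F G).card).filter (fun B =>
        2 * t + |2 * ((Xd j l F G).card : ℝ) - (Sd j l F G).card| <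
        |2 * ((B ∩ U G).card : ℝ) - (U G).card|)).card := by
    refine Eq.trans ?_ (Finset.natCast_card_filter _ _).symm
    apply Finset.sum_congr rfl
    intro B hB
    rw [(Finset.mem_powersetCard.1 hB).2]; rfl
  rw [hsum]
  refine tail.trans ?_
  gcongr

end Resample

section Ratio

lemma choose_mul_descFactorial {s x z : ℕ} (hx : x + z ≤ s) :
    s.choose x * (s - x).descFactorial z = s.choose (x + z) * (x + z).descFactorial z := by
  have h1 := Nat.choose_mul_factorial_mul_factorial (n := s) (k := x) (by omega)
  have h2 := Nat.choose_mul_factorial_mul_factorial hx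
  have h3 := Nat.factorial_mul_descFactorial (n := s - x) (k := z) (by omega)
  have h4 := Nat.factorial_mul_descFactorial (n := x + z) (k := z) (by omega)
  have e1 : s - x - z = s - (x + z) := by omega
  have e2 : x + z - z = x := by omega
  rw [e1] at h3
  rw [e2] at h4
  rw [← h3] at h1
  rw [← h4] at h2
  have hp : 0 < x.factorial * (s - (x + z)).factorial :=
    Nat.mul_pos (Nat.factorial_pos _) (Nat.factorial_pos _)
  refine Nat.eq_of_mul_eq_mul_right hp ?_
  calc _ = s.choose x * x.factorial * ((s - (x + z)).factorial * (s - x).descFactorial z) := by ring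
    _ = _ := by rw [h1, ← h2]; ring

lemma abs_tanh_sub_le {t : ℝ} (ht : |t| ≤ 1 / 2) :
    |(1 - Real.exp (-2 * t)) / (1 + Real.exp (-2 * t)) - t| ≤ 6 * |t| ^ 3 := by
  have hx : |(-2 * t)| ≤ 1 := by rw [abs_mul]; norm_num; linarith
  have hb := Real.exp_bound hx (n := 3) (by norm_num)
  simp only [Finset.sum_range_succ, Finset.sum_range_zero, Nat.factorial] at hb
  norm_num at hb
  set e := Real.exp (-(2 * t)) with he
  have hee : Real.exp (-2 * t) = e := by rw [he]; ring_nf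
  rw [hee]
  have he0 : 0 < e := Real.exp_pos _
  set θ := e - (1 + -(2 * t) + (2 * t) ^ 2 / 2) with hθ
  have hθ' : |θ| ≤ 2 * |t| ^ 3 := by
    refine hb.trans ?_
    rw [mul_pow]; nlinarith [pow_nonneg (abs_nonneg t) 3]
  have e1 : (1 - e) / (1 + e) - t = (-θ - 2 * t ^ 3 - t * θ) / (1 + e) := by
    rw [hθ]; field_simp; ring
  rw [e1, abs_div, abs_of_pos (show 0 < 1 + e by linarith), div_le_iff₀ (by linarith)]
  have h3 : |t ^ 3| = |t| ^ 3 := abs_pow t 3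
  have h4 : |t * θ| ≤ 1 / 2 * |θ| := by rw [abs_mul]; gcongr
  have h5 : |(-θ - 2 * t ^ 3 - t * θ)| ≤ |θ| + 2 * |t| ^ 3 + |t * θ| := by
    have a1 := abs_sub (-θ - 2 * t ^ 3) (t * θ)
    have a2 := abs_sub (-θ) (2 * t ^ 3)
    rw [abs_neg, abs_mul, abs_two, h3] at a2
    linarith
  have h6 : 0 ≤ |t| ^ 3 := by positivity
  nlinarith

lemma cube_add_le {t τ e : ℝ} (hτ : 0 ≤ τ) (he : 0 ≤ e) (hτ1 : τ ≤ 1 / 100) (heτ : e ≤ 3 * τ)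
    (ht : 0 ≤ t) (h : t ≤ τ + e) : t ^ 3 ≤ τ ^ 3 + e := by
  have h1 : t ^ 3 ≤ (τ + e) ^ 3 := by gcongr
  have h7 : (τ + e) ^ 3 = τ ^ 3 + e * (3 * τ ^ 2 + 3 * τ * e + e ^ 2) := by ring
  have h9 : e ≤ 1 / 30 := by linarith
  have h8 : 3 * τ ^ 2 + 3 * τ * e + e ^ 2 ≤ 1 := by
    have a1 : τ ^ 2 ≤ (1/100)^2 := by gcongr
    have a2 : τ * e ≤ (1/100) * (1/30) := by gcongr
    have a3 : e ^ 2 ≤ (1/30)^2 := by gcongr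
    norm_num at *; linarith
  rw [h7] at h1
  have := mul_le_mul_of_nonneg_left h8 he
  linarith

lemma ratio_nat {s x z : ℕ} {κ : ℝ} (hκ : 2 * ((x : ℝ) + z) - s = z - κ)
    (h1 : 8 * ((z : ℝ) + |κ| + 1) ≤ s) (h2 : 100 * (z * |κ|) ≤ s) :
    |((s.choose (x + z) : ℝ) - s.choose x) / (s.choose (x + z) + s.choose x) - z * κ / s| ≤
      6 * (z * |κ| / s) ^ 3 + 200 * (z * |κ|) * (z + |κ|) / (s : ℝ) ^ 2 := by
  have hκ0 := abs_nonneg κ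
  have hκ1 := le_abs_self κ
  have hκ2 := neg_abs_le κ
  have hz0 : (0 : ℝ) ≤ z := Nat.cast_nonneg z
  have hs : (0 : ℝ) < s := by linarith
  have hxz : x + z ≤ s := by
    have : ((x + z : ℕ) : ℝ) ≤ s := by push_cast; linarith
    exact_mod_cast this
  have hxz' : (x : ℝ) + z ≤ s := by exact_mod_cast hxz
  set y : ℕ → ℝ := fun i => ((s : ℝ) - x) - i with hy
  have hyi : ∀ i ∈ Finset.range z, (s : ℝ) / 4 ≤ y i ∧ |2 * y i - s| ≤ z + |κ| := by
    intro i hi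
    have hi' : (i : ℝ) ≤ z := by exact_mod_cast (Finset.mem_range.1 hi).le
    have hi0 : (0 : ℝ) ≤ i := Nat.cast_nonneg i
    simp only [hy]
    constructor
    · linarith
    · rw [abs_le]; constructor <;> linarith
  have hu : ∀ i ∈ Finset.range z, |κ / y i| ≤ 4 * |κ| / s ∧ |κ / y i| ≤ 1 / 2 := by
    intro i hi
    obtain ⟨a1, -⟩ := hyi i hi
    have : 0 < y i := by linarith
    rw [abs_div, abs_of_pos this]
    constructor
    · rw [div_le_div_iff₀ this hs]; nlinarith
    · rw [div_le_div_iff₀ this (by norm_num)]; linarith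
  have hprod : (s.choose x : ℝ) = s.choose (x + z) * ∏ i ∈ Finset.range z, (1 - κ / y i) := by
    have h := choose_mul_descFactorial hxz
    have hcast : (s.choose x : ℝ) * ∏ i ∈ Finset.range z, y i =
        s.choose (x + z) * ∏ i ∈ Finset.range z, (y i - κ) := by
      have h' : ((s.choose x * (s - x).descFactorial z : ℕ) : ℝ) =
        ((s.choose (x + z) * (x + z).descFactorial z : ℕ) : ℝ) := by exact_mod_cast h
      rw [Nat.descFactorial_eq_prod_range, Nat.descFactorial_eq_prod_range] at h'
      push_cast at h'
      convert h' using 2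
      · refine Finset.prod_congr rfl fun i hi => ?_
        have := Finset.mem_range.1 hi
        rw [Nat.cast_sub (by omega), Nat.cast_sub (by omega)]
      · refine Finset.prod_congr rfl fun i hi => ?_
        have := Finset.mem_range.1 hi
        rw [Nat.cast_sub (by omega)]; simp only [hy]; push_cast; linarith
    have hne : ∏ i ∈ Finset.range z, y i ≠ 0 := Finset.prod_ne_zero_iff.2 fun i hi => by
      have := (hyi i hi).1; linarith
    have e : ∏ i ∈ Finset.range z, (1 - κ / y i) =
        (∏ i ∈ Finset.range z, (y i - κ)) / ∏ i ∈ Finset.range z, y i := by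
      rw [← Finset.prod_div_distrib]
      refine Finset.prod_congr rfl fun i hi => ?_
      have : y i ≠ 0 := by have := (hyi i hi).1; linarith
      field_simp
    rw [e, ← mul_div_assoc, ← hcast]; field_simp
  set ρ := ∏ i ∈ Finset.range z, (1 - κ / y i) with hρ
  have hfac : ∀ i ∈ Finset.range z, 0 < 1 - κ / y i := fun i hi => by
    have := (abs_le.1 (hu i hi).2).2; linarith
  have hρ0 : 0 < ρ := Finset.prod_pos hfac
  have hlog : Real.log ρ = ∑ i ∈ Finset.range z, Real.log (1 - κ / y i) :=
    Real.log_prod fun i hi => (hfac i hi).ne'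
  have hterm : ∀ i ∈ Finset.range z, |Real.log (1 - κ / y i) + 2 * κ / s| ≤
      36 * |κ| * (z + |κ|) / (s : ℝ) ^ 2 := by
    intro i hi
    obtain ⟨a1, a2⟩ := hyi i hi
    obtain ⟨b1, b2⟩ := hu i hi
    have hyp : 0 < y i := by linarith
    have l1 := Real.abs_log_sub_add_sum_range_le (x := κ / y i) (by linarith) 1
    simp only [Finset.sum_range_one, zero_add, pow_one, Nat.cast_zero, div_one] at l1
    have l2 : |κ / y i| ^ (1 + 1) / (1 - |κ / y i|) ≤ 2 * (4 * |κ| / s) ^ 2 := by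
      rw [div_le_iff₀ (by linarith)]
      have : |κ / y i| ^ 2 ≤ (4 * |κ| / s) ^ 2 := by gcongr
      nlinarith [sq_nonneg (4 * |κ| / s)]
    have l3 : |2 * κ / s - κ / y i| ≤ 4 * |κ| * (z + |κ|) / (s : ℝ) ^ 2 := by
      have : 2 * κ / s - κ / y i = κ * (2 * y i - s) / (s * y i) := by field_simp
      rw [this, abs_div, abs_mul, abs_of_pos (show 0 < s * y i by positivity),
        div_le_div_iff₀ (by positivity) (by positivity)]
      have : |κ| * |2 * y i - s| ≤ |κ| * (z + |κ|) := by gcongr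
      have h5 : 0 ≤ |κ| * (z + |κ|) := by positivity
      calc |κ| * |2 * y i - s| * (s : ℝ) ^ 2 ≤ |κ| * (z + |κ|) * (s : ℝ) ^ 2 := by gcongr
        _ ≤ |κ| * (z + |κ|) * (s * (4 * y i)) := by
            gcongr; rw [sq]; gcongr; linarith
        _ = _ := by ring
    have l4 : 2 * (4 * |κ| / s) ^ 2 ≤ 32 * |κ| * (z + |κ|) / (s : ℝ) ^ 2 := by
      rw [div_pow, ← mul_div_assoc]
      refine div_le_div_of_nonneg_right ?_ (by positivity)
      nlinarith [mul_nonneg (abs_nonneg κ) hz0]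
    calc |Real.log (1 - κ / y i) + 2 * κ / s|
        = |(κ / y i + Real.log (1 - κ / y i)) + (2 * κ / s - κ / y i)| := by ring_nf
      _ ≤ _ := abs_add_le _ _
      _ ≤ 32 * |κ| * (z + |κ|) / (s : ℝ) ^ 2 + 4 * |κ| * (z + |κ|) / (s : ℝ) ^ 2 := by linarith
      _ = _ := by ring
  have hsum : |Real.log ρ + z * (2 * κ / s)| ≤ z * (36 * |κ| * (z + |κ|) / (s : ℝ) ^ 2) := by
    have : Real.log ρ + z * (2 * κ / s) =
        ∑ i ∈ Finset.range z, (Real.log (1 - κ / y i) + 2 * κ / s) := by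
      rw [Finset.sum_add_distrib, hlog]; simp
    rw [this]
    refine (Finset.abs_sum_le_sum_abs _ _).trans ((Finset.sum_le_sum hterm).trans ?_)
    simp
  set t := -(Real.log ρ) / 2 with ht
  have hexp : Real.exp (-2 * t) = ρ := by
    rw [ht, ← Real.exp_log hρ0]; congr 1; rw [Real.exp_log hρ0]; ring
  set e := 18 * (z * |κ|) * (z + |κ|) / (s : ℝ) ^ 2 with he
  have he0 : 0 ≤ e := by positivity
  have htt : |t - z * κ / s| ≤ e := by
    have : t - z * κ / s = -((Real.log ρ + z * (2 * κ / s)) / 2) := by rw [ht]; ring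
    rw [this, abs_neg, abs_div, abs_two, div_le_iff₀ (by norm_num)]
    refine hsum.trans (le_of_eq ?_); rw [he]; ring
  set τ := z * |κ| / s with hτ
  have hτ0 : 0 ≤ τ := by positivity
  have hτ' : |z * κ / s| = τ := by
    rw [abs_div, abs_mul, abs_of_nonneg hz0, abs_of_pos hs]
  have hτ1 : τ ≤ 1 / 100 := by rw [hτ, div_le_iff₀ hs]; linarith
  have heτ : e ≤ 3 * τ := by
    have : e = 18 * τ * ((z + |κ|) / s) := by rw [he, hτ]; field_simp
    rw [this]
    have : (z + |κ|) / s ≤ 1 / 8 := by rw [div_le_iff₀ hs]; linarith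
    nlinarith
  have ht1 : |t| ≤ τ + e := by
    have := abs_add_le (t - z * κ / s) (z * κ / s)
    rw [sub_add_cancel, hτ'] at this; linarith
  have hth := abs_tanh_sub_le (t := t) (by linarith)
  rw [hexp] at hth
  have hC : (s.choose (x + z) : ℝ) ≠ 0 := by exact_mod_cast (Nat.choose_pos hxz).ne'
  have e1 : ((s.choose (x + z) : ℝ) - s.choose x) / (s.choose (x + z) + s.choose x) =
      (1 - ρ) / (1 + ρ) := by
    rw [hprod]
    have : 1 + ρ ≠ 0 := by linarith
    field_simp
  rw [e1]
  have ht3 : |t| ^ 3 ≤ τ ^ 3 + e := by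
    exact cube_add_le hτ0 he0 hτ1 heτ (abs_nonneg t) ht1
  calc _ = |((1 - ρ) / (1 + ρ) - t) + (t - z * κ / s)| := by ring_nf
    _ ≤ 6 * |t| ^ 3 + e := (abs_add_le _ _).trans (add_le_add hth htt)
    _ ≤ 6 * τ ^ 3 + 7 * e := by linarith
    _ ≤ _ := by
      have e2 : 200 * (z * |κ|) * (z + |κ|) / (s : ℝ) ^ 2 = (200 / 18) * e := by rw [he]; ring
      have e3 : 0 ≤ τ ^ 3 := by positivity
      rw [e2]; linarith

/-- The resampling ratio for an arbitrary (signed) shift. -/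
lemma bin_ratio {s : ℕ} {x z : ℤ} {κ : ℝ} (hκ : 2 * (x : ℝ) - s = z - κ)
    (h1 : 8 * (|(z : ℝ)| + |κ| + 1) ≤ s) (h2 : 100 * (|(z : ℝ)| * |κ|) ≤ s) :
    |(bin s x - bin s (x - z)) / (bin s x + bin s (x - z)) - z * κ / s| ≤
      6 * (|(z : ℝ)| * |κ| / s) ^ 3 + 200 * (|(z : ℝ)| * |κ|) * (|(z : ℝ)| + |κ|) / (s : ℝ) ^ 2 := by
  have hκ0 := abs_nonneg κ
  have hκ1 := le_abs_self κ
  have hκ2 := neg_abs_le κ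
  have hz1 := le_abs_self (z : ℝ)
  have hz2 := neg_abs_le (z : ℝ)
  rcases le_total 0 z with hz | hz
  · obtain ⟨y, hy⟩ : ∃ y : ℕ, (y : ℤ) = x - z :=
      Int.eq_ofNat_of_zero_le (by
        have : (0 : ℝ) ≤ ((x - z : ℤ) : ℝ) := by push_cast; linarith
        exact_mod_cast this) |>.imp fun _ h => h.symm
    obtain ⟨z', rfl⟩ := Int.eq_ofNat_of_zero_le hz
    have hx : x = ((y + z' : ℕ) : ℤ) := by push_cast; omega
    have hzz : |((z' : ℤ) : ℝ)| = (z' : ℝ) := by simp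
    have := ratio_nat (s := s) (x := y) (z := z') (κ := κ)
      (by rw [hx] at hκ; push_cast at hκ ⊢; linarith) (by rw [hzz] at h1; exact h1)
      (by rw [hzz] at h2; exact h2)
    rw [← hy, hx, bin_natCast, bin_natCast, hzz]
    simpa using this
  · obtain ⟨y, rfl⟩ : ∃ y : ℕ, x = (y : ℤ) :=
      Int.eq_ofNat_of_zero_le (by
        have : (0 : ℝ) ≤ ((x : ℤ) : ℝ) := by linarith
        exact_mod_cast this)
    obtain ⟨z', hz'⟩ := Int.eq_ofNat_of_zero_le (neg_nonneg.2 hz)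
    obtain rfl : z = -(z' : ℤ) := by omega
    have hzz : |((-(z' : ℤ) : ℤ) : ℝ)| = (z' : ℝ) := by simp
    have := ratio_nat (s := s) (x := y) (z := z') (κ := κ)
      (by push_cast at hκ ⊢; linarith) (by rw [hzz] at h1; exact h1)
      (by rw [hzz] at h2; exact h2)
    have hyz : (y : ℤ) - -(z' : ℤ) = ((y + z' : ℕ) : ℤ) := by push_cast; omega
    rw [hyz, bin_natCast, bin_natCast, hzz]
    rw [← abs_neg] at this
    convert this using 2
    push_cast
    rw [add_comm (s.choose y : ℝ)]
    ring

end Ratio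

/-- The numerical regime in which the switching estimates are carried out: `r` stands for `√n`,
`p` for the density, `L` for a small power of `n`, `Hm` for the largest degree allowed for the
planted graph. -/
structure Ctx {n : ℕ} (𝒢 : Finset (SimpleGraph (Fin n))) (p δ R L Hm r : ℝ) : Prop where
  clos : Clos 𝒢
  r_sq : r ^ 2 = n
  r_pos : 0 < r
  p_pos : 0 < p
  p_lt : p < 1
  one_le_Lp : 1 ≤ L * p
  one_le_Lq : 1 ≤ L * (1 - p)
  L_ge : 100 ≤ L
  δ_nonneg : 0 ≤ δ
  δ_le : δ ≤ L * r
  Hm_ge : 20 ≤ Hm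
  Hm_le : Hm ≤ L * r
  δHm : L ^ 200 * (δ * Hm) ≤ n
  L_le : L ^ 400 ≤ r
  exp_L : (n : ℝ) ^ 10 ≤ Real.exp L
  sum_dev : ∀ G ∈ 𝒢, ∑ v, ((deg G v : ℝ) - p * (n - 1)) = 0
  sum_dev_sq : ∀ G ∈ 𝒢, ∑ v, ((deg G v : ℝ) - p * (n - 1)) ^ 2 = n * R
  dev_le : ∀ G ∈ 𝒢, ∀ v, |(deg G v : ℝ) - p * (n - 1)| ≤ δ

/-- The pair of a planted graph `H` and a forbidden graph `Q` leaves room for `k` more edges. -/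
structure Adm {n : ℕ} (𝒢 : Finset (SimpleGraph (Fin n))) (L Hm : ℝ) (k : ℕ)
    (H Q : SimpleGraph (Fin n)) : Prop where
  nonempty : (fam 𝒢 H Q).Nonempty
  deg_le : ∀ j, (deg H j : ℝ) + k ≤ Hm
  sum_le : ∑ j, (deg H j : ℝ) + 2 * k ≤ L ^ 2 * n
  degQ_le : ∀ j, (deg Q j : ℝ) + k ≤ 20

/-- The number of common neighbours. -/
noncomputable def cod {n : ℕ} (G : SimpleGraph (Fin n)) (j l : Fin n) : ℝ :=
  ∑ u, ad G j u * ad G l u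

/-- All codegrees are close to `p² n`. -/
def Good {n : ℕ} (p L r : ℝ) (G : SimpleGraph (Fin n)) : Prop :=
  ∀ j l, j ≠ l → |cod G j l - p ^ 2 * n| ≤ L ^ 2 * r

section Sizes
variable {n : ℕ} {𝒢 : Finset (SimpleGraph (Fin n))} {p δ R L Hm r : ℝ} {k : ℕ}
  {H Q G : SimpleGraph (Fin n)}

lemma Ctx.L_pos (c : Ctx 𝒢 p δ R L Hm r) : 0 < L := by have := c.L_ge; linarith

lemma Ctx.one_le_L (c : Ctx 𝒢 p δ R L Hm r) : 1 ≤ L := by have := c.L_ge; linarith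

lemma Ctx.Lpow_le (c : Ctx 𝒢 p δ R L Hm r) {k : ℕ} (hk : k ≤ 400) : L ^ k ≤ r :=
  (pow_le_pow_right₀ c.one_le_L hk).trans c.L_le

lemma Ctx.L_le_r (c : Ctx 𝒢 p δ R L Hm r) : L ≤ r := by
  simpa using c.Lpow_le (k := 1) (by norm_num)

lemma Ctx.r_ge (c : Ctx 𝒢 p δ R L Hm r) : 100 ≤ r := c.L_ge.trans c.L_le_r

lemma Ctx.n_ge (c : Ctx 𝒢 p δ R L Hm r) : (10000 : ℝ) ≤ n := by
  rw [← c.r_sq]; nlinarith [c.r_ge]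

lemma Ctx.R_nonneg (c : Ctx 𝒢 p δ R L Hm r) (h : 𝒢.Nonempty) : 0 ≤ R := by
  obtain ⟨G, hG⟩ := h
  have h1 := c.sum_dev_sq G hG
  have h2 : 0 ≤ ∑ v, ((deg G v : ℝ) - p * (n - 1)) ^ 2 := Finset.sum_nonneg fun _ _ => sq_nonneg _
  rw [h1] at h2
  have := c.n_ge
  exact nonneg_of_mul_nonneg_right (by linarith : 0 ≤ (n : ℝ) * R) (by linarith)

lemma Ctx.R_le (c : Ctx 𝒢 p δ R L Hm r) (h : 𝒢.Nonempty) : R ≤ δ ^ 2 := by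
  obtain ⟨G, hG⟩ := h
  have h1 := c.sum_dev_sq G hG
  have h2 : ∑ v, ((deg G v : ℝ) - p * (n - 1)) ^ 2 ≤ ∑ _v : Fin n, δ ^ 2 :=
    Finset.sum_le_sum fun v _ => by
      rw [← sq_abs]; exact pow_le_pow_left₀ (abs_nonneg _) (c.dev_le G hG v) 2
  rw [h1] at h2
  simp at h2
  have := c.n_ge
  exact le_of_mul_le_mul_left h2 (by linarith)

lemma deg_le_card (G : SimpleGraph (Fin n)) (v : Fin n) : (deg G v : ℝ) ≤ n - 1 := by
  have h : deg G v + 1 ≤ n := by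
    have h1 : (Finset.univ.filter fun k => G.Adj v k) ⊆ Finset.univ.erase v := fun w hw => by
      simp only [Finset.mem_filter, Finset.mem_univ, true_and] at hw
      simp [hw.ne']
    have := Finset.card_le_card h1
    rw [Finset.card_erase_of_mem (Finset.mem_univ _), Finset.card_univ, Fintype.card_fin] at this
    have := v.pos
    unfold deg; omega
  have : ((deg G v + 1 : ℕ) : ℝ) ≤ n := by exact_mod_cast h
  push_cast at this; linarith

lemma fam_subset : fam 𝒢 H Q ⊆ 𝒢 := fun _ hG => (mem_fam.1 hG).1

lemma card_compl_Fr_le (j l : Fin n) :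
    ((Fr j l (H ⊔ Q))ᶜ.card : ℝ) ≤ 2 + deg H j + deg H l + deg Q j + deg Q l := by
  have h1 : (Fr j l (H ⊔ Q))ᶜ ⊆ {j} ∪ {l} ∪ (Finset.univ.filter fun k => H.Adj j k) ∪
      (Finset.univ.filter fun k => H.Adj l k) ∪ (Finset.univ.filter fun k => Q.Adj j k) ∪
      (Finset.univ.filter fun k => Q.Adj l k) := by
    intro w hw
    simp only [Fr, Finset.mem_compl, Finset.mem_filter, Finset.mem_univ, true_and,
      SimpleGraph.sup_adj] at hw
    simp only [Finset.mem_union, Finset.mem_singleton, Finset.mem_filter, Finset.mem_univ, true_and]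
    tauto
  have h2 := Finset.card_le_card h1
  have h3 : (Fr j l (H ⊔ Q))ᶜ.card ≤ 1 + 1 + deg H j + deg H l + deg Q j + deg Q l := by
    refine h2.trans ?_
    refine (Finset.card_union_le _ _).trans (add_le_add ?_ le_rfl)
    refine (Finset.card_union_le _ _).trans (add_le_add ?_ le_rfl)
    refine (Finset.card_union_le _ _).trans (add_le_add ?_ le_rfl)
    refine (Finset.card_union_le _ _).trans (add_le_add ?_ le_rfl)
    refine (Finset.card_union_le _ _).trans (add_le_add ?_ ?_) <;> simp
  have : ((Fr j l (H ⊔ Q))ᶜ.card : ℝ) ≤ ((1 + 1 + deg H j + deg H l + deg Q j + deg Q l : ℕ) : ℝ) := by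
    exact_mod_cast h3
  push_cast at this; linarith

lemma Adm.deg_le_Hm (a : Adm 𝒢 L Hm k H Q) (j : Fin n) : (deg H j : ℝ) ≤ Hm := by
  have := a.deg_le j; have : (0 : ℝ) ≤ k := k.cast_nonneg; linarith

lemma Adm.degQ_le_20 (a : Adm 𝒢 L Hm k H Q) (j : Fin n) : (deg Q j : ℝ) ≤ 20 := by
  have := a.degQ_le j; have : (0 : ℝ) ≤ k := k.cast_nonneg; linarith

lemma card_compl_Fr_le_Hm (c : Ctx 𝒢 p δ R L Hm r) (a : Adm 𝒢 L Hm k H Q) (j l : Fin n) :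
    ((Fr j l (H ⊔ Q))ᶜ.card : ℝ) ≤ 5 * Hm := by
  have := card_compl_Fr_le (H := H) (Q := Q) j l
  have := a.deg_le_Hm j; have := a.deg_le_Hm l; have := a.degQ_le_20 j; have := a.degQ_le_20 l
  have := c.Hm_ge
  linarith

lemma abs_sum_compl_le (F : Finset (Fin n)) (f : Fin n → ℝ) (hf : ∀ u, |f u| ≤ 1) :
    |∑ u, f u - ∑ u ∈ F, f u| ≤ (Fᶜ.card : ℝ) := by
  rw [← Finset.sum_add_sum_compl F f, add_sub_cancel_left]
  refine (Finset.abs_sum_le_sum_abs _ _).trans ((Finset.sum_le_sum fun u _ => hf u).trans ?_)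
  simp

lemma abs_ad_sub_le (G : SimpleGraph (Fin n)) (u v w : Fin n) : |ad G u v - ad G w v| ≤ 1 := by
  have := ad_nonneg G u v; have := ad_le_one G u v
  have := ad_nonneg G w v; have := ad_le_one G w v
  rw [abs_le]; constructor <;> linarith

lemma abs_two_card_Xd_sub_le (F : Finset (Fin n)) (j l : Fin n) (G : SimpleGraph (Fin n)) :
    |(2 * ((Xd j l F G).card : ℝ) - (Sd j l F G).card) - ((deg G j : ℝ) - deg G l)| ≤ Fᶜ.card := by
  rw [two_card_Xd_sub, deg_eq_sum, deg_eq_sum, ← Finset.sum_sub_distrib, abs_sub_comm]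
  exact abs_sum_compl_le F _ fun u => abs_ad_sub_le G j u l

lemma Ctx.abs_deg_sub_le (c : Ctx 𝒢 p δ R L Hm r) (hG : G ∈ 𝒢) (j l : Fin n) :
    |(deg G j : ℝ) - deg G l| ≤ 2 * δ := by
  have h1 := c.dev_le G hG j
  have h2 := c.dev_le G hG l
  rw [abs_le] at *
  constructor <;> linarith

/-- Sum of the codegrees at a vertex. -/
lemma sum_cod (G : SimpleGraph (Fin n)) (w : Fin n) :
    ∑ l ∈ Finset.univ.erase w, cod G w l = ∑ u, ad G w u * ((deg G u : ℝ) - 1) := by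
  unfold cod
  rw [Finset.sum_comm]
  refine Finset.sum_congr rfl fun u _ => ?_
  rw [← Finset.mul_sum, Finset.sum_erase_eq_sub (Finset.mem_univ _), deg_eq_sum]
  rcases ad_eq_zero_or_one G w u with h | h
  · rw [h]; ring
  · rw [h]; congr 2
    exact Finset.sum_congr rfl fun l _ => ad_comm G l u

lemma good_of_tail (c : Ctx 𝒢 p δ R L Hm r) (a : Adm 𝒢 L Hm k H Q) (hG : G ∈ 𝒢)
    (hT : ∀ j l w, j ≠ l → w ≠ j → w ≠ l →
      |∑ u ∈ Fr j l (H ⊔ Q), ad G w u * (ad G j u - ad G l u)| ≤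
        2 * (L * r) + |2 * ((Xd j l (Fr j l (H ⊔ Q)) G).card : ℝ) -
          (Sd j l (Fr j l (H ⊔ Q)) G).card|) : Good p L r G := by
  have hL := c.L_ge
  have hr := c.r_ge
  have hn := c.n_ge
  have hδ := c.δ_le
  have hH := c.Hm_le
  have hp0 := c.p_pos
  have hp1 := c.p_lt
  have hLr : 1 ≤ L * r := by nlinarith
  have h1 : ∀ w j l, w ≠ j → w ≠ l → |cod G w j - cod G w l| ≤ 14 * (L * r) := by
    intro w j l hwj hwl
    rcases eq_or_ne j l with rfl | hjl
    · rw [sub_self, abs_zero]; linarith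
    have e1 : cod G w j - cod G w l = ∑ u, ad G w u * (ad G j u - ad G l u) := by
      unfold cod; rw [← Finset.sum_sub_distrib]
      exact Finset.sum_congr rfl fun u _ => by ring
    have b1 := hT j l w hjl hwj hwl
    have b2 := abs_sum_compl_le (Fr j l (H ⊔ Q)) (fun u => ad G w u * (ad G j u - ad G l u))
      (fun u => by
        rw [abs_mul, abs_of_nonneg (ad_nonneg _ _ _)]
        exact mul_le_one₀ (ad_le_one _ _ _) (abs_nonneg _) (abs_ad_sub_le G j u l))
    have b3 := abs_two_card_Xd_sub_le (Fr j l (H ⊔ Q)) j l G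
    have b4 := c.abs_deg_sub_le hG j l
    have b5 := card_compl_Fr_le_Hm c a j l
    rw [e1]
    have b6 := abs_sub_abs_le_abs_sub (∑ u, ad G w u * (ad G j u - ad G l u))
      (∑ u ∈ Fr j l (H ⊔ Q), ad G w u * (ad G j u - ad G l u))
    have b7 := abs_sub_abs_le_abs_sub (2 * ((Xd j l (Fr j l (H ⊔ Q)) G).card : ℝ) -
          (Sd j l (Fr j l (H ⊔ Q)) G).card) ((deg G j : ℝ) - deg G l)
    linarith
  intro w j hwj
  have h2 : |(n - 1 : ℝ) * cod G w j - ∑ l ∈ Finset.univ.erase w, cod G w l| ≤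
      (n - 1 : ℝ) * (14 * (L * r)) := by
    have hc : ((Finset.univ.erase w).card : ℝ) = n - 1 := by
      rw [Finset.card_erase_of_mem (Finset.mem_univ _), Finset.card_univ, Fintype.card_fin,
        Nat.cast_sub w.pos]; simp
    have e : (n - 1 : ℝ) * cod G w j - ∑ l ∈ Finset.univ.erase w, cod G w l =
        ∑ l ∈ Finset.univ.erase w, (cod G w j - cod G w l) := by
      rw [Finset.sum_sub_distrib, Finset.sum_const, nsmul_eq_mul, hc]
    rw [e]
    refine (Finset.abs_sum_le_sum_abs _ _).trans ((Finset.sum_le_sum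
      (fun l hl => h1 w j l hwj (Finset.ne_of_mem_erase hl).symm)).trans (le_of_eq ?_))
    rw [Finset.sum_const, nsmul_eq_mul, hc]
  have h3 : |∑ l ∈ Finset.univ.erase w, cod G w l - p * (n - 1) * deg G w| ≤
      (n - 1 : ℝ) * (δ + 1) := by
    rw [sum_cod]
    have e : ∑ u, ad G w u * ((deg G u : ℝ) - 1) - p * (n - 1) * deg G w =
        ∑ u, ad G w u * (((deg G u : ℝ) - p * (n - 1)) - 1) := by
      rw [deg_eq_sum G w, Finset.mul_sum, ← Finset.sum_sub_distrib]
      exact Finset.sum_congr rfl fun u _ => by ring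
    rw [e]
    calc _ ≤ ∑ u, ad G w u * (δ + 1) := by
          refine (Finset.abs_sum_le_sum_abs _ _).trans (Finset.sum_le_sum fun u _ => ?_)
          rw [abs_mul, abs_of_nonneg (ad_nonneg _ _ _)]
          refine mul_le_mul_of_nonneg_left ?_ (ad_nonneg _ _ _)
          have := c.dev_le G hG u
          rw [abs_le] at *; constructor <;> linarith
      _ = (deg G w : ℝ) * (δ + 1) := by rw [← Finset.sum_mul, deg_eq_sum]
      _ ≤ _ := mul_le_mul_of_nonneg_right (deg_le_card G w) (by linarith [c.δ_nonneg])
  have h4 : |cod G w j - p * deg G w| ≤ 14 * (L * r) + (δ + 1) := by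
    have hn1 : (0 : ℝ) < n - 1 := by linarith
    refine le_of_mul_le_mul_left ?_ hn1
    have e : (n - 1 : ℝ) * |cod G w j - p * deg G w| =
        |((n - 1 : ℝ) * cod G w j - ∑ l ∈ Finset.univ.erase w, cod G w l) +
          (∑ l ∈ Finset.univ.erase w, cod G w l - p * (n - 1) * deg G w)| := by
      rw [← abs_of_pos hn1, ← abs_mul, abs_of_pos hn1]; congr 1; ring
    rw [e]
    refine (abs_add_le _ _).trans ?_
    linarith
  have h5 : |p * deg G w - p ^ 2 * n| ≤ δ + 1 := by
    have e : p * deg G w - p ^ 2 * n = p * ((deg G w : ℝ) - p * (n - 1)) - p ^ 2 := by ring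
    have b1 := abs_sub (p * ((deg G w : ℝ) - p * (n - 1))) (p ^ 2)
    rw [e]
    rw [abs_mul, abs_of_pos hp0, abs_of_pos (by positivity : 0 < p ^ 2)] at b1
    have := c.dev_le G hG w
    have := abs_nonneg ((deg G w : ℝ) - p * (n - 1))
    nlinarith
  have h6 : L ^ 2 * r ≥ 100 * (L * r) := by nlinarith
  have := abs_add_le (cod G w j - p * deg G w) (p * deg G w - p ^ 2 * n)
  rw [sub_add_sub_cancel] at this
  linarith

/-- Atypical codegrees are very rare. -/
lemma Ex_bad_le (c : Ctx 𝒢 p δ R L Hm r) (a : Adm 𝒢 L Hm k H Q) :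
    Ex (fam 𝒢 H Q) (fun G => ind (¬ Good p L r G)) ≤ 1 / r ^ 20 := by
  have hL := c.L_ge
  have hr := c.r_ge
  have hn := c.n_ge
  have htn : L * r ≤ n := by rw [← c.r_sq, sq]; exact mul_le_mul_of_nonneg_right c.L_le_r (by linarith)
  set f : Fin n → Fin n → Fin n → SimpleGraph (Fin n) → ℝ := fun j l w G =>
    if j ≠ l ∧ w ≠ j ∧ w ≠ l then ind (2 * (L * r) + |2 * ((Xd j l (Fr j l (H ⊔ Q)) G).card : ℝ) -
        (Sd j l (Fr j l (H ⊔ Q)) G).card| <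
      |∑ u ∈ Fr j l (H ⊔ Q), ad G w u * (ad G j u - ad G l u)|) else 0 with hf
  set B := 2 * ((n : ℝ) + 1) * Real.exp (-((L * r) ^ 2 / (4 * n))) with hB
  have hB0 : 0 ≤ B := by positivity
  have hfB : ∀ j l w, Ex (fam 𝒢 H Q) (f j l w) ≤ B := by
    intro j l w
    by_cases h : j ≠ l ∧ w ≠ j ∧ w ≠ l
    · have := resample_tail (H := H) (Q := Q) c.clos h.1 h.2.1 h.2.2 (t := L * r) (by nlinarith) htn
      simp only [hf, if_pos h]; exact this
    · simp only [hf, if_neg h]; unfold Ex; simpa using hB0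
  have hle : ∀ G ∈ fam 𝒢 H Q, ind (¬ Good p L r G) ≤ ∑ j, ∑ l, ∑ w, f j l w G := by
    intro G hG
    have hf0 : ∀ j l w, 0 ≤ f j l w G := fun j l w => by
      simp only [hf]; split_ifs; exacts [ind_nonneg _, le_rfl]
    by_cases h : Good p L r G
    · simp only [ind, h, not_true, if_false]
      exact Finset.sum_nonneg fun j _ => Finset.sum_nonneg fun l _ => Finset.sum_nonneg fun w _ =>
        hf0 j l w
    · have : ¬ ∀ j l w, j ≠ l → w ≠ j → w ≠ l →
        |∑ u ∈ Fr j l (H ⊔ Q), ad G w u * (ad G j u - ad G l u)| ≤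
        2 * (L * r) + |2 * ((Xd j l (Fr j l (H ⊔ Q)) G).card : ℝ) -
          (Sd j l (Fr j l (H ⊔ Q)) G).card| := fun h' => h (good_of_tail c a (fam_subset hG) h')
      push Not at this
      obtain ⟨j, l, w, h1, h2, h3, h4⟩ := this
      have e : f j l w G = 1 := by simp only [hf]; rw [if_pos ⟨h1, h2, h3⟩]; simp [ind, h4]
      refine (ind_le_one _).trans ?_
      rw [← e]
      refine le_trans ?_ (Finset.single_le_sum (f := fun j => ∑ l, ∑ w, f j l w G)
        (fun j _ => Finset.sum_nonneg fun l _ => Finset.sum_nonneg fun w _ => hf0 j l w)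
        (Finset.mem_univ j))
      refine le_trans ?_ (Finset.single_le_sum (f := fun l => ∑ w, f j l w G)
        (fun l _ => Finset.sum_nonneg fun w _ => hf0 j l w) (Finset.mem_univ l))
      exact Finset.single_le_sum (f := fun w => f j l w G) (fun w _ => hf0 j l w) (Finset.mem_univ w)
  have h1 : Ex (fam 𝒢 H Q) (fun G => ind (¬ Good p L r G)) ≤ (n : ℝ) ^ 3 * B := by
    refine (Ex_mono hle).trans ?_
    simp only [Ex_sum]
    calc _ ≤ ∑ _j : Fin n, ∑ _l : Fin n, ∑ _w : Fin n, B :=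
          Finset.sum_le_sum fun j _ => Finset.sum_le_sum fun l _ => Finset.sum_le_sum fun w _ =>
            hfB j l w
      _ = _ := by simp; ring
  refine h1.trans ?_
  have e1 : (L * r) ^ 2 / (4 * n) = L ^ 2 / 4 := by rw [mul_pow, c.r_sq]; field_simp
  have e2 : Real.exp (-(L ^ 2 / 4)) ≤ 1 / (n : ℝ) ^ 20 := by
    rw [Real.exp_neg, ← one_div]
    refine one_div_le_one_div_of_le (by positivity) ?_
    calc (n : ℝ) ^ 20 = ((n : ℝ) ^ 10) ^ 2 := by ring
      _ ≤ Real.exp L ^ 2 := by gcongr; exact c.exp_L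
      _ = Real.exp (2 * L) := by rw [← Real.exp_nat_mul]; norm_num
      _ ≤ _ := Real.exp_le_exp.2 (by nlinarith)
  have e3 : r ^ 20 = (n : ℝ) ^ 10 := by rw [← c.r_sq]; ring
  rw [hB, e1, e3]
  calc (n : ℝ) ^ 3 * (2 * ((n : ℝ) + 1) * Real.exp (-(L ^ 2 / 4)))
      ≤ (n : ℝ) ^ 3 * ((n : ℝ) ^ 2 * (1 / (n : ℝ) ^ 20)) := by gcongr; nlinarith
    _ = 1 / (n : ℝ) ^ 15 := by field_simp
    _ ≤ _ := one_div_le_one_div_of_le (by positivity) (pow_le_pow_right₀ (by linarith) (by norm_num))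

lemma card_Sd_eq_sum (G : SimpleGraph (Fin n)) (j l : Fin n) (F : Finset (Fin n)) :
    ((Sd j l F G).card : ℝ) = ∑ u ∈ F, (ad G j u * (1 - ad G l u) + (1 - ad G j u) * ad G l u) := by
  unfold Sd
  rw [Finset.card_filter]
  push_cast
  refine Finset.sum_congr rfl fun u _ => ?_
  by_cases h1 : G.Adj j u <;> by_cases h2 : G.Adj l u <;> simp [ad, h1, h2]

lemma Good.sd (c : Ctx 𝒢 p δ R L Hm r) (hG : G ∈ 𝒢) (hg : Good p L r G) {j l : Fin n}
    (hjl : j ≠ l) {F : Finset (Fin n)} (hF : (Fᶜ.card : ℝ) ≤ 5 * Hm) :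
    |((Sd j l F G).card : ℝ) - 2 * (p * (1 - p)) * n| ≤ L ^ 3 * r := by
  have hL := c.L_ge
  have hr := c.r_ge
  have hδ := c.δ_le
  have hH := c.Hm_le
  have hp0 := c.p_pos
  have hp1 := c.p_lt
  have hLr : 1 ≤ L * r := by nlinarith
  rw [card_Sd_eq_sum]
  have h1 := abs_sum_compl_le F (fun u => ad G j u * (1 - ad G l u) + (1 - ad G j u) * ad G l u)
    (fun u => by
      rcases ad_eq_zero_or_one G j u with h | h <;> rcases ad_eq_zero_or_one G l u with h' | h' <;>
        simp [h, h'])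
  have h2 : ∑ u, (ad G j u * (1 - ad G l u) + (1 - ad G j u) * ad G l u) =
      deg G j + deg G l - 2 * cod G j l := by
    rw [deg_eq_sum, deg_eq_sum, cod, Finset.mul_sum, ← Finset.sum_add_distrib,
      ← Finset.sum_sub_distrib]
    exact Finset.sum_congr rfl fun u _ => by ring
  rw [h2] at h1
  have h3 := hg j l hjl
  have h4 := c.dev_le G hG j
  have h5 := c.dev_le G hG l
  have h6 : L ^ 3 * r ≥ 100 * (L ^ 2 * r) := by
    have : 0 ≤ L ^ 2 * r := by positivity
    have e : L ^ 3 * r = L * (L ^ 2 * r) := by ring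
    rw [e]; exact mul_le_mul_of_nonneg_right hL this
  have h7 : L ^ 2 * r ≥ 100 * (L * r) := by nlinarith
  rw [abs_le] at *
  constructor <;> nlinarith

end Sizes

/-- The probability of the edge `jv` given that `H` is present and `Q` absent. -/
noncomputable def pr {n : ℕ} (𝒢 : Finset (SimpleGraph (Fin n))) (H Q : SimpleGraph (Fin n))
    (j v : Fin n) : ℝ := Ex (fam 𝒢 H Q) (fun G => ad G j v)

section Crude
variable {n : ℕ} {𝒢 : Finset (SimpleGraph (Fin n))} {p δ R L Hm r : ℝ} {k : ℕ}
  {H Q G : SimpleGraph (Fin n)}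

lemma abs_Ex_le_good (c : Ctx 𝒢 p δ R L Hm r) (a : Adm 𝒢 L Hm k H Q)
    {f g : SimpleGraph (Fin n) → ℝ} {B : ℝ}
    (hg : ∀ G ∈ fam 𝒢 H Q, Good p L r G → |f G| ≤ g G) (hg0 : ∀ G ∈ fam 𝒢 H Q, 0 ≤ g G)
    (hB : ∀ G ∈ fam 𝒢 H Q, |f G| ≤ B) :
    |Ex (fam 𝒢 H Q) f| ≤ Ex (fam 𝒢 H Q) g + B / r ^ 20 := by
  obtain ⟨G₀, hG₀⟩ := a.nonempty
  have hB0 : 0 ≤ B := (abs_nonneg _).trans (hB G₀ hG₀)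
  have h1 : |Ex (fam 𝒢 H Q) f| ≤
      Ex (fam 𝒢 H Q) (fun G => g G + B * ind (¬ Good p L r G)) := by
    refine abs_Ex_le_of fun G hG => ?_
    by_cases h : Good p L r G
    · have := hg G hG h
      simpa [ind, h] using this
    · have := hB G hG
      have := hg0 G hG
      simp only [ind, h, not_false_eq_true, if_true]; linarith
  rw [Ex_add, Ex_mul] at h1
  have h2 := mul_le_mul_of_nonneg_left (Ex_bad_le c a) hB0
  calc _ ≤ _ := h1
    _ ≤ _ := by rw [div_eq_mul_one_div B]; linarith

lemma abs_Ex_le_good_const (c : Ctx 𝒢 p δ R L Hm r) (a : Adm 𝒢 L Hm k H Q)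
    {f : SimpleGraph (Fin n) → ℝ} {g B : ℝ}
    (hg : ∀ G ∈ fam 𝒢 H Q, Good p L r G → |f G| ≤ g) (hg0 : 0 ≤ g)
    (hB : ∀ G ∈ fam 𝒢 H Q, |f G| ≤ B) :
    |Ex (fam 𝒢 H Q) f| ≤ g + B / r ^ 20 := by
  have := abs_Ex_le_good c a (g := fun _ => g) hg (fun _ _ => hg0) hB
  rwa [Ex_const a.nonempty] at this

lemma Ctx.q_pos (c : Ctx 𝒢 p δ R L Hm r) : 0 < 1 - p := by linarith [c.p_lt]

lemma Ctx.Λ_pos (c : Ctx 𝒢 p δ R L Hm r) : 0 < p * (1 - p) := mul_pos c.p_pos c.q_pos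

lemma Ctx.one_le_LΛ (c : Ctx 𝒢 p δ R L Hm r) : 1 ≤ L ^ 2 * (p * (1 - p)) := by
  have := one_le_mul_of_one_le_of_one_le c.one_le_Lp c.one_le_Lq
  calc (1 : ℝ) ≤ L * p * (L * (1 - p)) := this
    _ = _ := by ring

lemma Ctx.Λ_lt (c : Ctx 𝒢 p δ R L Hm r) : p * (1 - p) ≤ 1 := by
  nlinarith [c.p_pos, c.p_lt]

lemma Good.sd_ge (c : Ctx 𝒢 p δ R L Hm r) (hG : G ∈ 𝒢) (hg : Good p L r G) {j l : Fin n}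
    (hjl : j ≠ l) {F : Finset (Fin n)} (hF : (Fᶜ.card : ℝ) ≤ 5 * Hm) :
    p * (1 - p) * n ≤ (Sd j l F G).card := by
  have h1 := abs_le.1 (hg.sd c hG hjl hF)
  have h2 : L ^ 3 * r ≤ p * (1 - p) * n := by
    rw [← c.r_sq]
    have h3 : L ^ 5 ≤ r := c.Lpow_le (by norm_num)
    have h4 : L ^ 3 * 1 ≤ L ^ 3 * (L ^ 2 * (p * (1 - p))) :=
      mul_le_mul_of_nonneg_left c.one_le_LΛ (pow_nonneg c.L_pos.le 3)
    have hΛ := c.Λ_pos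
    have hr := c.r_pos
    calc L ^ 3 * r = L ^ 3 * 1 * r := by ring
      _ ≤ L ^ 3 * (L ^ 2 * (p * (1 - p))) * r := by gcongr
      _ = p * (1 - p) * (L ^ 5 * r) := by ring
      _ ≤ p * (1 - p) * (r * r) := by gcongr
      _ = _ := by ring
  linarith [h1.1]

lemma Ctx.inv_Λn_le (c : Ctx 𝒢 p δ R L Hm r) : 1 / (p * (1 - p) * n) ≤ L ^ 2 / n := by
  have h := c.one_le_LΛ
  have hn : (0 : ℝ) < n := by linarith [c.n_ge]
  have hΛ := c.Λ_pos
  rw [div_le_div_iff₀ (by positivity) hn]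
  nlinarith

lemma Good.inv_sd_le (c : Ctx 𝒢 p δ R L Hm r) (hG : G ∈ 𝒢) (hg : Good p L r G) {j l : Fin n}
    (hjl : j ≠ l) {F : Finset (Fin n)} (hF : (Fᶜ.card : ℝ) ≤ 5 * Hm) :
    1 / ((Sd j l F G).card : ℝ) ≤ L ^ 2 / n := by
  have hn : (0 : ℝ) < n := by linarith [c.n_ge]
  have hΛ := c.Λ_pos
  exact (one_div_le_one_div_of_le (by positivity) (hg.sd_ge c hG hjl hF)).trans c.inv_Λn_le

lemma Good.inv_sd_sub (c : Ctx 𝒢 p δ R L Hm r) (hG : G ∈ 𝒢) (hg : Good p L r G) {j l : Fin n}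
    (hjl : j ≠ l) {F : Finset (Fin n)} (hF : (Fᶜ.card : ℝ) ≤ 5 * Hm) :
    |1 / ((Sd j l F G).card : ℝ) - 1 / (2 * (p * (1 - p)) * n)| ≤ L ^ 7 / r ^ 3 := by
  have hn : (0 : ℝ) < n := by linarith [c.n_ge]
  have hΛ := c.Λ_pos
  have hr := c.r_pos
  have h1 := hg.sd c hG hjl hF
  have h2 := hg.sd_ge c hG hjl hF
  have h3 := hg.inv_sd_le c hG hjl hF
  set s := ((Sd j l F G).card : ℝ)
  have hs : 0 < s := lt_of_lt_of_le (by positivity) h2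
  have h4 : 1 / (2 * (p * (1 - p)) * n) ≤ L ^ 2 / n := by
    refine le_trans ?_ c.inv_Λn_le
    exact one_div_le_one_div_of_le (by positivity) (by nlinarith [mul_pos hΛ hn])
  have e : 1 / s - 1 / (2 * (p * (1 - p)) * n) =
      (1 / s) * (1 / (2 * (p * (1 - p)) * n)) * -(s - 2 * (p * (1 - p)) * n) := by
    generalize p * (1 - p) = Λ at hΛ
    field_simp; ring
  rw [e, abs_mul, abs_neg, abs_of_nonneg (by have := c.q_pos; have := c.p_pos; positivity)]
  calc _ ≤ (L ^ 2 / n) * (L ^ 2 / n) * (L ^ 3 * r) := by gcongr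
    _ = _ := by rw [← c.r_sq]; field_simp

lemma abs_two_card_Xd_sub_le_card (F : Finset (Fin n)) (j l : Fin n) (G : SimpleGraph (Fin n)) :
    |2 * ((Xd j l F G).card : ℝ) - (Sd j l F G).card| ≤ (Sd j l F G).card := by
  have h : (Xd j l F G).card ≤ (Sd j l F G).card := Finset.card_le_card Xd_subset
  have h' : ((Xd j l F G).card : ℝ) ≤ (Sd j l F G).card := by exact_mod_cast h
  have : (0 : ℝ) ≤ (Xd j l F G).card := Nat.cast_nonneg _
  rw [abs_le]; constructor <;> linarith

lemma ind_Sd_mul {v : Fin n} {j l : Fin n} {F : Finset (Fin n)} (hv : v ∈ F) (G : SimpleGraph (Fin n)) :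
    ind (v ∈ Sd j l F G) * (ad G j v - ad G l v) = ad G j v - ad G l v := by
  by_cases h1 : G.Adj j v <;> by_cases h2 : G.Adj l v <;> simp [ind, Sd, ad, h1, h2, hv]

lemma ind_Sd_eq {v : Fin n} {j l : Fin n} {F : Finset (Fin n)} (hv : v ∈ F) (G : SimpleGraph (Fin n)) :
    ind (v ∈ Sd j l F G) = ad G j v * (1 - ad G l v) + (1 - ad G j v) * ad G l v := by
  by_cases h1 : G.Adj j v <;> by_cases h2 : G.Adj l v <;> simp [ind, Sd, ad, h1, h2, hv]

lemma mem_Fr {j l v : Fin n} {U : SimpleGraph (Fin n)} :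
    v ∈ Fr j l U ↔ v ≠ j ∧ v ≠ l ∧ ¬ U.Adj j v ∧ ¬ U.Adj l v := by simp [Fr]

/-- The difference of two edge probabilities at a common free vertex. -/
lemma pr_sub_pr (c : Ctx 𝒢 p δ R L Hm r) {j l v : Fin n} (hjl : j ≠ l)
    (hv : v ∈ Fr j l (H ⊔ Q)) :
    pr 𝒢 H Q j v - pr 𝒢 H Q l v = Ex (fam 𝒢 H Q) (fun G =>
      ind (v ∈ Sd j l (Fr j l (H ⊔ Q)) G) *
      ((2 * (Xd j l (Fr j l (H ⊔ Q)) G).card - (Sd j l (Fr j l (H ⊔ Q)) G).card) /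
        (Sd j l (Fr j l (H ⊔ Q)) G).card)) := by
  have h := resample_vertex (H := H) (Q := Q) c.clos hjl v (fun _ => 1) (fun _ _ _ => rfl)
  simp only [one_mul, ind_Sd_mul hv, Ex_sub] at h
  exact h

/-- The vertices that may still be joined to `v`. -/
noncomputable def Nb (v : Fin n) (U : SimpleGraph (Fin n)) : Finset (Fin n) :=
  Finset.univ.filter fun j => j ≠ v ∧ ¬ U.Adj j v

lemma mem_Nb {j v : Fin n} {U : SimpleGraph (Fin n)} : j ∈ Nb v U ↔ j ≠ v ∧ ¬ U.Adj j v := by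
  simp [Nb]

lemma mem_Fr_of_mem_Nb {j l v : Fin n} {U : SimpleGraph (Fin n)} (hj : j ∈ Nb v U) (hl : l ∈ Nb v U) :
    v ∈ Fr j l U := by
  rw [mem_Nb] at hj hl
  exact mem_Fr.2 ⟨hj.1.symm, hl.1.symm, hj.2, hl.2⟩

lemma card_compl_Nb_le (v : Fin n) : ((Nb v (H ⊔ Q))ᶜ.card : ℝ) ≤ 1 + deg H v + deg Q v := by
  have h1 : (Nb v (H ⊔ Q))ᶜ ⊆ {v} ∪ (Finset.univ.filter fun k => H.Adj v k) ∪
      (Finset.univ.filter fun k => Q.Adj v k) := by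
    intro w hw
    simp only [Nb, Finset.mem_compl, Finset.mem_filter, Finset.mem_univ, true_and,
      SimpleGraph.sup_adj] at hw
    simp only [Finset.mem_union, Finset.mem_singleton, Finset.mem_filter, Finset.mem_univ, true_and,
      SimpleGraph.adj_comm _ v w]
    tauto
  have h3 : (Nb v (H ⊔ Q))ᶜ.card ≤ 1 + deg H v + deg Q v := by
    refine (Finset.card_le_card h1).trans ?_
    refine (Finset.card_union_le _ _).trans (add_le_add ?_ le_rfl)
    refine (Finset.card_union_le _ _).trans (add_le_add ?_ le_rfl)
    simp
  exact_mod_cast h3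

lemma card_Nb (v : Fin n) (U : SimpleGraph (Fin n)) :
    ((Nb v U).card : ℝ) = n - (Nb v U)ᶜ.card := by
  rw [eq_sub_iff_add_eq]
  exact_mod_cast (Finset.card_add_card_compl (Nb v U)).trans (Fintype.card_fin n)

lemma pr_nonneg (j v : Fin n) : 0 ≤ pr 𝒢 H Q j v := Ex_nonneg fun _ _ => ad_nonneg _ _ _

lemma pr_le_one (a : (fam 𝒢 H Q).Nonempty) (j v : Fin n) : pr 𝒢 H Q j v ≤ 1 :=
  Ex_le_const a fun _ _ => ad_le_one _ _ _

lemma sum_pr (v : Fin n) : ∑ j, pr 𝒢 H Q j v = Ex (fam 𝒢 H Q) (fun G => (deg G v : ℝ)) := by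
  unfold pr
  rw [← Ex_sum]
  refine Ex_congr fun G _ => ?_
  rw [deg_eq_sum]; exact Finset.sum_congr rfl fun _ _ => ad_comm _ _ _

lemma mul_pr_eq (v j : Fin n) (N : Finset (Fin n)) :
    (N.card : ℝ) * pr 𝒢 H Q j v = Ex (fam 𝒢 H Q) (fun G => (deg G v : ℝ)) -
      ∑ l ∈ Nᶜ, pr 𝒢 H Q l v + ∑ l ∈ N, (pr 𝒢 H Q j v - pr 𝒢 H Q l v) := by
  rw [← sum_pr, ← Finset.sum_add_sum_compl N, Finset.sum_sub_distrib]
  simp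

/-- Edge probabilities are close to `p`. -/
lemma pr_crude (c : Ctx 𝒢 p δ R L Hm r) (a : Adm 𝒢 L Hm k H Q) {j v : Fin n} (hjv : j ≠ v)
    (hH : ¬ H.Adj j v) (hQ : ¬ Q.Adj j v) : |pr 𝒢 H Q j v - p| ≤ L ^ 4 / r := by
  have hL := c.L_ge
  have hr := c.r_pos
  have hn := c.n_ge
  have hp0 := c.p_pos
  have hp1 := c.p_lt
  have hδ := c.δ_le
  have hHm := c.Hm_le
  have hHm20 := c.Hm_ge
  have hj : j ∈ Nb v (H ⊔ Q) := mem_Nb.2 ⟨hjv, by simp [hH, hQ]⟩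
  have hdiff : ∀ l ∈ Nb v (H ⊔ Q), |pr 𝒢 H Q j v - pr 𝒢 H Q l v| ≤ 8 * L ^ 3 / r := by
    intro l hl
    rcases eq_or_ne j l with rfl | hjl
    · rw [sub_self, abs_zero]; positivity
    rw [pr_sub_pr c hjl (mem_Fr_of_mem_Nb hj hl)]
    have hFr := card_compl_Fr_le_Hm c a j l
    set F := Fr j l (H ⊔ Q)
    have hb : ∀ G, |(2 * ((Xd j l F G).card : ℝ) - (Sd j l F G).card) / (Sd j l F G).card| ≤ 1 := by
      intro G
      rw [abs_div, Nat.abs_cast]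
      exact div_le_one_of_le₀ (abs_two_card_Xd_sub_le_card F j l G) (Nat.cast_nonneg _)
    refine (abs_Ex_le_good_const c a (g := 7 * L ^ 3 / r) (B := 1) (fun G hG hg => ?_)
      (by positivity) (fun G hG => ?_)).trans ?_
    · rw [abs_mul, abs_of_nonneg (ind_nonneg _)]
      refine (mul_le_of_le_one_left (abs_nonneg _) (ind_le_one _)).trans ?_
      have h1 := hg.inv_sd_le c (fam_subset hG) hjl hFr
      have h2 : |2 * ((Xd j l F G).card : ℝ) - (Sd j l F G).card| ≤ 7 * (L * r) := by
        have h3 := abs_two_card_Xd_sub_le F j l G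
        have h4 := c.abs_deg_sub_le (fam_subset hG) j l
        rw [abs_le] at *
        constructor <;> linarith
      rw [abs_div, Nat.abs_cast, div_eq_mul_one_div]
      calc _ ≤ 7 * (L * r) * (L ^ 2 / n) := by gcongr
        _ = _ := by rw [← c.r_sq]; field_simp
    · rw [abs_mul, abs_of_nonneg (ind_nonneg _)]
      exact mul_le_one₀ (ind_le_one _) (abs_nonneg _) (hb G)
    · have : 1 / r ^ 20 ≤ 1 / r := by
        apply one_div_le_one_div_of_le hr
        exact le_self_pow₀ (by linarith [c.r_ge]) (by norm_num)
      have : 1 / r ≤ L ^ 3 / r := by gcongr; nlinarith [sq_nonneg L]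
      calc _ ≤ 7 * L ^ 3 / r + L ^ 3 / r := by linarith
        _ = _ := by ring
  set N := Nb v (H ⊔ Q) with hN
  have hNc : (Nᶜ.card : ℝ) ≤ 3 * Hm := by
    have := card_compl_Nb_le (H := H) (Q := Q) v
    have := a.deg_le_Hm v; have := a.degQ_le_20 v
    linarith
  have hNcard := card_Nb v (H ⊔ Q)
  rw [← hN] at hNcard
  have h1 := mul_pr_eq (𝒢 := 𝒢) (H := H) (Q := Q) v j N
  have h2 : |Ex (fam 𝒢 H Q) (fun G => (deg G v : ℝ)) - p * (n - 1)| ≤ δ := by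
    rw [← Ex_const a.nonempty (p * (n - 1)), ← Ex_sub]
    refine (abs_Ex_le_of fun G hG => c.dev_le G (fam_subset hG) v).trans ?_
    rw [Ex_const a.nonempty]
  have h3 : |∑ l ∈ Nᶜ, pr 𝒢 H Q l v| ≤ 3 * Hm := by
    refine (Finset.abs_sum_le_sum_abs _ _).trans ((Finset.sum_le_sum (g := fun _ => (1 : ℝ))
      fun l _ => ?_).trans ?_)
    · rw [abs_of_nonneg (pr_nonneg _ _)]; exact pr_le_one a.nonempty _ _
    · simpa using hNc
  have h4 : |∑ l ∈ N, (pr 𝒢 H Q j v - pr 𝒢 H Q l v)| ≤ N.card * (8 * L ^ 3 / r) := by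
    refine (Finset.abs_sum_le_sum_abs _ _).trans ((Finset.sum_le_sum hdiff).trans ?_)
    simp
  have hNc0 : (0 : ℝ) ≤ Nᶜ.card := Nat.cast_nonneg _
  have h5 : |(N.card : ℝ) * (pr 𝒢 H Q j v - p)| ≤ δ + 6 * Hm + N.card * (8 * L ^ 3 / r) := by
    have e : (N.card : ℝ) * (pr 𝒢 H Q j v - p) =
        (Ex (fam 𝒢 H Q) (fun G => (deg G v : ℝ)) - p * (n - 1)) - ∑ l ∈ Nᶜ, pr 𝒢 H Q l v +
        ∑ l ∈ N, (pr 𝒢 H Q j v - pr 𝒢 H Q l v) + p * (Nᶜ.card - 1) := by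
      rw [mul_sub, h1, hNcard]; ring
    have h6 : |p * ((Nᶜ.card : ℝ) - 1)| ≤ 3 * Hm := by
      rw [abs_mul, abs_of_pos hp0]
      have : |(Nᶜ.card : ℝ) - 1| ≤ 3 * Hm := by rw [abs_le]; constructor <;> linarith
      nlinarith [abs_nonneg ((Nᶜ.card : ℝ) - 1)]
    rw [e]
    rw [abs_le] at *
    constructor <;> linarith
  have hrL : 14 * L ≤ r := by
    have : L ^ 2 ≤ r := c.Lpow_le (by norm_num)
    nlinarith
  have hNn : r ^ 2 / 2 ≤ N.card := by
    rw [hNcard, ← c.r_sq]; nlinarith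
  rw [abs_mul, Nat.abs_cast] at h5
  have hNpos : (0 : ℝ) < N.card := lt_of_lt_of_le (by positivity) hNn
  refine le_of_mul_le_mul_left (h5.trans ?_) hNpos
  have h7 : δ + 6 * Hm ≤ N.card * (14 * L / r) := by
    calc δ + 6 * Hm ≤ 7 * (L * r) := by linarith
      _ = r ^ 2 / 2 * (14 * L / r) := by field_simp; ring
      _ ≤ _ := by gcongr
  calc _ ≤ N.card * (14 * L / r) + N.card * (8 * L ^ 3 / r) := by linarith
    _ = N.card * ((14 * L + 8 * L ^ 3) / r) := by ring
    _ ≤ _ := by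
      gcongr
      have : L ^ 4 = L * L ^ 3 := by ring
      have : L ≤ L ^ 3 := le_self_pow₀ (by linarith) (by norm_num)
      nlinarith

end Crude

section Edge
variable {n : ℕ} {𝒢 : Finset (SimpleGraph (Fin n))} {p δ R L Hm r : ℝ} {k : ℕ}
  {H Q G : SimpleGraph (Fin n)} {j l v : Fin n}

lemma ad_edge (hjv : j ≠ v) (u w : Fin n) : ad (SimpleGraph.edge j v) u w =
    ind (u = j) * ind (w = v) + ind (u = v) * ind (w = j) := by
  simp only [ad, SimpleGraph.edge_adj, ind]
  by_cases h1 : u = j <;> by_cases h2 : w = v <;> by_cases h3 : u = v <;> by_cases h4 : w = j <;>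
    simp [h1, h2, h3, h4] <;> simp_all

lemma ad_sup_edge (hjv : j ≠ v) (h : ¬ H.Adj j v) (u w : Fin n) :
    ad (H ⊔ SimpleGraph.edge j v) u w = ad H u w +
      (ind (u = j) * ind (w = v) + ind (u = v) * ind (w = j)) := by
  rw [← ad_edge hjv]
  by_cases h1 : H.Adj u w
  · have h2 : ¬ (SimpleGraph.edge j v).Adj u w := by
      rw [SimpleGraph.edge_adj]
      rintro ⟨⟨rfl, rfl⟩ | ⟨rfl, rfl⟩, -⟩
      exacts [h h1, h h1.symm]
    rw [ad_of_adj h1, ad_of_not_adj h2, ad_of_adj (Or.inl h1), add_zero]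
  · by_cases h2 : (SimpleGraph.edge j v).Adj u w
    · rw [ad_of_not_adj h1, ad_of_adj h2, ad_of_adj (Or.inr h2), zero_add]
    · rw [ad_of_not_adj h1, ad_of_not_adj h2, ad_of_not_adj (by simp [h1, h2]), add_zero]

lemma sum_ind_eq (v : Fin n) : ∑ w, ind (w = v) = 1 := by
  rw [Finset.sum_eq_single v (fun w _ h => by simp [ind, h]) (fun h => absurd (Finset.mem_univ v) h)]
  simp [ind]

lemma deg_sup_edge (hjv : j ≠ v) (h : ¬ H.Adj j v) (u : Fin n) :
    (deg (H ⊔ SimpleGraph.edge j v) u : ℝ) = deg H u + ind (u = j) + ind (u = v) := by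
  simp only [deg_eq_sum, ad_sup_edge hjv h, Finset.sum_add_distrib, ← Finset.mul_sum, sum_ind_eq]
  ring

lemma ind_add_ind_le (hjv : j ≠ v) (u : Fin n) : ind (u = j) + ind (u = v) ≤ 1 := by
  by_cases h1 : u = j
  · subst h1; simp [ind, hjv]
  · have : ind (u = j) = 0 := by simp [ind, h1]
    rw [this, zero_add]; exact ind_le_one _

lemma deg_sup_edge_le (hjv : j ≠ v) (h : ¬ H.Adj j v) (u : Fin n) :
    (deg (H ⊔ SimpleGraph.edge j v) u : ℝ) ≤ deg H u + 1 := by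
  rw [deg_sup_edge hjv h]; linarith [ind_add_ind_le hjv u]

lemma deg_le_deg_sup (H E : SimpleGraph (Fin n)) (u : Fin n) : deg H u ≤ deg (H ⊔ E) u :=
  Finset.card_le_card fun w hw => by
    simp only [Finset.mem_filter, Finset.mem_univ, true_and] at hw ⊢
    exact Or.inl hw

lemma L4_div_r_lt (c : Ctx 𝒢 p δ R L Hm r) : L ^ 4 / r < p ∧ L ^ 4 / r < 1 - p := by
  have hr := c.r_pos
  have hL := c.L_pos
  have h6 : L ^ 6 ≤ r := c.Lpow_le (by norm_num)
  have h5 : L ^ 4 * L < r := by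
    have h5' : 0 < L ^ 5 := by positivity
    have : L ^ 6 = L * L ^ 5 := by ring
    have : L ^ 4 * L = L ^ 5 := by ring
    nlinarith [c.L_ge]
  have key : ∀ x : ℝ, 1 ≤ L * x → L ^ 4 / r < x := fun x hx => by
    have hx0 : 0 < x := by
      by_contra! h; nlinarith
    rw [div_lt_iff₀ hr]
    calc L ^ 4 = L ^ 4 * 1 := by ring
      _ ≤ L ^ 4 * (L * x) := by gcongr
      _ = x * (L ^ 4 * L) := by ring
      _ < x * r := by gcongr
  exact ⟨key p c.one_le_Lp, key (1 - p) c.one_le_Lq⟩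

lemma pr_pos (c : Ctx 𝒢 p δ R L Hm r) (a : Adm 𝒢 L Hm k H Q) (hjv : j ≠ v)
    (hH : ¬ H.Adj j v) (hQ : ¬ Q.Adj j v) : 0 < pr 𝒢 H Q j v := by
  have := (abs_le.1 (pr_crude c a hjv hH hQ)).1
  linarith [(L4_div_r_lt c).1]

lemma pr_lt_one (c : Ctx 𝒢 p δ R L Hm r) (a : Adm 𝒢 L Hm k H Q) (hjv : j ≠ v)
    (hH : ¬ H.Adj j v) (hQ : ¬ Q.Adj j v) : pr 𝒢 H Q j v < 1 := by
  have := (abs_le.1 (pr_crude c a hjv hH hQ)).2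
  linarith [(L4_div_r_lt c).2]

lemma Adm.add (c : Ctx 𝒢 p δ R L Hm r) (a : Adm 𝒢 L Hm (k + 1) H Q) (hjv : j ≠ v)
    (hH : ¬ H.Adj j v) (hQ : ¬ Q.Adj j v) : Adm 𝒢 L Hm k (H ⊔ SimpleGraph.edge j v) Q where
  nonempty := by
    have h := card_fam_sup_edge a.nonempty hjv
    have h1 := pr_pos c a hjv hH hQ
    have h2 : (0 : ℝ) < (fam 𝒢 H Q).card := by exact_mod_cast a.nonempty.card_pos
    have h3 : (0 : ℝ) < (fam 𝒢 (H ⊔ SimpleGraph.edge j v) Q).card := by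
      rw [h]; exact mul_pos h1 h2
    exact Finset.card_pos.1 (by exact_mod_cast h3)
  deg_le u := by
    have := deg_sup_edge_le hjv hH u
    have := a.deg_le u
    push_cast at this; linarith
  sum_le := by
    have := a.sum_le
    simp only [deg_sup_edge hjv hH, Finset.sum_add_distrib, sum_ind_eq]
    push_cast at this; linarith
  degQ_le u := by
    have := a.degQ_le u
    push_cast at this; linarith

lemma Adm.addQ (c : Ctx 𝒢 p δ R L Hm r) (a : Adm 𝒢 L Hm (k + 1) H Q) (hjv : j ≠ v)
    (hH : ¬ H.Adj j v) (hQ : ¬ Q.Adj j v) : Adm 𝒢 L Hm k H (Q ⊔ SimpleGraph.edge j v) where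
  nonempty := by
    have h := card_fam_edge_sup a.nonempty hjv
    have h1 := pr_lt_one c a hjv hH hQ
    have h2 : (0 : ℝ) < (fam 𝒢 H Q).card := by exact_mod_cast a.nonempty.card_pos
    have h3 : (0 : ℝ) < (fam 𝒢 H (Q ⊔ SimpleGraph.edge j v)).card := by
      rw [h]; exact mul_pos (by unfold pr at h1; linarith) h2
    exact Finset.card_pos.1 (by exact_mod_cast h3)
  deg_le u := by
    have := a.deg_le u
    push_cast at this; linarith
  sum_le := by
    have := a.sum_le
    push_cast at this; linarith
  degQ_le u := by
    have := deg_sup_edge_le hjv hQ u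
    have := a.degQ_le u
    push_cast at this; linarith

lemma sup_edge_adj_iff {u w : Fin n} (hjv : j ≠ v) : (H ⊔ SimpleGraph.edge j v).Adj u w ↔
    H.Adj u w ∨ (u = j ∧ w = v) ∨ (u = v ∧ w = j) := by
  rw [SimpleGraph.sup_adj, SimpleGraph.edge_adj]
  constructor
  · rintro (h | ⟨h, -⟩)
    exacts [Or.inl h, Or.inr (by tauto)]
  · rintro (h | ⟨rfl, rfl⟩ | ⟨rfl, rfl⟩)
    exacts [Or.inl h, Or.inr ⟨by tauto, hjv⟩, Or.inr ⟨by tauto, hjv.symm⟩]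

lemma Ex_ad_mul' (hjv : j ≠ v) (f : SimpleGraph (Fin n) → ℝ) :
    Ex (fam 𝒢 H Q) (fun G => ad G j v * f G) =
      pr 𝒢 H Q j v * Ex (fam 𝒢 (H ⊔ SimpleGraph.edge j v) Q) f := Ex_ad_mul hjv f

lemma Ex_nad_mul' (a : Adm 𝒢 L Hm k H Q) (hjv : j ≠ v) (f : SimpleGraph (Fin n) → ℝ) :
    Ex (fam 𝒢 H Q) (fun G => (1 - ad G j v) * f G) =
      (1 - pr 𝒢 H Q j v) * Ex (fam 𝒢 H (Q ⊔ SimpleGraph.edge j v)) f := by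
  rw [Ex_nad_mul hjv, Ex_one_sub_ad a.nonempty]; rfl

/-- Main part of the contribution of planted edges to the row difference. -/
noncomputable def kap (H : SimpleGraph (Fin n)) (j l : Fin n) (G : SimpleGraph (Fin n)) : ℝ :=
  ∑ w, ad H j w * (1 - ad G l w) - ∑ w, ad H l w * (1 - ad G j w)

/-- The contribution of the non-free vertices to the difference of two rows. -/
noncomputable def kapF (F : Finset (Fin n)) (j l : Fin n) (G : SimpleGraph (Fin n)) : ℝ :=
  ((deg G j : ℝ) - deg G l) - (2 * ((Xd j l F G).card : ℝ) - (Sd j l F G).card)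

lemma abs_kapF_sub_kap_le (hjl : j ≠ l) (hG : G ∈ fam 𝒢 H Q) :
    |kapF (Fr j l (H ⊔ Q)) j l G - kap H j l G| ≤ deg Q j + deg Q l := by
  obtain ⟨-, hGH, hGQ⟩ := mem_fam.1 hG
  set F := Fr j l (H ⊔ Q) with hF
  have e : kapF F j l G - kap H j l G = ∑ w, (ind (w ∉ F) * (ad G j w - ad G l w) -
      (ad H j w * (1 - ad G l w) - ad H l w * (1 - ad G j w))) := by
    have e1 := Finset.sum_sub_distrib (s := Finset.univ) (fun w => ad G j w) (fun w => ad G l w)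
    have e2 := Finset.sum_sub_distrib (s := Finset.univ)
      (fun w => ad H j w * (1 - ad G l w)) (fun w => ad H l w * (1 - ad G j w))
    have e3 := Finset.sum_sub_distrib (s := Finset.univ)
      (fun w => ind (w ∉ F) * (ad G j w - ad G l w))
      (fun w => ad H j w * (1 - ad G l w) - ad H l w * (1 - ad G j w))
    rw [kapF, two_card_Xd_sub, deg_eq_sum, deg_eq_sum, kap, e3, ← e1, ← e2]
    congr 1
    rw [← Finset.sum_add_sum_compl F (fun w => ad G j w - ad G l w), add_sub_cancel_left]
    rw [← Finset.sum_add_sum_compl F (fun w => ind (w ∉ F) * (ad G j w - ad G l w)),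
      Finset.sum_eq_zero (s := F) (fun w hw => by simp [ind, hw]), zero_add]
    exact Finset.sum_congr rfl fun w hw => by simp [ind, Finset.mem_compl.1 hw]
  set φ : Fin n → ℝ := fun w => (ind (w = j) - ind (w = l)) * (ad H j l - ad G j l) with hφ
  have hφ0 : ∑ w, φ w = 0 := by
    simp only [hφ, ← Finset.sum_mul, Finset.sum_sub_distrib, sum_ind_eq]; ring
  rw [e, ← sub_zero (∑ w, _), ← hφ0, ← Finset.sum_sub_distrib, deg_eq_sum, deg_eq_sum,
    ← Finset.sum_add_distrib]
  refine (Finset.abs_sum_le_sum_abs _ _).trans (Finset.sum_le_sum fun w _ => ?_)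
  have hn1 := ad_nonneg Q j w
  have hn2 := ad_nonneg Q l w
  rcases eq_or_ne w j with rfl | hwj
  · have h1 : ¬ w ∈ F := left_notMem_Fr _ _ _
    have h0 : ad H l w = ad H w l := ad_comm _ _ _
    have h0' : ad G l w = ad G w l := ad_comm _ _ _
    simp only [hφ, ind, h1, hjl, ad_self, if_true, if_false, not_false_eq_true, h0, h0']
    ring_nf
    simpa [ad_self] using hn2
  rcases eq_or_ne w l with rfl | hwl
  · have h1 : ¬ w ∈ F := right_notMem_Fr _ _ _
    simp only [hφ, ind, h1, hwj, ad_self, if_true, if_false, not_false_eq_true]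
    ring_nf
    simpa [ad_self] using hn1
  have e1 : φ w = 0 := by simp [hφ, ind, hwj, hwl]
  rw [e1, sub_zero]
  by_cases h1 : H.Adj j w
  · have hm : w ∉ F := by rw [hF, mem_Fr]; simp [h1]
    have hg : G.Adj j w := hGH _ _ h1
    by_cases h2 : H.Adj l w
    · have hg' : G.Adj l w := hGH _ _ h2
      simpa [ind, hm, ad_of_adj h1, ad_of_adj h2, ad_of_adj hg, ad_of_adj hg'] using add_nonneg hn1 hn2
    · simpa [ind, hm, ad_of_adj h1, ad_of_not_adj h2, ad_of_adj hg] using add_nonneg hn1 hn2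
  · by_cases h2 : H.Adj l w
    · have hm : w ∉ F := by rw [hF, mem_Fr]; simp [h2]
      have hg' : G.Adj l w := hGH _ _ h2
      simpa [ind, hm, ad_of_not_adj h1, ad_of_adj h2, ad_of_adj hg'] using add_nonneg hn1 hn2
    · simp only [ad_of_not_adj h1, ad_of_not_adj h2, zero_mul, sub_zero]
      by_cases h3 : Q.Adj j w
      · rw [ad_of_adj h3]
        refine le_trans ?_ (le_add_of_nonneg_right hn2)
        rw [abs_mul, abs_of_nonneg (ind_nonneg _)]
        exact mul_le_one₀ (ind_le_one _) (abs_nonneg _) (abs_ad_sub_le _ _ _ _)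
      · by_cases h4 : Q.Adj l w
        · rw [ad_of_adj h4]
          refine le_trans ?_ (le_add_of_nonneg_left hn1)
          rw [abs_mul, abs_of_nonneg (ind_nonneg _)]
          exact mul_le_one₀ (ind_le_one _) (abs_nonneg _) (abs_ad_sub_le _ _ _ _)
        · have hm : w ∈ F := by
            rw [hF, mem_Fr]; simp [h1, h2, h3, h4, hwj, hwl]
          simpa [ind, hm] using add_nonneg hn1 hn2

lemma sum_ad_mul_nonneg_le (H : SimpleGraph (Fin n)) (j l : Fin n) (G : SimpleGraph (Fin n)) :
    0 ≤ ∑ w, ad H j w * (1 - ad G l w) ∧ ∑ w, ad H j w * (1 - ad G l w) ≤ deg H j := by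
  constructor
  · exact Finset.sum_nonneg fun w _ => mul_nonneg (ad_nonneg _ _ _) (by linarith [ad_le_one G l w])
  · rw [deg_eq_sum]
    exact Finset.sum_le_sum fun w _ =>
      mul_le_of_le_one_right (ad_nonneg _ _ _) (by linarith [ad_nonneg G l w])

lemma abs_kap_le (H : SimpleGraph (Fin n)) (j l : Fin n) (G : SimpleGraph (Fin n)) :
    |kap H j l G| ≤ deg H j + deg H l := by
  have h1 := sum_ad_mul_nonneg_le H j l G
  have h2 := sum_ad_mul_nonneg_le H l j G
  unfold kap
  rw [abs_le]; constructor <;> linarith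

lemma abs_kap_le' (H : SimpleGraph (Fin n)) (j l : Fin n) (G : SimpleGraph (Fin n)) :
    |kap H j l G| ≤ ∑ w, ad H j w * (1 - ad G l w) + ∑ w, ad H l w * (1 - ad G j w) := by
  have h1 := sum_ad_mul_nonneg_le H j l G
  have h2 := sum_ad_mul_nonneg_le H l j G
  unfold kap
  rw [abs_le]; constructor <;> linarith

/-- Number of edges at `j` or `l` in the planted and forbidden graphs. -/
noncomputable def kk (H Q : SimpleGraph (Fin n)) (j l : Fin n) : ℝ :=
  (deg H j + deg H l) + (deg Q j + deg Q l)

lemma abs_kapF_le (hjl : j ≠ l) (hG : G ∈ fam 𝒢 H Q) :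
    |kapF (Fr j l (H ⊔ Q)) j l G| ≤ kk H Q j l := by
  have h1 := abs_kapF_sub_kap_le hjl hG
  have h2 := abs_kap_le H j l G
  have := abs_sub_abs_le_abs_sub (kapF (Fr j l (H ⊔ Q)) j l G) (kap H j l G)
  unfold kk; linarith

/-- Linearised expectation of `kap · f`. -/
lemma Ex_kap_mul (K : Finset (SimpleGraph (Fin n))) (H : SimpleGraph (Fin n)) (j l : Fin n)
    (f : SimpleGraph (Fin n) → ℝ) :
    Ex K (fun G => kap H j l G * f G) = ∑ w, ad H j w * Ex K (fun G => (1 - ad G l w) * f G) -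
      ∑ w, ad H l w * Ex K (fun G => (1 - ad G j w) * f G) := by
  simp only [kap, sub_mul, Ex_sub, Finset.sum_mul, Ex_sum, mul_assoc, Ex_mul]

/-- Expected size of the planted contribution to the row difference. -/
lemma Ex_abs_kapF_le (c : Ctx 𝒢 p δ R L Hm r) (a : Adm 𝒢 L Hm k H Q) (hjl : j ≠ l) :
    Ex (fam 𝒢 H Q) (fun G => |kapF (Fr j l (H ⊔ Q)) j l G|) ≤
      (deg H j + deg H l) * (1 - p) + L ^ 6 := by
  have hL := c.L_ge
  have hr := c.r_pos
  have hq := c.q_pos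
  have key : ∀ j l : Fin n, j ≠ l → Ex (fam 𝒢 H Q) (fun G => ∑ w, ad H j w * (1 - ad G l w)) ≤
      deg H j * (1 - p) + L ^ 5 + 21 := by
    intro j l hjl
    have h1 : ∀ w, ad H j w * (1 - pr 𝒢 H Q l w) ≤
        ad H j w * ((1 - p) + L ^ 4 / r) + ad Q l w + ind (w = l) := by
      intro w
      have hi := ind_nonneg (w = l)
      have hQ := ad_nonneg Q l w
      have hp := pr_nonneg (𝒢 := 𝒢) (H := H) (Q := Q) l w
      have hH0 := ad_nonneg H j w
      have hH1 := ad_le_one H j w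
      have h4 : 0 ≤ L ^ 4 / r := by positivity
      have h5 : ad H j w * (1 - pr 𝒢 H Q l w) ≤ 1 := by
        refine mul_le_one₀ hH1 ?_ (by linarith)
        linarith [pr_le_one a.nonempty l w]
      have h6 : 0 ≤ ad H j w * ((1 - p) + L ^ 4 / r) := by positivity
      rcases eq_or_ne w l with rfl | hwl
      · have : ind (w = w) = 1 := by simp [ind]
        refine h5.trans ?_
        rw [this]; linarith
      by_cases h2 : H.Adj l w
      · have : pr 𝒢 H Q l w = 1 := by
          unfold pr
          rw [Ex_congr (g := fun _ => 1) fun G hG => ad_of_adj ((mem_fam.1 hG).2.1 _ _ h2)]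
          exact Ex_const a.nonempty 1
        rw [this]; linarith
      by_cases h3 : Q.Adj l w
      · rw [ad_of_adj h3]; linarith
      · have := (abs_le.1 (pr_crude c a hwl.symm h2 h3)).1
        have : ad H j w * (1 - pr 𝒢 H Q l w) ≤ ad H j w * ((1 - p) + L ^ 4 / r) :=
          mul_le_mul_of_nonneg_left (by linarith) hH0
        linarith
    rw [Ex_sum]
    simp only [Ex_mul]
    calc ∑ w, ad H j w * Ex (fam 𝒢 H Q) (fun G => 1 - ad G l w)
        ≤ ∑ w, (ad H j w * ((1 - p) + L ^ 4 / r) + ad Q l w + ind (w = l)) := by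
          refine Finset.sum_le_sum fun w _ => ?_
          rw [Ex_one_sub_ad a.nonempty]; exact h1 w
      _ = deg H j * ((1 - p) + L ^ 4 / r) + deg Q l + 1 := by
          rw [Finset.sum_add_distrib, Finset.sum_add_distrib, ← Finset.sum_mul, sum_ind_eq,
            deg_eq_sum, deg_eq_sum]
      _ ≤ _ := by
          have h2 : (deg H j : ℝ) * (L ^ 4 / r) ≤ L * r * (L ^ 4 / r) := by
            gcongr; exact (a.deg_le_Hm j).trans c.Hm_le
          have h3 : L * r * (L ^ 4 / r) = L ^ 5 := by field_simp
          have := a.degQ_le_20 l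
          nlinarith
  have h1 : ∀ G ∈ fam 𝒢 H Q, |kapF (Fr j l (H ⊔ Q)) j l G| ≤
      (∑ w, ad H j w * (1 - ad G l w) + ∑ w, ad H l w * (1 - ad G j w)) + 40 := by
    intro G hG
    have h1 := abs_kapF_sub_kap_le hjl hG
    have h2 := abs_kap_le' H j l G
    have := abs_sub_abs_le_abs_sub (kapF (Fr j l (H ⊔ Q)) j l G) (kap H j l G)
    linarith [a.degQ_le_20 j, a.degQ_le_20 l]
  refine (Ex_mono h1).trans ?_
  rw [Ex_add, Ex_add, Ex_const a.nonempty]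
  have := key j l hjl
  have := key l j hjl.symm
  have : L ^ 6 = L * L ^ 5 := by ring
  have : 100 ≤ L ^ 5 := hL.trans (le_self_pow₀ (by linarith) (by norm_num))
  nlinarith

end Edge

section Swap
variable {n : ℕ} {𝒢 : Finset (SimpleGraph (Fin n))} {p δ R L Hm r : ℝ} {k : ℕ}
  {H Q G : SimpleGraph (Fin n)} {j l v : Fin n}

lemma Ctx.pow_le (c : Ctx 𝒢 p δ R L Hm r) {a b : ℕ} (h : a ≤ b) : L ^ a ≤ L ^ b :=
  pow_le_pow_right₀ c.one_le_L h

lemma Ctx.n_pos (c : Ctx 𝒢 p δ R L Hm r) : (0 : ℝ) < n := by linarith [c.n_ge]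

lemma Ctx.mul_pow_le (c : Ctx 𝒢 p δ R L Hm r) {a b : ℕ} (h : a + 1 ≤ b) {x : ℝ} (hx : x ≤ 100) :
    x * L ^ a ≤ L ^ b := by
  have hL := c.L_pos
  calc x * L ^ a ≤ L * L ^ a := by gcongr; exact hx.trans c.L_ge
    _ = L ^ (a + 1) := by ring
    _ ≤ L ^ b := c.pow_le h

lemma kk_nonneg (H Q : SimpleGraph (Fin n)) (j l : Fin n) : 0 ≤ kk H Q j l := by
  unfold kk; positivity

lemma Adm.kk_le (c : Ctx 𝒢 p δ R L Hm r) (a : Adm 𝒢 L Hm k H Q) (j l : Fin n) :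
    kk H Q j l ≤ 4 * Hm := by
  unfold kk
  linarith [a.deg_le_Hm j, a.deg_le_Hm l, a.degQ_le_20 j, a.degQ_le_20 l, c.Hm_ge]

/-- The swap ratio of two rows. -/
noncomputable def rho (F : Finset (Fin n)) (j l : Fin n) (G : SimpleGraph (Fin n)) : ℝ :=
  ((bin (Sd j l F G).card (Xd j l F G).card : ℝ) -
    bin (Sd j l F G).card ((Xd j l F G).card - ((deg G j : ℤ) - deg G l))) /
  ((bin (Sd j l F G).card (Xd j l F G).card : ℝ) +
    bin (Sd j l F G).card ((Xd j l F G).card - ((deg G j : ℤ) - deg G l)))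

lemma abs_rho_le_one (F : Finset (Fin n)) (j l : Fin n) (G : SimpleGraph (Fin n)) :
    |rho F j l G| ≤ 1 := by
  unfold rho
  set x : ℝ := (bin (Sd j l F G).card (Xd j l F G).card : ℝ)
  set y : ℝ := (bin (Sd j l F G).card ((Xd j l F G).card - ((deg G j : ℤ) - deg G l)) : ℝ)
  have hx : 0 ≤ x := Nat.cast_nonneg _
  have hy : 0 ≤ y := Nat.cast_nonneg _
  rw [abs_div, abs_of_nonneg (add_nonneg hx hy)]
  refine div_le_one_of_le₀ ?_ (add_nonneg hx hy)
  rw [abs_le]; constructor <;> linarith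

lemma Ctx.L2_s (c : Ctx 𝒢 p δ R L Hm r) {s : ℝ} (hs : p * (1 - p) * n ≤ s) : (n : ℝ) ≤ L ^ 2 * s := by
  have := c.one_le_LΛ
  have hL := c.L_pos
  calc (n : ℝ) = 1 * n := by ring
    _ ≤ L ^ 2 * (p * (1 - p)) * n := by gcongr
    _ = L ^ 2 * (p * (1 - p) * n) := by ring
    _ ≤ _ := by gcongr

lemma small_of_good (c : Ctx 𝒢 p δ R L Hm r) (a : Adm 𝒢 L Hm k H Q) {s z κ : ℝ}
    (hs : p * (1 - p) * n ≤ s) (hz : |z| ≤ 2 * δ) (hκ : |κ| ≤ kk H Q j l) :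
    200 * (|z| + |κ| + 1) ≤ s ∧ 100 * (|z| * |κ|) ≤ s := by
  have hL := c.L_ge
  have hLp := c.L_pos
  have hr := c.r_pos
  have hn := c.L2_s hs
  have hκ' := hκ.trans (a.kk_le c j l)
  have hδ := c.δ_le
  have hHm := c.Hm_le
  have hHm20 := c.Hm_ge
  have hδ0 := c.δ_nonneg
  have hL2 : 0 < L ^ 2 := by positivity
  constructor
  · have h1 : 200 * (|z| + |κ| + 1) ≤ 2000 * (L * r) := by nlinarith [c.L_le_r]
    have h2 : L ^ 2 * (2000 * (L * r)) ≤ n := by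
      have h3 : L ^ 5 ≤ r := c.Lpow_le (by norm_num)
      have h4 : 2000 * L ^ 3 ≤ L ^ 5 := by
        have : L ^ 5 = L ^ 2 * L ^ 3 := by ring
        rw [this]; gcongr; nlinarith
      rw [← c.r_sq]
      calc L ^ 2 * (2000 * (L * r)) = 2000 * L ^ 3 * r := by ring
        _ ≤ r * r := by gcongr; linarith
        _ = r ^ 2 := by ring
    exact le_of_mul_le_mul_left (by nlinarith) hL2
  · have h1 : |z| * |κ| ≤ 2 * δ * (4 * Hm) := by gcongr
    have h3 : 800 * (δ * Hm) * L ^ 2 ≤ n := by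
      refine le_trans ?_ c.δHm
      have : 800 * L ^ 2 ≤ L ^ 200 := by
        have h8 : 800 * L ^ 2 ≤ L ^ 4 := by
          have : L ^ 4 = L ^ 2 * L ^ 2 := by ring
          rw [this]; gcongr; nlinarith
        exact h8.trans (c.pow_le (by norm_num))
      have h0 : 0 ≤ δ * Hm := by positivity
      nlinarith
    exact le_of_mul_le_mul_left (by nlinarith) hL2

lemma two_card_Xd_sub_eq_kapF (F : Finset (Fin n)) (j l : Fin n) (G : SimpleGraph (Fin n)) :
    2 * ((Xd j l F G).card : ℝ) - (Sd j l F G).card =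
      ((deg G j : ℝ) - deg G l) - kapF F j l G := by unfold kapF; ring

lemma rho_approx (c : Ctx 𝒢 p δ R L Hm r) (a : Adm 𝒢 L Hm k H Q) (hG : G ∈ fam 𝒢 H Q)
    (hg : Good p L r G) (hjl : j ≠ l) {s z κ : ℝ} (hs : s = (Sd j l (Fr j l (H ⊔ Q)) G).card)
    (hz : z = (deg G j : ℝ) - deg G l) (hκ : κ = kapF (Fr j l (H ⊔ Q)) j l G) :
    |rho (Fr j l (H ⊔ Q)) j l G - z * κ / s| ≤
      6 * (|z| * |κ| / s) ^ 3 + 200 * (|z| * |κ|) * (|z| + |κ|) / s ^ 2 ∧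
    |rho (Fr j l (H ⊔ Q)) j l G| ≤ 3 * (|z| * |κ| / s) := by
  have hFr := card_compl_Fr_le_Hm c a j l
  have hsge : p * (1 - p) * n ≤ s := by rw [hs]; exact hg.sd_ge c (fam_subset hG) hjl hFr
  have hz' : |z| ≤ 2 * δ := by rw [hz]; exact c.abs_deg_sub_le (fam_subset hG) j l
  have hκ' : |κ| ≤ kk H Q j l := by rw [hκ]; exact abs_kapF_le hjl hG
  obtain ⟨h1, h2⟩ := small_of_good c a hsge hz' hκ'
  have hs0 : 0 < s := lt_of_lt_of_le (mul_pos (mul_pos c.p_pos c.q_pos) c.n_pos) hsge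
  have key : |rho (Fr j l (H ⊔ Q)) j l G - z * κ / s| ≤
      6 * (|z| * |κ| / s) ^ 3 + 200 * (|z| * |κ|) * (|z| + |κ|) / s ^ 2 := by
    have hzc : z = (((deg G j : ℤ) - deg G l : ℤ) : ℝ) := by rw [hz]; push_cast; ring
    have := bin_ratio (s := (Sd j l (Fr j l (H ⊔ Q)) G).card)
      (x := ((Xd j l (Fr j l (H ⊔ Q)) G).card : ℤ)) (z := (deg G j : ℤ) - deg G l) (κ := κ)
      (by rw [← hzc, hz, hκ, ← two_card_Xd_sub_eq_kapF]; push_cast; ring)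
      (by rw [← hzc, ← hs]; nlinarith [abs_nonneg z, abs_nonneg κ]) (by rw [← hzc, ← hs]; exact h2)
    rw [← hzc, ← hs] at this
    unfold rho
    rw [← hs] at *
    exact this
  refine ⟨key, ?_⟩
  set τ := |z| * |κ| / s with hτ
  have hτ0 : 0 ≤ τ := by positivity
  have hτ1 : τ ≤ 1 / 100 := by rw [hτ, div_le_iff₀ hs0]; linarith
  have e1 : |z * κ / s| = τ := by rw [abs_div, abs_mul, abs_of_pos hs0]
  have e2 : 200 * (|z| * |κ|) * (|z| + |κ|) / s ^ 2 ≤ τ := by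
    have : 200 * (|z| * |κ|) * (|z| + |κ|) / s ^ 2 = τ * (200 * (|z| + |κ|) / s) := by
      rw [hτ]; field_simp
    rw [this]
    refine mul_le_of_le_one_right hτ0 ?_
    rw [div_le_one hs0]; linarith
  have e3 : 6 * τ ^ 3 ≤ τ := by
    have : 6 * τ ^ 3 = τ * (6 * τ ^ 2) := by ring
    rw [this]
    exact mul_le_of_le_one_right hτ0 (by nlinarith)
  have := abs_sub_abs_le_abs_sub (rho (Fr j l (H ⊔ Q)) j l G) (z * κ / s)
  rw [e1] at this
  linarith

lemma resample_swap' (c : Ctx 𝒢 p δ R L Hm r) (hjl : j ≠ l) (ψ : SimpleGraph (Fin n) → ℝ)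
    (hψ : ∀ G T, T ⊆ Sd j l (Fr j l (H ⊔ Q)) G →
      (((symmDiff (Xd j l (Fr j l (H ⊔ Q)) G) T).card : ℤ) =
        (Xd j l (Fr j l (H ⊔ Q)) G).card - ((deg G j : ℤ) - deg G l)) → ψ (tog j l T G) = ψ G) :
    Ex (fam 𝒢 H Q) (fun G => ψ G * ((deg G j : ℝ) - deg G l)) =
    Ex (fam 𝒢 H Q) (fun G => ψ G * (((deg G j : ℝ) - deg G l) * rho (Fr j l (H ⊔ Q)) j l G)) :=
  resample_swap c.clos hjl ψ hψ

/-- Exchanging two rows nearly preserves an expectation. -/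
lemma swap_bound (c : Ctx 𝒢 p δ R L Hm r) (a : Adm 𝒢 L Hm k H Q) (hjl : j ≠ l)
    (ψ : SimpleGraph (Fin n) → ℝ)
    (hψ : ∀ G T, T ⊆ Sd j l (Fr j l (H ⊔ Q)) G →
      (((symmDiff (Xd j l (Fr j l (H ⊔ Q)) G) T).card : ℤ) =
        (Xd j l (Fr j l (H ⊔ Q)) G).card - ((deg G j : ℤ) - deg G l)) → ψ (tog j l T G) = ψ G)
    (hB : ∀ G ∈ fam 𝒢 H Q, |ψ G| ≤ 2 * δ) :
    |Ex (fam 𝒢 H Q) (fun G => ψ G * ((deg G j : ℝ) - deg G l))| ≤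
      24 * δ ^ 3 * (deg H j + deg H l) / (p * n) + L ^ 9 * (δ ^ 3 + 1) / n := by
  rw [resample_swap' c hjl ψ hψ]
  have hFr := card_compl_Fr_le_Hm c a j l
  set F := Fr j l (H ⊔ Q) with hF
  have hδ0 := c.δ_nonneg
  have hn := c.n_pos
  have hp := c.p_pos
  have hq := c.q_pos
  have hr := c.r_pos
  have hΛn : 0 < p * (1 - p) * n := mul_pos (mul_pos hp hq) hn
  refine (abs_Ex_le_good c a (g := fun G => 24 * δ ^ 3 / (p * (1 - p) * n) * |kapF F j l G|)
    (B := 4 * δ ^ 2) (fun G hG hg => ?_) (fun G _ => by positivity) (fun G hG => ?_)).trans ?_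
  · have h1 := (rho_approx c a hG hg hjl rfl rfl rfl).2
    have h2 := hB G hG
    have h3 := c.abs_deg_sub_le (fam_subset hG) j l
    have h4 := hg.sd_ge c (fam_subset hG) hjl hFr
    rw [← hF] at h1
    set z := (deg G j : ℝ) - deg G l
    set s := ((Sd j l F G).card : ℝ)
    have hs0 : 0 < s := lt_of_lt_of_le hΛn h4
    rw [abs_mul, abs_mul]
    calc |ψ G| * (|z| * |rho F j l G|) ≤ 2 * δ * (|z| * (3 * (|z| * |kapF F j l G| / s))) := by gcongr
      _ ≤ 2 * δ * ((2 * δ) * (3 * ((2 * δ) * |kapF F j l G| / (p * (1 - p) * n)))) := by gcongr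
      _ = _ := by ring
  · have h2 := hB G hG
    have h3 := c.abs_deg_sub_le (fam_subset hG) j l
    have h1 := abs_rho_le_one F j l G
    rw [abs_mul, abs_mul]
    calc |ψ G| * (|(deg G j : ℝ) - deg G l| * |rho F j l G|) ≤ 2 * δ * ((2 * δ) * 1) := by gcongr
      _ = _ := by ring
  · rw [Ex_mul]
    have h1 := Ex_abs_kapF_le c a hjl
    rw [← hF] at h1
    have hL := c.L_ge
    have hLp := c.L_pos
    have h2 : 24 * δ ^ 3 / (p * (1 - p) * n) * ((deg H j + deg H l) * (1 - p) + L ^ 6) =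
        24 * δ ^ 3 * (deg H j + deg H l) / (p * n) +
          24 * δ ^ 3 * L ^ 6 * (1 / (p * (1 - p) * n)) := by
      field_simp
    have h3 : 24 * δ ^ 3 * L ^ 6 * (1 / (p * (1 - p) * n)) ≤ 24 * δ ^ 3 * L ^ 6 * (L ^ 2 / n) :=
      mul_le_mul_of_nonneg_left c.inv_Λn_le (by positivity)
    have h4 : 4 * δ ^ 2 / r ^ 20 ≤ 4 * (δ ^ 3 + 1) / n := by
      rw [← c.r_sq]
      have : δ ^ 2 ≤ δ ^ 3 + 1 := by nlinarith [sq_nonneg (δ - 1), mul_nonneg hδ0 (sq_nonneg (δ - 1))]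
      have hr1 : r ^ 2 ≤ r ^ 20 := pow_le_pow_right₀ (by linarith [c.r_ge]) (by norm_num)
      gcongr
    have h5 : 24 * δ ^ 3 * L ^ 6 * (L ^ 2 / n) + 4 * (δ ^ 3 + 1) / n ≤ L ^ 9 * (δ ^ 3 + 1) / n := by
      have e : 24 * δ ^ 3 * L ^ 6 * (L ^ 2 / n) + 4 * (δ ^ 3 + 1) / n =
        (24 * δ ^ 3 * L ^ 8 + 4 * (δ ^ 3 + 1)) / n := by field_simp
      rw [e]
      gcongr
      have h8 : 100 * L ^ 8 ≤ L ^ 9 := c.mul_pow_le (by norm_num) le_rfl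
      have h81 : 1 ≤ L ^ 8 := one_le_pow₀ c.one_le_L
      have hδ3 : 0 ≤ δ ^ 3 := by positivity
      nlinarith [mul_le_mul_of_nonneg_right h8 hδ3, mul_le_mul_of_nonneg_right h81 hδ3]
    calc _ ≤ 24 * δ ^ 3 / (p * (1 - p) * n) * ((deg H j + deg H l) * (1 - p) + L ^ 6) +
          4 * δ ^ 2 / r ^ 20 := by gcongr
      _ ≤ _ := by rw [h2]; linarith

end Swap

section Second
variable {n : ℕ} {𝒢 : Finset (SimpleGraph (Fin n))} {p δ R L Hm r : ℝ} {k : ℕ}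
  {H Q G : SimpleGraph (Fin n)} {j l v : Fin n}

/-- Deviation of a degree from its mean. -/
noncomputable def dv (p : ℝ) (j : Fin n) (G : SimpleGraph (Fin n)) : ℝ := (deg G j : ℝ) - p * (n - 1)

lemma deg_tog_swap {U : SimpleGraph (Fin n)} {T : Finset (Fin n)}
    (hT : T ⊆ Sd j l (Fr j l U) G)
    (hc : ((symmDiff (Xd j l (Fr j l U) G) T).card : ℤ) =
        (Xd j l (Fr j l U) G).card - ((deg G j : ℤ) - deg G l)) :
    deg (tog j l T G) j = deg G l ∧ deg (tog j l T G) l = deg G j := by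
  have hj : j ∉ Fr j l U := left_notMem_Fr _ _ _
  have hl : l ∉ Fr j l U := right_notMem_Fr _ _ _
  have h1 := deg_tog_left hj hl hT
  have h2 := deg_tog_right hj hl hT
  constructor <;> omega

lemma deg_tog_other' (hjl : j ≠ l) {U : SimpleGraph (Fin n)} {T : Finset (Fin n)}
    (hT : T ⊆ Sd j l (Fr j l U) G) (hvj : v ≠ j) (hvl : v ≠ l) :
    deg (tog j l T G) v = deg G v :=
  deg_tog_other hjl (left_notMem_Fr _ _ _) (right_notMem_Fr _ _ _) hT hvj hvl

lemma Ctx.abs_dv_le (c : Ctx 𝒢 p δ R L Hm r) (hG : G ∈ fam 𝒢 H Q) (v : Fin n) : |dv p v G| ≤ δ :=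
  c.dev_le G (fam_subset hG) v

lemma average_bound (c : Ctx 𝒢 p δ R L Hm r) (a : Adm 𝒢 L Hm k H Q) {x A B h : ℝ} {y : Fin n → ℝ}
    (hA : 0 ≤ A) (hy : ∀ l, |x - y l| ≤ A * (h + deg H l) + B) :
    |x - (∑ l, y l) / n| ≤ A * h + A * L ^ 2 + B := by
  have hn := c.n_pos
  have e : x - (∑ l, y l) / n = (∑ l, (x - y l)) / n := by
    rw [Finset.sum_sub_distrib]; simp; field_simp
  rw [e, abs_div, Nat.abs_cast, div_le_iff₀ hn]
  refine (Finset.abs_sum_le_sum_abs _ _).trans ((Finset.sum_le_sum fun l _ => hy l).trans ?_)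
  rw [Finset.sum_add_distrib, ← Finset.mul_sum, Finset.sum_add_distrib]
  have := a.sum_le
  have hk : (0 : ℝ) ≤ k := Nat.cast_nonneg _
  have h1 : A * ∑ l, (deg H l : ℝ) ≤ A * (L ^ 2 * n) := by gcongr; linarith
  simp; nlinarith

/-- Error in second moments of degree deviations. -/
noncomputable def Bz (H : SimpleGraph (Fin n)) (p δ L : ℝ) (j l : Fin n) : ℝ :=
  72 * δ ^ 3 * (deg H j + deg H l) / (p * n) + L ^ 10 * (δ ^ 3 + 1) / n

lemma sq_le_cube_add_one {x : ℝ} (hx : 0 ≤ x) : x ^ 2 ≤ x ^ 3 + 1 := by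
  nlinarith [sq_nonneg (x - 1), mul_nonneg hx (sq_nonneg (x - 1))]

lemma Ctx.inv_p_le (c : Ctx 𝒢 p δ R L Hm r) : 1 / p ≤ L := by
  rw [div_le_iff₀ c.p_pos]; exact c.one_le_Lp

lemma Ex_dv_sq_diff (c : Ctx 𝒢 p δ R L Hm r) (a : Adm 𝒢 L Hm k H Q) (j l : Fin n) :
    |Ex (fam 𝒢 H Q) (fun G => dv p j G ^ 2) - Ex (fam 𝒢 H Q) (fun G => dv p l G ^ 2)| ≤
      24 * δ ^ 3 / (p * n) * (deg H j + deg H l) + L ^ 9 * (δ ^ 3 + 1) / n := by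
  have hδ0 := c.δ_nonneg
  have hn := c.n_pos
  have hp := c.p_pos
  have hL := c.L_pos
  rcases eq_or_ne j l with rfl | hjl
  · rw [sub_self, abs_zero]; positivity
  · have h := swap_bound c a hjl (fun G => dv p j G + dv p l G) (fun G T hT hc => by
      obtain ⟨h1, h2⟩ := deg_tog_swap hT hc
      simp only [dv, h1, h2]; ring) (fun G hG => by
      refine (abs_add_le _ _).trans ?_
      linarith [c.abs_dv_le hG j, c.abs_dv_le hG l])
    rw [← Ex_sub, Ex_congr (g := fun G => (dv p j G + dv p l G) * ((deg G j : ℝ) - deg G l))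
      (fun G _ => by simp only [dv]; ring)]
    refine h.trans (le_of_eq ?_)
    ring

lemma Ex_dv_sq (c : Ctx 𝒢 p δ R L Hm r) (a : Adm 𝒢 L Hm k H Q) (j : Fin n) :
    |Ex (fam 𝒢 H Q) (fun G => dv p j G ^ 2) - R| ≤
      24 * δ ^ 3 * deg H j / (p * n) + 2 * L ^ 9 * (δ ^ 3 + 1) / n := by
  have hδ0 := c.δ_nonneg
  have hn := c.n_pos
  have hp := c.p_pos
  have hL := c.L_pos
  have h := average_bound c a (by positivity) (Ex_dv_sq_diff c a j)
  have e : (∑ l, Ex (fam 𝒢 H Q) (fun G => dv p l G ^ 2)) / n = R := by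
    rw [← Ex_sum, Ex_congr (f := fun G => ∑ i, dv p i G ^ 2) (g := fun _ => n * R)
        (fun G hG => c.sum_dev_sq G (fam_subset hG)), Ex_const a.nonempty]
    field_simp
  rw [e] at h
  refine h.trans ?_
  have h1 : 24 * δ ^ 3 / (p * n) * L ^ 2 ≤ L ^ 9 * (δ ^ 3 + 1) / n := by
    calc 24 * δ ^ 3 / (p * n) * L ^ 2 = (1 / p) * (24 * δ ^ 3 * L ^ 2 / n) := by field_simp
      _ ≤ L * (24 * δ ^ 3 * L ^ 2 / n) := by gcongr; exact c.inv_p_le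
      _ = 24 * L ^ 3 * δ ^ 3 / n := by ring
      _ ≤ L ^ 9 * (δ ^ 3 + 1) / n := by
        have h2 : 24 * L ^ 3 ≤ L ^ 9 := c.mul_pow_le (by norm_num) (by norm_num)
        have hδ3 : 0 ≤ δ ^ 3 := by positivity
        gcongr
        linarith
  calc _ ≤ 24 * δ ^ 3 / (p * n) * deg H j + L ^ 9 * (δ ^ 3 + 1) / n + L ^ 9 * (δ ^ 3 + 1) / n := by
        gcongr
    _ = _ := by ring

lemma Ex_dv_mul (c : Ctx 𝒢 p δ R L Hm r) (a : Adm 𝒢 L Hm k H Q) (hjl : j ≠ l) :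
    |Ex (fam 𝒢 H Q) (fun G => dv p j G * dv p l G)| ≤
      24 * δ ^ 3 * deg H l / (p * n) + 4 * L ^ 9 * (δ ^ 3 + 1) / n := by
  have hδ0 := c.δ_nonneg
  have hn := c.n_pos
  have hp := c.p_pos
  have hL := c.L_pos
  have hL9 : 100 ≤ L ^ 9 := c.L_ge.trans (le_self_pow₀ c.one_le_L (by norm_num))
  have hs : ∀ l', |(Ex (fam 𝒢 H Q) (fun G => dv p j G * dv p l G)) -
      (Ex (fam 𝒢 H Q) (fun G => dv p j G * dv p l' G) -
        if l' = j then (Ex (fam 𝒢 H Q) (fun G => dv p j G * dv p j G) -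
          Ex (fam 𝒢 H Q) (fun G => dv p j G * dv p l G)) else 0)| ≤
      24 * δ ^ 3 / (p * n) * (deg H l + deg H l') + L ^ 9 * (δ ^ 3 + 1) / n := by
    intro l'
    rcases eq_or_ne l' j with rfl | hl'j
    · simp; positivity
    rw [if_neg hl'j, sub_zero]
    rcases eq_or_ne l l' with rfl | hll'
    · rw [sub_self, abs_zero]; positivity
    have h := swap_bound c a hll' (fun G => dv p j G) (fun G T hT hc => by
      simp only [dv, deg_tog_other' hll' hT hjl hl'j.symm]) (fun G hG => by
      linarith [c.abs_dv_le hG j])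
    rw [← Ex_sub, Ex_congr (g := fun G => dv p j G * ((deg G l : ℝ) - deg G l'))
      (fun G _ => by simp only [dv]; ring)]
    refine h.trans (le_of_eq ?_)
    ring
  have h := average_bound c a (by positivity) hs
  have e : ∑ l', (Ex (fam 𝒢 H Q) (fun G => dv p j G * dv p l' G)) = 0 := by
    rw [← Ex_sum, Ex_congr (g := fun _ => 0), Ex_const a.nonempty]
    intro G hG
    rw [← Finset.mul_sum, show ∑ i, dv p i G = 0 from c.sum_dev G (fam_subset hG), mul_zero]
  rw [Finset.sum_sub_distrib, e, Finset.sum_ite_eq' Finset.univ j, if_pos (Finset.mem_univ j)] at h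
  have hb : ∀ i, |Ex (fam 𝒢 H Q) (fun G => dv p j G * dv p i G)| ≤ δ ^ 2 := by
    intro i
    refine (abs_Ex_le_of (g := fun _ => δ ^ 2) fun G hG => ?_).trans (Ex_const a.nonempty _).le
    rw [abs_mul, sq]
    exact mul_le_mul (c.abs_dv_le hG _) (c.abs_dv_le hG _) (abs_nonneg _) hδ0
  have hb1 := hb j
  have hb2 := hb l
  set X := Ex (fam 𝒢 H Q) (fun G => dv p j G * dv p l G)
  set Y := Ex (fam 𝒢 H Q) (fun G => dv p j G * dv p j G)
  have h1 : 24 * δ ^ 3 / (p * n) * L ^ 2 ≤ L ^ 9 * (δ ^ 3 + 1) / n := by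
    calc 24 * δ ^ 3 / (p * n) * L ^ 2 = (1 / p) * (24 * δ ^ 3 * L ^ 2 / n) := by field_simp
      _ ≤ L * (24 * δ ^ 3 * L ^ 2 / n) := by gcongr; exact c.inv_p_le
      _ = 24 * L ^ 3 * δ ^ 3 / n := by ring
      _ ≤ L ^ 9 * (δ ^ 3 + 1) / n := by
        have h2 : 24 * L ^ 3 ≤ L ^ 9 := c.mul_pow_le (by norm_num) (by norm_num)
        have hδ3 : 0 ≤ δ ^ 3 := by positivity
        gcongr
        linarith
  have h2 : |(Y - X) / n| ≤ L ^ 9 * (δ ^ 3 + 1) / n := by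
    rw [abs_div, Nat.abs_cast]
    gcongr
    have := sq_le_cube_add_one hδ0
    have hδ3 : 0 ≤ δ ^ 3 := by positivity
    calc |Y - X| ≤ |Y| + |X| := abs_sub _ _
      _ ≤ 2 * (δ ^ 3 + 1) := by linarith
      _ ≤ _ := by gcongr; linarith
  have e3 : X - (0 - (Y - X)) / n = X + (Y - X) / n := by ring
  rw [e3] at h
  have h4 : |X| ≤ |X + (Y - X) / n| + |(Y - X) / n| := by
    have := abs_sub (X + (Y - X) / n) ((Y - X) / n)
    rwa [add_sub_cancel_right] at this
  have h0 : 0 ≤ L ^ 9 * (δ ^ 3 + 1) / n := by positivity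
  calc _ ≤ 24 * δ ^ 3 / (p * n) * deg H l + 4 * (L ^ 9 * (δ ^ 3 + 1) / n) := by linarith
    _ = _ := by ring

/-- The second moment of a difference of two degrees. -/
lemma Ex_sq_sub (c : Ctx 𝒢 p δ R L Hm r) (a : Adm 𝒢 L Hm k H Q) (hjl : j ≠ l) :
    |Ex (fam 𝒢 H Q) (fun G => ((deg G j : ℝ) - deg G l) ^ 2) - 2 * R| ≤ Bz H p δ L j l := by
  have h1 := Ex_dv_sq c a j
  have h2 := Ex_dv_sq c a l
  have h3 := Ex_dv_mul c a hjl
  have hδ0 := c.δ_nonneg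
  have hn := c.n_pos
  have hp := c.p_pos
  have hL := c.L_pos
  have e : Ex (fam 𝒢 H Q) (fun G => ((deg G j : ℝ) - deg G l) ^ 2) =
      Ex (fam 𝒢 H Q) (fun G => dv p j G ^ 2) + Ex (fam 𝒢 H Q) (fun G => dv p l G ^ 2) -
      2 * Ex (fam 𝒢 H Q) (fun G => dv p j G * dv p l G) := by
    rw [← Ex_mul, ← Ex_add, ← Ex_sub]
    exact Ex_congr fun G _ => by simp only [dv]; ring
  rw [e]
  have h4 : 12 * (L ^ 9 * (δ ^ 3 + 1) / n) ≤ L ^ 10 * (δ ^ 3 + 1) / n := by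
    have : 12 * L ^ 9 ≤ L ^ 10 := c.mul_pow_le (by norm_num) (by norm_num)
    calc 12 * (L ^ 9 * (δ ^ 3 + 1) / n) = 12 * L ^ 9 * (δ ^ 3 + 1) / n := by ring
      _ ≤ _ := by gcongr
  have h5 : 0 ≤ δ ^ 3 * deg H j / (p * n) := by positivity
  have e1 : 24 * δ ^ 3 * deg H j / (p * n) = 24 * (δ ^ 3 * deg H j / (p * n)) := by ring
  have e2 : 24 * δ ^ 3 * deg H l / (p * n) = 24 * (δ ^ 3 * deg H l / (p * n)) := by ring
  have e3 : Bz H p δ L j l = 72 * (δ ^ 3 * deg H j / (p * n)) + 72 * (δ ^ 3 * deg H l / (p * n)) +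
    L ^ 10 * (δ ^ 3 + 1) / n := by unfold Bz; ring
  have e4 : 2 * L ^ 9 * (δ ^ 3 + 1) / n = 2 * (L ^ 9 * (δ ^ 3 + 1) / n) := by ring
  have e5 : 4 * L ^ 9 * (δ ^ 3 + 1) / n = 4 * (L ^ 9 * (δ ^ 3 + 1) / n) := by ring
  rw [e1, e4] at h1
  rw [e2, e4] at h2
  rw [e2, e5] at h3
  rw [e3]
  rw [abs_le] at *
  constructor <;> linarith

end Second

section Kap
variable {n : ℕ} {𝒢 : Finset (SimpleGraph (Fin n))} {p δ R L Hm r : ℝ} {k : ℕ}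
  {H Q H₀ Q₀ G : SimpleGraph (Fin n)} {j l v : Fin n}

lemma Ex_kap_near {K : Finset (SimpleGraph (Fin n))} {f : SimpleGraph (Fin n) → ℝ}
    {y y' : Fin n → ℝ} {e B d : ℝ} (hjl : j ≠ l) (hK : K.Nonempty) (he : 0 ≤ e) (hd : 0 ≤ d)
    (h1 : ∀ G ∈ K, ∀ u w, H.Adj u w → G.Adj u w)
    (h2 : ∀ w, H.Adj j w → w ≠ l → ¬ H.Adj l w → ¬ Q.Adj l w →
      |Ex K (fun G => (1 - ad G l w) * f G) - y w| ≤ e)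
    (h3 : ∀ w, H.Adj l w → w ≠ j → ¬ H.Adj j w → ¬ Q.Adj j w →
      |Ex K (fun G => (1 - ad G j w) * f G) - y' w| ≤ e)
    (hf : ∀ G ∈ K, |f G| ≤ B) (hy : ∀ w, |y w| ≤ B) (hy' : ∀ w, |y' w| ≤ B)
    (hc : ∀ w, H.Adj j w → H.Adj l w → |y w - y' w| ≤ d)
    (hc' : H.Adj j l → |y l - y' j| ≤ d) :
    |Ex K (fun G => kap H j l G * f G) - (∑ w, ad H j w * y w - ∑ w, ad H l w * y' w)| ≤
      (deg H j + deg H l) * e + 2 * B * (deg Q j + deg Q l) + d * (cod H j l + ad H j l) := by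
  have hB : 0 ≤ B := (abs_nonneg _).trans (hy j)
  set φ : Fin n → ℝ := fun w => (ind (w = l) - ind (w = j)) * (ad H j l * (Ex K f - y l)) with hφ
  have hφ0 : ∑ w, φ w = 0 := by
    simp only [hφ, ← Finset.sum_mul, Finset.sum_sub_distrib, sum_ind_eq]; ring
  have hEb : ∀ i w, |Ex K (fun G => (1 - ad G i w) * f G)| ≤ B := by
    intro i w
    refine (abs_Ex_le_of (g := fun _ => B) fun G hG => ?_).trans (Ex_const hK _).le
    rw [abs_mul]
    refine (mul_le_of_le_one_left (abs_nonneg _) ?_).trans (hf G hG)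
    have := ad_nonneg G i w; have := ad_le_one G i w
    rw [abs_le]; constructor <;> linarith
  have e0 : Ex K (fun G => kap H j l G * f G) - (∑ w, ad H j w * y w - ∑ w, ad H l w * y' w) =
      ∑ w, (ad H j w * (Ex K (fun G => (1 - ad G l w) * f G) - y w) -
        ad H l w * (Ex K (fun G => (1 - ad G j w) * f G) - y' w) - φ w) := by
    rw [Ex_kap_mul, Finset.sum_sub_distrib, hφ0, Finset.sum_sub_distrib]
    simp only [mul_sub, Finset.sum_sub_distrib]; ring
  have e1 : (deg H j + deg H l) * e + 2 * B * (deg Q j + deg Q l) + d * (cod H j l + ad H j l) =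
      ∑ w, (((ad H j w + ad H l w) * e + 2 * B * (ad Q j w + ad Q l w)) +
        d * (ad H j w * ad H l w + ind (w = j) * ad H j l)) := by
    simp only [Finset.sum_add_distrib, ← Finset.mul_sum, ← Finset.sum_mul, deg_eq_sum, cod, sum_ind_eq]
    ring
  rw [e0, e1]
  refine (Finset.abs_sum_le_sum_abs _ _).trans (Finset.sum_le_sum fun w _ => ?_)
  have p1 := ad_nonneg H j w
  have p2 := ad_nonneg H l w
  have p3 := ad_nonneg Q j w
  have p4 := ad_nonneg Q l w
  have p5 := ad_nonneg H j l
  have n1 : 0 ≤ (ad H j w + ad H l w) * e := by positivity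
  have n2 : 0 ≤ 2 * B * (ad Q j w + ad Q l w) := by positivity
  have n3 : 0 ≤ d * (ad H j w * ad H l w) := by positivity
  have n4 : 0 ≤ d * (ind (w = j) * ad H j l) :=
    mul_nonneg hd (mul_nonneg (ind_nonneg _) p5)
  by_cases hwl : w = l
  · have hwj : w ≠ j := fun h => hjl (h.symm.trans hwl)
    have : ad H j w * (Ex K (fun G => (1 - ad G l w) * f G) - y w) -
        ad H l w * (Ex K (fun G => (1 - ad G j w) * f G) - y' w) - φ w = 0 := by
      have i1 : ind (w = l) = 1 := by simp [ind, hwl]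
      have i2 : ind (w = j) = 0 := by simp [ind, hwj]
      simp only [hφ, i1, i2]
      rw [hwl]
      simp only [ad_self, sub_zero, one_mul, zero_mul, sub_self]
    rw [this, abs_zero]; nlinarith
  by_cases hwj : w = j
  · have i1 : ind (w = l) = 0 := by simp [ind, hwl]
    have i2 : ind (w = j) = 1 := by simp [ind, hwj]
    have : ad H j w * (Ex K (fun G => (1 - ad G l w) * f G) - y w) -
        ad H l w * (Ex K (fun G => (1 - ad G j w) * f G) - y' w) - φ w =
        ad H j l * -(y l - y' j) := by
      simp only [hφ, i1, i2]
      rw [hwj]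
      simp only [ad_self, sub_zero, one_mul, zero_mul, ad_comm H l j]
      ring
    rw [this, abs_mul, abs_neg, abs_of_nonneg p5]
    have : ad H j l * |y l - y' j| ≤ d * (ind (w = j) * ad H j l) := by
      rw [i2]
      by_cases h : H.Adj j l
      · have := hc' h
        rw [ad_of_adj h]; linarith
      · rw [ad_of_not_adj h]; simp
    nlinarith
  have e3 : φ w = 0 := by simp [hφ, ind, hwj, hwl]
  rw [e3, sub_zero]
  by_cases hj : H.Adj j w
  · by_cases hl : H.Adj l w
    · have z1 : Ex K (fun G => (1 - ad G l w) * f G) = 0 := by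
        rw [Ex_congr (g := fun _ => 0) fun G hG => by rw [ad_of_adj (h1 G hG _ _ hl)]; ring,
          Ex_const hK]
      have z2 : Ex K (fun G => (1 - ad G j w) * f G) = 0 := by
        rw [Ex_congr (g := fun _ => 0) fun G hG => by rw [ad_of_adj (h1 G hG _ _ hj)]; ring,
          Ex_const hK]
      rw [z1, z2]
      have := hc w hj hl
      rw [ad_of_adj hj, ad_of_adj hl] at *
      have e4 : 1 * (0 - y w) - 1 * (0 - y' w) = -(y w - y' w) := by ring
      rw [e4, abs_neg]; linarith
    · rw [ad_of_not_adj hl] at *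
      rw [ad_of_adj hj] at *
      rw [zero_mul, sub_zero, one_mul]
      by_cases hq : Q.Adj l w
      · rw [ad_of_adj hq] at *
        have b1 := hEb l w
        have b2 := hy w
        have := abs_sub (Ex K (fun G => (1 - ad G l w) * f G)) (y w)
        nlinarith
      · have := h2 w hj hwl hl hq
        linarith
  · rw [ad_of_not_adj hj] at *
    by_cases hl : H.Adj l w
    · rw [ad_of_adj hl] at *
      rw [zero_mul, zero_sub, one_mul, abs_neg]
      by_cases hq : Q.Adj j w
      · rw [ad_of_adj hq] at *
        have b1 := hEb j w
        have b2 := hy' w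
        have := abs_sub (Ex K (fun G => (1 - ad G j w) * f G)) (y' w)
        nlinarith
      · have := h3 w hl hwj hj hq
        linarith
    · rw [ad_of_not_adj hl] at *
      simp only [zero_mul, sub_zero, abs_zero]
      linarith

/-- Small modifications of the pair of planted and forbidden graphs, away from the edges between
one of the rows and the planted neighbours of the other. -/
structure Near (H Q H₀ Q₀ : SimpleGraph (Fin n)) (j l : Fin n) : Prop where
  le : ∀ u w, H.Adj u w → H₀.Adj u w
  deg : (deg H₀ j : ℝ) + deg H₀ l ≤ deg H j + deg H l + 1
  left : ∀ w, H.Adj j w → w ≠ l → ¬ H.Adj l w → ¬ Q.Adj l w → ¬ H₀.Adj l w ∧ ¬ Q₀.Adj l w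
  right : ∀ w, H.Adj l w → w ≠ j → ¬ H.Adj j w → ¬ Q.Adj j w → ¬ H₀.Adj j w ∧ ¬ Q₀.Adj j w

lemma Near.symm (h : Near H Q H₀ Q₀ j l) : Near H Q H₀ Q₀ l j where
  le := h.le
  deg := by linarith [h.deg]
  left := h.right
  right := h.left

lemma Near.add (hjl : j ≠ l) (hv : v ∈ Fr j l (H ⊔ Q)) :
    Near H Q (H ⊔ SimpleGraph.edge j v) (Q ⊔ SimpleGraph.edge l v) j l := by
  obtain ⟨hvj, hvl, h1, h2⟩ := mem_Fr.1 hv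
  rw [SimpleGraph.sup_adj, not_or] at h1 h2
  refine ⟨fun u w h => Or.inl h, ?_, ?_, ?_⟩
  · rw [deg_sup_edge hvj.symm h1.1, deg_sup_edge hvj.symm h1.1]
    simp [ind, hjl.symm, hvl.symm, hvj.symm]
    linarith
  · intro w hw hwl h3 h4
    rw [sup_edge_adj_iff hvj.symm, sup_edge_adj_iff hvl.symm]
    have : w ≠ v := by rintro rfl; exact h1.1 hw
    simp [h3, h4, hjl.symm, hvl.symm, this]
  · intro w hw hwj h3 h4
    rw [sup_edge_adj_iff hvj.symm, sup_edge_adj_iff hvl.symm]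
    have : w ≠ v := by rintro rfl; exact h2.1 hw
    simp [h3, h4, hjl, hvj.symm, this]

lemma Fr_comm (j l : Fin n) (U : SimpleGraph (Fin n)) : Fr j l U = Fr l j U := by
  ext w; rw [mem_Fr, mem_Fr]; tauto

lemma Near.add' (hjl : j ≠ l) (hv : v ∈ Fr j l (H ⊔ Q)) :
    Near H Q (H ⊔ SimpleGraph.edge l v) (Q ⊔ SimpleGraph.edge j v) j l :=
  (Near.add hjl.symm (by rwa [Fr_comm])).symm

/-- The two ways in which `v` can be a switchable vertex. -/
lemma Ex_ind_Sd_mul (c : Ctx 𝒢 p δ R L Hm r) (a : Adm 𝒢 L Hm (k + 2) H Q) (hjl : j ≠ l)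
    (hv : v ∈ Fr j l (H ⊔ Q)) (g : SimpleGraph (Fin n) → ℝ) :
    Ex (fam 𝒢 H Q) (fun G => ind (v ∈ Sd j l (Fr j l (H ⊔ Q)) G) * g G) =
      pr 𝒢 H Q j v * (1 - pr 𝒢 (H ⊔ SimpleGraph.edge j v) Q l v) *
        Ex (fam 𝒢 (H ⊔ SimpleGraph.edge j v) (Q ⊔ SimpleGraph.edge l v)) g +
      pr 𝒢 H Q l v * (1 - pr 𝒢 (H ⊔ SimpleGraph.edge l v) Q j v) *
        Ex (fam 𝒢 (H ⊔ SimpleGraph.edge l v) (Q ⊔ SimpleGraph.edge j v)) g := by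
  obtain ⟨hvj, hvl, h1, h2⟩ := mem_Fr.1 hv
  rw [SimpleGraph.sup_adj, not_or] at h1 h2
  have a1 := a.add c hvj.symm h1.1 h1.2
  have a2 := a.add c hvl.symm h2.1 h2.2
  rw [Ex_congr (g := fun G => ad G j v * ((1 - ad G l v) * g G) + ad G l v * ((1 - ad G j v) * g G))
    (fun G _ => by rw [ind_Sd_eq hv]; ring), Ex_add, Ex_ad_mul' hvj.symm, Ex_ad_mul' hvl.symm,
    Ex_nad_mul' a1 hvl.symm, Ex_nad_mul' a2 hvj.symm]
  ring

lemma two_L4_le (c : Ctx 𝒢 p δ R L Hm r) : 2 * L ^ 4 / r ≤ p * (1 - p) := by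
  have h1 := c.one_le_LΛ
  have hL := c.L_pos
  have hr := c.r_pos
  rw [div_le_iff₀ hr]
  have h2 : 2 * L ^ 6 ≤ L ^ 7 := c.mul_pow_le (by norm_num) (by norm_num)
  have h3 : L ^ 7 ≤ r := c.Lpow_le (by norm_num)
  have h4 : 0 < p * (1 - p) := mul_pos c.p_pos c.q_pos
  calc 2 * L ^ 4 = 2 * L ^ 4 * 1 := by ring
    _ ≤ 2 * L ^ 4 * (L ^ 2 * (p * (1 - p))) := by gcongr
    _ = p * (1 - p) * (2 * L ^ 6) := by ring
    _ ≤ _ := by gcongr; linarith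

lemma status_prob (c : Ctx 𝒢 p δ R L Hm r) (a : Adm 𝒢 L Hm (k + 2) H Q) (hjl : j ≠ l)
    (hv : v ∈ Fr j l (H ⊔ Q)) :
    |pr 𝒢 H Q j v * (1 - pr 𝒢 (H ⊔ SimpleGraph.edge j v) Q l v) - p * (1 - p)| ≤ 2 * L ^ 4 / r := by
  obtain ⟨hvj, hvl, h1, h2⟩ := mem_Fr.1 hv
  rw [SimpleGraph.sup_adj, not_or] at h1 h2
  have a1 := a.add c hvj.symm h1.1 h1.2
  have b1 := pr_crude c a hvj.symm h1.1 h1.2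
  have b2 := pr_crude c a1 hvl.symm (by
    rw [sup_edge_adj_iff hvj.symm]; simp [h2.1, hjl.symm, hvl.symm]) h2.2
  set x := pr 𝒢 H Q j v
  set y := pr 𝒢 (H ⊔ SimpleGraph.edge j v) Q l v
  have y0 : 0 ≤ y := pr_nonneg _ _
  have y1 : y ≤ 1 := pr_le_one a1.nonempty _ _
  have e : x * (1 - y) - p * (1 - p) = (x - p) * (1 - y) + p * (p - y) := by ring
  rw [e]
  refine (abs_add_le _ _).trans ?_
  rw [abs_mul, abs_mul, abs_of_nonneg (by linarith : 0 ≤ 1 - y), abs_of_pos c.p_pos, abs_sub_comm p y]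
  have : |x - p| * (1 - y) ≤ |x - p| := mul_le_of_le_one_right (abs_nonneg _) (by linarith)
  have : p * |y - p| ≤ |y - p| := mul_le_of_le_one_left (abs_nonneg _) c.p_lt.le
  have e2 : 2 * L ^ 4 / r = L ^ 4 / r + L ^ 4 / r := by ring
  linarith

lemma Ex_ind_Sd_near (c : Ctx 𝒢 p δ R L Hm r) (a : Adm 𝒢 L Hm (k + 2) H Q) (hjl : j ≠ l)
    (hv : v ∈ Fr j l (H ⊔ Q)) {g : SimpleGraph (Fin n) → ℝ} {Y e : ℝ}
    (h1 : |Ex (fam 𝒢 (H ⊔ SimpleGraph.edge j v) (Q ⊔ SimpleGraph.edge l v)) g - Y| ≤ e)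
    (h2 : |Ex (fam 𝒢 (H ⊔ SimpleGraph.edge l v) (Q ⊔ SimpleGraph.edge j v)) g - Y| ≤ e) :
    |Ex (fam 𝒢 H Q) (fun G => ind (v ∈ Sd j l (Fr j l (H ⊔ Q)) G) * g G) - 2 * (p * (1 - p)) * Y| ≤
      4 * (p * (1 - p)) * e + 4 * L ^ 4 / r * |Y| := by
  rw [Ex_ind_Sd_mul c a hjl hv]
  have s1 := status_prob c a hjl hv
  have s2 := status_prob c a hjl.symm (by rwa [Fr_comm])
  have hΛ := two_L4_le c
  set P1 := pr 𝒢 H Q j v * (1 - pr 𝒢 (H ⊔ SimpleGraph.edge j v) Q l v)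
  set P2 := pr 𝒢 H Q l v * (1 - pr 𝒢 (H ⊔ SimpleGraph.edge l v) Q j v)
  set E1 := Ex (fam 𝒢 (H ⊔ SimpleGraph.edge j v) (Q ⊔ SimpleGraph.edge l v)) g
  set E2 := Ex (fam 𝒢 (H ⊔ SimpleGraph.edge l v) (Q ⊔ SimpleGraph.edge j v)) g
  set Λ := p * (1 - p)
  have hΛ0 : 0 ≤ Λ := mul_nonneg c.p_pos.le c.q_pos.le
  have he : 0 ≤ e := (abs_nonneg _).trans h1
  have key : ∀ P E : ℝ, |P - Λ| ≤ 2 * L ^ 4 / r → |E - Y| ≤ e →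
      |P * E - Λ * Y| ≤ 2 * Λ * e + 2 * L ^ 4 / r * |Y| := by
    intro P E hP hE
    have e1 : P * E - Λ * Y = P * (E - Y) + (P - Λ) * Y := by ring
    rw [e1]
    refine (abs_add_le _ _).trans ?_
    rw [abs_mul, abs_mul]
    have hP' : |P| ≤ 2 * Λ := by rw [abs_le] at *; constructor <;> linarith
    gcongr
  have k1 := key P1 E1 s1 h1
  have k2 := key P2 E2 s2 h2
  have e3 : P1 * E1 + P2 * E2 - 2 * Λ * Y = (P1 * E1 - Λ * Y) + (P2 * E2 - Λ * Y) := by ring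
  rw [e3]
  refine (abs_add_le _ _).trans ((add_le_add k1 k2).trans (le_of_eq ?_))
  ring

end Kap

section Absorb
variable {n : ℕ} {𝒢 : Finset (SimpleGraph (Fin n))} {p δ R L Hm r y : ℝ}

lemma Ctx.y_le (c : Ctx 𝒢 p δ R L Hm r) (hy : y ≤ 4 * Hm) : y ≤ 4 * (L * r) :=
  hy.trans (by linarith [c.Hm_le])

lemma Ctx.δ_cube_le (c : Ctx 𝒢 p δ R L Hm r) : δ ^ 3 ≤ L ^ 3 * r ^ 3 := by
  rw [← mul_pow]; exact pow_le_pow_left₀ c.δ_nonneg c.δ_le 3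

lemma Ctx.δ_sq_le (c : Ctx 𝒢 p δ R L Hm r) : δ ^ 2 ≤ L ^ 2 * r ^ 2 := by
  rw [← mul_pow]; exact pow_le_pow_left₀ c.δ_nonneg c.δ_le 2

lemma Ctx.absorb_lin (c : Ctx 𝒢 p δ R L Hm r) (a : ℕ) :
    L ^ a * δ ^ 3 * y / r ^ 6 ≤ δ ^ 3 * y ^ 2 / r ^ 6 + L ^ (2 * a + 3) / r ^ 3 := by
  have hr := c.r_pos
  have hL := c.L_pos
  have hδ := c.δ_nonneg
  have e : L ^ (2 * a + 3) / r ^ 3 = L ^ (2 * a) * (L ^ 3 * r ^ 3) / r ^ 6 := by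
    rw [pow_add]; field_simp
  rw [e, ← add_div]
  gcongr
  have h1 : L ^ a * y ≤ y ^ 2 + L ^ (2 * a) := by
    rw [two_mul, pow_add]
    nlinarith [sq_nonneg (L ^ a - y), sq_nonneg y, sq_nonneg (L ^ a)]
  calc L ^ a * δ ^ 3 * y = δ ^ 3 * (L ^ a * y) := by ring
    _ ≤ δ ^ 3 * (y ^ 2 + L ^ (2 * a)) := by gcongr
    _ = δ ^ 3 * y ^ 2 + L ^ (2 * a) * δ ^ 3 := by ring
    _ ≤ _ := by gcongr; exact c.δ_cube_le

lemma Ctx.absorb_sq (c : Ctx 𝒢 p δ R L Hm r) (hy : 0 ≤ y) (a : ℕ) :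
    L ^ a * δ ^ 2 * y / r ^ 5 ≤ δ ^ 3 * y ^ 2 / r ^ 6 + L ^ (2 * a + 1) / r ^ 3 := by
  have hr := c.r_pos
  have hL := c.L_pos
  have hδ := c.δ_nonneg
  have e : L ^ (2 * a + 1) / r ^ 3 = (L * r) * (L ^ a * r) * (L ^ a * r) / r ^ 6 := by
    rw [pow_add, two_mul, pow_add]; field_simp
  have e2 : L ^ a * δ ^ 2 * y / r ^ 5 = δ * (δ * y) * (L ^ a * r) / r ^ 6 := by field_simp
  rw [e, e2, ← add_div]
  gcongr
  rcases le_total (L ^ a * r) (δ * y) with h | h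
  · calc δ * (δ * y) * (L ^ a * r) ≤ δ * (δ * y) * (δ * y) := by gcongr
      _ = δ ^ 3 * y ^ 2 := by ring
      _ ≤ _ := by have : 0 ≤ (L * r) * (L ^ a * r) * (L ^ a * r) := by positivity
                  linarith
  · calc δ * (δ * y) * (L ^ a * r) ≤ (L * r) * (L ^ a * r) * (L ^ a * r) := by
          gcongr; exact c.δ_le
      _ ≤ _ := by have : 0 ≤ δ ^ 3 * y ^ 2 := by positivity
                  linarith

lemma Ctx.absorb_sq_sq (c : Ctx 𝒢 p δ R L Hm r) (hy0 : 0 ≤ y) (hy : y ≤ 4 * Hm) (a : ℕ) :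
    L ^ a * δ ^ 2 * y ^ 2 / r ^ 6 ≤ δ ^ 3 * y ^ 2 / r ^ 6 + L ^ (3 * a + 4) / r ^ 3 := by
  have hr := c.r_pos
  have hL := c.L_pos
  have hδ := c.δ_nonneg
  have hr1 := c.r_ge
  have e : L ^ (3 * a + 4) / r ^ 3 = L ^ (3 * a + 4) * r ^ 3 / r ^ 6 := by field_simp
  rw [e, ← add_div]
  gcongr
  rcases le_total (L ^ a) δ with h | h
  · calc L ^ a * δ ^ 2 * y ^ 2 ≤ δ * δ ^ 2 * y ^ 2 := by gcongr
      _ = δ ^ 3 * y ^ 2 := by ring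
      _ ≤ _ := by have : 0 ≤ L ^ (3 * a + 4) * r ^ 3 := by positivity
                  linarith
  · have h2 : (16 : ℝ) * L ^ (3 * a + 2) ≤ L ^ (3 * a + 4) := c.mul_pow_le (by omega) (by norm_num)
    have h3 : r ^ 2 ≤ r ^ 3 := pow_le_pow_right₀ (by linarith) (by norm_num)
    calc L ^ a * δ ^ 2 * y ^ 2 ≤ L ^ a * (L ^ a) ^ 2 * (4 * (L * r)) ^ 2 := by
          gcongr; exact c.y_le hy
      _ = 16 * L ^ (3 * a + 2) * r ^ 2 := by ring
      _ ≤ L ^ (3 * a + 4) * r ^ 3 := by gcongr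
      _ ≤ _ := by have : 0 ≤ δ ^ 3 * y ^ 2 := by positivity
                  linarith

lemma Ctx.absorb_cube (c : Ctx 𝒢 p δ R L Hm r) (hy0 : 0 ≤ y) (hy : y ≤ 4 * Hm) {a : ℕ} (ha : a ≤ 190) :
    L ^ a * δ ^ 4 * y ^ 3 / r ^ 8 ≤ δ ^ 3 * y ^ 2 / r ^ 6 := by
  have hr := c.r_pos
  have hL := c.L_pos
  have hδ := c.δ_nonneg
  have hH : 0 ≤ Hm := by linarith [c.Hm_ge]
  have e : δ ^ 3 * y ^ 2 / r ^ 6 = δ ^ 3 * y ^ 2 * r ^ 2 / r ^ 8 := by field_simp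
  rw [e]
  refine div_le_div_of_nonneg_right ?_ (by positivity)
  have h1 : L ^ a * (δ * y) ≤ r ^ 2 := by
    rw [c.r_sq]
    refine le_trans ?_ c.δHm
    have h2 : 4 * L ^ a ≤ L ^ 200 := c.mul_pow_le (by omega) (by norm_num)
    calc L ^ a * (δ * y) ≤ L ^ a * (δ * (4 * Hm)) := by gcongr
      _ = (4 * L ^ a) * (δ * Hm) := by ring
      _ ≤ _ := by gcongr
  calc L ^ a * δ ^ 4 * y ^ 3 = δ ^ 3 * y ^ 2 * (L ^ a * (δ * y)) := by ring
    _ ≤ _ := by gcongr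

lemma Ctx.absorb_one (c : Ctx 𝒢 p δ R L Hm r) (hy : y ≤ 4 * Hm) (a : ℕ) :
    L ^ a * y / r ^ 6 ≤ L ^ (a + 2) / r ^ 3 := by
  have hr := c.r_pos
  have hL := c.L_pos
  have hr1 := c.r_ge
  have h1 := c.y_le hy
  have hL1 := c.L_ge
  have h3 : r ≤ r ^ 3 := le_self_pow₀ (by linarith) (by norm_num)
  have e : L ^ (a + 2) / r ^ 3 = L ^ (a + 2) * r ^ 3 / r ^ 6 := by field_simp
  rw [e]
  refine div_le_div_of_nonneg_right ?_ (by positivity)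
  calc L ^ a * y ≤ L ^ a * (4 * (L * r)) := by gcongr
    _ = L ^ a * (4 * L) * r := by ring
    _ ≤ L ^ a * (L * L) * r ^ 3 := by gcongr; linarith
    _ = _ := by ring

end Absorb

section SqKap
variable {n : ℕ} {𝒢 : Finset (SimpleGraph (Fin n))} {p δ R L Hm r : ℝ} {k : ℕ}
  {H Q H₀ Q₀ G : SimpleGraph (Fin n)} {j l v : Fin n}

lemma Adm.ne (a : Adm 𝒢 L Hm k H Q) : 𝒢.Nonempty := by
  obtain ⟨G, hG⟩ := a.nonempty
  exact ⟨G, fam_subset hG⟩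

lemma Ex_nad_sq (c : Ctx 𝒢 p δ R L Hm r) (a : Adm 𝒢 L Hm (k + 1) H Q) (hjl : j ≠ l) {u w : Fin n}
    (huw : u ≠ w) (hH : ¬ H.Adj u w) (hQ : ¬ Q.Adj u w) :
    |Ex (fam 𝒢 H Q) (fun G => (1 - ad G u w) * ((deg G j : ℝ) - deg G l) ^ 2) - 2 * R * (1 - p)| ≤
      2 * (1 - p) * Bz H p δ L j l + 2 * L ^ 4 * δ ^ 2 / r := by
  rw [Ex_nad_mul' a huw]
  have a1 := a.addQ c huw hH hQ
  have h1 := Ex_sq_sub c a1 hjl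
  have h2 := pr_crude c a huw hH hQ
  have h3 := (L4_div_r_lt c).2
  have hR0 := c.R_nonneg a.ne
  have hR := c.R_le a.ne
  have hr := c.r_pos
  have hL := c.L_pos
  set E := Ex (fam 𝒢 H (Q ⊔ SimpleGraph.edge u w)) (fun G => ((deg G j : ℝ) - deg G l) ^ 2)
  set x := pr 𝒢 H Q u w
  have e : (1 - x) * E - 2 * R * (1 - p) = (1 - x) * (E - 2 * R) + (p - x) * (2 * R) := by ring
  rw [e]
  refine (abs_add_le _ _).trans ?_
  rw [abs_mul, abs_mul, abs_sub_comm p x, abs_of_nonneg (by linarith : 0 ≤ 2 * R)]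
  have hx : |1 - x| ≤ 2 * (1 - p) := by rw [abs_le] at *; constructor <;> linarith
  have hq := c.q_pos
  have e2 : 2 * L ^ 4 * δ ^ 2 / r = (L ^ 4 / r) * (2 * δ ^ 2) := by ring
  rw [e2]
  gcongr

lemma Bz_le_of_near (c : Ctx 𝒢 p δ R L Hm r) (hN : Near H Q H₀ Q₀ j l) :
    Bz H₀ p δ L j l ≤ 72 * δ ^ 3 * (deg H j + deg H l) / (p * n) + 2 * L ^ 10 * (δ ^ 3 + 1) / n := by
  have hδ := c.δ_nonneg
  have hp := c.p_pos
  have hn := c.n_pos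
  have hL := c.L_pos
  have h1 := hN.deg
  have h2 := c.inv_p_le
  have h3 : (72 : ℝ) * L ^ 1 ≤ L ^ 10 := c.mul_pow_le (by norm_num) (by norm_num)
  unfold Bz
  have e1 : 72 * δ ^ 3 * ((deg H₀ j : ℝ) + deg H₀ l) / (p * n) ≤
      72 * δ ^ 3 * ((deg H j + deg H l : ℝ) + 1) / (p * n) := by gcongr
  have e2 : 72 * δ ^ 3 * ((deg H j + deg H l : ℝ) + 1) / (p * n) =
      72 * δ ^ 3 * (deg H j + deg H l) / (p * n) + 72 * (1 / p) * δ ^ 3 / n := by field_simp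
  have e3 : 72 * (1 / p) * δ ^ 3 / n ≤ L ^ 10 * (δ ^ 3 + 1) / n := by
    gcongr
    · calc 72 * (1 / p) ≤ 72 * L := by gcongr
        _ = 72 * L ^ 1 := by ring
        _ ≤ _ := h3
    · linarith
  have e4 : 2 * L ^ 10 * (δ ^ 3 + 1) / n = L ^ 10 * (δ ^ 3 + 1) / n + L ^ 10 * (δ ^ 3 + 1) / n := by ring
  linarith

/-- The error term in the estimate of `E[z² κ]`. -/
noncomputable def Ezk (H Q : SimpleGraph (Fin n)) (p δ L r : ℝ) (j l : Fin n) : ℝ :=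
  (deg H j + deg H l) * (2 * (1 - p) * (72 * δ ^ 3 * (deg H j + deg H l) / (p * n) +
    2 * L ^ 10 * (δ ^ 3 + 1) / n) + 2 * L ^ 4 * δ ^ 2 / r) + 12 * δ ^ 2 * (deg Q j + deg Q l)

lemma Ex_sq_kapF_near (c : Ctx 𝒢 p δ R L Hm r) (a : Adm 𝒢 L Hm (k + 1) H₀ Q₀) (hjl : j ≠ l)
    (hN : Near H Q H₀ Q₀ j l) (hsub : fam 𝒢 H₀ Q₀ ⊆ fam 𝒢 H Q) :
    |Ex (fam 𝒢 H₀ Q₀) (fun G => ((deg G j : ℝ) - deg G l) ^ 2 * kapF (Fr j l (H ⊔ Q)) j l G) -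
      2 * R * (1 - p) * (deg H j - deg H l)| ≤ Ezk H Q p δ L r j l := by
  have hR0 := c.R_nonneg a.ne
  have hR := c.R_le a.ne
  have hr := c.r_pos
  have hL := c.L_pos
  have hq := c.q_pos
  have hp := c.p_pos
  have hδ := c.δ_nonneg
  have hn := c.n_pos
  have hz : ∀ G ∈ fam 𝒢 H₀ Q₀, |((deg G j : ℝ) - deg G l) ^ 2| ≤ 4 * δ ^ 2 := by
    intro G hG
    have h := c.abs_deg_sub_le (fam_subset hG) j l
    rw [abs_pow]
    calc |(deg G j : ℝ) - deg G l| ^ 2 ≤ (2 * δ) ^ 2 := by gcongr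
      _ = _ := by ring
  have hY0 : 0 ≤ 2 * R * (1 - p) := by positivity
  have hY : |2 * R * (1 - p)| ≤ 4 * δ ^ 2 := by
    rw [abs_of_nonneg hY0]
    calc 2 * R * (1 - p) ≤ 2 * R * 1 := by gcongr; linarith
      _ ≤ _ := by nlinarith [sq_nonneg δ]
  set e := 2 * (1 - p) * (72 * δ ^ 3 * (deg H j + deg H l) / (p * n) +
    2 * L ^ 10 * (δ ^ 3 + 1) / n) + 2 * L ^ 4 * δ ^ 2 / r with he
  have hBz : 2 * (1 - p) * Bz H₀ p δ L j l + 2 * L ^ 4 * δ ^ 2 / r ≤ e := by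
    rw [he]; gcongr; exact Bz_le_of_near c hN
  have key := Ex_kap_near (K := fam 𝒢 H₀ Q₀) (H := H) (Q := Q)
    (f := fun G => ((deg G j : ℝ) - deg G l) ^ 2)
    (y := fun _ => 2 * R * (1 - p)) (y' := fun _ => 2 * R * (1 - p)) (e := e) (B := 4 * δ ^ 2) (d := 0)
    hjl a.nonempty (by positivity) le_rfl
    (fun G hG u w h => (mem_fam.1 hG).2.1 u w (hN.le u w h))
    (fun w h1 h2 h3 h4 => by
      obtain ⟨h5, h6⟩ := hN.left w h1 h2 h3 h4
      exact (Ex_nad_sq c a hjl h2.symm h5 h6).trans hBz)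
    (fun w h1 h2 h3 h4 => by
      obtain ⟨h5, h6⟩ := hN.right w h1 h2 h3 h4
      exact (Ex_nad_sq c a hjl h2.symm h5 h6).trans hBz)
    hz (fun _ => hY) (fun _ => hY) (fun _ _ _ => by simp) (fun _ => by simp)
  have h2 : |Ex (fam 𝒢 H₀ Q₀) (fun G => (kapF (Fr j l (H ⊔ Q)) j l G - kap H j l G) *
      ((deg G j : ℝ) - deg G l) ^ 2)| ≤ (deg Q j + deg Q l) * (4 * δ ^ 2) := by
    refine (abs_Ex_le_of (g := fun _ => (deg Q j + deg Q l) * (4 * δ ^ 2)) fun G hG => ?_).trans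
      (le_of_eq (Ex_const a.nonempty _))
    rw [abs_mul]
    exact mul_le_mul (abs_kapF_sub_kap_le hjl (hsub hG)) (hz G hG) (abs_nonneg _) (by positivity)
  have e3 : Ex (fam 𝒢 H₀ Q₀) (fun G => ((deg G j : ℝ) - deg G l) ^ 2 * kapF (Fr j l (H ⊔ Q)) j l G) =
      Ex (fam 𝒢 H₀ Q₀) (fun G => kap H j l G * ((deg G j : ℝ) - deg G l) ^ 2) +
      Ex (fam 𝒢 H₀ Q₀) (fun G => (kapF (Fr j l (H ⊔ Q)) j l G - kap H j l G) *
      ((deg G j : ℝ) - deg G l) ^ 2) := by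
    rw [← Ex_add]
    exact Ex_congr fun G _ => by ring
  rw [e3]
  rw [← Finset.sum_mul, ← Finset.sum_mul, ← deg_eq_sum, ← deg_eq_sum] at key
  unfold Ezk
  rw [← he]
  rw [abs_le] at *
  constructor <;> nlinarith [key.1, key.2, h2.1, h2.2]

end SqKap

section L10
variable {n : ℕ} {𝒢 : Finset (SimpleGraph (Fin n))} {p δ R L Hm r : ℝ} {k : ℕ}
  {H Q H₀ Q₀ G : SimpleGraph (Fin n)} {j l v : Fin n}

lemma Ctx.const_mul_pow_le (c : Ctx 𝒢 p δ R L Hm r) {a b : ℕ} (h : a + 2 ≤ b) {x : ℝ} (hx : x ≤ 10000) :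
    x * L ^ a ≤ L ^ b := by
  have hL := c.L_ge
  have h1 : x ≤ L ^ 2 := by nlinarith
  calc x * L ^ a ≤ L ^ 2 * L ^ a := by gcongr
    _ = L ^ (a + 2) := by ring
    _ ≤ L ^ b := c.pow_le h

lemma swap_term_good (c : Ctx 𝒢 p δ R L Hm r) (a : Adm 𝒢 L Hm k H Q) (hG : G ∈ fam 𝒢 H Q)
    (hg : Good p L r G) (hjl : j ≠ l) {s z κ : ℝ} (hs : s = (Sd j l (Fr j l (H ⊔ Q)) G).card)
    (hz : z = (deg G j : ℝ) - deg G l) (hκ : κ = kapF (Fr j l (H ⊔ Q)) j l G) :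
    |z * rho (Fr j l (H ⊔ Q)) j l G / s - z ^ 2 * κ / (2 * (p * (1 - p)) * n) ^ 2| ≤
      4 * (δ ^ 3 * kk H Q j l ^ 2 / r ^ 6) + L ^ 29 / r ^ 3 := by
  have h1 := (rho_approx c a hG hg hjl hs hz hκ).1
  have hFr := card_compl_Fr_le_Hm c a j l
  have hz2 := c.abs_deg_sub_le (fam_subset hG) j l
  have hκ2 := abs_kapF_le hjl hG
  have hi1 := hg.inv_sd_le c (fam_subset hG) hjl hFr
  have hi2 := hg.inv_sd_sub c (fam_subset hG) hjl hFr
  have hs0 := hg.sd_ge c (fam_subset hG) hjl hFr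
  have hi3 := c.inv_Λn_le
  rw [← hs] at hi1 hi2 hs0
  rw [← hz] at hz2
  rw [← hκ] at hκ2
  have hy0 := kk_nonneg H Q j l
  have hy := a.kk_le c j l
  set y := kk H Q j l
  have hn := c.n_pos
  have hr := c.r_pos
  have hL := c.L_pos
  have hδ := c.δ_nonneg
  have hp := c.p_pos
  have hq := c.q_pos
  have hΛ : 0 < p * (1 - p) := mul_pos hp hq
  have hs1 : 0 < s := lt_of_lt_of_le (by positivity) hs0
  set s1 := 2 * (p * (1 - p)) * n with hs1d
  have hs1p : 0 < s1 := by positivity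
  have hi4 : 1 / s1 ≤ L ^ 2 / n := by
    refine le_trans ?_ hi3
    apply one_div_le_one_div_of_le (by positivity)
    rw [hs1d]; nlinarith [mul_pos hΛ hn]
  rw [← c.r_sq] at hi1 hi4
  set ρ := rho (Fr j l (H ⊔ Q)) j l G
  have e1 : z * ρ / s - z ^ 2 * κ / s1 ^ 2 =
      z * (1 / s) * (ρ - z * κ / s) + z ^ 2 * κ * ((1 / s - 1 / s1) * (1 / s + 1 / s1)) := by
    field_simp
    ring
  have hb1 : |ρ - z * κ / s| ≤ 6 * (2 * δ * y * (L ^ 2 / r ^ 2)) ^ 3 +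
      200 * (2 * δ * y) * (2 * δ + y) * (L ^ 2 / r ^ 2) ^ 2 := by
    refine h1.trans ?_
    have e2 : 200 * (|z| * |κ|) * (|z| + |κ|) / s ^ 2 = 200 * (|z| * |κ|) * (|z| + |κ|) * (1 / s) ^ 2 := by
      field_simp
    have e3 : |z| * |κ| / s = |z| * |κ| * (1 / s) := by field_simp
    rw [e2, e3]
    gcongr
  have t1 : |z * (1 / s) * (ρ - z * κ / s)| ≤ 2 * δ * (L ^ 2 / r ^ 2) *
      (6 * (2 * δ * y * (L ^ 2 / r ^ 2)) ^ 3 + 200 * (2 * δ * y) * (2 * δ + y) * (L ^ 2 / r ^ 2) ^ 2) := by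
    rw [abs_mul, abs_mul, abs_of_pos (by positivity : 0 < 1 / s)]
    gcongr
  have t2 : |z ^ 2 * κ * ((1 / s - 1 / s1) * (1 / s + 1 / s1))| ≤
      (2 * δ) ^ 2 * y * (L ^ 7 / r ^ 3 * (L ^ 2 / r ^ 2 + L ^ 2 / r ^ 2)) := by
    rw [abs_mul, abs_mul, abs_mul, abs_pow, abs_of_pos (by positivity : 0 < 1 / s + 1 / s1)]
    gcongr
  rw [e1]
  refine (abs_add_le _ _).trans ((add_le_add t1 t2).trans ?_)
  have b1 := c.absorb_cube hy0 hy (a := 9) (by norm_num)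
  have b2 := c.absorb_lin (y := y) 8
  have b3 := c.absorb_sq_sq hy0 hy 8
  have b4 := c.absorb_sq hy0 10
  have m1 : (96 : ℝ) * L ^ 8 ≤ L ^ 9 := c.mul_pow_le (by norm_num) (by norm_num)
  have m2 : (1600 : ℝ) * L ^ 6 ≤ L ^ 8 := c.const_mul_pow_le (by norm_num) (by norm_num)
  have m3 : (800 : ℝ) * L ^ 6 ≤ L ^ 8 := c.const_mul_pow_le (by norm_num) (by norm_num)
  have m4 : (8 : ℝ) * L ^ 9 ≤ L ^ 10 := c.mul_pow_le (by norm_num) (by norm_num)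
  have c1 : 96 * L ^ 8 * (δ ^ 4 * y ^ 3 / r ^ 8) ≤ L ^ 9 * (δ ^ 4 * y ^ 3 / r ^ 8) := by gcongr
  have c2 : 1600 * L ^ 6 * (δ ^ 3 * y / r ^ 6) ≤ L ^ 8 * (δ ^ 3 * y / r ^ 6) := by gcongr
  have c3 : 800 * L ^ 6 * (δ ^ 2 * y ^ 2 / r ^ 6) ≤ L ^ 8 * (δ ^ 2 * y ^ 2 / r ^ 6) := by gcongr
  have c4 : 8 * L ^ 9 * (δ ^ 2 * y / r ^ 5) ≤ L ^ 10 * (δ ^ 2 * y / r ^ 5) := by gcongr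
  have d1 : L ^ (2 * 8 + 3) / r ^ 3 + L ^ (3 * 8 + 4) / r ^ 3 + L ^ (2 * 10 + 1) / r ^ 3 ≤ L ^ 29 / r ^ 3 := by
    rw [← add_div, ← add_div]
    gcongr
    have := c.pow_le (show 19 ≤ 28 by norm_num)
    have := c.pow_le (show 21 ≤ 28 by norm_num)
    have : 3 * L ^ 28 ≤ L ^ 29 := c.mul_pow_le (by norm_num) (by norm_num)
    norm_num
    linarith
  have e4 : 2 * δ * (L ^ 2 / r ^ 2) * (6 * (2 * δ * y * (L ^ 2 / r ^ 2)) ^ 3 +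
      200 * (2 * δ * y) * (2 * δ + y) * (L ^ 2 / r ^ 2) ^ 2) +
      (2 * δ) ^ 2 * y * (L ^ 7 / r ^ 3 * (L ^ 2 / r ^ 2 + L ^ 2 / r ^ 2)) =
      96 * L ^ 8 * (δ ^ 4 * y ^ 3 / r ^ 8) + 1600 * L ^ 6 * (δ ^ 3 * y / r ^ 6) +
      800 * L ^ 6 * (δ ^ 2 * y ^ 2 / r ^ 6) + 8 * L ^ 9 * (δ ^ 2 * y / r ^ 5) := by
    field_simp
    ring
  rw [e4]
  have f1 : L ^ 9 * (δ ^ 4 * y ^ 3 / r ^ 8) = L ^ 9 * δ ^ 4 * y ^ 3 / r ^ 8 := by ring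
  have f2 : L ^ 8 * (δ ^ 3 * y / r ^ 6) = L ^ 8 * δ ^ 3 * y / r ^ 6 := by ring
  have f3 : L ^ 8 * (δ ^ 2 * y ^ 2 / r ^ 6) = L ^ 8 * δ ^ 2 * y ^ 2 / r ^ 6 := by ring
  have f4 : L ^ 10 * (δ ^ 2 * y / r ^ 5) = L ^ 10 * δ ^ 2 * y / r ^ 5 := by ring
  linarith

lemma Adm.addAddQ (c : Ctx 𝒢 p δ R L Hm r) (a : Adm 𝒢 L Hm (k + 2) H Q) (hjl : j ≠ l)
    (hv : v ∈ Fr j l (H ⊔ Q)) :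
    Adm 𝒢 L Hm k (H ⊔ SimpleGraph.edge j v) (Q ⊔ SimpleGraph.edge l v) := by
  obtain ⟨hvj, hvl, h1, h2⟩ := mem_Fr.1 hv
  rw [SimpleGraph.sup_adj, not_or] at h1 h2
  refine (a.add c hvj.symm h1.1 h1.2).addQ c hvl.symm ?_ h2.2
  rw [sup_edge_adj_iff hvj.symm]
  simp [h2.1, hjl.symm, hvl.symm]

lemma Adm.addAddQ' (c : Ctx 𝒢 p δ R L Hm r) (a : Adm 𝒢 L Hm (k + 2) H Q) (hjl : j ≠ l)
    (hv : v ∈ Fr j l (H ⊔ Q)) :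
    Adm 𝒢 L Hm k (H ⊔ SimpleGraph.edge l v) (Q ⊔ SimpleGraph.edge j v) :=
  a.addAddQ c hjl.symm (by rwa [Fr_comm])

lemma fam_mono {H Q H₀ Q₀ : SimpleGraph (Fin n)} (h : H ≤ H₀) (h' : Q ≤ Q₀) :
    fam 𝒢 H₀ Q₀ ⊆ fam 𝒢 H Q := by
  intro G hG
  obtain ⟨h1, h2, h3⟩ := mem_fam.1 hG
  exact mem_fam.2 ⟨h1, fun u w e => h2 u w (h e), fun u w e => h3 u w (h' e)⟩

lemma Ezk_div_le (c : Ctx 𝒢 p δ R L Hm r) (a : Adm 𝒢 L Hm k H Q) (j l : Fin n) :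
    Ezk H Q p δ L r j l / (p * (1 - p) * n ^ 2) ≤
      148 * (δ ^ 3 * kk H Q j l ^ 2 / (p ^ 2 * n ^ 3)) + L ^ 28 / r ^ 3 +
        L ^ 6 * (deg Q j + deg Q l) / n := by
  have hy0 := kk_nonneg H Q j l
  have hy := a.kk_le c j l
  have hhy : (deg H j + deg H l : ℝ) ≤ kk H Q j l := by
    unfold kk; have : (0 : ℝ) ≤ deg Q j + deg Q l := by positivity
    linarith
  set y := kk H Q j l
  set hh : ℝ := deg H j + deg H l with hhd
  have hh0 : 0 ≤ hh := by positivity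
  set qq : ℝ := deg Q j + deg Q l with hqd
  have hq0 : 0 ≤ qq := by positivity
  have hn := c.n_pos
  have hr := c.r_pos
  have hL := c.L_pos
  have hδ := c.δ_nonneg
  have hp := c.p_pos
  have hq := c.q_pos
  have hip := c.inv_p_le
  have hn2 : (n : ℝ) = r ^ 2 := c.r_sq.symm
  have hiΛ : 1 / (p * (1 - p)) ≤ L ^ 2 := by
    rw [div_le_iff₀ (by positivity)]; exact c.one_le_LΛ
  have e1 : Ezk H Q p δ L r j l / (p * (1 - p) * n ^ 2) =
      144 * (δ ^ 3 * hh ^ 2 / (p ^ 2 * n ^ 3)) + 4 * L ^ 10 * (1 / p) * (δ ^ 3 * hh) / n ^ 3 +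
      4 * L ^ 10 * (1 / p) * hh / n ^ 3 + 2 * L ^ 4 * (1 / (p * (1 - p))) * (δ ^ 2 * hh) / (r * n ^ 2) +
      12 * (1 / (p * (1 - p))) * δ ^ 2 * qq / n ^ 2 := by
    unfold Ezk
    rw [← hhd, ← hqd]
    field_simp
    ring
  rw [e1]
  have t1 : 144 * (δ ^ 3 * hh ^ 2 / (p ^ 2 * n ^ 3)) ≤ 144 * (δ ^ 3 * y ^ 2 / (p ^ 2 * n ^ 3)) := by
    gcongr
  have m1 : (4 : ℝ) * L ^ 11 ≤ L ^ 12 := c.mul_pow_le (by norm_num) (by norm_num)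
  have m2 : (2 : ℝ) * L ^ 6 ≤ L ^ 7 := c.mul_pow_le (by norm_num) (by norm_num)
  have m3 : (12 : ℝ) * L ^ 4 ≤ L ^ 6 := c.mul_pow_le (by norm_num) (by norm_num)
  have t2 : 4 * L ^ 10 * (1 / p) * (δ ^ 3 * hh) / n ^ 3 ≤ L ^ 12 * δ ^ 3 * y / r ^ 6 := by
    rw [hn2, ← pow_mul]
    calc 4 * L ^ 10 * (1 / p) * (δ ^ 3 * hh) / r ^ (2 * 3) ≤ 4 * L ^ 10 * L * (δ ^ 3 * y) / r ^ (2 * 3) := by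
          gcongr
      _ = (4 * L ^ 11) * (δ ^ 3 * y) / r ^ 6 := by ring
      _ ≤ L ^ 12 * (δ ^ 3 * y) / r ^ 6 := by gcongr
      _ = _ := by ring
  have t3 : 4 * L ^ 10 * (1 / p) * hh / n ^ 3 ≤ L ^ 12 * y / r ^ 6 := by
    rw [hn2, ← pow_mul]
    calc 4 * L ^ 10 * (1 / p) * hh / r ^ (2 * 3) ≤ 4 * L ^ 10 * L * y / r ^ (2 * 3) := by
          gcongr
      _ = (4 * L ^ 11) * y / r ^ 6 := by ring
      _ ≤ L ^ 12 * y / r ^ 6 := by gcongr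
  have t4 : 2 * L ^ 4 * (1 / (p * (1 - p))) * (δ ^ 2 * hh) / (r * n ^ 2) ≤ L ^ 7 * δ ^ 2 * y / r ^ 5 := by
    rw [hn2]
    calc 2 * L ^ 4 * (1 / (p * (1 - p))) * (δ ^ 2 * hh) / (r * (r ^ 2) ^ 2) ≤
        2 * L ^ 4 * L ^ 2 * (δ ^ 2 * y) / (r * (r ^ 2) ^ 2) := by gcongr
      _ = (2 * L ^ 6) * (δ ^ 2 * y) / r ^ 5 := by ring
      _ ≤ L ^ 7 * (δ ^ 2 * y) / r ^ 5 := by gcongr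
      _ = _ := by ring
  have t5 : 12 * (1 / (p * (1 - p))) * δ ^ 2 * qq / n ^ 2 ≤ L ^ 6 * qq / n := by
    calc 12 * (1 / (p * (1 - p))) * δ ^ 2 * qq / n ^ 2 ≤ 12 * L ^ 2 * (L ^ 2 * n) * qq / n ^ 2 := by
          gcongr; rw [hn2]; exact c.δ_sq_le
      _ = (12 * L ^ 4) * qq / n := by field_simp
      _ ≤ _ := by gcongr
  have b1 := c.absorb_lin (y := y) 12
  have b2 := c.absorb_one hy 12
  have b3 := c.absorb_sq hy0 7
  have hEA : δ ^ 3 * y ^ 2 / r ^ 6 ≤ δ ^ 3 * y ^ 2 / (p ^ 2 * n ^ 3) := by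
    rw [hn2, ← pow_mul]
    apply div_le_div_of_nonneg_left (by positivity) (by positivity)
    have : p ^ 2 ≤ 1 := pow_le_one₀ hp.le c.p_lt.le
    have : 0 < r ^ 6 := by positivity
    norm_num
    nlinarith
  have d1 : L ^ (2 * 12 + 3) / r ^ 3 + L ^ (12 + 2) / r ^ 3 + L ^ (2 * 7 + 1) / r ^ 3 ≤ L ^ 28 / r ^ 3 := by
    rw [← add_div, ← add_div]
    gcongr
    have := c.pow_le (show 14 ≤ 27 by norm_num)
    have := c.pow_le (show 15 ≤ 27 by norm_num)
    have : 3 * L ^ 27 ≤ L ^ 28 := c.mul_pow_le (by norm_num) (by norm_num)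
    norm_num
    linarith
  have h0 : 0 ≤ δ ^ 3 * y ^ 2 / r ^ 6 := by positivity
  linarith

end L10

section L10
variable {n : ℕ} {𝒢 : Finset (SimpleGraph (Fin n))} {p δ R L Hm r : ℝ} {k : ℕ}
  {H Q H₀ Q₀ G : SimpleGraph (Fin n)} {j l v : Fin n}

/-- The main error term. -/
noncomputable def EA (H Q : SimpleGraph (Fin n)) (p δ : ℝ) (j l : Fin n) : ℝ :=
  δ ^ 3 * kk H Q j l ^ 2 / (p ^ 2 * n ^ 3)

lemma EA_nonneg (c : Ctx 𝒢 p δ R L Hm r) (H Q : SimpleGraph (Fin n)) (j l : Fin n) : 0 ≤ EA H Q p δ j l := by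
  have := c.δ_nonneg
  have := c.n_pos
  unfold EA; positivity

lemma le_EA (c : Ctx 𝒢 p δ R L Hm r) (H Q : SimpleGraph (Fin n)) (j l : Fin n) :
    δ ^ 3 * kk H Q j l ^ 2 / r ^ 6 ≤ EA H Q p δ j l := by
  have hδ := c.δ_nonneg
  have hr := c.r_pos
  have hp := c.p_pos
  unfold EA
  rw [← c.r_sq, ← pow_mul]
  apply div_le_div_of_nonneg_left (by positivity) (by positivity)
  have : p ^ 2 ≤ 1 := pow_le_one₀ hp.le c.p_lt.le
  have : 0 < r ^ 6 := by positivity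
  norm_num
  nlinarith

lemma hh_le_kk (H Q : SimpleGraph (Fin n)) (j l : Fin n) : (deg H j + deg H l : ℝ) ≤ kk H Q j l := by
  unfold kk; have : (0 : ℝ) ≤ deg Q j + deg Q l := by positivity
  linarith

lemma Ctx.inv_Λ_le (c : Ctx 𝒢 p δ R L Hm r) : 1 / (p * (1 - p)) ≤ L ^ 2 := by
  rw [div_le_iff₀ (mul_pos c.p_pos c.q_pos)]; exact c.one_le_LΛ

lemma Ex_ind_Sd_sq_kapF (c : Ctx 𝒢 p δ R L Hm r) (a : Adm 𝒢 L Hm (k + 3) H Q) (hjl : j ≠ l)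
    (hv : v ∈ Fr j l (H ⊔ Q)) :
    |Ex (fam 𝒢 H Q) (fun G => ind (v ∈ Sd j l (Fr j l (H ⊔ Q)) G) *
      (((deg G j : ℝ) - deg G l) ^ 2 * kapF (Fr j l (H ⊔ Q)) j l G)) / (2 * (p * (1 - p)) * n) ^ 2 -
      R * (deg H j - deg H l) / (p * n ^ 2)| ≤
      149 * EA H Q p δ j l + L ^ 29 / r ^ 3 + L ^ 6 * (deg Q j + deg Q l) / n := by
  have b1 := Ex_sq_kapF_near c (a.addAddQ c hjl hv) hjl (Near.add hjl hv) (fam_mono le_sup_left le_sup_left)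
  have b2 := Ex_sq_kapF_near c (a.addAddQ' c hjl hv) hjl (Near.add' hjl hv) (fam_mono le_sup_left le_sup_left)
  have key := Ex_ind_Sd_near (k := k + 1) c a hjl hv b1 b2
  have hEz := Ezk_div_le c a j l
  have hy0 := kk_nonneg H Q j l
  have hy := a.kk_le c j l
  have hhy := hh_le_kk H Q j l
  have hEA := le_EA c H Q j l
  have hR0 := c.R_nonneg a.ne
  have hR := c.R_le a.ne
  change _ ≤ 148 * EA H Q p δ j l + _ + _ at hEz
  set y := kk H Q j l
  have hn := c.n_pos
  have hr := c.r_pos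
  have hL := c.L_pos
  have hδ := c.δ_nonneg
  have hp := c.p_pos
  have hq := c.q_pos
  have hn2 : (n : ℝ) = r ^ 2 := c.r_sq.symm
  have hiΛ := c.inv_Λ_le
  set X := Ex (fam 𝒢 H Q) (fun G => ind (v ∈ Sd j l (Fr j l (H ⊔ Q)) G) *
      (((deg G j : ℝ) - deg G l) ^ 2 * kapF (Fr j l (H ⊔ Q)) j l G))
  set Y := 2 * R * (1 - p) * ((deg H j : ℝ) - deg H l) with hYd
  have hY : |Y| ≤ 2 * δ ^ 2 * y := by
    rw [hYd, abs_mul, abs_of_nonneg (by positivity : 0 ≤ 2 * R * (1 - p))]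
    have h1 : |(deg H j : ℝ) - deg H l| ≤ y := by
      refine le_trans ?_ hhy
      have h1 : (0 : ℝ) ≤ deg H j := Nat.cast_nonneg _
      have h2 : (0 : ℝ) ≤ deg H l := Nat.cast_nonneg _
      rw [abs_le]; constructor <;> linarith
    calc 2 * R * (1 - p) * |(deg H j : ℝ) - deg H l| ≤ 2 * δ ^ 2 * 1 * y := by
          gcongr; linarith
      _ = _ := by ring
  have e1 : X / (2 * (p * (1 - p)) * n) ^ 2 - R * (deg H j - deg H l) / (p * n ^ 2) =
      (X - 2 * (p * (1 - p)) * Y) / (2 * (p * (1 - p)) * n) ^ 2 := by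
    rw [hYd]; field_simp
  rw [e1, abs_div, abs_of_pos (by positivity : 0 < (2 * (p * (1 - p)) * (n : ℝ)) ^ 2)]
  have e2 : (4 * (p * (1 - p)) * Ezk H Q p δ L r j l + 4 * L ^ 4 / r * |Y|) / (2 * (p * (1 - p)) * n) ^ 2 =
      Ezk H Q p δ L r j l / (p * (1 - p) * n ^ 2) + L ^ 4 * (1 / (p * (1 - p))) ^ 2 * |Y| / (r * n ^ 2) := by
    field_simp
    ring
  have t1 : L ^ 4 * (1 / (p * (1 - p))) ^ 2 * |Y| / (r * n ^ 2) ≤ L ^ 9 * δ ^ 2 * y / r ^ 5 := by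
    have m2 : (2 : ℝ) * L ^ 8 ≤ L ^ 9 := c.mul_pow_le (by norm_num) (by norm_num)
    rw [hn2]
    calc L ^ 4 * (1 / (p * (1 - p))) ^ 2 * |Y| / (r * (r ^ 2) ^ 2) ≤
        L ^ 4 * (L ^ 2) ^ 2 * (2 * δ ^ 2 * y) / (r * (r ^ 2) ^ 2) := by gcongr
      _ = (2 * L ^ 8) * (δ ^ 2 * y) / r ^ 5 := by ring
      _ ≤ L ^ 9 * (δ ^ 2 * y) / r ^ 5 := by gcongr
      _ = _ := by ring
  have b3 := c.absorb_sq hy0 9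
  have d1 : L ^ 28 / r ^ 3 + L ^ (2 * 9 + 1) / r ^ 3 ≤ L ^ 29 / r ^ 3 := by
    rw [← add_div]
    gcongr
    have := c.pow_le (show 19 ≤ 28 by norm_num)
    have : 2 * L ^ 28 ≤ L ^ 29 := c.mul_pow_le (by norm_num) (by norm_num)
    norm_num
    linarith
  have key2 : |X - 2 * (p * (1 - p)) * Y| / (2 * (p * (1 - p)) * n) ^ 2 ≤
      (4 * (p * (1 - p)) * Ezk H Q p δ L r j l + 4 * L ^ 4 / r * |Y|) / (2 * (p * (1 - p)) * n) ^ 2 := by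
    gcongr
  rw [e2] at key2
  linarith

/-- The exact effect of planted edges on the degree difference, localised at a switchable vertex. -/
lemma Ex_ind_Sd_div (c : Ctx 𝒢 p δ R L Hm r) (a : Adm 𝒢 L Hm (k + 3) H Q) (hjl : j ≠ l)
    (hv : v ∈ Fr j l (H ⊔ Q)) :
    |Ex (fam 𝒢 H Q) (fun G => ind (v ∈ Sd j l (Fr j l (H ⊔ Q)) G) *
      ((deg G j : ℝ) - deg G l) / (Sd j l (Fr j l (H ⊔ Q)) G).card) -
      R * (deg H j - deg H l) / (p * n ^ 2)| ≤
      153 * EA H Q p δ j l + L ^ 30 / r ^ 3 + L ^ 6 * (deg Q j + deg Q l) / n := by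
  have h1 := Ex_ind_Sd_sq_kapF c a hjl hv
  have hEA := le_EA c H Q j l
  have hy0 := kk_nonneg H Q j l
  have hy := c.y_le (a.kk_le c j l)
  have hsw := fun G hG hg => swap_term_good (G := G) c a hG hg hjl rfl rfl rfl
  set F := Fr j l (H ⊔ Q) with hF
  set y := kk H Q j l
  have hn := c.n_pos
  have hr := c.r_pos
  have hr1 := c.r_ge
  have hL := c.L_pos
  have hδ := c.δ_nonneg
  have hp := c.p_pos
  have hq := c.q_pos
  have hn2 : (n : ℝ) = r ^ 2 := c.r_sq.symm
  have e1 : Ex (fam 𝒢 H Q) (fun G => ind (v ∈ Sd j l F G) * ((deg G j : ℝ) - deg G l) / (Sd j l F G).card) =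
      Ex (fam 𝒢 H Q) (fun G => (ind (v ∈ Sd j l F G) / (Sd j l F G).card) *
        (((deg G j : ℝ) - deg G l) * rho F j l G)) := by
    rw [hF, ← resample_swap' c hjl]
    · exact Ex_congr fun G _ => by ring
    · intro G T hT hc
      have hj : j ∉ T := fun h => left_notMem_Fr j l _ (Sd_subset (hT h))
      have hl : l ∉ T := fun h => right_notMem_Fr j l _ (Sd_subset (hT h))
      simp only [Sd_tog hj hl]
  have e2 : Ex (fam 𝒢 H Q) (fun G => ind (v ∈ Sd j l F G) *
      (((deg G j : ℝ) - deg G l) ^ 2 * kapF F j l G)) / (2 * (p * (1 - p)) * n) ^ 2 =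
      Ex (fam 𝒢 H Q) (fun G => (1 / (2 * (p * (1 - p)) * n) ^ 2) * (ind (v ∈ Sd j l F G) *
      (((deg G j : ℝ) - deg G l) ^ 2 * kapF F j l G))) := by
    rw [Ex_mul]; ring
  have h2 : |Ex (fam 𝒢 H Q) (fun G => (ind (v ∈ Sd j l F G) / (Sd j l F G).card) *
        (((deg G j : ℝ) - deg G l) * rho F j l G) - (1 / (2 * (p * (1 - p)) * n) ^ 2) * (ind (v ∈ Sd j l F G) *
      (((deg G j : ℝ) - deg G l) ^ 2 * kapF F j l G)))| ≤
      (4 * (δ ^ 3 * y ^ 2 / r ^ 6) + L ^ 29 / r ^ 3) + (r ^ 10) / r ^ 20 := by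
    refine abs_Ex_le_good_const c a (fun G hG hg => ?_) (by positivity) (fun G hG => ?_)
    · have h3 := hsw G hG hg
      have h4 := ind_nonneg (v ∈ Sd j l F G)
      have h5 := ind_le_one (v ∈ Sd j l F G)
      set X := ((deg G j : ℝ) - deg G l) * rho F j l G / (Sd j l F G).card -
        ((deg G j : ℝ) - deg G l) ^ 2 * kapF F j l G / (2 * (p * (1 - p)) * n) ^ 2 with hX
      have e3 : (ind (v ∈ Sd j l F G) / (Sd j l F G).card) *
        (((deg G j : ℝ) - deg G l) * rho F j l G) - (1 / (2 * (p * (1 - p)) * n) ^ 2) * (ind (v ∈ Sd j l F G) *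
        (((deg G j : ℝ) - deg G l) ^ 2 * kapF F j l G)) = ind (v ∈ Sd j l F G) * X := by
        rw [hX]; ring
      rw [e3, abs_mul, abs_of_nonneg h4]
      calc ind (v ∈ Sd j l F G) * |X| ≤ 1 * |X| := by gcongr
        _ ≤ _ := by rw [one_mul]; exact h3
    · have hz := c.abs_deg_sub_le (fam_subset hG) j l
      have hκ := abs_kapF_le hjl hG
      have h4 := ind_nonneg (v ∈ Sd j l F G)
      have h5 := ind_le_one (v ∈ Sd j l F G)
      have h6 := abs_rho_le_one F j l G
      rw [← hF] at hκ
      have h7 : |ind (v ∈ Sd j l F G) / (Sd j l F G).card| ≤ 1 := by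
        by_cases hvS : v ∈ Sd j l F G
        · have : (1 : ℝ) ≤ (Sd j l F G).card := by
            exact_mod_cast Finset.card_pos.2 ⟨v, hvS⟩
          rw [abs_of_nonneg (by positivity)]
          rw [div_le_one (by linarith)]; linarith
        · simp [ind, hvS]
      have hi : (1 / (2 * (p * (1 - p)) * n)) ≤ L ^ 2 := by
        have h8 := c.inv_Λn_le
        have h9 : L ^ 2 / n ≤ L ^ 2 := div_le_self (by positivity) (by linarith [c.n_ge])
        refine le_trans ?_ (h8.trans h9)
        apply one_div_le_one_div_of_le (by positivity)
        nlinarith [mul_pos (mul_pos hp hq) hn]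
      set z := (deg G j : ℝ) - deg G l
      set κ := kapF F j l G
      have t1 : |(ind (v ∈ Sd j l F G) / (Sd j l F G).card) * (z * rho F j l G)| ≤ 1 * ((2 * δ) * 1) := by
        rw [abs_mul, abs_mul]; gcongr
      have t2 : |(1 / (2 * (p * (1 - p)) * n) ^ 2) * (ind (v ∈ Sd j l F G) * (z ^ 2 * κ))| ≤
          (L ^ 2) ^ 2 * (1 * ((2 * δ) ^ 2 * y)) := by
        rw [abs_mul, abs_mul, abs_mul, abs_pow, abs_of_nonneg h4, abs_of_nonneg (by positivity),
          ← one_div_pow]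
        gcongr
      refine (abs_sub _ _).trans ((add_le_add t1 t2).trans ?_)
      have hδ1 := c.δ_le
      have hLr : L ≤ r := c.L_le_r
      have hL4 : L ^ 4 ≤ r := c.Lpow_le (by norm_num)
      calc 1 * ((2 * δ) * 1) + (L ^ 2) ^ 2 * (1 * ((2 * δ) ^ 2 * y)) =
          2 * δ + L ^ 4 * (4 * δ ^ 2 * y) := by ring
        _ ≤ 2 * (r * r) + r * (4 * (r * r) ^ 2 * (4 * (r * r))) := by
          have : δ ≤ r * r := hδ1.trans (by gcongr)
          have : y ≤ 4 * (r * r) := hy.trans (by gcongr)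
          gcongr
        _ = 2 * r ^ 2 + 16 * r ^ 7 := by ring
        _ ≤ r ^ 10 := by
          have h1 : r ^ 2 ≤ r ^ 9 := pow_le_pow_right₀ (by linarith) (by norm_num)
          have h2 : r ^ 7 ≤ r ^ 9 := pow_le_pow_right₀ (by linarith) (by norm_num)
          have h3 : r ^ 10 = r * r ^ 9 := by ring
          have h4 : 0 < r ^ 9 := by positivity
          nlinarith
  rw [Ex_sub, ← e1, ← e2] at h2
  have h3 : (r ^ 10) / r ^ 20 ≤ L ^ 29 / r ^ 3 := by
    rw [div_le_div_iff₀ (by positivity) (by positivity)]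
    calc r ^ 10 * r ^ 3 = 1 * r ^ 13 := by ring
      _ ≤ L ^ 29 * r ^ 20 := by
        gcongr
        · exact one_le_pow₀ c.one_le_L
        · linarith
        · norm_num
  have d1 : L ^ 29 / r ^ 3 + L ^ 29 / r ^ 3 + L ^ 29 / r ^ 3 ≤ L ^ 30 / r ^ 3 := by
    rw [← add_div, ← add_div]
    gcongr
    have : 3 * L ^ 29 ≤ L ^ 30 := c.mul_pow_le (by norm_num) (by norm_num)
    linarith
  have := abs_sub_le (Ex (fam 𝒢 H Q) (fun G => ind (v ∈ Sd j l F G) * ((deg G j : ℝ) - deg G l) / (Sd j l F G).card))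
    (Ex (fam 𝒢 H Q) (fun G => ind (v ∈ Sd j l F G) *
      (((deg G j : ℝ) - deg G l) ^ 2 * kapF F j l G)) / (2 * (p * (1 - p)) * n) ^ 2)
    (R * (deg H j - deg H l) / (p * n ^ 2))
  linarith

end L10

section L10
variable {n : ℕ} {𝒢 : Finset (SimpleGraph (Fin n))} {p δ R L Hm r : ℝ} {k : ℕ}
  {H Q H₀ Q₀ G : SimpleGraph (Fin n)} {j l v : Fin n}

lemma sum_ind_Sd (j l : Fin n) (F : Finset (Fin n)) (G : SimpleGraph (Fin n)) :
    ∑ v ∈ F, ind (v ∈ Sd j l F G) = (Sd j l F G).card := by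
  rw [Finset.card_eq_sum_ones, ← Finset.sum_subset (Sd_subset (j := j) (l := l) (F := F) (G := G))
    (fun w _ h => by simp [ind, h])]
  push_cast
  exact Finset.sum_congr rfl (fun w h => by simp [ind, h])

lemma Ex_deg_sub_local (c : Ctx 𝒢 p δ R L Hm r) (a : Adm 𝒢 L Hm k H Q) (hjl : j ≠ l) :
    |Ex (fam 𝒢 H Q) (fun G => (deg G j : ℝ) - deg G l) -
      ∑ v ∈ Fr j l (H ⊔ Q), Ex (fam 𝒢 H Q) (fun G => ind (v ∈ Sd j l (Fr j l (H ⊔ Q)) G) *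
        ((deg G j : ℝ) - deg G l) / (Sd j l (Fr j l (H ⊔ Q)) G).card)| ≤ 2 * δ / r ^ 20 := by
  have hFr := card_compl_Fr_le_Hm c a j l
  set F := Fr j l (H ⊔ Q) with hF
  have hs : ∀ G, (∑ v ∈ F, ind (v ∈ Sd j l F G) * ((deg G j : ℝ) - deg G l) / (Sd j l F G).card) =
      ((Sd j l F G).card : ℝ) * (((deg G j : ℝ) - deg G l) / (Sd j l F G).card) := by
    intro G
    simp only [mul_div_assoc]
    rw [← Finset.sum_mul, sum_ind_Sd]
  rw [← Ex_sum, ← Ex_sub, ← zero_add (2 * δ / r ^ 20)]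
  refine abs_Ex_le_good_const c a (fun G hG hg => ?_) le_rfl (fun G hG => ?_)
  · have h4 := hg.sd_ge c (fam_subset hG) hjl hFr
    have h5 : 0 < ((Sd j l F G).card : ℝ) :=
      lt_of_lt_of_le (mul_pos (mul_pos c.p_pos c.q_pos) c.n_pos) h4
    rw [hs, mul_div_cancel₀ _ h5.ne']
    simp
  · have hz := c.abs_deg_sub_le (fam_subset hG) j l
    rw [hs]
    rcases eq_or_ne ((Sd j l F G).card : ℝ) 0 with h | h
    · rw [h, zero_mul, sub_zero]; exact hz
    · rw [mul_div_cancel₀ _ h, sub_self, abs_zero]; linarith [c.δ_nonneg]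

/-- The effect of planted edges on the expected degree difference. -/
lemma Ex_deg_sub (c : Ctx 𝒢 p δ R L Hm r) (a : Adm 𝒢 L Hm (k + 3) H Q) (hjl : j ≠ l) :
    |Ex (fam 𝒢 H Q) (fun G => (deg G j : ℝ) - deg G l) - R * (deg H j - deg H l) / (p * n)| ≤
      n * (155 * EA H Q p δ j l + L ^ 31 / r ^ 3 + L ^ 6 * (deg Q j + deg Q l) / n) := by
  have h1 := Ex_deg_sub_local c a hjl
  have hv := fun v hv => Ex_ind_Sd_div (v := v) c a hjl hv
  have hFr := card_compl_Fr_le_Hm c a j l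
  have hFr2 := card_compl_Fr_le (H := H) (Q := Q) j l
  have hy0 := kk_nonneg H Q j l
  have hy := a.kk_le c j l
  have hhy := hh_le_kk H Q j l
  have hEA := le_EA c H Q j l
  have hEA0 := EA_nonneg c H Q j l
  have hR0 := c.R_nonneg a.ne
  have hR := c.R_le a.ne
  have hkk : kk H Q j l = (deg H j + deg H l) + (deg Q j + deg Q l) := rfl
  set F := Fr j l (H ⊔ Q) with hF
  set y := kk H Q j l
  have hn := c.n_pos
  have hr := c.r_pos
  have hr1 := c.r_ge
  have hL := c.L_pos
  have hL1 := c.L_ge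
  have hδ := c.δ_nonneg
  have hp := c.p_pos
  have hq := c.q_pos
  have hn2 : (n : ℝ) = r ^ 2 := c.r_sq.symm
  set Y := R * ((deg H j : ℝ) - deg H l) / (p * n ^ 2) with hY
  set e := 153 * EA H Q p δ j l + L ^ 30 / r ^ 3 + L ^ 6 * (deg Q j + deg Q l) / n with he
  have he0 : 0 ≤ e := by positivity
  have h2 : |∑ v ∈ F, Ex (fam 𝒢 H Q) (fun G => ind (v ∈ Sd j l F G) * ((deg G j : ℝ) - deg G l) /
      (Sd j l F G).card) - (F.card : ℝ) * Y| ≤ n * e := by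
    rw [← nsmul_eq_mul, ← Finset.sum_const, ← Finset.sum_sub_distrib]
    refine (Finset.abs_sum_le_sum_abs _ _).trans ((Finset.sum_le_sum hv).trans ?_)
    rw [Finset.sum_const, nsmul_eq_mul]
    gcongr
    simpa using F.card_le_univ
  have hFc : (F.card : ℝ) = n - (Fᶜ.card : ℝ) := by
    have := F.card_add_card_compl
    rw [Fintype.card_fin] at this
    rw [eq_sub_iff_add_eq]; exact_mod_cast this
  have hYb : |Y| ≤ L * δ ^ 2 * y / r ^ 4 := by
    have h3 : |(deg H j : ℝ) - deg H l| ≤ y := by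
      refine le_trans ?_ hhy
      have h1 : (0 : ℝ) ≤ deg H j := Nat.cast_nonneg _
      have h2 : (0 : ℝ) ≤ deg H l := Nat.cast_nonneg _
      rw [abs_le]; constructor <;> linarith
    rw [hY, abs_div, abs_mul, abs_of_nonneg hR0, abs_of_pos (by positivity : 0 < p * (n : ℝ) ^ 2)]
    calc R * |(deg H j : ℝ) - deg H l| / (p * n ^ 2) ≤ δ ^ 2 * y / (p * n ^ 2) := by gcongr
      _ = (1 / p) * (δ ^ 2 * y) / (r ^ 2) ^ 2 := by rw [hn2]; field_simp
      _ ≤ L * (δ ^ 2 * y) / (r ^ 2) ^ 2 := by gcongr; exact c.inv_p_le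
      _ = _ := by ring
  have h3 : |(F.card : ℝ) * Y - n * Y| ≤ n * (2 * EA H Q p δ j l + L ^ 8 / r ^ 3) := by
    rw [hFc, ← sub_mul, abs_mul, sub_sub_cancel_left, abs_neg, Nat.abs_cast]
    have b1 := c.absorb_sq_sq hy0 hy 1
    have b2 := c.absorb_sq hy0 2
    have b3 : L ^ (3 * 1 + 4) / r ^ 3 + L ^ (2 * 2 + 1) / r ^ 3 ≤ L ^ 8 / r ^ 3 := by
      rw [← add_div]
      gcongr
      have := c.pow_le (show 5 ≤ 7 by norm_num)
      have : 2 * L ^ 7 ≤ L ^ 8 := c.mul_pow_le (by norm_num) (by norm_num)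
      norm_num
      linarith
    calc (Fᶜ.card : ℝ) * |Y| ≤ (2 + y) * (L * δ ^ 2 * y / r ^ 4) := by
          gcongr; rw [hkk]; linarith
      _ = r ^ 2 * (L ^ 1 * δ ^ 2 * y ^ 2 / r ^ 6 + 2 * L * (1 / r) * (δ ^ 2 * y / r ^ 5)) := by
          field_simp
          ring
      _ ≤ r ^ 2 * (L ^ 1 * δ ^ 2 * y ^ 2 / r ^ 6 + L ^ 2 * (δ ^ 2 * y / r ^ 5)) := by
          gcongr
          have : 1 / r ≤ 1 := by rw [div_le_one hr]; linarith
          calc 2 * L * (1 / r) ≤ 2 * L * 1 := by gcongr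
            _ ≤ L ^ 2 := by nlinarith
      _ = r ^ 2 * (L ^ 1 * δ ^ 2 * y ^ 2 / r ^ 6 + L ^ 2 * δ ^ 2 * y / r ^ 5) := by ring
      _ ≤ n * (2 * EA H Q p δ j l + L ^ 8 / r ^ 3) := by
          rw [← hn2]; exact mul_le_mul_of_nonneg_left (by linarith) hn.le
  have e1 : R * ((deg H j : ℝ) - deg H l) / (p * n) = n * Y := by
    rw [hY]; field_simp
  have h4 : 2 * δ / r ^ 20 ≤ n * (L ^ 8 / r ^ 3) := by
    rw [hn2]
    have h5 := c.δ_le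
    have h6 : L ^ 1 ≤ L ^ 8 := c.pow_le (by norm_num)
    have e2 : r ^ 2 * (L ^ 8 / r ^ 3) = L ^ 8 * r ^ 19 / r ^ 20 := by field_simp
    rw [e2]
    refine div_le_div_of_nonneg_right ?_ (by positivity)
    have h7 : r ^ 2 ≤ r ^ 19 := pow_le_pow_right₀ (by linarith) (by norm_num)
    calc 2 * δ ≤ 2 * (L * r) := by gcongr
      _ = L ^ 1 * (2 * r) := by ring
      _ ≤ L ^ 8 * r ^ 19 := by gcongr; nlinarith
  rw [e1]
  have d1 : L ^ 30 / r ^ 3 + L ^ 8 / r ^ 3 + L ^ 8 / r ^ 3 ≤ L ^ 31 / r ^ 3 := by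
    rw [← add_div, ← add_div]
    gcongr
    have := c.pow_le (show 8 ≤ 30 by norm_num)
    have : 3 * L ^ 30 ≤ L ^ 31 := c.mul_pow_le (by norm_num) (by norm_num)
    linarith
  have d2 := mul_le_mul_of_nonneg_left d1 hn.le
  have := abs_sub_le (Ex (fam 𝒢 H Q) (fun G => (deg G j : ℝ) - deg G l))
    (∑ v ∈ F, Ex (fam 𝒢 H Q) (fun G => ind (v ∈ Sd j l F G) * ((deg G j : ℝ) - deg G l) /
      (Sd j l F G).card)) (n * Y)
  have := abs_sub_le (∑ v ∈ F, Ex (fam 𝒢 H Q) (fun G => ind (v ∈ Sd j l F G) * ((deg G j : ℝ) - deg G l) /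
      (Sd j l F G).card)) (F.card * Y) (n * Y)
  have e5 : n * (155 * EA H Q p δ j l + L ^ 31 / r ^ 3 + L ^ 6 * (deg Q j + deg Q l) / n) =
    n * e + n * (2 * EA H Q p δ j l) + n * (L ^ 31 / r ^ 3) - n * (L ^ 30 / r ^ 3) := by rw [he]; ring
  rw [e5]
  linarith

end L10

/-- A truncated reciprocal of the number of swappable vertices. -/
noncomputable def wt {n : ℕ} (L : ℝ) (j l : Fin n) (F : Finset (Fin n)) (G : SimpleGraph (Fin n)) : ℝ :=
  min (1 / ((Sd j l F G).card : ℝ)) (L ^ 2 / n)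

section FirstOrder
variable {n : ℕ} {𝒢 : Finset (SimpleGraph (Fin n))} {p δ R L Hm r : ℝ} {k : ℕ}
  {H Q H₀ Q₀ G : SimpleGraph (Fin n)} {j l v : Fin n}

lemma wt_nonneg (c : Ctx 𝒢 p δ R L Hm r) (j l : Fin n) (F : Finset (Fin n)) (G : SimpleGraph (Fin n)) :
    0 ≤ wt L j l F G :=
  le_min (by positivity) (by have := c.n_pos; positivity)

lemma wt_le (L : ℝ) (j l : Fin n) (F : Finset (Fin n)) (G : SimpleGraph (Fin n)) :
    wt L j l F G ≤ L ^ 2 / n := min_le_right _ _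

lemma inv_card_le_one (s : ℕ) : 1 / (s : ℝ) ≤ 1 := by
  rcases Nat.eq_zero_or_pos s with h | h
  · simp [h]
  · have : (1 : ℝ) ≤ s := by exact_mod_cast h
    rw [div_le_one (by linarith)]; exact this

lemma wt_le_one (L : ℝ) (j l : Fin n) (F : Finset (Fin n)) (G : SimpleGraph (Fin n)) :
    wt L j l F G ≤ 1 := (min_le_left _ _).trans (inv_card_le_one _)

lemma Good.wt_eq (c : Ctx 𝒢 p δ R L Hm r) (hG : G ∈ 𝒢) (hg : Good p L r G)
    (hjl : j ≠ l) {F : Finset (Fin n)} (hF : (Fᶜ.card : ℝ) ≤ 5 * Hm) :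
    wt L j l F G = 1 / ((Sd j l F G).card : ℝ) :=
  min_eq_left (hg.inv_sd_le c hG hjl hF)

lemma Ctx.s1_inv_le (c : Ctx 𝒢 p δ R L Hm r) : 1 / (2 * (p * (1 - p)) * n) ≤ L ^ 2 / n := by
  have hp := c.p_pos
  have hq := c.q_pos
  have hn := c.n_pos
  have hΛ := mul_pos hp hq
  refine le_trans ?_ c.inv_Λn_le
  exact one_div_le_one_div_of_le (by positivity) (by nlinarith [mul_pos hΛ hn])

lemma Ex_wt_near (c : Ctx 𝒢 p δ R L Hm r) (a : Adm 𝒢 L Hm k H₀ Q₀)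
    (hjl : j ≠ l) {F : Finset (Fin n)} (hF : (Fᶜ.card : ℝ) ≤ 5 * Hm) :
    |Ex (fam 𝒢 H₀ Q₀) (wt L j l F) - 1 / (2 * (p * (1 - p)) * n)| ≤ L ^ 8 / r ^ 3 := by
  have hr := c.r_pos
  have hL := c.L_pos
  have hL1 := c.L_ge
  have hr1 := c.r_ge
  have hn := c.n_pos
  have h1 := abs_Ex_le_good_const c a (f := fun G => wt L j l F G - 1 / (2 * (p * (1 - p)) * n))
    (g := L ^ 7 / r ^ 3) (B := 1) (fun G hG hg => by
      rw [hg.wt_eq c (fam_subset hG) hjl hF]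
      exact hg.inv_sd_sub c (fam_subset hG) hjl hF) (by positivity) (fun G hG => by
      have h2 := c.s1_inv_le
      have h3 : L ^ 2 / (n : ℝ) ≤ 1 := by
        rw [← c.r_sq, div_le_one (by positivity)]
        have := c.L_le_r
        gcongr
      have h4 := wt_nonneg c j l F G
      have h5 := wt_le_one L j l F G
      have h6 : 0 ≤ 1 / (2 * (p * (1 - p)) * n) := by
        have := c.p_pos; have := c.q_pos; positivity
      rw [abs_le]; constructor <;> linarith)
  rw [Ex_sub, Ex_const a.nonempty] at h1
  refine h1.trans ?_
  have h2 : 1 / r ^ 20 ≤ 1 / r ^ 3 := one_div_le_one_div_of_le (by positivity)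
    (pow_le_pow_right₀ (by linarith) (by norm_num))
  calc L ^ 7 / r ^ 3 + 1 / r ^ 20 ≤ L ^ 7 / r ^ 3 + 1 / r ^ 3 := by linarith
    _ = (L ^ 7 + 1) / r ^ 3 := by ring
    _ ≤ L ^ 8 / r ^ 3 := by
      gcongr
      have : 2 * L ^ 7 ≤ L ^ 8 := c.mul_pow_le (by norm_num) (by norm_num)
      have : 1 ≤ L ^ 7 := one_le_pow₀ c.one_le_L
      linarith

lemma Ex_ind_wt_near (c : Ctx 𝒢 p δ R L Hm r) (a : Adm 𝒢 L Hm (k + 2) H Q) (hjl : j ≠ l)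
    (hv : v ∈ Fr j l (H ⊔ Q)) :
    |Ex (fam 𝒢 H Q) (fun G => ind (v ∈ Sd j l (Fr j l (H ⊔ Q)) G) * wt L j l (Fr j l (H ⊔ Q)) G) -
      1 / n| ≤ L ^ 9 / r ^ 3 := by
  have hF := card_compl_Fr_le_Hm c a j l
  have h1 := Ex_wt_near c (a.addAddQ c hjl hv) hjl hF
  have h2 := Ex_wt_near c (a.addAddQ' c hjl hv) hjl hF
  have h3 := Ex_ind_Sd_near c a hjl hv h1 h2
  have hp := c.p_pos
  have hq := c.q_pos
  have hn := c.n_pos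
  have hr := c.r_pos
  have hL := c.L_pos
  have hΛ := mul_pos hp hq
  have hΛ1 := c.Λ_lt
  have e1 : 2 * (p * (1 - p)) * (1 / (2 * (p * (1 - p)) * n)) = 1 / n := by field_simp
  rw [e1] at h3
  refine h3.trans ?_
  have h4 : |1 / (2 * (p * (1 - p)) * (n : ℝ))| ≤ L ^ 2 / n := by
    rw [abs_of_nonneg (by positivity)]; exact c.s1_inv_le
  calc 4 * (p * (1 - p)) * (L ^ 8 / r ^ 3) + 4 * L ^ 4 / r * |1 / (2 * (p * (1 - p)) * (n : ℝ))|
      ≤ 4 * 1 * (L ^ 8 / r ^ 3) + 4 * L ^ 4 / r * (L ^ 2 / n) := by gcongr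
    _ = (4 * L ^ 8 + 4 * L ^ 6) / r ^ 3 := by rw [← c.r_sq]; field_simp
    _ ≤ L ^ 9 / r ^ 3 := by
      gcongr
      have : 8 * L ^ 8 ≤ L ^ 9 := c.mul_pow_le (by norm_num) (by norm_num)
      have := c.pow_le (show 6 ≤ 8 by norm_num)
      linarith

lemma Fr_sup_edge_eq {w : Fin n} {U : SimpleGraph (Fin n)} (hw : w ∉ Fr j l U) (hwl : w ≠ l) (hjl : j ≠ l) :
    Fr j l (U ⊔ SimpleGraph.edge l w) = Fr j l U := by
  ext u
  simp only [mem_Fr, sup_edge_adj_iff hwl.symm] at hw ⊢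
  constructor
  · rintro ⟨h1, h2, h3, h4⟩
    exact ⟨h1, h2, fun h => h3 (Or.inl h), fun h => h4 (Or.inl h)⟩
  · rintro ⟨h1, h2, h3, h4⟩
    refine ⟨h1, h2, ?_, ?_⟩
    · rintro (h | h | h)
      · exact h3 h
      · exact hjl h.1
      · exact h2 h.2
    · rintro (h | h | h)
      · exact h4 h
      · exact hw (h.2 ▸ ⟨h1, h2, h3, h4⟩)
      · exact h2 h.2

lemma Ex_nad_ind_wt_near (c : Ctx 𝒢 p δ R L Hm r) (a : Adm 𝒢 L Hm (k + 3) H Q) (hjl : j ≠ l)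
    (hv : v ∈ Fr j l (H ⊔ Q)) {w : Fin n} (hw : w ∉ Fr j l (H ⊔ Q)) (hwl : w ≠ l)
    (hH : ¬ H.Adj l w) (hQ : ¬ Q.Adj l w) :
    |Ex (fam 𝒢 H Q) (fun G => (1 - ad G l w) *
      (ind (v ∈ Sd j l (Fr j l (H ⊔ Q)) G) * wt L j l (Fr j l (H ⊔ Q)) G)) -
      (1 - p) / n| ≤ L ^ 10 / r ^ 3 := by
  have e1 : Fr j l (H ⊔ (Q ⊔ SimpleGraph.edge l w)) = Fr j l (H ⊔ Q) := by
    rw [← sup_assoc]; exact Fr_sup_edge_eq hw hwl hjl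
  have a' : Adm 𝒢 L Hm (k + 2) H (Q ⊔ SimpleGraph.edge l w) := Adm.addQ c a hwl.symm hH hQ
  have h1 := Ex_ind_wt_near c a' hjl (e1 ▸ hv)
  rw [e1] at h1
  have h2 := pr_crude c a hwl.symm hH hQ
  rw [Ex_nad_mul' a hwl.symm]
  set x := Ex (fam 𝒢 H (Q ⊔ SimpleGraph.edge l w)) (fun G => ind (v ∈ Sd j l (Fr j l (H ⊔ Q)) G) *
    wt L j l (Fr j l (H ⊔ Q)) G)
  set y := pr 𝒢 H Q l w
  have hy : |1 - y| ≤ 1 := by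
    rw [abs_le]; constructor <;> linarith [pr_nonneg (𝒢 := 𝒢) (H := H) (Q := Q) l w,
      pr_le_one (𝒢 := 𝒢) a.nonempty l w]
  have hn := c.n_pos
  have hr := c.r_pos
  have hL := c.L_pos
  have e2 : (1 - y) * x - (1 - p) / n = (1 - y) * (x - 1 / n) - (y - p) * (1 / n) := by ring
  rw [e2]
  calc |(1 - y) * (x - 1 / n) - (y - p) * (1 / n)| ≤ |1 - y| * |x - 1 / n| + |y - p| * |1 / (n : ℝ)| := by
        rw [← abs_mul, ← abs_mul]; exact abs_sub _ _
    _ ≤ 1 * (L ^ 9 / r ^ 3) + L ^ 4 / r * (1 / n) := by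
        rw [abs_of_pos (by positivity : (0:ℝ) < 1 / n)]
        gcongr
    _ = (L ^ 9 + L ^ 4) / r ^ 3 := by rw [← c.r_sq]; field_simp
    _ ≤ L ^ 10 / r ^ 3 := by
      gcongr
      have : 2 * L ^ 9 ≤ L ^ 10 := c.mul_pow_le (by norm_num) (by norm_num)
      have := c.pow_le (show 4 ≤ 9 by norm_num)
      linarith

lemma Sd_comm (j l : Fin n) (F : Finset (Fin n)) (G : SimpleGraph (Fin n)) : Sd j l F G = Sd l j F G := by
  unfold Sd
  refine Finset.filter_congr fun u _ => ?_
  tauto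

lemma wt_comm (L : ℝ) (j l : Fin n) (F : Finset (Fin n)) (G : SimpleGraph (Fin n)) :
    wt L j l F G = wt L l j F G := by
  unfold wt
  rw [Sd_comm]

lemma Ex_kap_wt_near (c : Ctx 𝒢 p δ R L Hm r) (a : Adm 𝒢 L Hm (k + 3) H Q) (hjl : j ≠ l)
    (hv : v ∈ Fr j l (H ⊔ Q)) :
    |Ex (fam 𝒢 H Q) (fun G => kap H j l G *
      (ind (v ∈ Sd j l (Fr j l (H ⊔ Q)) G) * wt L j l (Fr j l (H ⊔ Q)) G)) -
      (1 - p) * (deg H j - deg H l) / n| ≤ L ^ 13 / n := by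
  have hn := c.n_pos
  have hr := c.r_pos
  have hL := c.L_pos
  have hL1 := c.L_ge
  have hp := c.p_pos
  have hq := c.q_pos
  have hB : |(1 - p) / (n : ℝ)| ≤ L ^ 2 / n := by
    rw [abs_of_pos (by positivity)]
    gcongr
    nlinarith
  have key := Ex_kap_near (K := fam 𝒢 H Q) (H := H) (Q := Q)
    (f := fun G => ind (v ∈ Sd j l (Fr j l (H ⊔ Q)) G) * wt L j l (Fr j l (H ⊔ Q)) G)
    (y := fun _ => (1 - p) / n) (y' := fun _ => (1 - p) / n) (e := L ^ 10 / r ^ 3) (B := L ^ 2 / n) (d := 0)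
    hjl a.nonempty (by positivity) le_rfl
    (fun G hG u w h => (mem_fam.1 hG).2.1 u w h)
    (fun w h1 h2 h3 h4 => Ex_nad_ind_wt_near c a hjl hv
      (fun h => (mem_Fr.1 h).2.2.1 (Or.inl h1)) h2 h3 h4)
    (fun w h1 h2 h3 h4 => by
      have := Ex_nad_ind_wt_near c a hjl.symm (Fr_comm _ _ _ ▸ hv) (w := w)
        (fun h => (mem_Fr.1 h).2.2.1 (Or.inl h1)) h2 h3 h4
      rw [Fr_comm l j] at this
      simpa only [Sd_comm l j, wt_comm L l j] using this)
    (fun G _ => by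
      have h1 := wt_nonneg c j l (Fr j l (H ⊔ Q)) G
      rw [abs_of_nonneg (mul_nonneg (ind_nonneg _) h1)]
      calc _ ≤ 1 * wt L j l (Fr j l (H ⊔ Q)) G := by gcongr; exact ind_le_one _
        _ ≤ _ := by rw [one_mul]; exact wt_le _ _ _ _ _)
    (fun _ => hB) (fun _ => hB) (fun _ _ _ => by simp) (fun _ => by simp)
  rw [← Finset.sum_mul, ← Finset.sum_mul, ← deg_eq_sum, ← deg_eq_sum] at key
  have e1 : (deg H j : ℝ) * ((1 - p) / n) - deg H l * ((1 - p) / n) = (1 - p) * (deg H j - deg H l) / n := by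
    ring
  rw [e1] at key
  refine key.trans ?_
  have h1 := a.deg_le_Hm j
  have h2 := a.deg_le_Hm l
  have h3 := a.degQ_le_20 j
  have h4 := a.degQ_le_20 l
  have h5 := c.Hm_le
  calc (deg H j + deg H l) * (L ^ 10 / r ^ 3) + 2 * (L ^ 2 / n) * (deg Q j + deg Q l) +
        0 * (cod H j l + ad H j l)
      ≤ (L * r + L * r) * (L ^ 10 / r ^ 3) + 2 * (L ^ 2 / n) * (20 + 20) + 0 := by
        rw [zero_mul]; gcongr <;> linarith
    _ = (2 * L ^ 11 + 80 * L ^ 2) / n := by rw [← c.r_sq]; field_simp; ring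
    _ ≤ L ^ 13 / n := by
      gcongr
      have : 82 * L ^ 11 ≤ L ^ 13 := c.mul_pow_le (by norm_num) (by norm_num)
      have := c.pow_le (show 2 ≤ 11 by norm_num)
      linarith

lemma Ctx.Hm_lt_n (c : Ctx 𝒢 p δ R L Hm r) : Hm ≤ r ^ 2 := by
  have := c.Hm_le
  have := c.L_le_r
  have := c.r_pos
  nlinarith

lemma Ex_kapF_wt_sub (c : Ctx 𝒢 p δ R L Hm r) (a : Adm 𝒢 L Hm k H Q) (hjl : j ≠ l) (v : Fin n) :
    |Ex (fam 𝒢 H Q) (fun G => ind (v ∈ Sd j l (Fr j l (H ⊔ Q)) G) *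
        kapF (Fr j l (H ⊔ Q)) j l G / (Sd j l (Fr j l (H ⊔ Q)) G).card) -
      Ex (fam 𝒢 H Q) (fun G => kap H j l G *
      (ind (v ∈ Sd j l (Fr j l (H ⊔ Q)) G) * wt L j l (Fr j l (H ⊔ Q)) G))| ≤
      L ^ 2 / n * (deg Q j + deg Q l) + 1 / r ^ 10 := by
  have hF := card_compl_Fr_le_Hm c a j l
  have hy := a.kk_le c j l
  have hy0 := kk_nonneg H Q j l
  have hn := c.n_pos
  have hr := c.r_pos
  have hL := c.L_pos
  set F := Fr j l (H ⊔ Q) with hFd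
  rw [← Ex_sub]
  have h1 := abs_Ex_le_good_const c a (f := fun G => ind (v ∈ Sd j l F G) *
        kapF F j l G / (Sd j l F G).card - kap H j l G * (ind (v ∈ Sd j l F G) * wt L j l F G))
    (g := L ^ 2 / n * (deg Q j + deg Q l)) (B := kk H Q j l + (kk H Q j l + (deg Q j + deg Q l)))
    (fun G hG hg => by
      have h1 := hg.wt_eq c (fam_subset hG) hjl hF
      have e1 : ind (v ∈ Sd j l F G) * kapF F j l G / (Sd j l F G).card -
        kap H j l G * (ind (v ∈ Sd j l F G) * wt L j l F G) =
          ind (v ∈ Sd j l F G) * wt L j l F G * (kapF F j l G - kap H j l G) := by rw [h1]; ring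
      rw [e1, abs_mul, abs_of_nonneg (mul_nonneg (ind_nonneg _) (wt_nonneg c j l F G))]
      refine mul_le_mul ?_ (abs_kapF_sub_kap_le hjl hG) (abs_nonneg _) (by positivity)
      calc _ ≤ 1 * wt L j l F G := by
            gcongr
            · exact wt_nonneg c j l F G
            · exact ind_le_one _
        _ ≤ _ := by rw [one_mul]; exact wt_le _ _ _ _ _) (by positivity) (fun G hG => by
      have h2 := abs_kapF_le hjl hG
      have h3 := abs_kapF_sub_kap_le hjl hG
      rw [← hFd] at h2 h3
      have h4 : |kap H j l G| ≤ kk H Q j l + (deg Q j + deg Q l) := by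
        rw [abs_le] at *
        constructor <;> linarith [h2.1, h2.2, h3.1, h3.2]
      refine (abs_sub _ _).trans (add_le_add ?_ ?_)
      · rw [mul_div_assoc, abs_mul, abs_of_nonneg (ind_nonneg _), abs_div, Nat.abs_cast]
        calc ind (v ∈ Sd j l F G) * (|kapF F j l G| / (Sd j l F G).card)
            ≤ 1 * (kk H Q j l * (1 / (Sd j l F G).card)) := by
              rw [mul_one_div]
              gcongr
              exact ind_le_one _
          _ ≤ 1 * (kk H Q j l * 1) := by gcongr; exact inv_card_le_one _
          _ = _ := by ring
      · rw [abs_mul, abs_of_nonneg (mul_nonneg (ind_nonneg _) (wt_nonneg c j l F G))]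
        calc |kap H j l G| * (ind (v ∈ Sd j l F G) * wt L j l F G)
            ≤ (kk H Q j l + (deg Q j + deg Q l)) * (1 * 1) := by
              gcongr
              · exact mul_nonneg (ind_nonneg _) (wt_nonneg c j l F G)
              · exact wt_nonneg c j l F G
              · exact ind_le_one _
              · exact wt_le_one _ _ _ _ _
          _ = _ := by ring)
  refine h1.trans (add_le_add le_rfl ?_)
  have h3 := a.degQ_le_20 j
  have h4 := a.degQ_le_20 l
  have h5 := c.Hm_lt_n
  have h6 := c.Hm_ge
  have h7 := c.r_ge
  rw [div_le_div_iff₀ (by positivity) (by positivity)]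
  have h8 : kk H Q j l + (kk H Q j l + (deg Q j + deg Q l)) ≤ r ^ 10 := by
    calc _ ≤ 10 * r ^ 2 := by linarith
      _ ≤ r ^ 3 := by nlinarith [sq_nonneg r]
      _ ≤ r ^ 10 := pow_le_pow_right₀ (by linarith) (by norm_num)
  calc _ ≤ r ^ 10 * r ^ 10 := by gcongr
    _ = _ := by ring

lemma Ex_ind_kapF_div (c : Ctx 𝒢 p δ R L Hm r) (a : Adm 𝒢 L Hm (k + 3) H Q) (hjl : j ≠ l)
    (hv : v ∈ Fr j l (H ⊔ Q)) :
    |Ex (fam 𝒢 H Q) (fun G => ind (v ∈ Sd j l (Fr j l (H ⊔ Q)) G) *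
        kapF (Fr j l (H ⊔ Q)) j l G / (Sd j l (Fr j l (H ⊔ Q)) G).card) -
      (1 - p) * (deg H j - deg H l) / n| ≤ L ^ 14 / n := by
  have h1 := Ex_kapF_wt_sub c a hjl v
  have h2 := Ex_kap_wt_near c a hjl hv
  refine (abs_sub_le _ _ _).trans ((add_le_add h1 h2).trans ?_)
  have h3 := a.degQ_le_20 j
  have h4 := a.degQ_le_20 l
  have hn := c.n_pos
  have hr := c.r_pos
  have hL := c.L_pos
  have h5 := c.one_le_L
  have h6 := c.r_ge
  have h7 : 1 / r ^ 10 ≤ 1 / n := by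
    rw [← c.r_sq]
    gcongr
    · linarith
    · norm_num
  calc L ^ 2 / n * (deg Q j + deg Q l) + 1 / r ^ 10 + L ^ 13 / n
      ≤ L ^ 2 / n * (20 + 20) + 1 / n + L ^ 13 / n := by gcongr
    _ = (40 * L ^ 2 + 1 + L ^ 13) / n := by ring
    _ ≤ L ^ 14 / n := by
      gcongr
      have : 42 * L ^ 13 ≤ L ^ 14 := c.mul_pow_le (by norm_num) (by norm_num)
      have := c.pow_le (show 2 ≤ 13 by norm_num)
      have : 1 ≤ L ^ 13 := one_le_pow₀ h5
      linarith

lemma pr_sub_pr' (c : Ctx 𝒢 p δ R L Hm r) (hjl : j ≠ l) (hv : v ∈ Fr j l (H ⊔ Q)) :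
    pr 𝒢 H Q j v - pr 𝒢 H Q l v =
      Ex (fam 𝒢 H Q) (fun G => ind (v ∈ Sd j l (Fr j l (H ⊔ Q)) G) *
        ((deg G j : ℝ) - deg G l) / (Sd j l (Fr j l (H ⊔ Q)) G).card) -
      Ex (fam 𝒢 H Q) (fun G => ind (v ∈ Sd j l (Fr j l (H ⊔ Q)) G) *
        kapF (Fr j l (H ⊔ Q)) j l G / (Sd j l (Fr j l (H ⊔ Q)) G).card) := by
  rw [pr_sub_pr c hjl hv, ← Ex_sub]
  refine Ex_congr fun G _ => ?_
  rw [two_card_Xd_sub_eq_kapF]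
  ring

end FirstOrder

/-- The linear coefficient in the edge probabilities. -/
noncomputable def omg (n : ℕ) (p R : ℝ) : ℝ := (1 - p) - R / (p * n)

/-- The scale of the degree fluctuations. -/
noncomputable def Dl (n : ℕ) (δ : ℝ) : ℝ := 1 + δ ^ 3 / n

section FirstOrder
variable {n : ℕ} {𝒢 : Finset (SimpleGraph (Fin n))} {p δ R L Hm r : ℝ} {k : ℕ}
  {H Q H₀ Q₀ G : SimpleGraph (Fin n)} {j l v : Fin n}

lemma one_le_Dl (c : Ctx 𝒢 p δ R L Hm r) : 1 ≤ Dl n δ := by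
  have := c.δ_nonneg
  unfold Dl
  have : 0 ≤ δ ^ 3 / (n : ℝ) := by positivity
  linarith

lemma Ctx.R_div_le (c : Ctx 𝒢 p δ R L Hm r) (h : 𝒢.Nonempty) : R / (p * n) ≤ L ^ 3 := by
  have hR := c.R_le h
  have hp := c.p_pos
  have hn := c.n_pos
  have hL := c.L_pos
  have hδ := c.δ_le
  have hδ0 := c.δ_nonneg
  have h1 := c.one_le_Lp
  rw [div_le_iff₀ (by positivity), ← c.r_sq]
  calc R ≤ δ ^ 2 := hR
    _ ≤ (L * r) ^ 2 := by gcongr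
    _ = L ^ 2 * r ^ 2 * 1 := by ring
    _ ≤ L ^ 2 * r ^ 2 * (L * p) := by gcongr
    _ = _ := by ring

lemma abs_omg_le (c : Ctx 𝒢 p δ R L Hm r) (h : 𝒢.Nonempty) : |omg n p R| ≤ L ^ 4 := by
  have h1 := c.R_div_le h
  have h2 := c.R_nonneg h
  have hp := c.p_pos
  have hp1 := c.p_lt
  have hn := c.n_pos
  have h3 : 0 ≤ R / (p * n) := by positivity
  have h4 : 2 * L ^ 3 ≤ L ^ 4 := c.mul_pow_le (by norm_num) (by norm_num)
  have h5 : 1 ≤ L ^ 3 := one_le_pow₀ c.one_le_L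
  unfold omg
  rw [abs_le]; constructor <;> linarith

lemma EA_le_crude (c : Ctx 𝒢 p δ R L Hm r) (a : Adm 𝒢 L Hm k H Q) (j l : Fin n) :
    EA H Q p δ j l ≤ L ^ 5 * (δ ^ 3 / n) / n := by
  have hy := a.kk_le c j l
  have hy0 := kk_nonneg H Q j l
  have hp := c.p_pos
  have hn := c.n_pos
  have hr := c.r_pos
  have hL := c.L_pos
  have hδ := c.δ_nonneg
  have hHm := c.Hm_le
  unfold EA
  calc δ ^ 3 * kk H Q j l ^ 2 / (p ^ 2 * n ^ 3) ≤ δ ^ 3 * (4 * (L * r)) ^ 2 / (p ^ 2 * n ^ 3) := by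
        gcongr; linarith
    _ = (1 / p) ^ 2 * (16 * L ^ 2) * (δ ^ 3 / n) / n := by rw [← c.r_sq]; field_simp; norm_num
    _ ≤ L ^ 2 * (16 * L ^ 2) * (δ ^ 3 / n) / n := by gcongr; exact c.inv_p_le
    _ ≤ L ^ 5 * (δ ^ 3 / n) / n := by
      gcongr
      have : 16 * L ^ 4 ≤ L ^ 5 := c.mul_pow_le (by norm_num) (by norm_num)
      linarith

lemma Ex_deg_near (c : Ctx 𝒢 p δ R L Hm r) (a : Adm 𝒢 L Hm (k + 3) H Q) (v : Fin n) :
    |Ex (fam 𝒢 H Q) (fun G => (deg G v : ℝ)) - p * (n - 1) -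
      R * (deg H v - (∑ u, (deg H u : ℝ)) / n) / (p * n)| ≤
      ∑ l, (155 * EA H Q p δ v l + L ^ 31 / r ^ 3 + L ^ 6 * (deg Q v + deg Q l) / n) := by
  have hn := c.n_pos
  have hp := c.p_pos
  have h1 : Ex (fam 𝒢 H Q) (fun G => ∑ u, ((deg G u : ℝ) - p * (n - 1))) = 0 := by
    rw [Ex_congr (g := fun _ => (0 : ℝ)) fun G hG => c.sum_dev G (fam_subset hG), Ex_const a.nonempty]
  have e1 : Ex (fam 𝒢 H Q) (fun G => (deg G v : ℝ)) - p * (n - 1) -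
      R * (deg H v - (∑ u, (deg H u : ℝ)) / n) / (p * n) =
      (∑ l, (Ex (fam 𝒢 H Q) (fun G => (deg G v : ℝ) - deg G l) -
        R * (deg H v - deg H l) / (p * n))) / n := by
    rw [Ex_sum] at h1
    simp only [Ex_sub, Ex_const a.nonempty] at h1
    rw [Finset.sum_sub_distrib, Finset.sum_const, Finset.card_univ, Fintype.card_fin, nsmul_eq_mul,
      sub_eq_zero] at h1
    simp only [Ex_sub]
    rw [Finset.sum_sub_distrib, Finset.sum_sub_distrib, ← Finset.sum_div, ← Finset.mul_sum,
      Finset.sum_sub_distrib, Finset.sum_const, Finset.sum_const, Finset.card_univ, Fintype.card_fin,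
      nsmul_eq_mul, nsmul_eq_mul, h1]
    field_simp
  rw [e1, abs_div, Nat.abs_cast, div_le_iff₀ hn, Finset.sum_mul]
  refine (Finset.abs_sum_le_sum_abs _ _).trans (Finset.sum_le_sum fun l _ => ?_)
  rcases eq_or_ne v l with rfl | hvl
  · have := EA_nonneg c H Q v v
    have := c.r_pos
    have := c.L_pos
    simp only [sub_self, mul_zero, zero_div, Ex_const a.nonempty, abs_zero]
    positivity
  · exact (Ex_deg_sub c a hvl).trans (le_of_eq (mul_comm _ _))

lemma Ex_deg_crude (c : Ctx 𝒢 p δ R L Hm r) (a : Adm 𝒢 L Hm (k + 3) H Q) (v : Fin n) :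
    |Ex (fam 𝒢 H Q) (fun G => (deg G v : ℝ)) - p * n - R * deg H v / (p * n)| ≤ L ^ 9 * Dl n δ := by
  have hn := c.n_pos
  have hp := c.p_pos
  have hr := c.r_pos
  have hL := c.L_pos
  have hδ := c.δ_nonneg
  have h1 := Ex_deg_near c a v
  have h2 : ∑ l, (155 * EA H Q p δ v l + L ^ 31 / r ^ 3 + L ^ 6 * (deg Q v + deg Q l) / n) ≤
      n * (155 * (L ^ 5 * (δ ^ 3 / n) / n) + 1 / n + L ^ 6 * 40 / n) := by
    refine (Finset.sum_le_sum (g := fun _ => 155 * (L ^ 5 * (δ ^ 3 / n) / n) + 1 / n + L ^ 6 * 40 / n)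
      fun l _ => ?_).trans (le_of_eq (by simp [mul_add]))
    have h2 := EA_le_crude c a v l
    have h3 := a.degQ_le_20 v
    have h4 := a.degQ_le_20 l
    have h5 : L ^ 31 / r ^ 3 ≤ 1 / n := by
      rw [← c.r_sq, div_le_div_iff₀ (by positivity) (by positivity)]
      have := c.Lpow_le (k := 31) (by norm_num)
      calc L ^ 31 * r ^ 2 ≤ r * r ^ 2 := by gcongr
        _ = _ := by ring
    gcongr
    linarith
  have h3 := c.R_div_le a.ne
  have hR0 := c.R_nonneg a.ne
  have h4 : (∑ u, (deg H u : ℝ)) / n ≤ L ^ 2 := by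
    rw [div_le_iff₀ hn]
    have := a.sum_le
    push_cast at this
    have hk : (0 : ℝ) ≤ k := Nat.cast_nonneg _
    linarith
  have h40 : 0 ≤ (∑ u, (deg H u : ℝ)) / n := by positivity
  set μ := (∑ u, (deg H u : ℝ)) / n
  have h5 : |R * μ / (p * n)| ≤ L ^ 5 := by
    rw [abs_of_nonneg (by positivity)]
    calc R * μ / (p * n) = (R / (p * n)) * μ := by ring
      _ ≤ L ^ 3 * L ^ 2 := by gcongr
      _ = _ := by ring
  have e1 : Ex (fam 𝒢 H Q) (fun G => (deg G v : ℝ)) - p * n - R * deg H v / (p * n) =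
    (Ex (fam 𝒢 H Q) (fun G => (deg G v : ℝ)) - p * (n - 1) - R * (deg H v - μ) / (p * n)) - p -
      R * μ / (p * n) := by ring
  rw [e1]
  have h6 : |p| ≤ 1 := by rw [abs_of_pos hp]; exact c.p_lt.le
  refine (abs_sub _ _).trans ((add_le_add ((abs_sub _ _).trans (add_le_add (h1.trans h2) h6)) h5).trans ?_)
  have h7 : 0 ≤ δ ^ 3 / (n : ℝ) := by positivity
  have e2 : n * (155 * (L ^ 5 * (δ ^ 3 / n) / n) + 1 / n + L ^ 6 * 40 / n) + 1 + L ^ 5 =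
    155 * L ^ 5 * (δ ^ 3 / n) + (2 + L ^ 6 * 40 + L ^ 5) := by field_simp; ring
  rw [e2]
  unfold Dl
  have h8 : 155 * L ^ 5 ≤ L ^ 9 := by
    have : 100 * L ^ 5 ≤ L ^ 6 := c.mul_pow_le (by norm_num) (by norm_num)
    have : 100 * L ^ 6 ≤ L ^ 9 := c.mul_pow_le (by norm_num) (by norm_num)
    have : 0 < L ^ 5 := by positivity
    linarith
  have h9 : 2 + L ^ 6 * 40 + L ^ 5 ≤ L ^ 9 := by
    have : 100 * L ^ 6 ≤ L ^ 9 := c.mul_pow_le (by norm_num) (by norm_num)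
    have : 1 ≤ L ^ 6 := one_le_pow₀ c.one_le_L
    have := c.pow_le (show 5 ≤ 6 by norm_num)
    linarith
  nlinarith

lemma pr_of_notMem_Nb (hK : (fam 𝒢 H Q).Nonempty) (hl : l ∉ Nb v (H ⊔ Q)) : pr 𝒢 H Q l v = ad H v l := by
  unfold pr
  rw [← Ex_const hK (ad H v l)]
  refine Ex_congr fun G hG => ?_
  obtain ⟨_, h1, h2⟩ := mem_fam.1 hG
  rw [ad_comm]
  by_cases hH : H.Adj v l
  · rw [ad_of_adj hH, ad_of_adj (h1 _ _ hH)]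
  rw [ad_of_not_adj hH]
  rw [mem_Nb] at hl
  push Not at hl
  rcases eq_or_ne l v with rfl | hlv
  · exact ad_self _ _
  · rcases hl hlv with h | h
    · exact absurd h.symm hH
    · exact ad_of_not_adj (h2 _ _ h.symm)

lemma sum_pr_compl_Nb (hK : (fam 𝒢 H Q).Nonempty) (v : Fin n) :
    ∑ l ∈ (Nb v (H ⊔ Q))ᶜ, pr 𝒢 H Q l v = deg H v := by
  rw [deg_eq_sum, Finset.sum_congr rfl fun l hl => pr_of_notMem_Nb hK (Finset.mem_compl.1 hl)]
  refine Finset.sum_subset (Finset.subset_univ _) fun l _ hl => ?_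
  rw [Finset.mem_compl, not_not, mem_Nb] at hl
  exact ad_of_not_adj fun h => hl.2 (Or.inl h.symm)

lemma deg_le_card_compl_Nb (v : Fin n) : (deg H v : ℝ) ≤ (Nb v (H ⊔ Q))ᶜ.card := by
  unfold deg
  exact_mod_cast Finset.card_le_card fun l hl => by
    rw [Finset.mem_compl, mem_Nb]
    exact fun h => h.2 (Or.inl (Finset.mem_filter.1 hl).2.symm)

lemma pr_sub_first (c : Ctx 𝒢 p δ R L Hm r) (a : Adm 𝒢 L Hm (k + 3) H Q)
    (hj : j ∈ Nb v (H ⊔ Q)) (hl : l ∈ Nb v (H ⊔ Q)) :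
    |(pr 𝒢 H Q j v - pr 𝒢 H Q l v) + omg n p R * (deg H j - deg H l) / n| ≤ L ^ 15 * Dl n δ / n := by
  have hn := c.n_pos
  have hp := c.p_pos
  have hr := c.r_pos
  have hL := c.L_pos
  have hδ := c.δ_nonneg
  rcases eq_or_ne j l with rfl | hjl
  · have := one_le_Dl c
    simp only [sub_self, mul_zero, zero_div, add_zero, abs_zero]
    positivity
  have hv := mem_Fr_of_mem_Nb hj hl
  rw [pr_sub_pr' c hjl hv]
  have h1 := Ex_ind_Sd_div c a hjl hv
  have h2 := Ex_ind_kapF_div c a hjl hv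
  have h3 := EA_le_crude c a j l
  have h4 := a.degQ_le_20 j
  have h5 := a.degQ_le_20 l
  have e1 : omg n p R * (deg H j - deg H l) / n =
    (1 - p) * (deg H j - deg H l) / n - R * (deg H j - deg H l) / (p * n ^ 2) := by
    unfold omg; field_simp
  rw [e1]
  set A := Ex (fam 𝒢 H Q) (fun G => ind (v ∈ Sd j l (Fr j l (H ⊔ Q)) G) *
        ((deg G j : ℝ) - deg G l) / (Sd j l (Fr j l (H ⊔ Q)) G).card)
  set B := Ex (fam 𝒢 H Q) (fun G => ind (v ∈ Sd j l (Fr j l (H ⊔ Q)) G) *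
        kapF (Fr j l (H ⊔ Q)) j l G / (Sd j l (Fr j l (H ⊔ Q)) G).card)
  have e2 : A - B + ((1 - p) * (deg H j - deg H l) / n - R * (deg H j - deg H l) / (p * n ^ 2)) =
    (A - R * (deg H j - deg H l) / (p * n ^ 2)) - (B - (1 - p) * (deg H j - deg H l) / n) := by ring
  rw [e2]
  refine (abs_sub _ _).trans ((add_le_add h1 h2).trans ?_)
  have h6 : L ^ 30 / r ^ 3 ≤ 1 / n := by
    rw [← c.r_sq, div_le_div_iff₀ (by positivity) (by positivity)]
    have := c.Lpow_le (k := 30) (by norm_num)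
    calc L ^ 30 * r ^ 2 ≤ r * r ^ 2 := by gcongr
      _ = _ := by ring
  have h7 : 0 ≤ δ ^ 3 / (n : ℝ) := by positivity
  calc 153 * EA H Q p δ j l + L ^ 30 / r ^ 3 + L ^ 6 * (deg Q j + deg Q l) / n + L ^ 14 / n
      ≤ 153 * (L ^ 5 * (δ ^ 3 / n) / n) + 1 / n + L ^ 6 * 40 / n + L ^ 14 / n := by
        gcongr; linarith
    _ = (153 * L ^ 5 * (δ ^ 3 / n) + (1 + L ^ 6 * 40 + L ^ 14)) / n := by ring
    _ ≤ L ^ 15 * Dl n δ / n := by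
      gcongr
      unfold Dl
      have b1 : 100 * L ^ 14 ≤ L ^ 15 := c.mul_pow_le (by norm_num) (by norm_num)
      have b2 : 1 ≤ L ^ 14 := one_le_pow₀ c.one_le_L
      have b3 := c.pow_le (show 6 ≤ 14 by norm_num)
      have b4 : 100 * L ^ 5 ≤ L ^ 14 := c.mul_pow_le (by norm_num) (by norm_num)
      have b5 : 153 * L ^ 5 ≤ L ^ 15 := by
        have : 0 < L ^ 5 := by positivity
        linarith
      nlinarith

/-- First-order expansion of the edge probabilities. -/
lemma pr_first (c : Ctx 𝒢 p δ R L Hm r) (a : Adm 𝒢 L Hm (k + 3) H Q) (hjv : j ≠ v)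
    (hH : ¬ H.Adj j v) (hQ : ¬ Q.Adj j v) :
    |pr 𝒢 H Q j v - (p - omg n p R * (deg H j + deg H v) / n)| ≤ L ^ 16 * Dl n δ / n := by
  have hn := c.n_pos
  have hp := c.p_pos
  have hr := c.r_pos
  have hL := c.L_pos
  have hδ := c.δ_nonneg
  have hj : j ∈ Nb v (H ⊔ Q) := mem_Nb.2 ⟨hjv, by simp [hH, hQ]⟩
  have hcr := pr_crude c a hjv hH hQ
  have h1 := mul_pr_eq (𝒢 := 𝒢) (H := H) (Q := Q) v j (Nb v (H ⊔ Q))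
  have h2 := Ex_deg_crude c a v
  have h3 := card_compl_Nb_le (H := H) (Q := Q) v
  have h4 := deg_le_card_compl_Nb (H := H) (Q := Q) v
  have h5 := card_Nb v (H ⊔ Q)
  have hω := abs_omg_le c a.ne
  rw [sum_pr_compl_Nb a.nonempty, h5] at h1
  have hQv := a.degQ_le_20 v
  have hHv := a.deg_le_Hm v
  have hHm := c.Hm_le
  have hHm20 := c.Hm_ge
  have hdl := one_le_Dl c
  have hπ0 := pr_nonneg (𝒢 := 𝒢) (H := H) (Q := Q) j v
  have hπ1 := pr_le_one (𝒢 := 𝒢) a.nonempty j v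
  have h6 : |∑ l ∈ Nb v (H ⊔ Q), (pr 𝒢 H Q j v - pr 𝒢 H Q l v) +
      ∑ l ∈ Nb v (H ⊔ Q), omg n p R * (deg H j - deg H l) / n| ≤ L ^ 15 * Dl n δ := by
    rw [← Finset.sum_add_distrib]
    refine (Finset.abs_sum_le_sum_abs _ _).trans ((Finset.sum_le_sum fun l hl => pr_sub_first c a hj hl).trans ?_)
    rw [Finset.sum_const, nsmul_eq_mul]
    calc ((Nb v (H ⊔ Q)).card : ℝ) * (L ^ 15 * Dl n δ / n) ≤ n * (L ^ 15 * Dl n δ / n) := by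
          gcongr
          simpa using (Nb v (H ⊔ Q)).card_le_univ
      _ = _ := by field_simp
  have e1 : ∑ l ∈ Nb v (H ⊔ Q), omg n p R * (deg H j - deg H l) / n =
      omg n p R * (deg H j - (∑ u, (deg H u : ℝ)) / n) -
        ∑ l ∈ (Nb v (H ⊔ Q))ᶜ, omg n p R * (deg H j - deg H l) / n := by
    rw [eq_sub_iff_add_eq, Finset.sum_add_sum_compl, ← Finset.sum_div, ← Finset.mul_sum,
      Finset.sum_sub_distrib, Finset.sum_const, Finset.card_univ, Fintype.card_fin, nsmul_eq_mul]
    field_simp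
  have h7 : |∑ l ∈ (Nb v (H ⊔ Q))ᶜ, omg n p R * (deg H j - deg H l) / n| ≤ 3 * L ^ 6 := by
    calc _ ≤ ∑ l ∈ (Nb v (H ⊔ Q))ᶜ, L ^ 4 * Hm / n := by
          refine (Finset.abs_sum_le_sum_abs _ _).trans (Finset.sum_le_sum fun l _ => ?_)
          rw [abs_div, abs_mul, Nat.abs_cast]
          gcongr
          have := a.deg_le_Hm l
          have := a.deg_le_Hm j
          have q1 : (0 : ℝ) ≤ deg H j := Nat.cast_nonneg _
          have q2 : (0 : ℝ) ≤ deg H l := Nat.cast_nonneg _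
          rw [abs_le]; constructor <;> linarith
      _ = ((Nb v (H ⊔ Q))ᶜ.card : ℝ) * (L ^ 4 * Hm / n) := by rw [Finset.sum_const, nsmul_eq_mul]
      _ ≤ (3 * (L * r)) * (L ^ 4 * (L * r) / n) := by
        gcongr
        · linarith
      _ = _ := by rw [← c.r_sq]; field_simp
  have h8 : |(Nb v (H ⊔ Q))ᶜ.card * pr 𝒢 H Q j v - deg H v * p| ≤ 21 + L ^ 5 := by
    have e : ((Nb v (H ⊔ Q))ᶜ.card : ℝ) * pr 𝒢 H Q j v - deg H v * p =
      ((Nb v (H ⊔ Q))ᶜ.card - deg H v) * pr 𝒢 H Q j v + deg H v * (pr 𝒢 H Q j v - p) := by ring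
    rw [e]
    refine (abs_add_le _ _).trans (add_le_add ?_ ?_)
    · rw [abs_mul, abs_of_nonneg (sub_nonneg.2 h4), abs_of_nonneg hπ0]
      calc _ ≤ (21 : ℝ) * 1 := by gcongr; linarith
        _ = _ := by ring
    · rw [abs_mul, Nat.abs_cast]
      calc (deg H v : ℝ) * |pr 𝒢 H Q j v - p| ≤ (L * r) * (L ^ 4 / r) := by gcongr; linarith
        _ = _ := by field_simp
  have hμ : (∑ u, (deg H u : ℝ)) / n ≤ L ^ 2 := by
    rw [div_le_iff₀ hn]
    have := a.sum_le
    push_cast at this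
    have hk : (0 : ℝ) ≤ k := Nat.cast_nonneg _
    linarith
  have hμ0 : 0 ≤ (∑ u, (deg H u : ℝ)) / n := by positivity
  set μ := (∑ u, (deg H u : ℝ)) / n
  have h9 : |omg n p R * μ| ≤ L ^ 6 := by
    rw [abs_mul, abs_of_nonneg hμ0]
    calc _ ≤ L ^ 4 * L ^ 2 := by gcongr
      _ = _ := by ring
  set W := ∑ l ∈ (Nb v (H ⊔ Q))ᶜ, omg n p R * (deg H j - deg H l) / n
  set S := ∑ l ∈ Nb v (H ⊔ Q), (pr 𝒢 H Q j v - pr 𝒢 H Q l v)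
  set D := Ex (fam 𝒢 H Q) (fun G => (deg G v : ℝ))
  set π := pr 𝒢 H Q j v
  set cc := ((Nb v (H ⊔ Q))ᶜ.card : ℝ)
  rw [e1] at h6
  have e2 : π - (p - omg n p R * (deg H j + deg H v) / n) =
      ((D - p * n - R * deg H v / (p * n)) + (cc * π - deg H v * p) +
        (S + (omg n p R * (deg H j - μ) - W)) + W + omg n p R * μ) / n := by
    rw [eq_div_iff hn.ne']
    have : (π - (p - omg n p R * (deg H j + deg H v) / n)) * n =
      (n - cc) * π + cc * π - p * n + omg n p R * (deg H j + deg H v) := by field_simp; ring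
    rw [this, h1]
    unfold omg
    ring
  rw [e2, abs_div, Nat.abs_cast]
  refine div_le_div_of_nonneg_right ?_ hn.le
  refine (abs_add_le _ _).trans ((add_le_add ((abs_add_le _ _).trans (add_le_add ((abs_add_le _ _).trans
    (add_le_add ((abs_add_le _ _).trans (add_le_add h2 h8)) h6)) h7)) h9).trans ?_)
  have b1 : 100 * L ^ 15 ≤ L ^ 16 := c.mul_pow_le (by norm_num) (by norm_num)
  have b2 : 1 ≤ L ^ 15 := one_le_pow₀ c.one_le_L
  have b3 := c.pow_le (show 9 ≤ 15 by norm_num)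
  have b4 := c.pow_le (show 5 ≤ 15 by norm_num)
  have b5 := c.pow_le (show 6 ≤ 15 by norm_num)
  have b6 : L ^ 9 * Dl n δ ≤ L ^ 15 * Dl n δ := by gcongr
  have b7 : 100 * L ^ 15 * Dl n δ ≤ L ^ 16 * Dl n δ := by gcongr
  nlinarith

end FirstOrder

section SecondOrder
variable {n : ℕ} {𝒢 : Finset (SimpleGraph (Fin n))} {p δ R L Hm r : ℝ} {k : ℕ}
  {H Q H₀ Q₀ G : SimpleGraph (Fin n)} {j l v : Fin n}

lemma pr_first_of (c : Ctx 𝒢 p δ R L Hm r) (a : Adm 𝒢 L Hm (k + 3) H Q) (hjv : j ≠ v)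
    (hH : ¬ H.Adj j v) (hQ : ¬ Q.Adj j v) {y : ℝ} (hy : |(deg H j : ℝ) + deg H v - y| ≤ 6) :
    |pr 𝒢 H Q j v - (p - omg n p R * y / n)| ≤ L ^ 17 * Dl n δ / n := by
  have h1 := pr_first c a hjv hH hQ
  have h2 := abs_omg_le c a.ne
  have hn := c.n_pos
  have hL := c.L_pos
  have hD := one_le_Dl c
  have e1 : pr 𝒢 H Q j v - (p - omg n p R * y / n) =
      (pr 𝒢 H Q j v - (p - omg n p R * (deg H j + deg H v) / n)) -
      omg n p R * ((deg H j : ℝ) + deg H v - y) / n := by ring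
  rw [e1]
  refine (abs_sub _ _).trans ?_
  have h3 : |omg n p R * ((deg H j : ℝ) + deg H v - y) / n| ≤ L ^ 4 * 6 / n := by
    rw [abs_div, abs_mul, Nat.abs_cast]; gcongr
  calc _ ≤ L ^ 16 * Dl n δ / n + L ^ 4 * 6 / n := add_le_add h1 h3
    _ = (L ^ 16 * Dl n δ + 6 * L ^ 4 * 1) / n := by ring
    _ ≤ (L ^ 16 * Dl n δ + L ^ 16 * Dl n δ) / n := by
        gcongr
        exact c.mul_pow_le (by norm_num) (by norm_num)
    _ = (2 * L ^ 16) * Dl n δ / n := by ring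
    _ ≤ L ^ 17 * Dl n δ / n := by
        gcongr
        exact c.mul_pow_le (by norm_num) (by norm_num)

lemma abs_omg_mul_le (c : Ctx 𝒢 p δ R L Hm r) (h : 𝒢.Nonempty) {y : ℝ} (hy : |y| ≤ 4 * Hm) :
    |omg n p R * y / n| ≤ 4 * L ^ 5 / r := by
  have h2 := abs_omg_le c h
  have hn := c.n_pos
  have hr := c.r_pos
  have hL := c.L_pos
  have hHm := c.Hm_le
  rw [abs_div, abs_mul, Nat.abs_cast]
  calc |omg n p R| * |y| / n ≤ L ^ 4 * (4 * (L * r)) / n := by gcongr; linarith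
    _ = 4 * L ^ 5 / r := by rw [← c.r_sq]; field_simp

lemma abs_mul_sub_mul_le {a b x y η : ℝ} (ha : |a - x| ≤ η) (hb : |b - y| ≤ η) (hb1 : |b| ≤ 1) (hx : |x| ≤ 2) :
    |a * b - x * y| ≤ 3 * η := by
  have e : a * b - x * y = (a - x) * b + x * (b - y) := by ring
  have hη : 0 ≤ η := (abs_nonneg _).trans ha
  rw [e]
  calc |(a - x) * b + x * (b - y)| ≤ |a - x| * |b| + |x| * |b - y| := by
        rw [← abs_mul, ← abs_mul]; exact abs_add_le _ _
    _ ≤ η * 1 + 2 * η := by gcongr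
    _ = 3 * η := by ring

/-- The probability that exactly one of the pairs `jv`, `lv` is an edge, split by cases. -/
lemma status_first (c : Ctx 𝒢 p δ R L Hm r) (a : Adm 𝒢 L Hm (k + 4) H Q) (hjl : j ≠ l)
    (hv : v ∈ Fr j l (H ⊔ Q)) {y y' : ℝ} (hy : |(deg H j : ℝ) + deg H v - y| ≤ 4)
    (hy' : |(deg H l : ℝ) + deg H v - y'| ≤ 4) (hyH : |y| ≤ 4 * Hm) (hyH' : |y'| ≤ 4 * Hm) :
    |pr 𝒢 H Q j v * (1 - pr 𝒢 (H ⊔ SimpleGraph.edge j v) Q l v) +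
      pr 𝒢 H Q l v * (1 - pr 𝒢 (H ⊔ SimpleGraph.edge l v) Q j v) -
      (2 * (p * (1 - p)) - (1 - 2 * p) * omg n p R * (y + y') / n)| ≤ L ^ 19 * Dl n δ / n := by
  rw [mem_Fr] at hv
  obtain ⟨hvj, hvl, h1, h2⟩ := hv
  rw [SimpleGraph.sup_adj, not_or] at h1 h2
  have hn := c.n_pos
  have hr := c.r_pos
  have hL := c.L_pos
  have hD := one_le_Dl c
  have hp := c.p_pos
  have hp1 := c.p_lt
  have aj := Adm.add c a hvj.symm h1.1 h1.2
  have al := Adm.add c a hvl.symm h2.1 h2.2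
  have key : ∀ {j l : Fin n}, j ≠ l → v ≠ j → v ≠ l → ¬ H.Adj j v → ¬ H.Adj l v →
      ¬ (H ⊔ SimpleGraph.edge j v).Adj l v := by
    intro j l hjl hvj hvl h1 h2
    rw [sup_edge_adj_iff hvj.symm]
    rintro (h | h | h)
    · exact h2 h
    · exact hjl h.1.symm
    · exact hvl h.1.symm
  have degs : ∀ {j l : Fin n}, j ≠ l → v ≠ j → v ≠ l → ¬ H.Adj j v → ∀ {y : ℝ},
      |(deg H l : ℝ) + deg H v - y| ≤ 4 →
      |(deg (H ⊔ SimpleGraph.edge j v) l : ℝ) + deg (H ⊔ SimpleGraph.edge j v) v - y| ≤ 6 := by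
    intro j l hjl hvj hvl h1 y hy
    rw [deg_sup_edge hvj.symm h1, deg_sup_edge hvj.symm h1]
    have e1 : ind (l = j) = 0 := if_neg hjl.symm
    have e2 : ind (l = v) = 0 := if_neg hvl.symm
    have e3 : ind (v = j) = 0 := if_neg hvj
    have e4 : ind (v = v) = 1 := if_pos rfl
    rw [e1, e2, e3, e4]
    rw [abs_le] at hy ⊢
    constructor <;> linarith
  have b1 := pr_first_of c (k := k + 1) a hvj.symm h1.1 h1.2 (hy.trans (by norm_num))
  have b2 := pr_first_of c (k := k + 1) a hvl.symm h2.1 h2.2 (hy'.trans (by norm_num))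
  have b3 := pr_first_of c (k := k) aj hvl.symm (key hjl hvj hvl h1.1 h2.1) h2.2 (degs hjl hvj hvl h1.1 hy')
  have b4 := pr_first_of c (k := k) al hvj.symm (key hjl.symm hvl hvj h2.1 h1.1) h1.2
    (degs hjl.symm hvl hvj h2.1 hy)
  have x1 := abs_omg_mul_le c a.ne hyH
  have x2 := abs_omg_mul_le c a.ne hyH'
  have u3 : |1 - pr 𝒢 (H ⊔ SimpleGraph.edge j v) Q l v| ≤ 1 := by
    have := pr_nonneg (𝒢 := 𝒢) (H := H ⊔ SimpleGraph.edge j v) (Q := Q) l v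
    have := pr_le_one (𝒢 := 𝒢) aj.nonempty l v
    rw [abs_le]; constructor <;> linarith
  have u4 : |1 - pr 𝒢 (H ⊔ SimpleGraph.edge l v) Q j v| ≤ 1 := by
    have := pr_nonneg (𝒢 := 𝒢) (H := H ⊔ SimpleGraph.edge l v) (Q := Q) j v
    have := pr_le_one (𝒢 := 𝒢) al.nonempty j v
    rw [abs_le]; constructor <;> linarith
  have small : 4 * L ^ 5 / r ≤ 1 := by
    rw [div_le_one hr]
    exact (c.mul_pow_le (b := 6) (by norm_num) (by norm_num)).trans (c.Lpow_le (by norm_num))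
  set X := omg n p R * y / n with hX
  set Y := omg n p R * y' / n with hY
  have hX1 : |p - X| ≤ 2 := by
    have := abs_le.1 (x1.trans small)
    rw [abs_le]; constructor <;> linarith
  have hY1 : |p - Y| ≤ 2 := by
    have := abs_le.1 (x2.trans small)
    rw [abs_le]; constructor <;> linarith
  have b3' : |(1 - pr 𝒢 (H ⊔ SimpleGraph.edge j v) Q l v) - (1 - p + Y)| ≤ L ^ 17 * Dl n δ / n := by
    rw [abs_sub_comm]; convert b3 using 2; ring
  have b4' : |(1 - pr 𝒢 (H ⊔ SimpleGraph.edge l v) Q j v) - (1 - p + X)| ≤ L ^ 17 * Dl n δ / n := by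
    rw [abs_sub_comm]; convert b4 using 2; ring
  have m1 := abs_mul_sub_mul_le b1 b3' u3 hX1
  have m2 := abs_mul_sub_mul_le b2 b4' u4 hY1
  have hXY : |X * Y| ≤ 16 * L ^ 10 / n := by
    rw [abs_mul]
    calc |X| * |Y| ≤ (4 * L ^ 5 / r) * (4 * L ^ 5 / r) := by gcongr
      _ = 16 * L ^ 10 / n := by rw [← c.r_sq]; field_simp; norm_num
  have e1 : (1 - 2 * p) * omg n p R * (y + y') / n = (1 - 2 * p) * (X + Y) := by
    rw [hX, hY]; ring
  rw [e1]
  have e2 : ∀ A B C D : ℝ, A * B + C * D - (2 * (p * (1 - p)) - (1 - 2 * p) * (X + Y)) =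
      (A * B - (p - X) * (1 - p + Y)) + (C * D - (p - Y) * (1 - p + X)) - 2 * (X * Y) := by
    intros; ring
  rw [e2]
  refine (abs_sub _ _).trans ?_
  rw [abs_mul 2, abs_two]
  calc _ ≤ (3 * (L ^ 17 * Dl n δ / n) + 3 * (L ^ 17 * Dl n δ / n)) + 2 * (16 * L ^ 10 / n) := by
        gcongr
        exact (abs_add_le _ _).trans (add_le_add m1 m2)
    _ = (6 * L ^ 17 * Dl n δ + 32 * L ^ 10 * 1) / n := by ring
    _ ≤ (L ^ 18 * Dl n δ + L ^ 18 * Dl n δ) / n := by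
        gcongr
        · exact c.mul_pow_le (by norm_num) (by norm_num)
        · exact c.mul_pow_le (by norm_num) (by norm_num)
    _ = (2 * L ^ 18) * Dl n δ / n := by ring
    _ ≤ L ^ 19 * Dl n δ / n := by
        gcongr
        exact c.mul_pow_le (by norm_num) (by norm_num)

lemma deg_bot (u : Fin n) : deg (⊥ : SimpleGraph (Fin n)) u = 0 := by simp [deg]

lemma card_compl_eq_sum_ind (F : Finset (Fin n)) : (Fᶜ.card : ℝ) = ∑ w, ind (w ∉ F) := by
  have : ∀ w, ind (w ∉ F) = if w ∈ Fᶜ then 1 else 0 := fun w => by simp [ind]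
  simp only [this, Finset.sum_ite_mem, Finset.univ_inter, Finset.sum_const]
  simp

lemma cod_nonneg (j l : Fin n) : 0 ≤ cod H j l :=
  Finset.sum_nonneg fun _ _ => mul_nonneg (ad_nonneg _ _ _) (ad_nonneg _ _ _)

lemma abs_card_compl_Fr_sub_le (j l : Fin n) :
    |((Fr j l H)ᶜ.card : ℝ) - (deg H j + deg H l)| ≤ cod H j l + 2 := by
  have h1 := card_compl_Fr_le (H := H) (Q := ⊥) j l
  rw [deg_bot, deg_bot, sup_bot_eq] at h1
  have h2 : ((Fr j l H)ᶜ.card : ℝ) ≥ deg H j + deg H l - cod H j l := by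
    rw [card_compl_eq_sum_ind, deg_eq_sum, deg_eq_sum, cod, ← Finset.sum_add_distrib, ← Finset.sum_sub_distrib, ge_iff_le]
    refine Finset.sum_le_sum fun w _ => ?_
    by_cases hw : w ∈ Fr j l H
    · rw [mem_Fr] at hw
      rw [ad_of_not_adj hw.2.2.1, ad_of_not_adj hw.2.2.2]
      have := ind_nonneg (w ∉ Fr j l H)
      linarith
    · have : ind (w ∉ Fr j l H) = 1 := if_pos hw
      rw [this]
      have h3 := ad_le_one H j w
      have h4 := ad_le_one H l w
      nlinarith
  have h3 := cod_nonneg (H := H) j l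
  push_cast at h1
  rw [abs_le]; constructor <;> linarith

set_option maxHeartbeats 1000000 in
/-- The expected number of vertices distinguishing `j` and `l`, to second order. -/
lemma Ex_card_Sd_fine (c : Ctx 𝒢 p δ R L Hm r) (a : Adm 𝒢 L Hm (k + 4) H₀ Q₀) (hjl : j ≠ l)
    (hH : ∀ x, (deg H x : ℝ) + 4 ≤ Hm) (hS : ∑ x, (deg H x : ℝ) ≤ L ^ 2 * n)
    (hsub : ∀ u ∈ Fr j l H, u ≠ v → u ∈ Fr j l (H₀ ⊔ Q₀))
    (hdeg : ∀ x, |(deg H₀ x : ℝ) - deg H x| ≤ 2) :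
    |Ex (fam 𝒢 H₀ Q₀) (fun G => ((Sd j l (Fr j l H) G).card : ℝ)) -
      (2 * (p * (1 - p)) * n - (2 * (p * (1 - p)) + (1 - 2 * p) * omg n p R) * (deg H j + deg H l))| ≤
      L ^ 21 * (Dl n δ + cod H j l) := by
  have hn := c.n_pos
  have hr := c.r_pos
  have hL := c.L_pos
  have hL1 := c.one_le_L
  have hD := one_le_Dl c
  have hp := c.p_pos
  have hq := c.q_pos
  have hp1 := c.p_lt
  have hHm := c.Hm_le
  have hω := abs_omg_le c a.ne
  have hc0 := cod_nonneg (H := H) j l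
  have hΛ := c.Λ_lt
  set F := Fr j l H with hF
  set θ := (1 - 2 * p) * omg n p R with hθ
  have hθ1 : |θ| ≤ L ^ 4 := by
    rw [hθ, abs_mul]
    have : |1 - 2 * p| ≤ 1 := by rw [abs_le]; constructor <;> linarith
    calc |1 - 2 * p| * |omg n p R| ≤ 1 * L ^ 4 := by gcongr
      _ = L ^ 4 := one_mul _
  set m : Fin n → ℝ := fun u => 2 * (p * (1 - p)) - θ * (deg H j + deg H l + 2 * deg H u) / n with hm
  set t : Fin n → ℝ := fun u => Ex (fam 𝒢 H₀ Q₀)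
    (fun G => ad G j u * (1 - ad G l u) + (1 - ad G j u) * ad G l u) with ht
  have e1 : Ex (fam 𝒢 H₀ Q₀) (fun G => ((Sd j l F G).card : ℝ)) = ∑ u ∈ F, t u := by
    rw [← Ex_sum]; exact Ex_congr fun G _ => card_Sd_eq_sum G j l F
  have ht1 : ∀ u, 0 ≤ t u ∧ t u ≤ 1 := by
    intro u
    have hb : ∀ G, 0 ≤ ad G j u * (1 - ad G l u) + (1 - ad G j u) * ad G l u ∧
        ad G j u * (1 - ad G l u) + (1 - ad G j u) * ad G l u ≤ 1 := by
      intro G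
      rcases ad_eq_zero_or_one G j u with h | h <;> rcases ad_eq_zero_or_one G l u with h' | h' <;>
        rw [h, h'] <;> norm_num
    exact ⟨Ex_nonneg fun G _ => (hb G).1, Ex_le_const a.nonempty fun G _ => (hb G).2⟩
  have hdegn : ∀ x, (deg H x : ℝ) ≤ L * r := fun x => by linarith [hH x]
  have hm2 : ∀ u, |m u| ≤ 2 := by
    intro u
    have h1 : |θ * (deg H j + deg H l + 2 * deg H u) / (n : ℝ)| ≤ 1 := by
      rw [abs_div, Nat.abs_cast, div_le_one hn, abs_mul,
        abs_of_nonneg (by positivity : (0 : ℝ) ≤ deg H j + deg H l + 2 * deg H u)]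
      calc |θ| * (deg H j + deg H l + 2 * deg H u) ≤ L ^ 4 * (L * r + L * r + 2 * (L * r)) := by
            gcongr <;> exact hdegn _
        _ = 4 * L ^ 5 * r := by ring
        _ ≤ L ^ 6 * r := by gcongr; exact c.mul_pow_le (by norm_num) (by norm_num)
        _ ≤ r * r := by gcongr; exact c.Lpow_le (by norm_num)
        _ = n := by rw [← c.r_sq]; ring
    rw [abs_le] at h1
    have : 0 < p * (1 - p) := mul_pos hp hq
    have : 4 * (p * (1 - p)) ≤ 1 := by nlinarith [sq_nonneg (1 - 2 * p)]
    rw [hm, abs_le]; constructor <;> simp only <;> linarith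
  have hone : ∀ u ∈ F, |t u - m u| ≤ L ^ 19 * Dl n δ / n + 3 * ind (u = v) := by
    intro u hu
    by_cases huv : u = v
    · have h1 := ht1 u
      have h2 := abs_le.1 (hm2 u)
      have : ind (u = v) = 1 := if_pos huv
      have : 0 ≤ L ^ 19 * Dl n δ / n := by positivity
      rw [abs_le]; constructor <;> nlinarith
    · have hu' := hsub u hu huv
      have h0 : ind (u = v) = 0 := if_neg huv
      have bd : ∀ j, |(deg H₀ j : ℝ) + deg H₀ u - (deg H j + deg H u)| ≤ 4 := fun j => by
        have h1 := abs_le.1 (hdeg j)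
        have h2 := abs_le.1 (hdeg u)
        rw [abs_le]; constructor <;> linarith
      have bh : ∀ j, |(deg H j : ℝ) + deg H u| ≤ 4 * Hm := fun j => by
        rw [abs_of_nonneg (by positivity)]
        linarith [hH j, hH u, c.Hm_ge]
      have h1 := status_first c a hjl hu' (bd j) (bd l) (bh j) (bh l)
      rw [h0, mul_zero, add_zero]
      have e2 : t u = pr 𝒢 H₀ Q₀ j u * (1 - pr 𝒢 (H₀ ⊔ SimpleGraph.edge j u) Q₀ l u) +
          pr 𝒢 H₀ Q₀ l u * (1 - pr 𝒢 (H₀ ⊔ SimpleGraph.edge l u) Q₀ j u) := by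
        rw [mem_Fr] at hu'
        obtain ⟨huj, hul, h3, h4⟩ := hu'
        rw [SimpleGraph.sup_adj, not_or] at h3 h4
        have aj := Adm.add c a huj.symm h3.1 h3.2
        have al := Adm.add c a hul.symm h4.1 h4.2
        have e5 : Ex (fam 𝒢 H₀ Q₀) (fun G => ad G j u * (1 - ad G l u)) =
            pr 𝒢 H₀ Q₀ j u * (1 - pr 𝒢 (H₀ ⊔ SimpleGraph.edge j u) Q₀ l u) := by
          rw [Ex_ad_mul' huj.symm, Ex_sub, Ex_const aj.nonempty]; rfl
        have e6 : Ex (fam 𝒢 H₀ Q₀) (fun G => (1 - ad G j u) * ad G l u) =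
            pr 𝒢 H₀ Q₀ l u * (1 - pr 𝒢 (H₀ ⊔ SimpleGraph.edge l u) Q₀ j u) := by
          rw [Ex_congr (g := fun G => ad G l u * (1 - ad G j u)) fun G _ => mul_comm _ _,
            Ex_ad_mul' hul.symm, Ex_sub, Ex_const al.nonempty]; rfl
        rw [← e5, ← e6, ← Ex_add]
      rw [e2, hm]
      convert h1 using 2
      ring
  have h1 : |∑ u ∈ F, (t u - m u)| ≤ L ^ 19 * Dl n δ + 3 := by
    calc |∑ u ∈ F, (t u - m u)| ≤ ∑ u ∈ F, (L ^ 19 * Dl n δ / n + 3 * ind (u = v)) :=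
          (Finset.abs_sum_le_sum_abs _ _).trans (Finset.sum_le_sum hone)
      _ ≤ ∑ u, (L ^ 19 * Dl n δ / n + 3 * ind (u = v)) :=
          Finset.sum_le_sum_of_subset_of_nonneg (Finset.subset_univ _) fun u _ _ => by
            have := ind_nonneg (u = v); positivity
      _ = L ^ 19 * Dl n δ + 3 := by
          rw [Finset.sum_add_distrib, ← Finset.mul_sum, sum_ind_eq, Finset.sum_const, Finset.card_univ,
            Fintype.card_fin, nsmul_eq_mul]
          field_simp
  have e3 : ∑ u ∈ F, m u = (F.card : ℝ) * (2 * (p * (1 - p)) - θ * (deg H j + deg H l) / n) -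
      2 * θ / n * ∑ u ∈ F, (deg H u : ℝ) := by
    rw [Finset.mul_sum, ← nsmul_eq_mul, ← Finset.sum_const, ← Finset.sum_sub_distrib]
    refine Finset.sum_congr rfl fun u _ => ?_
    rw [hm]; ring
  have hFc : (F.card : ℝ) = n - Fᶜ.card := by
    rw [Finset.card_compl, Fintype.card_fin, Nat.cast_sub (by simpa using F.card_le_univ)]
    ring
  have h2 := abs_card_compl_Fr_sub_le (H := H) j l
  rw [← hF] at h2
  have h3 : (Fᶜ.card : ℝ) ≤ 5 * (L * r) := by
    have h := card_compl_Fr_le (H := H) (Q := ⊥) j l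
    rw [deg_bot, deg_bot, sup_bot_eq, ← hF] at h
    push_cast at h
    have := c.Hm_ge
    linarith [hH j, hH l]
  have h4 : ∑ u ∈ F, (deg H u : ℝ) ≤ L ^ 2 * n :=
    (Finset.sum_le_sum_of_subset_of_nonneg (Finset.subset_univ _) fun u _ _ => by positivity).trans hS
  have h4' : 0 ≤ ∑ u ∈ F, (deg H u : ℝ) := Finset.sum_nonneg fun u _ => by positivity
  set hh := (deg H j : ℝ) + deg H l with hhh
  have hh0 : 0 ≤ hh := by positivity
  have hh1 : hh ≤ 2 * (L * r) := by linarith [hdegn j, hdegn l]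
  have e4 : ∑ u ∈ F, t u - (2 * (p * (1 - p)) * n - (2 * (p * (1 - p)) + θ) * hh) =
      ∑ u ∈ F, (t u - m u) + (-(2 * (p * (1 - p)) * ((Fᶜ.card : ℝ) - hh)) + θ * hh * Fᶜ.card / n) -
        2 * θ / n * ∑ u ∈ F, (deg H u : ℝ) := by
    rw [Finset.sum_sub_distrib, e3, hFc]
    field_simp
    ring
  rw [e1, e4]
  have b1 : |2 * (p * (1 - p)) * ((Fᶜ.card : ℝ) - hh)| ≤ 2 * (cod H j l + 2) := by
    rw [abs_mul, abs_of_nonneg (by positivity)]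
    have : 0 < p * (1 - p) := mul_pos hp hq
    calc 2 * (p * (1 - p)) * |(Fᶜ.card : ℝ) - hh| ≤ 2 * 1 * (cod H j l + 2) := by gcongr
      _ = _ := by ring
  have b2 : |θ * hh * Fᶜ.card / n| ≤ 10 * L ^ 6 := by
    rw [abs_div, Nat.abs_cast, abs_mul, abs_mul, abs_of_nonneg hh0, Nat.abs_cast, div_le_iff₀ hn]
    calc |θ| * hh * Fᶜ.card ≤ L ^ 4 * (2 * (L * r)) * (5 * (L * r)) := by gcongr
      _ = 10 * L ^ 6 * n := by rw [← c.r_sq]; ring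
  have b3 : |2 * θ / n * ∑ u ∈ F, (deg H u : ℝ)| ≤ 2 * L ^ 6 := by
    rw [abs_mul, abs_div, abs_mul, abs_two, Nat.abs_cast, abs_of_nonneg h4']
    calc 2 * |θ| / n * ∑ u ∈ F, (deg H u : ℝ) ≤ 2 * L ^ 4 / n * (L ^ 2 * n) := by gcongr
      _ = 2 * L ^ 6 := by field_simp
  have hLL : 1 ≤ L ^ 19 := one_le_pow₀ hL1
  have h20 : L ^ 6 ≤ L ^ 19 := c.pow_le (by norm_num)
  calc _ ≤ (L ^ 19 * Dl n δ + 3) + (2 * (cod H j l + 2) + 10 * L ^ 6) + 2 * L ^ 6 := by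
        refine (abs_sub _ _).trans (add_le_add ((abs_add_le _ _).trans (add_le_add h1 ?_)) b3)
        refine (abs_add_le _ _).trans (add_le_add ?_ b2)
        rw [abs_neg]; exact b1
    _ ≤ 20 * L ^ 19 * Dl n δ + 2 * cod H j l := by nlinarith
    _ ≤ L ^ 21 * Dl n δ + L ^ 21 * cod H j l := by
        have : 1 ≤ L ^ 20 := one_le_pow₀ hL1
        have : 2 * L ^ 20 ≤ L ^ 21 := c.mul_pow_le (by norm_num) (by norm_num)
        gcongr
        · exact c.mul_pow_le (by norm_num) (by norm_num)
        · linarith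
    _ = _ := by ring

end SecondOrder

section SecondOrder
variable {n : ℕ} {𝒢 : Finset (SimpleGraph (Fin n))} {p δ R L Hm r : ℝ} {k : ℕ}
  {H Q H₀ Q₀ G : SimpleGraph (Fin n)} {j l v : Fin n}

lemma Ctx.s1_pos (c : Ctx 𝒢 p δ R L Hm r) : 0 < 2 * (p * (1 - p)) * n := by
  have hp := c.p_pos
  have hq := c.q_pos
  have hn := c.n_pos
  positivity

lemma Ctx.inv_s1_sq_le (c : Ctx 𝒢 p δ R L Hm r) : 1 / (2 * (p * (1 - p)) * n) ^ 2 ≤ L ^ 4 / (n : ℝ) ^ 2 := by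
  have h := c.s1_inv_le
  have hs := c.s1_pos
  calc 1 / (2 * (p * (1 - p)) * n) ^ 2 = (1 / (2 * (p * (1 - p)) * n)) ^ 2 := by rw [div_pow, one_pow]
    _ ≤ (L ^ 2 / n) ^ 2 := by gcongr
    _ = L ^ 4 / (n : ℝ) ^ 2 := by rw [div_pow, ← pow_mul]

lemma Ex_wt_fine (c : Ctx 𝒢 p δ R L Hm r) (a : Adm 𝒢 L Hm k H₀ Q₀)
    (hjl : j ≠ l) {F : Finset (Fin n)} (hF : (Fᶜ.card : ℝ) ≤ 5 * Hm) {T e : ℝ}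
    (h : |Ex (fam 𝒢 H₀ Q₀) (fun G => ((Sd j l F G).card : ℝ)) - (2 * (p * (1 - p)) * n - T)| ≤ e) :
    |Ex (fam 𝒢 H₀ Q₀) (wt L j l F) -
      (1 / (2 * (p * (1 - p)) * n) + T / (2 * (p * (1 - p)) * n) ^ 2)| ≤
      (L ^ 4 * e + L ^ 13) / (n : ℝ) ^ 2 := by
  have hn := c.n_pos
  have hr := c.r_pos
  have hL := c.L_pos
  have hL1 := c.one_le_L
  have hs := c.s1_pos
  have h1s := c.s1_inv_le
  have h2s := c.inv_s1_sq_le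
  have hnn := c.n_ge
  set s := 2 * (p * (1 - p)) * (n : ℝ) with hs1
  have hLr : L ^ 4 ≤ r := c.Lpow_le (by norm_num)
  have hrn : r ≤ n := by rw [← c.r_sq]; nlinarith [c.r_ge]
  have hdet : ∀ G ∈ fam 𝒢 H₀ Q₀, Good p L r G →
      |wt L j l F G - 2 / s + (Sd j l F G).card / s ^ 2| ≤ L ^ 12 / (n : ℝ) ^ 2 := by
    intro G hG hg
    rw [hg.wt_eq c (fam_subset hG) hjl hF]
    have h1 := hg.sd c (fam_subset hG) hjl hF
    have h2 := hg.inv_sd_le c (fam_subset hG) hjl hF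
    have h3 := hg.sd_ge c (fam_subset hG) hjl hF
    have hpos : (0 : ℝ) < (Sd j l F G).card := lt_of_lt_of_le (by rw [hs1] at hs; linarith) h3
    rw [← hs1] at h1
    have e1 : 1 / ((Sd j l F G).card : ℝ) - 2 / s + (Sd j l F G).card / s ^ 2 =
        ((Sd j l F G).card - s) ^ 2 * (1 / (Sd j l F G).card) * (1 / s ^ 2) := by
      field_simp
      ring
    rw [e1, abs_of_nonneg (by positivity), ← sq_abs]
    calc |((Sd j l F G).card : ℝ) - s| ^ 2 * (1 / (Sd j l F G).card) * (1 / s ^ 2) ≤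
          (L ^ 3 * r) ^ 2 * (L ^ 2 / n) * (L ^ 4 / (n : ℝ) ^ 2) := by gcongr
      _ = L ^ 12 / (n : ℝ) ^ 2 := by rw [← c.r_sq]; field_simp
  have hB : ∀ G ∈ fam 𝒢 H₀ Q₀, |wt L j l F G - 2 / s + (Sd j l F G).card / s ^ 2| ≤ 4 := by
    intro G _
    have h1 := wt_nonneg c j l F G
    have h2 := wt_le_one L j l F G
    have h3 : ((Sd j l F G).card : ℝ) ≤ n := by
      exact_mod_cast (Finset.card_le_univ _).trans (le_of_eq (Fintype.card_fin n))
    have h4 : ((Sd j l F G).card : ℝ) / s ^ 2 ≤ 1 := by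
      calc ((Sd j l F G).card : ℝ) / s ^ 2 = (Sd j l F G).card * (1 / s ^ 2) := by ring
        _ ≤ n * (L ^ 4 / (n : ℝ) ^ 2) := by gcongr
        _ = L ^ 4 / n := by field_simp
        _ ≤ 1 := by rw [div_le_one hn]; linarith
    have h5 : 2 / s ≤ 2 := by
      have : 1 / s ≤ 1 := h1s.trans (by
        rw [div_le_one hn]
        have := c.pow_le (show 2 ≤ 4 by norm_num)
        linarith)
      calc 2 / s = 2 * (1 / s) := by ring
        _ ≤ 2 * 1 := by gcongr
        _ = 2 := by norm_num
    have h6 : 0 ≤ ((Sd j l F G).card : ℝ) / s ^ 2 := by positivity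
    have h7 : 0 ≤ 2 / s := by positivity
    rw [abs_le]; constructor <;> linarith
  have h1 := abs_Ex_le_good_const c a hdet (by positivity) hB
  rw [Ex_add, Ex_sub, Ex_const a.nonempty] at h1
  have e2 : Ex (fam 𝒢 H₀ Q₀) (fun G => ((Sd j l F G).card : ℝ) / s ^ 2) =
      Ex (fam 𝒢 H₀ Q₀) (fun G => ((Sd j l F G).card : ℝ)) / s ^ 2 := by
    simp only [div_eq_mul_inv]
    rw [mul_comm, ← Ex_mul]
    exact Ex_congr fun G _ => mul_comm _ _
  rw [e2] at h1
  set W := Ex (fam 𝒢 H₀ Q₀) (wt L j l F)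
  set X := Ex (fam 𝒢 H₀ Q₀) (fun G => ((Sd j l F G).card : ℝ))
  have e3 : W - (1 / s + T / s ^ 2) = (W - 2 / s + X / s ^ 2) - (X - (s - T)) * (1 / s ^ 2) := by
    field_simp
    ring
  have he : 0 ≤ e := (abs_nonneg _).trans h
  rw [e3]
  refine (abs_sub _ _).trans ?_
  have h3 : |(X - (s - T)) * (1 / s ^ 2)| ≤ e * (L ^ 4 / (n : ℝ) ^ 2) := by
    rw [abs_mul, abs_of_nonneg (by positivity : 0 ≤ 1 / s ^ 2)]; gcongr
  have h4 : 4 / r ^ 20 ≤ L / (n : ℝ) ^ 2 := by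
    rw [← c.r_sq]
    have := c.L_ge
    have : (r ^ 2) ^ 2 ≤ r ^ 20 := by
      rw [← pow_mul]; exact pow_le_pow_right₀ (by linarith [c.r_ge]) (by norm_num)
    gcongr
    linarith
  calc _ ≤ (L ^ 12 / (n : ℝ) ^ 2 + L / (n : ℝ) ^ 2) + e * (L ^ 4 / (n : ℝ) ^ 2) := by linarith
    _ = (L ^ 4 * e + (L ^ 12 + L ^ 1)) / (n : ℝ) ^ 2 := by ring
    _ ≤ (L ^ 4 * e + L ^ 13) / (n : ℝ) ^ 2 := by
      gcongr
      have := c.pow_le (show 1 ≤ 12 by norm_num)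
      have : 2 * L ^ 12 ≤ L ^ 13 := c.mul_pow_le (by norm_num) (by norm_num)
      linarith

/-- The probability that the switching vertex is `v`, to second order. -/
noncomputable def psE (H : SimpleGraph (Fin n)) (p R : ℝ) (j l v : Fin n) : ℝ :=
  1 / n * (1 + (deg H j + deg H l) / n - (1 - 2 * p) / (p * (1 - p)) * (omg n p R * deg H v / n))

lemma psE_aux {P₁ P₂ W₁ W₂ S W es ew : ℝ} (h1 : |P₁ + P₂ - S| ≤ es) (hP₁ : 0 ≤ P₁) (hP₂ : 0 ≤ P₂)
    (hP₁' : P₁ ≤ 1) (hP₂' : P₂ ≤ 1) (hW₁ : |W₁ - W| ≤ ew) (hW₂ : |W₂ - W| ≤ ew) :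
    |P₁ * W₁ + P₂ * W₂ - S * W| ≤ 2 * ew + es * |W| := by
  have e : P₁ * W₁ + P₂ * W₂ - S * W = P₁ * (W₁ - W) + P₂ * (W₂ - W) + (P₁ + P₂ - S) * W := by ring
  have hew : 0 ≤ ew := (abs_nonneg _).trans hW₁
  rw [e]
  refine (abs_add_three _ _ _).trans ?_
  rw [abs_mul, abs_mul, abs_mul, abs_of_nonneg hP₁, abs_of_nonneg hP₂]
  calc _ ≤ 1 * ew + 1 * ew + es * |W| := by gcongr
    _ = _ := by ring

set_option maxHeartbeats 1000000 in
lemma Ex_ind_wt_fine (c : Ctx 𝒢 p δ R L Hm r) (a : Adm 𝒢 L Hm (k + 6) H Q) (hjl : j ≠ l)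
    (hFr : Fr j l (H ⊔ Q) = Fr j l H) (hv : v ∈ Fr j l H) :
    |Ex (fam 𝒢 H Q) (fun G => ind (v ∈ Sd j l (Fr j l H) G) * wt L j l (Fr j l H) G) -
      psE H p R j l v| ≤ L ^ 27 * (Dl n δ + cod H j l) / (n : ℝ) ^ 2 := by
  have hn := c.n_pos
  have hr := c.r_pos
  have hL := c.L_pos
  have hL1 := c.one_le_L
  have hD := one_le_Dl c
  have hp := c.p_pos
  have hq := c.q_pos
  have hp1 := c.p_lt
  have hHm := c.Hm_le
  have hω := abs_omg_le c a.ne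
  have hc0 := cod_nonneg (H := H) j l
  have hΛ := c.Λ_lt
  have hs := c.s1_pos
  have h1s := c.s1_inv_le
  have h2s := c.inv_s1_sq_le
  have hv' : v ∈ Fr j l (H ⊔ Q) := hFr ▸ hv
  have hF : ((Fr j l H)ᶜ.card : ℝ) ≤ 5 * Hm := hFr ▸ card_compl_Fr_le_Hm c a j l
  have hH : ∀ x, (deg H x : ℝ) + 4 ≤ Hm := fun x => by
    have := a.deg_le x; push_cast at this
    have : (0 : ℝ) ≤ k := Nat.cast_nonneg _
    linarith
  have hS : ∑ x, (deg H x : ℝ) ≤ L ^ 2 * n := by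
    have := a.sum_le; push_cast at this
    have : (0 : ℝ) ≤ k := Nat.cast_nonneg _
    linarith
  obtain ⟨hvj, hvl, g1, g2⟩ := mem_Fr.1 hv'
  rw [SimpleGraph.sup_adj, not_or] at g1 g2
  have a1 : Adm 𝒢 L Hm (k + 4) (H ⊔ SimpleGraph.edge j v) (Q ⊔ SimpleGraph.edge l v) :=
    a.addAddQ c hjl hv'
  have a2 : Adm 𝒢 L Hm (k + 4) (H ⊔ SimpleGraph.edge l v) (Q ⊔ SimpleGraph.edge j v) :=
    a.addAddQ' c hjl hv'
  have hsub : ∀ {x y : Fin n}, x ≠ y → v ≠ x → v ≠ y → ∀ u ∈ Fr x y (H ⊔ Q), u ≠ v →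
      u ∈ Fr x y ((H ⊔ SimpleGraph.edge x v) ⊔ (Q ⊔ SimpleGraph.edge y v)) := by
    intro x y hxy hvx hvy u hu huv
    rw [mem_Fr] at hu ⊢
    obtain ⟨hux, huy, k1, k2⟩ := hu
    rw [SimpleGraph.sup_adj, not_or] at k1 k2
    refine ⟨hux, huy, ?_, ?_⟩ <;>
    · rw [SimpleGraph.sup_adj, sup_edge_adj_iff hvx.symm, sup_edge_adj_iff hvy.symm]
      tauto
  have hdeg : ∀ {x : Fin n}, v ≠ x → ¬ H.Adj x v → ∀ u,
      |(deg (H ⊔ SimpleGraph.edge x v) u : ℝ) - deg H u| ≤ 2 := by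
    intro x hvx hx u
    have h1 := deg_sup_edge_le hvx.symm hx u
    have h2 : (deg H u : ℝ) ≤ deg (H ⊔ SimpleGraph.edge x v) u := by
      exact_mod_cast deg_le_deg_sup H _ u
    rw [abs_le]; constructor <;> linarith
  have w1 := Ex_wt_fine c a1 hjl hF (Ex_card_Sd_fine (v := v) c a1 hjl hH hS
    (fun u hu huv => hsub hjl hvj hvl u (hFr ▸ hu) huv) (hdeg hvj g1.1))
  have w2 := Ex_wt_fine c a2 hjl hF (Ex_card_Sd_fine (v := v) c a2 hjl hH hS
    (fun u hu huv => by
      have := hsub hjl.symm hvl hvj u (by rw [Fr_comm, hFr]; exact hu) huv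
      rwa [Fr_comm]) (hdeg hvl g2.1))
  have bd : ∀ x, |(deg H x : ℝ) + deg H v - (deg H x + deg H v)| ≤ 4 := fun x => by
    rw [sub_self, abs_zero]; norm_num
  have bh : ∀ x, |(deg H x : ℝ) + deg H v| ≤ 4 * Hm := fun x => by
    rw [abs_of_nonneg (by positivity)]
    linarith [hH x, hH v, c.Hm_ge]
  have hst := status_first (k := k + 2) c a hjl hv' (bd j) (bd l) (bh j) (bh l)
  have hEx := Ex_ind_Sd_mul (k := k + 4) c a hjl hv' (wt L j l (Fr j l H))
  rw [hFr] at hEx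
  rw [hEx]
  have hpr : ∀ {H' Q' : SimpleGraph (Fin n)} {x y : Fin n}, (fam 𝒢 H' Q').Nonempty → 
      0 ≤ pr 𝒢 H' Q' x y ∧ pr 𝒢 H' Q' x y ≤ 1 := fun h => ⟨pr_nonneg _ _, pr_le_one h _ _⟩
  have aj : Adm 𝒢 L Hm (k + 5) (H ⊔ SimpleGraph.edge j v) Q := Adm.add c a hvj.symm g1.1 g1.2
  have al : Adm 𝒢 L Hm (k + 5) (H ⊔ SimpleGraph.edge l v) Q := Adm.add c a hvl.symm g2.1 g2.2
  have q1 := hpr (x := j) (y := v) a.nonempty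
  have q2 := hpr (x := l) (y := v) a.nonempty
  have q3 := hpr (x := l) (y := v) aj.nonempty
  have q4 := hpr (x := j) (y := v) al.nonempty
  have main := psE_aux hst (mul_nonneg q1.1 (by linarith)) (mul_nonneg q2.1 (by linarith))
    (by nlinarith) (by nlinarith) w1 w2
  set θ := (1 - 2 * p) * omg n p R with hθ
  set hh := (deg H j : ℝ) + deg H l with hhh
  set s := 2 * (p * (1 - p)) * (n : ℝ) with hs1
  have hθ1 : |θ| ≤ L ^ 4 := by
    rw [hθ, abs_mul]
    have : |1 - 2 * p| ≤ 1 := by rw [abs_le]; constructor <;> linarith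
    calc |1 - 2 * p| * |omg n p R| ≤ 1 * L ^ 4 := by gcongr
      _ = L ^ 4 := one_mul _
  have hdegn : ∀ x, (deg H x : ℝ) ≤ L * r := fun x => by linarith [hH x]
  have hh0 : 0 ≤ hh := by positivity
  have hh1 : hh ≤ 2 * (L * r) := by linarith [hdegn j, hdegn l]
  have hL4 : 1 ≤ L ^ 4 := one_le_pow₀ hL1
  have hT : |(2 * (p * (1 - p)) + θ) * hh| ≤ 6 * L ^ 5 * r := by
    rw [abs_mul, abs_of_nonneg hh0]
    have : |2 * (p * (1 - p)) + θ| ≤ 3 * L ^ 4 := by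
      refine (abs_add_le _ _).trans ?_
      rw [abs_of_nonneg (by have := mul_pos hp hq; positivity)]
      linarith
    calc _ ≤ 3 * L ^ 4 * (2 * (L * r)) := by gcongr
      _ = _ := by ring
  have hT2 : |(2 * (p * (1 - p)) + θ) * hh / s ^ 2| ≤ 6 * L ^ 9 * r / (n : ℝ) ^ 2 := by
    rw [abs_div, abs_of_nonneg (by positivity : 0 ≤ s ^ 2), div_eq_mul_one_div]
    calc _ ≤ 6 * L ^ 5 * r * (L ^ 4 / (n : ℝ) ^ 2) := by gcongr
      _ = _ := by ring
  have hW : |1 / s + (2 * (p * (1 - p)) + θ) * hh / s ^ 2| ≤ L ^ 3 / n := by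
    refine (abs_add_le _ _).trans ?_
    rw [abs_of_nonneg (by positivity : 0 ≤ 1 / s)]
    have h9 : 6 * L ^ 9 * r / (n : ℝ) ^ 2 ≤ 1 / n := by
      rw [div_le_div_iff₀ (by positivity) hn, one_mul, sq]
      have : 6 * L ^ 9 ≤ r := (c.mul_pow_le (b := 10) (by norm_num) (by norm_num)).trans (c.Lpow_le (by norm_num))
      gcongr
      calc 6 * L ^ 9 * r ≤ r * r := by gcongr
        _ = n := by rw [← c.r_sq]; ring
    have h10 : L ^ 2 + 1 ≤ L ^ 3 := by
      have : 2 * L ^ 2 ≤ L ^ 3 := c.mul_pow_le (by norm_num) (by norm_num)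
      have : 1 ≤ L ^ 2 := one_le_pow₀ hL1
      linarith
    calc _ ≤ L ^ 2 / n + 1 / n := add_le_add h1s (hT2.trans h9)
      _ = (L ^ 2 + 1) / n := by ring
      _ ≤ L ^ 3 / n := by gcongr
  set S := 2 * (p * (1 - p)) - θ * ((deg H j : ℝ) + deg H v + (deg H l + deg H v)) / n with hS'
  set W := 1 / s + (2 * (p * (1 - p)) + θ) * hh / s ^ 2 with hW'
  have e1 : S * W - psE H p R j l v =
      -(θ * ((deg H j : ℝ) + deg H v + (deg H l + deg H v)) / n * ((2 * (p * (1 - p)) + θ) * hh / s ^ 2)) := by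
    rw [hS', hW', hs1, psE, ← hhh]
    have e0 : (1 - 2 * p) / (p * (1 - p)) * (omg n p R * deg H v / n) = θ * deg H v / (p * (1 - p) * n) := by
      rw [hθ]; field_simp
    rw [e0, show (deg H j : ℝ) + deg H v + (deg H l + deg H v) = hh + 2 * deg H v by rw [hhh]; ring]
    field_simp
    ring
  have h5 : |S * W - psE H p R j l v| ≤ L ^ 16 / (n : ℝ) ^ 2 := by
    rw [e1, abs_neg, abs_mul, abs_div, Nat.abs_cast, abs_mul,
      abs_of_nonneg (by positivity : (0 : ℝ) ≤ deg H j + deg H v + (deg H l + deg H v))]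
    calc _ ≤ L ^ 4 * (L * r + L * r + (L * r + L * r)) / n * (6 * L ^ 9 * r / (n : ℝ) ^ 2) := by
          gcongr <;> exact hdegn _
      _ = 24 * L ^ 14 / (n : ℝ) ^ 2 := by rw [← c.r_sq]; field_simp; ring
      _ ≤ L ^ 16 / (n : ℝ) ^ 2 := by
          gcongr; exact c.mul_pow_le (by norm_num) (by norm_num)
  refine (abs_sub_le _ (S * W) _).trans ((add_le_add main h5).trans ?_)
  have hL22 : L ^ 22 ≤ L ^ 25 := c.pow_le (by norm_num)
  have hL13 : L ^ 13 ≤ L ^ 25 := c.pow_le (by norm_num)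
  have hL16 : L ^ 16 ≤ L ^ 25 := c.pow_le (by norm_num)
  have hL27 : 6 * L ^ 25 ≤ L ^ 27 := c.mul_pow_le (by norm_num) (by norm_num)
  calc _ ≤ 2 * ((L ^ 4 * (L ^ 21 * (Dl n δ + cod H j l)) + L ^ 13) / (n : ℝ) ^ 2) +
        L ^ 19 * Dl n δ / n * (L ^ 3 / n) + L ^ 16 / (n : ℝ) ^ 2 := by gcongr
    _ = (2 * L ^ 25 * (Dl n δ + cod H j l) + 2 * L ^ 13 + L ^ 22 * Dl n δ + L ^ 16) / (n : ℝ) ^ 2 := by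
        field_simp
    _ ≤ (6 * L ^ 25 * (Dl n δ + cod H j l)) / (n : ℝ) ^ 2 := by
        gcongr
        have x1 : L ^ 22 * Dl n δ ≤ L ^ 25 * (Dl n δ + cod H j l) := by gcongr; linarith
        have x2 : L ^ 25 * 1 ≤ L ^ 25 * (Dl n δ + cod H j l) := by gcongr; linarith
        linarith
    _ ≤ _ := by gcongr

end SecondOrder

/-- The sum of the degrees of the neighbours of `j`. -/
noncomputable def gs {n : ℕ} (H : SimpleGraph (Fin n)) (j : Fin n) : ℝ := ∑ w, ad H j w * deg H w

section SecondOrder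
variable {n : ℕ} {𝒢 : Finset (SimpleGraph (Fin n))} {p δ R L Hm r : ℝ} {k : ℕ}
  {H Q H₀ Q₀ G : SimpleGraph (Fin n)} {j l v : Fin n}

lemma gs_nonneg (H : SimpleGraph (Fin n)) (j : Fin n) : 0 ≤ gs H j :=
  Finset.sum_nonneg fun _ _ => mul_nonneg (ad_nonneg _ _ _) (Nat.cast_nonneg _)

lemma gs_le (a : Adm 𝒢 L Hm k H Q) (j : Fin n) : gs H j ≤ L ^ 2 * n := by
  have h1 : gs H j ≤ ∑ w, (deg H w : ℝ) := Finset.sum_le_sum fun w _ => by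
    have := ad_le_one H j w
    have h : (0 : ℝ) ≤ deg H w := Nat.cast_nonneg _
    nlinarith
  have h2 := a.sum_le
  have : (0 : ℝ) ≤ k := Nat.cast_nonneg _
  linarith

lemma Adm.deg_le_Lr (c : Ctx 𝒢 p δ R L Hm r) (a : Adm 𝒢 L Hm k H Q) (j : Fin n) : (deg H j : ℝ) ≤ L * r := by
  have := a.deg_le j
  have := c.Hm_le
  have : (0 : ℝ) ≤ k := Nat.cast_nonneg _
  linarith

lemma abs_psE_sub_le (c : Ctx 𝒢 p δ R L Hm r) (a : Adm 𝒢 L Hm k H Q) (j l v : Fin n) :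
    |psE H p R j l v - 1 / n| ≤ L ^ 8 / r ^ 3 := by
  have hn := c.n_pos
  have hr := c.r_pos
  have hL := c.L_pos
  have hp := c.p_pos
  have hq := c.q_pos
  have hp1 := c.p_lt
  have hω := abs_omg_le c a.ne
  have hΛ := c.inv_Λ_le
  have hd := fun x => a.deg_le_Lr c x
  have e : psE H p R j l v - 1 / n = 1 / n * ((deg H j + deg H l) / n) -
      1 / n * ((1 - 2 * p) * (1 / (p * (1 - p))) * (omg n p R * deg H v / n)) := by
    rw [psE]; ring
  rw [e]
  refine (abs_sub _ _).trans ?_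
  have h1 : |1 / (n : ℝ) * ((deg H j + deg H l) / n)| ≤ 2 * L / r ^ 3 := by
    rw [abs_of_nonneg (by positivity)]
    calc 1 / (n : ℝ) * ((deg H j + deg H l) / n) ≤ 1 / n * ((L * r + L * r) / n) := by
          gcongr <;> exact hd _
      _ = 2 * L / r ^ 3 := by rw [← c.r_sq]; field_simp; ring
  have h2 : |1 / (n : ℝ) * ((1 - 2 * p) * (1 / (p * (1 - p))) * (omg n p R * deg H v / n))| ≤ L ^ 7 / r ^ 3 := by
    have : |1 - 2 * p| ≤ 1 := by rw [abs_le]; constructor <;> linarith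
    have h4 : 0 ≤ 1 / (p * (1 - p)) := by have := mul_pos hp hq; positivity
    rw [abs_mul, abs_mul, abs_mul, abs_div (omg n p R * _), abs_mul (omg n p R), Nat.abs_cast, Nat.abs_cast,
      abs_of_nonneg (by positivity : 0 ≤ 1 / (n : ℝ)), abs_of_nonneg h4]
    calc _ ≤ 1 / (n : ℝ) * (1 * L ^ 2 * (L ^ 4 * (L * r) / n)) := by gcongr; exact hd _
      _ = L ^ 7 / r ^ 3 := by rw [← c.r_sq]; field_simp
  calc _ ≤ 2 * L / r ^ 3 + L ^ 7 / r ^ 3 := add_le_add h1 h2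
    _ = (2 * L ^ 1 + L ^ 7) / r ^ 3 := by ring
    _ ≤ L ^ 8 / r ^ 3 := by
      gcongr
      have := c.pow_le (show 1 ≤ 7 by norm_num)
      have : 3 * L ^ 7 ≤ L ^ 8 := c.mul_pow_le (by norm_num) (by norm_num)
      linarith

lemma abs_psE_le (c : Ctx 𝒢 p δ R L Hm r) (a : Adm 𝒢 L Hm k H Q) (j l v : Fin n) :
    |psE H p R j l v| ≤ 2 / n := by
  have h := abs_psE_sub_le c a j l v
  have hn := c.n_pos
  have hr := c.r_pos
  have h2 : L ^ 8 / r ^ 3 ≤ 1 / n := by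
    rw [div_le_div_iff₀ (by positivity) hn, ← c.r_sq, one_mul]
    have := c.Lpow_le (show 8 ≤ 400 by norm_num)
    calc L ^ 8 * r ^ 2 ≤ r * r ^ 2 := by gcongr
      _ = r ^ 3 := by ring
  calc |psE H p R j l v| = |(psE H p R j l v - 1 / n) + 1 / n| := by congr 1; ring
    _ ≤ 1 / n + 1 / n := by
      refine (abs_add_le _ _).trans (add_le_add (h.trans h2) ?_)
      rw [abs_of_pos (by positivity)]
    _ = 2 / n := by ring

lemma Ex_nad_ind_wt_fine (c : Ctx 𝒢 p δ R L Hm r) (a : Adm 𝒢 L Hm (k + 7) H ⊥) (hjl : j ≠ l)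
    (hv : v ∈ Fr j l H) {w : Fin n} (hw : w ∉ Fr j l H) (hwl : w ≠ l) (hH : ¬ H.Adj l w) :
    |Ex (fam 𝒢 H ⊥) (fun G => (1 - ad G l w) *
      (ind (v ∈ Sd j l (Fr j l H) G) * wt L j l (Fr j l H) G)) -
      (1 - p + omg n p R * (deg H l + deg H w) / n) * psE H p R j l v| ≤
      L ^ 28 * (Dl n δ + cod H j l) / (n : ℝ) ^ 2 := by
  have e1 : Fr j l (H ⊔ (⊥ ⊔ SimpleGraph.edge l w)) = Fr j l H := by
    rw [bot_sup_eq]; exact Fr_sup_edge_eq hw hwl hjl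
  have a' : Adm 𝒢 L Hm (k + 6) H (⊥ ⊔ SimpleGraph.edge l w) := Adm.addQ c a hwl.symm hH (by simp)
  have h1 := Ex_ind_wt_fine c a' hjl e1 hv
  have h2 := pr_first (k := k + 4) c a hwl.symm hH (by simp)
  have h3 := abs_psE_le c a j l v
  have hn := c.n_pos
  have hL := c.L_pos
  have hD := one_le_Dl c
  have hc0 := cod_nonneg (H := H) j l
  rw [Ex_nad_mul' a hwl.symm]
  set x := Ex (fam 𝒢 H (⊥ ⊔ SimpleGraph.edge l w)) (fun G => ind (v ∈ Sd j l (Fr j l H) G) *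
    wt L j l (Fr j l H) G)
  set y := pr 𝒢 H ⊥ l w
  set z := psE H p R j l v
  have hy : |1 - y| ≤ 1 := by
    rw [abs_le]; constructor <;> linarith [pr_nonneg (𝒢 := 𝒢) (H := H) (Q := ⊥) l w,
      pr_le_one (𝒢 := 𝒢) a.nonempty l w]
  have e2 : (1 - y) * x - (1 - p + omg n p R * (deg H l + deg H w) / n) * z =
    (1 - y) * (x - z) - (y - (p - omg n p R * (deg H l + deg H w) / n)) * z := by ring
  rw [e2]
  refine (abs_sub _ _).trans ?_
  rw [abs_mul, abs_mul]
  calc _ ≤ 1 * (L ^ 27 * (Dl n δ + cod H j l) / (n : ℝ) ^ 2) + L ^ 16 * Dl n δ / n * (2 / n) := by gcongr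
    _ = (L ^ 27 * (Dl n δ + cod H j l) + 2 * L ^ 16 * Dl n δ) / (n : ℝ) ^ 2 := by field_simp
    _ ≤ (L ^ 27 * (Dl n δ + cod H j l) + L ^ 27 * (Dl n δ + cod H j l)) / (n : ℝ) ^ 2 := by
        gcongr
        · exact c.mul_pow_le (by norm_num) (by norm_num)
        · linarith
    _ = 2 * L ^ 27 * (Dl n δ + cod H j l) / (n : ℝ) ^ 2 := by ring
    _ ≤ _ := by gcongr; exact c.mul_pow_le (by norm_num) (by norm_num)

lemma Ex_kap_wt_fine (c : Ctx 𝒢 p δ R L Hm r) (a : Adm 𝒢 L Hm (k + 7) H ⊥) (hjl : j ≠ l)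
    (hv : v ∈ Fr j l H) :
    |Ex (fam 𝒢 H ⊥) (fun G => kap H j l G *
      (ind (v ∈ Sd j l (Fr j l H) G) * wt L j l (Fr j l H) G)) -
      psE H p R j l v * ((1 - p) * (deg H j - deg H l) + omg n p R * (gs H j - gs H l) / n)| ≤
      (deg H j + deg H l) * (L ^ 28 * (Dl n δ + cod H j l) / (n : ℝ) ^ 2) +
        L ^ 7 / r ^ 3 * (cod H j l + 1) := by
  have hn := c.n_pos
  have hr := c.r_pos
  have hL := c.L_pos
  have hD := one_le_Dl c
  have hp := c.p_pos
  have hq := c.q_pos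
  have hc0 := cod_nonneg (H := H) j l
  have hz := abs_psE_le c a j l v
  have hd : ∀ x, (deg H x : ℝ) ≤ Hm := fun x => by
    have := a.deg_le x
    have : (0 : ℝ) ≤ ((k + 7 : ℕ) : ℝ) := Nat.cast_nonneg _
    linarith
  have hd0 : ∀ x, (0 : ℝ) ≤ deg H x := fun x => Nat.cast_nonneg _
  set z := psE H p R j l v
  have small : 4 * L ^ 5 / r ≤ 1 := by
    rw [div_le_one hr]
    exact (c.mul_pow_le (b := 6) (by norm_num) (by norm_num)).trans (c.Lpow_le (by norm_num))
  have hB : ∀ x w, |(1 - p + omg n p R * (deg H x + deg H w) / n) * z| ≤ L ^ 2 / n := by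
    intro x w
    have h1 := (abs_omg_mul_le c a.ne (y := deg H x + deg H w) (by
      rw [abs_of_nonneg (by positivity)]; linarith [hd x, hd w, hd0 x])).trans small
    rw [abs_mul]
    have h2 : |1 - p + omg n p R * (deg H x + deg H w) / n| ≤ 2 := by
      refine (abs_add_le _ _).trans ?_
      rw [abs_of_pos hq]; linarith
    calc _ ≤ 2 * (2 / (n : ℝ)) := by gcongr
      _ = 4 * L ^ 0 / n := by ring
      _ ≤ L ^ 2 / n := by gcongr; exact c.mul_pow_le (by norm_num) (by norm_num)
  have hdiff : ∀ y : ℝ, |y| ≤ 4 * Hm → |omg n p R * y / n * z| ≤ L ^ 7 / r ^ 3 := by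
    intro y hy
    have h1 := abs_omg_mul_le c a.ne hy
    rw [abs_mul]
    calc _ ≤ 4 * L ^ 5 / r * (2 / n) := by gcongr
      _ = 8 * L ^ 5 / r ^ 3 := by rw [← c.r_sq]; field_simp; norm_num
      _ ≤ L ^ 7 / r ^ 3 := by gcongr; exact c.mul_pow_le (by norm_num) (by norm_num)
  have main := Ex_kap_near (H := H) (Q := ⊥) (K := fam 𝒢 H ⊥)
    (f := fun G => ind (v ∈ Sd j l (Fr j l H) G) * wt L j l (Fr j l H) G)
    (y := fun w => (1 - p + omg n p R * (deg H l + deg H w) / n) * z)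
    (y' := fun w => (1 - p + omg n p R * (deg H j + deg H w) / n) * z)
    (e := L ^ 28 * (Dl n δ + cod H j l) / (n : ℝ) ^ 2) (B := L ^ 2 / n) (d := L ^ 7 / r ^ 3)
    hjl a.nonempty (by positivity) (by positivity)
    (fun G hG u w h => (mem_fam.1 hG).2.1 u w h)
    (fun w h1 h2 h3 _ => Ex_nad_ind_wt_fine c a hjl hv (fun h => (mem_Fr.1 h).2.2.1 h1) h2 h3)
    (fun w h1 h2 h3 _ => by
      have h := Ex_nad_ind_wt_fine (j := l) (l := j) (v := v) (w := w) c a hjl.symm (Fr_comm l j H ▸ hv)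
        (fun h => (mem_Fr.1 h).2.2.1 h1) h2 h3
      have e2 : cod H l j = cod H j l := Finset.sum_congr rfl fun _ _ => mul_comm _ _
      have e3 : psE H p R l j v = psE H p R j l v := by rw [psE, psE, add_comm (deg H l : ℝ)]
      have e4 : wt L l j (Fr j l H) = wt L j l (Fr j l H) := funext fun G => wt_comm _ _ _ _ _
      rw [Fr_comm l j, e2, e3, e4] at h
      simpa only [Sd_comm l j] using h)
    (fun G _ => by
      have h1 := wt_nonneg c j l (Fr j l H) G
      have h2 := wt_le L j l (Fr j l H) G
      have h3 := ind_nonneg (v ∈ Sd j l (Fr j l H) G)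
      have h4 := ind_le_one (v ∈ Sd j l (Fr j l H) G)
      rw [abs_of_nonneg (by positivity)]
      nlinarith)
    (fun w => hB l w) (fun w => hB j w)
    (fun w _ _ => by
      convert hdiff ((deg H l : ℝ) - deg H j) (by
        rw [abs_le]; constructor <;> linarith [hd l, hd j, hd0 l, hd0 j, c.Hm_ge]) using 2
      ring)
    (fun _ => by
      convert hdiff (2 * ((deg H l : ℝ) - deg H j)) (by
        rw [abs_le]; constructor <;> linarith [hd l, hd j, hd0 l, hd0 j, c.Hm_ge]) using 2
      ring)
  have e1 : ∀ x y : Fin n, ∑ w, ad H x w * ((1 - p + omg n p R * (deg H y + deg H w) / n) * z) =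
      z * ((1 - p) * deg H x + omg n p R * (deg H x * deg H y + gs H x) / n) := by
    intro x y
    have : ∀ w, ad H x w * ((1 - p + omg n p R * (deg H y + deg H w) / n) * z) =
        ad H x w * (z * (1 - p + omg n p R * deg H y / n)) +
          (ad H x w * deg H w) * (z * (omg n p R / n)) := fun w => by ring
    simp only [this]
    rw [Finset.sum_add_distrib, ← Finset.sum_mul, ← Finset.sum_mul, ← deg_eq_sum, ← gs]
    ring
  rw [e1 j l, e1 l j, deg_bot, deg_bot] at main
  have e5 : z * ((1 - p) * deg H j + omg n p R * (deg H j * deg H l + gs H j) / n) -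
      z * ((1 - p) * deg H l + omg n p R * (deg H l * deg H j + gs H l) / n) =
      z * ((1 - p) * (deg H j - deg H l) + omg n p R * (gs H j - gs H l) / n) := by ring
  rw [e5] at main
  refine main.trans ?_
  have := ad_le_one H j l
  push_cast
  rw [add_zero, mul_zero, add_zero]
  gcongr

end SecondOrder

/-- The dependence on `j` of the second order approximation of `pr j v`. -/
noncomputable def Psi {n : ℕ} (H : SimpleGraph (Fin n)) (p R : ℝ) (v j : Fin n) : ℝ :=
  -((1 - p) * deg H j / n) + R * deg H j / (p * n ^ 2) - (1 - p) * (deg H j ^ 2 + gs H j) / n ^ 2 +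
    (1 - p) * (1 - 2 * p) / p * deg H j * deg H v / n ^ 2

section Fine
variable {n : ℕ} {𝒢 : Finset (SimpleGraph (Fin n))} {p δ R L Hm r : ℝ} {k : ℕ}
  {H Q G : SimpleGraph (Fin n)} {j l v : Fin n}

lemma abs_gs_sub_le (a : Adm 𝒢 L Hm k H Q) (j l : Fin n) : |gs H j - gs H l| ≤ L ^ 2 * n := by
  rw [abs_le]
  constructor <;> linarith [gs_nonneg H j, gs_nonneg H l, gs_le a j, gs_le a l]

/-- A quadratic error weighted with a sum of neighbouring degrees is absorbed in the cubic one. -/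
lemma Ctx.absorb_gs (c : Ctx 𝒢 p δ R L Hm r) {g : ℝ} (h0 : 0 ≤ g) (h1 : g ≤ 2 * (L ^ 2 * n)) :
    L * δ ^ 2 * g / r ^ 6 ≤ δ ^ 3 * g / r ^ 6 + L ^ 6 / r ^ 3 := by
  have hL := c.L_pos
  have hr := c.r_pos
  have hδ := c.δ_nonneg
  rcases le_total L δ with h | h
  · have : L * δ ^ 2 * g ≤ δ ^ 3 * g := by
      rw [pow_succ δ 2, mul_comm (δ ^ 2)]; gcongr
    have h2 : L * δ ^ 2 * g / r ^ 6 ≤ δ ^ 3 * g / r ^ 6 := div_le_div_of_nonneg_right this (by positivity)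
    have : 0 ≤ L ^ 6 / r ^ 3 := by positivity
    linarith
  · have h2 : L * δ ^ 2 * g / r ^ 6 ≤ L ^ 6 / r ^ 3 := by
      calc L * δ ^ 2 * g / r ^ 6 ≤ L * L ^ 2 * (2 * (L ^ 2 * n)) / r ^ 6 := by gcongr
        _ = 2 * L ^ 5 / r ^ 3 * (1 / r) := by rw [← c.r_sq]; field_simp
        _ ≤ 2 * L ^ 5 / r ^ 3 * 1 := by
          gcongr
          rw [div_le_one hr]; linarith [c.r_ge]
        _ ≤ L ^ 6 / r ^ 3 := by
          rw [mul_one]; gcongr; exact c.mul_pow_le (by norm_num) (by norm_num)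
    have : 0 ≤ δ ^ 3 * g / r ^ 6 := by positivity
    linarith

lemma psE_mul_sub_Psi (c : Ctx 𝒢 p δ R L Hm r) (j l v : Fin n) :
    R * (deg H j - deg H l) / (p * n ^ 2) -
      psE H p R j l v * ((1 - p) * (deg H j - deg H l) + omg n p R * (gs H j - gs H l) / n) -
      (Psi H p R v j - Psi H p R v l) =
    -((1 - 2 * p) / p * (R / (p * n)) * (deg H v * (deg H j - deg H l)) / n ^ 2) -
      (psE H p R j l v - 1 / n) * omg n p R * (gs H j - gs H l) / n +
      R / (p * n) * (gs H j - gs H l) / n ^ 2 := by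
  have hn := c.n_pos
  have hp := c.p_pos
  have hq := c.q_pos
  simp only [psE, Psi, omg]
  field_simp
  ring

lemma abs_psE_mul_sub_Psi_le (c : Ctx 𝒢 p δ R L Hm r) (a : Adm 𝒢 L Hm k H Q) (j l v : Fin n) :
    |R * (deg H j - deg H l) / (p * n ^ 2) -
      psE H p R j l v * ((1 - p) * (deg H j - deg H l) + omg n p R * (gs H j - gs H l) / n) -
      (Psi H p R v j - Psi H p R v l)| ≤
      3 * (δ ^ 3 * (deg H j ^ 2 + deg H l ^ 2 + deg H v ^ 2 + gs H j + gs H l) / r ^ 6) +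
        L ^ 16 / r ^ 3 := by
  have hn := c.n_pos
  have hr := c.r_pos
  have hL := c.L_pos
  have hp := c.p_pos
  have hq := c.q_pos
  have hp1 := c.p_lt
  have hδ := c.δ_nonneg
  have hω := abs_omg_le c a.ne
  have hip := c.inv_p_le
  have hR0 := c.R_nonneg a.ne
  have hR := c.R_le a.ne
  have hg := abs_gs_sub_le a j l
  have gj := gs_nonneg H j
  have gl := gs_nonneg H l
  have hj : (0 : ℝ) ≤ deg H j := Nat.cast_nonneg _
  have hl : (0 : ℝ) ≤ deg H l := Nat.cast_nonneg _
  have hv : (0 : ℝ) ≤ deg H v := Nat.cast_nonneg _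
  have hρ : R / (p * n) ≤ L * δ ^ 2 / n := by
    calc R / (p * n) = 1 / p * R / n := by field_simp
      _ ≤ L * δ ^ 2 / n := by gcongr
  have hρ0 : 0 ≤ R / (p * n) := by positivity
  rw [psE_mul_sub_Psi c]
  have t1 : |(1 - 2 * p) / p * (R / (p * n)) * (deg H v * (deg H j - deg H l)) / n ^ 2| ≤
      3 * (δ ^ 3 * (deg H j ^ 2 + deg H l ^ 2 + deg H v ^ 2) / r ^ 6) + L ^ 10 / r ^ 3 := by
    have hy : (deg H j + deg H l + deg H v : ℝ) ≤ 4 * Hm := by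
      linarith [a.deg_le_Hm j, a.deg_le_Hm l, a.deg_le_Hm v, c.Hm_ge]
    have h := c.absorb_sq_sq (by positivity) hy 2
    have h2 : δ ^ 3 * (deg H j + deg H l + deg H v : ℝ) ^ 2 / r ^ 6 ≤
        3 * (δ ^ 3 * (deg H j ^ 2 + deg H l ^ 2 + deg H v ^ 2) / r ^ 6) := by
      rw [← mul_div_assoc, mul_left_comm]
      gcongr
      nlinarith [sq_nonneg ((deg H j : ℝ) - deg H l), sq_nonneg ((deg H j : ℝ) - deg H v),
        sq_nonneg ((deg H l : ℝ) - deg H v)]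
    have hd : |(deg H j : ℝ) - deg H l| ≤ deg H j + deg H l + deg H v :=
      abs_sub_le_iff.2 ⟨by linarith, by linarith⟩
    have hp2 : |1 - 2 * p| ≤ 1 := abs_le.2 ⟨by linarith, by linarith⟩
    rw [abs_div, abs_mul, abs_mul, abs_mul, abs_div, abs_of_nonneg hρ0, abs_of_nonneg hv, abs_of_pos hp,
      abs_of_nonneg (by positivity : (0:ℝ) ≤ n ^ 2)]
    have e : L * (L * δ ^ 2 / n) * ((deg H j + deg H l + deg H v) * (deg H j + deg H l + deg H v)) / n ^ 2 =
        L ^ 2 * δ ^ 2 * (deg H j + deg H l + deg H v : ℝ) ^ 2 / r ^ 6 := by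
      rw [← c.r_sq]; field_simp
    have h3 : |1 - 2 * p| / p ≤ L := (div_le_div_of_nonneg_right hp2 hp.le).trans hip
    have h4 : |1 - 2 * p| / p * (R / (p * n)) * (deg H v * |(deg H j : ℝ) - deg H l|) / n ^ 2 ≤
        L * (L * δ ^ 2 / n) * ((deg H j + deg H l + deg H v) * (deg H j + deg H l + deg H v)) / n ^ 2 := by
      gcongr
      linarith
    norm_num at h
    linarith
  have t2 : |(psE H p R j l v - 1 / n) * omg n p R * (gs H j - gs H l) / n| ≤ L ^ 14 / r ^ 3 := by
    rw [abs_div, abs_mul, abs_mul, abs_of_pos hn]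
    calc _ ≤ L ^ 8 / r ^ 3 * L ^ 4 * (L ^ 2 * n) / n := by
          gcongr
          exact abs_psE_sub_le c a j l v
      _ = _ := by field_simp
  have t3 : |R / (p * n) * (gs H j - gs H l) / n ^ 2| ≤ δ ^ 3 * (gs H j + gs H l) / r ^ 6 + L ^ 6 / r ^ 3 := by
    refine le_trans ?_ (c.absorb_gs (by positivity) (by linarith [gs_le a j, gs_le a l]))
    rw [abs_div, abs_mul, abs_of_nonneg hρ0, abs_of_nonneg (by positivity : (0:ℝ) ≤ n ^ 2)]
    have : |gs H j - gs H l| ≤ gs H j + gs H l := abs_sub_le_iff.2 ⟨by linarith, by linarith⟩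
    calc _ ≤ L * δ ^ 2 / n * (gs H j + gs H l) / n ^ 2 := by gcongr
      _ = _ := by rw [← c.r_sq]; field_simp
  have t4 : L ^ 10 / r ^ 3 + L ^ 14 / r ^ 3 + L ^ 6 / r ^ 3 ≤ L ^ 16 / r ^ 3 := by
    rw [← add_div, ← add_div]
    gcongr
    have := c.pow_le (show 10 ≤ 14 by norm_num)
    have := c.pow_le (show 6 ≤ 14 by norm_num)
    have := c.mul_pow_le (show 14 + 1 ≤ 16 by norm_num) (show (3 : ℝ) ≤ 100 by norm_num)
    linarith
  have t5 : 0 ≤ δ ^ 3 * (gs H j + gs H l) / r ^ 6 := by positivity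
  have t6 : δ ^ 3 * (deg H j ^ 2 + deg H l ^ 2 + deg H v ^ 2 + gs H j + gs H l) / r ^ 6 =
      δ ^ 3 * (deg H j ^ 2 + deg H l ^ 2 + deg H v ^ 2) / r ^ 6 + δ ^ 3 * (gs H j + gs H l) / r ^ 6 := by ring
  rw [t6]
  rw [abs_le] at t1 t2 t3 ⊢
  constructor <;> linarith [t1.1, t1.2, t2.1, t2.2, t3.1, t3.2]

set_option maxHeartbeats 1000000 in
/-- The dependence of `pr j v` on `j` to second order. -/
lemma pr_sub_fine (c : Ctx 𝒢 p δ R L Hm r) (a : Adm 𝒢 L Hm (k + 7) H ⊥) (hjl : j ≠ l) (hv : v ∈ Fr j l H) :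
    |pr 𝒢 H ⊥ j v - pr 𝒢 H ⊥ l v - (Psi H p R v j - Psi H p R v l)| ≤
      400 * (δ ^ 3 * (deg H j ^ 2 + deg H l ^ 2 + deg H v ^ 2 + gs H j + gs H l) / (p ^ 2 * n ^ 3)) +
        L ^ 70 * (1 + cod H j l) / r ^ 3 := by
  have hn := c.n_pos
  have hr := c.r_pos
  have hL := c.L_pos
  have hp := c.p_pos
  have hp1 := c.p_lt
  have hδ := c.δ_nonneg
  have gj := gs_nonneg H j
  have gl := gs_nonneg H l
  have hc := cod_nonneg (H := H) j l
  have hj : (0 : ℝ) ≤ deg H j := Nat.cast_nonneg _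
  have hl : (0 : ℝ) ≤ deg H l := Nat.cast_nonneg _
  have hv' : v ∈ Fr j l (H ⊔ ⊥) := by rwa [sup_bot_eq]
  have e1 := pr_sub_pr' c hjl hv'
  have e2 := Ex_ind_Sd_div (k := k + 4) c a hjl hv'
  have e3 := Ex_kapF_wt_sub c a hjl v
  have e4 := Ex_kap_wt_fine c a hjl hv
  have e5 := abs_psE_mul_sub_Psi_le c a j l v
  simp only [sup_bot_eq, deg_bot, Nat.cast_zero, add_zero, mul_zero, zero_div, zero_add] at e1 e2 e3
  set S : ℝ := deg H j ^ 2 + deg H l ^ 2 + deg H v ^ 2 + gs H j + gs H l with hS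
  have hS0 : (0 : ℝ) ≤ S := by positivity
  set M := δ ^ 3 * S / (p ^ 2 * n ^ 3) with hM
  have f1 : EA H ⊥ p δ j l ≤ 2 * M := by
    rw [EA, kk, deg_bot, deg_bot, hM, ← mul_div_assoc]
    refine div_le_div_of_nonneg_right ?_ (by positivity)
    push_cast
    have : (deg H j + deg H l + (0 + 0) : ℝ) ^ 2 ≤ 2 * S := by
      nlinarith [sq_nonneg ((deg H j : ℝ) - deg H l), sq_nonneg (deg H v : ℝ)]
    have := mul_le_mul_of_nonneg_left this (pow_nonneg hδ 3)
    linarith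
  have f2 : δ ^ 3 * S / r ^ 6 ≤ M := by
    have : r ^ 6 = (n : ℝ) ^ 3 := by rw [← c.r_sq]; ring
    rw [this, hM]
    gcongr
    nlinarith [pow_le_one₀ hp.le hp1.le (n := 2), pow_pos hn 3]
  have f3 : (deg H j + deg H l) * (L ^ 28 * (Dl n δ + cod H j l) / (n : ℝ) ^ 2) ≤
      2 * M + L ^ 60 * (1 + cod H j l) / r ^ 3 := by
    have h1 := c.absorb_lin 28 (y := deg H j + deg H l)
    have h2 : δ ^ 3 * (deg H j + deg H l : ℝ) ^ 2 / r ^ 6 ≤ 2 * (δ ^ 3 * S / r ^ 6) := by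
      rw [← mul_div_assoc, mul_left_comm]
      gcongr
      nlinarith [sq_nonneg ((deg H j : ℝ) - deg H l), sq_nonneg (deg H v : ℝ)]
    have h3 : (deg H j + deg H l : ℝ) ≤ 2 * (L * r) := by
      linarith [a.deg_le_Lr c j, a.deg_le_Lr c l]
    have h4 : (deg H j + deg H l : ℝ) * (L ^ 28 * (1 + cod H j l) / (n : ℝ) ^ 2) ≤
        2 * L ^ 29 / r ^ 3 * (1 + cod H j l) := by
      calc _ ≤ 2 * (L * r) * (L ^ 28 * (1 + cod H j l) / (n : ℝ) ^ 2) := by gcongr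
        _ = _ := by rw [← c.r_sq]; field_simp
    have h5 : (deg H j + deg H l) * (L ^ 28 * (Dl n δ + cod H j l) / (n : ℝ) ^ 2) =
        (deg H j + deg H l : ℝ) * (L ^ 28 * (1 + cod H j l) / (n : ℝ) ^ 2) +
        L ^ 28 * δ ^ 3 * (deg H j + deg H l) / r ^ 6 := by
      rw [Dl, ← c.r_sq]; field_simp; ring
    have h6 : 2 * L ^ 29 / r ^ 3 * (1 + cod H j l) + L ^ 59 / r ^ 3 ≤ L ^ 60 * (1 + cod H j l) / r ^ 3 := by
      have q1 : 2 * L ^ 29 ≤ L ^ 59 := c.mul_pow_le (by norm_num) (by norm_num)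
      have q2 : 2 * L ^ 59 ≤ L ^ 60 := c.mul_pow_le (by norm_num) (by norm_num)
      calc _ ≤ L ^ 59 / r ^ 3 * (1 + cod H j l) + L ^ 59 / r ^ 3 * (1 + cod H j l) := by
            gcongr
            exact le_mul_of_one_le_right (by positivity) (by linarith)
        _ = 2 * L ^ 59 * (1 + cod H j l) / r ^ 3 := by ring
        _ ≤ _ := by gcongr
    norm_num at h1
    linarith
  have f4 : 1 / r ^ 10 ≤ 1 / r ^ 3 := by
    gcongr
    · linarith [c.r_ge]
    · norm_num
  have f5 : L ^ 30 / r ^ 3 + 1 / r ^ 3 + L ^ 7 / r ^ 3 * (cod H j l + 1) + L ^ 16 / r ^ 3 +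
      L ^ 60 * (1 + cod H j l) / r ^ 3 ≤ L ^ 70 * (1 + cod H j l) / r ^ 3 := by
    have q1 := c.pow_le (show 30 ≤ 60 by norm_num)
    have q2 := c.pow_le (show 7 ≤ 60 by norm_num)
    have q3 := c.pow_le (show 16 ≤ 60 by norm_num)
    have q4 := c.pow_le (show 0 ≤ 60 by norm_num)
    rw [pow_zero] at q4
    have q5 : 5 * L ^ 60 ≤ L ^ 70 := c.mul_pow_le (by norm_num) (by norm_num)
    calc _ = (L ^ 30 + 1 + L ^ 7 * (1 + cod H j l) + L ^ 16 + L ^ 60 * (1 + cod H j l)) / r ^ 3 := by ring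
      _ ≤ (L ^ 60 * (1 + cod H j l) + L ^ 60 * (1 + cod H j l) + L ^ 60 * (1 + cod H j l) +
          L ^ 60 * (1 + cod H j l) + L ^ 60 * (1 + cod H j l)) / r ^ 3 := by
        gcongr
        all_goals nlinarith [pow_pos hL 60]
      _ = 5 * L ^ 60 * (1 + cod H j l) / r ^ 3 := by ring
      _ ≤ _ := by gcongr
  have hM0 : 0 ≤ M := by positivity
  rw [abs_le] at e2 e3 e4 e5 ⊢
  constructor <;> linarith [e2.1, e2.2, e3.1, e3.2, e4.1, e4.2, e5.1, e5.2]

end Fine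

section Moments
variable {n : ℕ} {H : SimpleGraph (Fin n)}

lemma sum_compl_Nb (H : SimpleGraph (Fin n)) (v : Fin n) (f : Fin n → ℝ) :
    ∑ l ∈ (Nb v H)ᶜ, f l = f v + ∑ l, ad H v l * f l := by
  have h1 : ∑ l ∈ (Nb v H)ᶜ, f l = ∑ l, if l ∈ (Nb v H)ᶜ then f l else 0 := by
    rw [Finset.sum_ite_mem, Finset.univ_inter]
  have h2 : f v = ∑ l, if l = v then f l else 0 := by simp
  rw [h1, h2, ← Finset.sum_add_distrib]
  refine Finset.sum_congr rfl fun l _ => ?_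
  by_cases h : l = v
  · subst h; simp [mem_Nb, ad_self]
  · by_cases h3 : H.Adj v l
    · rw [ad_of_adj h3]; simp [mem_Nb, h, h3.symm]
    · rw [ad_of_not_adj h3]; simp [mem_Nb, h, show ¬ H.Adj l v from fun h4 => h3 h4.symm]

lemma card_compl_Nb_self (H : SimpleGraph (Fin n)) (v : Fin n) : ((Nb v H)ᶜ.card : ℝ) = 1 + deg H v := by
  have := sum_compl_Nb H v (fun _ => 1)
  simpa [deg_eq_sum] using this

lemma sum_deg_pow (h : (n : ℝ) ≠ 0) (t : ℕ) : ∑ l, (deg H l : ℝ) ^ t = n * mu n H t := by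
  rw [mu]; field_simp

lemma sum_deg (h : (n : ℝ) ≠ 0) : ∑ l, (deg H l : ℝ) = n * mu n H 1 := by
  simpa using sum_deg_pow (H := H) h 1

lemma sum_gs (h : (n : ℝ) ≠ 0) : ∑ l, gs H l = n * mu n H 2 := by
  simp only [gs]
  rw [Finset.sum_comm, ← sum_deg_pow h]
  refine Finset.sum_congr rfl fun w _ => ?_
  rw [← Finset.sum_mul, Finset.sum_congr rfl fun l _ => ad_comm H l w, ← deg_eq_sum]
  ring

lemma mu_nonneg (H : SimpleGraph (Fin n)) (t : ℕ) : 0 ≤ mu n H t := by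
  rw [mu]; positivity

lemma sum_Psi (hn : (n : ℝ) ≠ 0) (p R : ℝ) (v : Fin n) :
    ∑ l, Psi H p R v l = -((1 - p) * mu n H 1) + R * mu n H 1 / (p * n) - 2 * (1 - p) * mu n H 2 / n +
      (1 - p) * (1 - 2 * p) / p * mu n H 1 * deg H v / n := by
  have e : ∀ l, Psi H p R v l = (-(1 - p) / n + R / (p * n ^ 2) + (1 - p) * (1 - 2 * p) / p * deg H v / n ^ 2) * deg H l -
      (1 - p) / n ^ 2 * ((deg H l : ℝ) ^ 2 + gs H l) := fun l => by rw [Psi]; ring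
  simp only [e]
  rw [Finset.sum_sub_distrib, ← Finset.mul_sum, ← Finset.mul_sum, Finset.sum_add_distrib, sum_deg hn,
    sum_deg_pow hn, sum_gs hn]
  by_cases hp : p = 0
  · subst hp; simp; field_simp; ring
  · field_simp; ring

lemma sum_compl_Psi (hn : (n : ℝ) ≠ 0) (p R : ℝ) (v : Fin n) :
    ∑ l ∈ (Nb v H)ᶜ, Psi H p R v l = -((1 - p) * (deg H v + gs H v) / n) +
      R * (deg H v + gs H v) / (p * n ^ 2) -
      (1 - p) * (∑ l ∈ (Nb v H)ᶜ, ((deg H l : ℝ) ^ 2 + gs H l)) / n ^ 2 +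
      (1 - p) * (1 - 2 * p) / p * (deg H v + gs H v) * deg H v / n ^ 2 := by
  have e : ∀ l, Psi H p R v l = (-(1 - p) / n + R / (p * n ^ 2) + (1 - p) * (1 - 2 * p) / p * deg H v / n ^ 2) * deg H l -
      (1 - p) / n ^ 2 * ((deg H l : ℝ) ^ 2 + gs H l) := fun l => by rw [Psi]; ring
  simp only [e]
  rw [Finset.sum_sub_distrib, ← Finset.mul_sum, ← Finset.mul_sum, sum_compl_Nb H v (fun l => (deg H l : ℝ)), ← gs]
  by_cases hp : p = 0
  · subst hp; simp; field_simp
  · field_simp; ring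

end Moments

/-- The second order approximation of `pr j v - p`. -/
noncomputable def Tht {n : ℕ} (H : SimpleGraph (Fin n)) (p R : ℝ) (j v : Fin n) : ℝ :=
  -((1 - p) * (deg H j + deg H v - mu n H 1) / n) +
    R * (deg H j + deg H v - 2 * mu n H 1) / (p * n ^ 2) -
    (1 - p) / n ^ 2 * (deg H j ^ 2 + deg H v ^ 2 + gs H j + gs H v - (1 - 2 * p) / p * deg H j * deg H v)

section Fine
variable {n : ℕ} {𝒢 : Finset (SimpleGraph (Fin n))} {p δ R L Hm r : ℝ} {k : ℕ}
  {H Q G : SimpleGraph (Fin n)} {j l v : Fin n}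

lemma Adm.mu_one_le (c : Ctx 𝒢 p δ R L Hm r) (a : Adm 𝒢 L Hm k H Q) : mu n H 1 ≤ L ^ 2 := by
  have hn := c.n_pos
  have := a.sum_le
  rw [sum_deg hn.ne'] at this
  have : (0 : ℝ) ≤ k := Nat.cast_nonneg _
  exact le_of_mul_le_mul_left (by linarith) hn

lemma Adm.mu_two_le (c : Ctx 𝒢 p δ R L Hm r) (a : Adm 𝒢 L Hm k H Q) : mu n H 2 ≤ L ^ 3 * r := by
  have hn := c.n_pos
  have hr := c.r_pos
  have hL := c.L_pos
  refine le_of_mul_le_mul_left (a := (n : ℝ)) ?_ hn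
  rw [← sum_deg_pow hn.ne']
  calc ∑ l, (deg H l : ℝ) ^ 2 ≤ ∑ l, L * r * (deg H l : ℝ) := Finset.sum_le_sum fun l _ => by
        rw [sq]; exact mul_le_mul_of_nonneg_right (a.deg_le_Lr c l) (Nat.cast_nonneg _)
    _ = L * r * (n * mu n H 1) := by rw [← Finset.mul_sum, sum_deg hn.ne']
    _ ≤ L * r * (n * L ^ 2) := by gcongr; exact a.mu_one_le c
    _ = _ := by ring

lemma sq_deg_le (c : Ctx 𝒢 p δ R L Hm r) (a : Adm 𝒢 L Hm k H Q) (l : Fin n) : (deg H l : ℝ) ^ 2 ≤ L ^ 2 * n := by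
  have := pow_le_pow_left₀ (Nat.cast_nonneg _) (a.deg_le_Lr c l) 2
  rwa [mul_pow, c.r_sq] at this

/-- The terms of the second order approximation that are negligible. -/
lemma Tht_rem_eq (c : Ctx 𝒢 p δ R L Hm r) (j v : Fin n) :
    p * (n - 1) + R * (deg H v - mu n H 1) / (p * n) - deg H v +
      ((n - 1 - deg H v) * Psi H p R v j - ∑ l, Psi H p R v l + ∑ l ∈ (Nb v H)ᶜ, Psi H p R v l) -
      (n - 1 - deg H v) * (p + Tht H p R j v) =
    -((1 - p) * (2 * deg H v - mu n H 1 - deg H v * mu n H 1) / n) +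
      R / (p * n) * ((1 + deg H v) * (deg H v - 2 * mu n H 1) + deg H v + gs H v) / n -
      (1 - p) * (1 + deg H v) * (deg H v ^ 2 + gs H v) / n ^ 2 +
      2 * (1 - p) * mu n H 2 / n - (1 - p) * (1 - 2 * p) / p * mu n H 1 * deg H v / n -
      (1 - p) * (∑ l ∈ (Nb v H)ᶜ, ((deg H l : ℝ) ^ 2 + gs H l)) / n ^ 2 +
      (1 - p) * (1 - 2 * p) / p * (deg H v + gs H v) * deg H v / n ^ 2 := by
  have hn := c.n_pos
  have hp := c.p_pos
  rw [sum_Psi hn.ne', sum_compl_Psi hn.ne', Psi, Tht]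
  field_simp
  ring

set_option maxHeartbeats 1000000 in
lemma abs_Tht_rem_le (c : Ctx 𝒢 p δ R L Hm r) (a : Adm 𝒢 L Hm k H Q) (j v : Fin n) :
    |p * (n - 1) + R * (deg H v - mu n H 1) / (p * n) - deg H v +
      ((n - 1 - deg H v) * Psi H p R v j - ∑ l, Psi H p R v l + ∑ l ∈ (Nb v H)ᶜ, Psi H p R v l) -
      (n - 1 - deg H v) * (p + Tht H p R j v)| ≤
    δ ^ 3 * (deg H v ^ 2 + gs H v) / r ^ 4 + L ^ 10 / r := by
  rw [Tht_rem_eq c]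
  have hn := c.n_pos
  have hr := c.r_pos
  have hL := c.L_pos
  have hL1 : 1 ≤ L := by linarith [c.L_ge]
  have hp := c.p_pos
  have hq := c.q_pos
  have hp1 := c.p_lt
  have hδ := c.δ_nonneg
  have hip := c.inv_p_le
  have hR0 := c.R_nonneg a.ne
  have hR := c.R_le a.ne
  have hgv := gs_le a v
  have gv := gs_nonneg H v
  have m1 := mu_nonneg H 1
  have m2 := mu_nonneg H 2
  have hm1 := a.mu_one_le c
  have hm2 := a.mu_two_le c
  have hv : (0 : ℝ) ≤ deg H v := Nat.cast_nonneg _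
  have hv2 := sq_deg_le c a v
  have hvL := a.deg_le_Lr c v
  have hrL := c.L_le_r
  have hr1 : 1 ≤ r := hL1.trans hrL
  have hns := c.r_sq
  have hS0 : 0 ≤ ∑ l ∈ (Nb v H)ᶜ, ((deg H l : ℝ) ^ 2 + gs H l) :=
    Finset.sum_nonneg fun l _ => add_nonneg (sq_nonneg _) (gs_nonneg H l)
  have h1v : 1 + (deg H v : ℝ) ≤ 2 * (L * r) := by nlinarith
  have hS : ∑ l ∈ (Nb v H)ᶜ, ((deg H l : ℝ) ^ 2 + gs H l) ≤ 4 * L ^ 3 * r ^ 3 := by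
    refine (Finset.sum_le_sum (g := fun _ => L ^ 2 * n + L ^ 2 * n) fun l _ =>
      add_le_add (sq_deg_le c a l) (gs_le a l)).trans ?_
    rw [Finset.sum_const, nsmul_eq_mul, card_compl_Nb_self]
    calc _ ≤ 2 * (L * r) * (L ^ 2 * n + L ^ 2 * n) := by gcongr
      _ = _ := by rw [← hns]; ring
  have hp2 : |1 - 2 * p| ≤ 1 := abs_le.2 ⟨by linarith, by linarith⟩
  have hpp : |(1 - p) * (1 - 2 * p) / p| ≤ L := by
    rw [abs_div, abs_mul, abs_of_pos hp, abs_of_pos hq]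
    calc (1 - p) * |1 - 2 * p| / p ≤ 1 * 1 / p := by gcongr; linarith
      _ ≤ L := by rw [mul_one]; exact hip
  have hρ0 : 0 ≤ R / (p * n) := by positivity
  have hρ : R / (p * n) ≤ L * δ ^ 2 / n := by
    calc R / (p * n) = 1 / p * R / n := by field_simp
      _ ≤ L * δ ^ 2 / n := by gcongr
  have hρ3 := c.R_div_le a.ne
  have b1 : |(1 - p) * (2 * deg H v - mu n H 1 - deg H v * mu n H 1) / n| ≤ 4 * L ^ 3 / r := by
    rw [abs_div, abs_mul, abs_of_pos hq, abs_of_pos hn]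
    have : |2 * (deg H v : ℝ) - mu n H 1 - deg H v * mu n H 1| ≤ 4 * L ^ 3 * r := by
      have q1 : deg H v * mu n H 1 ≤ L * r * L ^ 2 := by gcongr
      have q2 : L * r ≤ L ^ 3 * r := by gcongr; exact le_self_pow₀ hL1 (by norm_num)
      have q3 : L ^ 2 ≤ L ^ 3 * r := by
        calc L ^ 2 = L ^ 2 * 1 := by ring
          _ ≤ L ^ 3 * r := by gcongr; norm_num
      have q4 : 0 ≤ deg H v * mu n H 1 := by positivity
      have q5 : L * r * L ^ 2 = L ^ 3 * r := by ring
      exact abs_le.2 ⟨by nlinarith, by nlinarith⟩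
    calc _ ≤ 1 * (4 * L ^ 3 * r) / n := by gcongr; linarith
      _ = _ := by rw [← hns]; field_simp
  have b2 : |R / (p * n) * ((1 + deg H v) * (deg H v - 2 * mu n H 1) + deg H v + gs H v) / n| ≤
      δ ^ 3 * (deg H v ^ 2 + gs H v) / r ^ 4 + L ^ 6 / r + 6 * L ^ 6 / r := by
    have h := c.absorb_gs (g := deg H v ^ 2 + gs H v) (by positivity) (by linarith)
    have h' : L * δ ^ 2 * (deg H v ^ 2 + gs H v) / r ^ 4 ≤ δ ^ 3 * (deg H v ^ 2 + gs H v) / r ^ 4 + L ^ 6 / r := by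
      calc _ = r ^ 2 * (L * δ ^ 2 * (deg H v ^ 2 + gs H v) / r ^ 6) := by field_simp
        _ ≤ r ^ 2 * (δ ^ 3 * (deg H v ^ 2 + gs H v) / r ^ 6 + L ^ 6 / r ^ 3) := by gcongr
        _ = _ := by field_simp
    rw [abs_div, abs_mul, abs_of_nonneg hρ0, abs_of_pos hn]
    have q : |(1 + (deg H v : ℝ)) * (deg H v - 2 * mu n H 1) + deg H v + gs H v| ≤
        (deg H v ^ 2 + gs H v) + 6 * L ^ 3 * r := by
      have q1 : deg H v * mu n H 1 ≤ L * r * L ^ 2 := by gcongr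
      have q2 : L * r ≤ L ^ 3 * r := by gcongr; exact le_self_pow₀ hL1 (by norm_num)
      have q3 : L ^ 2 ≤ L ^ 3 * r := by
        calc L ^ 2 = L ^ 2 * 1 := by ring
          _ ≤ L ^ 3 * r := by gcongr; norm_num
      have q4 : 0 ≤ deg H v * mu n H 1 := by positivity
      have q5 : L * r * L ^ 2 = L ^ 3 * r := by ring
      exact abs_le.2 ⟨by nlinarith, by nlinarith⟩
    calc _ ≤ R / (p * n) * ((deg H v ^ 2 + gs H v) + 6 * L ^ 3 * r) / n := by gcongr
      _ = R / (p * n) * (deg H v ^ 2 + gs H v) / n + R / (p * n) * (6 * L ^ 3 * r) / n := by ring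
      _ ≤ L * δ ^ 2 / n * (deg H v ^ 2 + gs H v) / n + L ^ 3 * (6 * L ^ 3 * r) / n := by gcongr
      _ = L * δ ^ 2 * (deg H v ^ 2 + gs H v) / r ^ 4 + 6 * L ^ 6 / r := by
        rw [← hns]; field_simp
      _ ≤ _ := by linarith
  have b3 : |(1 - p) * (1 + deg H v) * (deg H v ^ 2 + gs H v) / n ^ 2| ≤ 4 * L ^ 3 / r := by
    rw [abs_of_nonneg (by positivity)]
    calc _ ≤ 1 * (2 * (L * r)) * (L ^ 2 * n + L ^ 2 * n) / n ^ 2 := by gcongr; linarith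
      _ = _ := by rw [← hns]; field_simp; ring
  have b4 : |2 * (1 - p) * mu n H 2 / n| ≤ 2 * L ^ 3 / r := by
    rw [abs_of_nonneg (by positivity)]
    calc _ ≤ 2 * 1 * (L ^ 3 * r) / n := by gcongr; linarith
      _ = _ := by rw [← hns]; field_simp
  have b5 : |(1 - p) * (1 - 2 * p) / p * mu n H 1 * deg H v / n| ≤ L ^ 4 / r := by
    rw [abs_div, abs_mul, abs_mul, abs_of_pos hn, abs_of_nonneg m1, abs_of_nonneg hv]
    calc _ ≤ L * L ^ 2 * (L * r) / n := by gcongr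
      _ = _ := by rw [← hns]; field_simp
  have b6 : |(1 - p) * (∑ l ∈ (Nb v H)ᶜ, ((deg H l : ℝ) ^ 2 + gs H l)) / n ^ 2| ≤ 4 * L ^ 3 / r := by
    rw [abs_of_nonneg (by positivity)]
    calc _ ≤ 1 * (4 * L ^ 3 * r ^ 3) / n ^ 2 := by gcongr; linarith
      _ = _ := by rw [← hns]; field_simp
  have b7 : |(1 - p) * (1 - 2 * p) / p * (deg H v + gs H v) * deg H v / n ^ 2| ≤ 2 * L ^ 4 / r := by
    rw [abs_div, abs_mul, abs_mul, abs_of_nonneg (sq_nonneg (n : ℝ)), abs_of_nonneg (add_nonneg hv gv),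
      abs_of_nonneg hv]
    have : deg H v + gs H v ≤ 2 * L ^ 2 * n := by
      have : L * r ≤ L ^ 2 * n := by
        rw [← hns, ← mul_pow]; exact le_self_pow₀ (one_le_mul_of_one_le_of_one_le hL1 hr1) (by norm_num)
      linarith
    calc _ ≤ L * (2 * L ^ 2 * n) * (L * r) / n ^ 2 := by gcongr
      _ = _ := by rw [← hns]; field_simp
  have hfin : 4 * L ^ 3 / r + (L ^ 6 / r + 6 * L ^ 6 / r) + 4 * L ^ 3 / r + 2 * L ^ 3 / r + L ^ 4 / r +
      4 * L ^ 3 / r + 2 * L ^ 4 / r ≤ L ^ 10 / r := by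
    simp only [← add_div]
    gcongr
    have := c.pow_le (show 3 ≤ 6 by norm_num)
    have := c.pow_le (show 4 ≤ 6 by norm_num)
    have := c.mul_pow_le (show 6 + 1 ≤ 10 by norm_num) (show (30 : ℝ) ≤ 100 by norm_num)
    nlinarith [pow_pos hL 6]
  rw [abs_le] at b1 b2 b3 b4 b5 b6 b7 ⊢
  constructor <;> linarith [b1.1, b1.2, b2.1, b2.2, b3.1, b3.2, b4.1, b4.2, b5.1, b5.2, b6.1, b6.2, b7.1, b7.2]

end Fine

lemma sum_cod_univ {n : ℕ} (H : SimpleGraph (Fin n)) (j : Fin n) : ∑ l, cod H j l = gs H j := by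
  simp only [cod, gs]
  rw [Finset.sum_comm]
  refine Finset.sum_congr rfl fun w _ => ?_
  rw [← Finset.mul_sum, Finset.sum_congr rfl fun l _ => ad_comm H l w, ← deg_eq_sum]

/-- The size of the cubic error. -/
noncomputable def EC {n : ℕ} (H : SimpleGraph (Fin n)) (p δ : ℝ) (j v : Fin n) : ℝ :=
  δ ^ 3 * (deg H j ^ 2 + deg H v ^ 2 + gs H j + gs H v + mu n H 2) / (p ^ 3 * n ^ 3)

section Fine
variable {n : ℕ} {𝒢 : Finset (SimpleGraph (Fin n))} {p δ R L Hm r : ℝ} {k : ℕ}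
  {H Q G : SimpleGraph (Fin n)} {j l v : Fin n}

lemma EC_nonneg (c : Ctx 𝒢 p δ R L Hm r) (j v : Fin n) : 0 ≤ EC H p δ j v := by
  have := c.p_pos
  have := c.δ_nonneg
  have := gs_nonneg H j
  have := gs_nonneg H v
  have := mu_nonneg H 2
  rw [EC]; positivity

lemma sum_EA_le (c : Ctx 𝒢 p δ R L Hm r) (v : Fin n) :
    ∑ l, EA H ⊥ p δ v l ≤ 2 * (δ ^ 3 * (deg H v ^ 2 + mu n H 2) / (p ^ 2 * n ^ 2)) := by
  have hn := c.n_pos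
  have hp := c.p_pos
  have hδ := c.δ_nonneg
  calc ∑ l, EA H ⊥ p δ v l ≤ ∑ l, (2 * δ ^ 3 / (p ^ 2 * n ^ 3)) * ((deg H v : ℝ) ^ 2 + deg H l ^ 2) :=
        Finset.sum_le_sum fun l _ => by
          rw [EA, kk, deg_bot, deg_bot, div_mul_eq_mul_div]
          refine div_le_div_of_nonneg_right ?_ (by positivity)
          have : (deg H v + deg H l + (((0 : ℕ) : ℝ) + ((0 : ℕ) : ℝ))) ^ 2 ≤ 2 * ((deg H v : ℝ) ^ 2 + deg H l ^ 2) := by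
            push_cast
            nlinarith [sq_nonneg ((deg H v : ℝ) - deg H l)]
          have := mul_le_mul_of_nonneg_left this (pow_nonneg hδ 3)
          linarith
    _ = _ := by
      rw [← Finset.mul_sum, Finset.sum_add_distrib, sum_deg_pow hn.ne', Finset.sum_const, Finset.card_univ,
        Fintype.card_fin, nsmul_eq_mul]
      field_simp

lemma sum_pr_sub_le (c : Ctx 𝒢 p δ R L Hm r) (a : Adm 𝒢 L Hm (k + 7) H ⊥) (hj : j ∈ Nb v H) :
    |∑ l ∈ Nb v H, (pr 𝒢 H ⊥ j v - pr 𝒢 H ⊥ l v) - ∑ l ∈ Nb v H, (Psi H p R v j - Psi H p R v l)| ≤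
      800 * (δ ^ 3 * (deg H j ^ 2 + deg H v ^ 2 + gs H j + mu n H 2) / (p ^ 2 * n ^ 2)) + L ^ 74 / r := by
  have hn := c.n_pos
  have hr := c.r_pos
  have hL := c.L_pos
  have hp := c.p_pos
  have hδ := c.δ_nonneg
  have gj := gs_nonneg H j
  have m2 := mu_nonneg H 2
  rw [← Finset.sum_sub_distrib]
  have hterm : ∀ l ∈ Nb v H, |pr 𝒢 H ⊥ j v - pr 𝒢 H ⊥ l v - (Psi H p R v j - Psi H p R v l)| ≤
      400 * δ ^ 3 / (p ^ 2 * n ^ 3) * ((deg H j ^ 2 + deg H v ^ 2 + gs H j) + (deg H l ^ 2 + gs H l)) +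
        L ^ 70 / r ^ 3 * (1 + cod H j l) := fun l hl => by
    have hl0 := gs_nonneg H l
    have hc := cod_nonneg (H := H) j l
    by_cases h : j = l
    · subst h
      simp only [sub_self, abs_zero]
      positivity
    · refine (pr_sub_fine c a h (mem_Fr_of_mem_Nb hj hl)).trans (le_of_eq ?_)
      ring
  refine (Finset.abs_sum_le_sum_abs _ _).trans ((Finset.sum_le_sum hterm).trans ?_)
  refine (Finset.sum_le_sum_of_subset_of_nonneg (Finset.subset_univ (Nb v H)) fun l _ _ => ?_).trans ?_
  · have := gs_nonneg H l
    have := cod_nonneg (H := H) j l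
    positivity
  rw [Finset.sum_add_distrib, ← Finset.mul_sum, ← Finset.mul_sum]
  simp only [Finset.sum_add_distrib, sum_deg_pow hn.ne', sum_gs hn.ne', sum_cod_univ, Finset.sum_const,
    Finset.card_univ, Fintype.card_fin, nsmul_eq_mul, mul_one]
  rw [← mul_add, ← mul_add]
  refine add_le_add ?_ ?_
  · have : 400 * δ ^ 3 / (p ^ 2 * n ^ 3) * (n * (deg H j ^ 2 + deg H v ^ 2 + gs H j) + (n * mu n H 2 + n * mu n H 2)) =
        400 * (δ ^ 3 * (deg H j ^ 2 + deg H v ^ 2 + gs H j + 2 * mu n H 2) / (p ^ 2 * n ^ 2)) := by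
      field_simp
      ring
    rw [this]
    calc _ ≤ 400 * (δ ^ 3 * (2 * (deg H j ^ 2 + deg H v ^ 2 + gs H j + mu n H 2)) / (p ^ 2 * n ^ 2)) := by
          gcongr
          nlinarith [sq_nonneg (deg H j : ℝ), sq_nonneg (deg H v : ℝ)]
      _ = _ := by ring
  · have h1 : 1 ≤ L ^ 2 := one_le_pow₀ (by linarith [c.L_ge])
    calc L ^ 70 / r ^ 3 * (n + gs H j) ≤ L ^ 70 / r ^ 3 * (L ^ 2 * n + L ^ 2 * n) := by
          gcongr
          · exact le_mul_of_one_le_left hn.le h1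
          · exact gs_le a j
      _ = 2 * L ^ 72 / r := by rw [← c.r_sq]; field_simp; ring
      _ ≤ L ^ 74 / r := by gcongr; exact c.mul_pow_le (by norm_num) (by norm_num)

/-- The edge probabilities to second order. -/
lemma pr_fine (c : Ctx 𝒢 p δ R L Hm r) (a : Adm 𝒢 L Hm (k + 7) H ⊥) (hjv : j ≠ v) (hH : ¬ H.Adj j v) :
    |pr 𝒢 H ⊥ j v - (p + Tht H p R j v)| ≤ 2400 * (p * EC H p δ j v) + L ^ 76 / r ^ 3 := by
  have hn := c.n_pos
  have hr := c.r_pos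
  have hL := c.L_pos
  have hp := c.p_pos
  have hp1 := c.p_lt
  have hδ := c.δ_nonneg
  have gj := gs_nonneg H j
  have gv := gs_nonneg H v
  have m2 := mu_nonneg H 2
  have hj : j ∈ Nb v H := mem_Nb.2 ⟨hjv, hH⟩
  have h1 := mul_pr_eq (𝒢 := 𝒢) (H := H) (Q := ⊥) v j (Nb v H)
  have h2 := sum_pr_compl_Nb a.nonempty v
  have h3 := sum_pr_sub_le c a hj
  have h4 := Ex_deg_near (k := k + 4) c a v
  have h5 := abs_Tht_rem_le c a j v
  have h6 := sum_EA_le (H := H) c v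
  have hN : ((Nb v H).card : ℝ) = n - 1 - deg H v := by rw [card_Nb, card_compl_Nb_self]; ring
  have h7 : ∑ l ∈ Nb v H, (Psi H p R v j - Psi H p R v l) =
      (n - 1 - deg H v) * Psi H p R v j - ∑ l, Psi H p R v l + ∑ l ∈ (Nb v H)ᶜ, Psi H p R v l := by
    rw [Finset.sum_sub_distrib, Finset.sum_const, nsmul_eq_mul, hN, ← Finset.sum_add_sum_compl (Nb v H)]
    ring
  simp only [sup_bot_eq, deg_bot, Nat.cast_zero, add_zero, mul_zero, zero_div] at h2 h4
  rw [sum_deg hn.ne', mul_div_cancel_left₀ _ hn.ne', Finset.sum_add_distrib, ← Finset.mul_sum, Finset.sum_const,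
    Finset.card_univ, Fintype.card_fin, nsmul_eq_mul] at h4
  rw [h2, hN] at h1
  rw [h7] at h3
  have e0 : n * (L ^ 31 / r ^ 3) = L ^ 31 / r := by rw [← c.r_sq]; field_simp
  have hnh : (n : ℝ) / 2 ≤ n - 1 - deg H v := by
    have h8 := a.deg_le_Lr c v
    have h9 := c.Lpow_le (k := 2) (by norm_num)
    have h10 := c.L_ge
    have h11 := c.r_sq
    have h12 := c.r_ge
    nlinarith [mul_le_mul_of_nonneg_right h10 hL.le, mul_le_mul_of_nonneg_right h9 hr.le,
      mul_le_mul_of_nonneg_right h10 (mul_pos hL hr).le]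
  set S := δ ^ 3 * (deg H j ^ 2 + deg H v ^ 2 + gs H j + gs H v + mu n H 2) / (p ^ 2 * n ^ 2) with hS
  have hS0 : 0 ≤ S := by positivity
  have k3 : δ ^ 3 * (deg H j ^ 2 + deg H v ^ 2 + gs H j + mu n H 2) / (p ^ 2 * n ^ 2) ≤ S := by
    rw [hS]
    exact div_le_div_of_nonneg_right (mul_le_mul_of_nonneg_left (by linarith) (by positivity)) (by positivity)
  have k6 : δ ^ 3 * (deg H v ^ 2 + mu n H 2) / (p ^ 2 * n ^ 2) ≤ S := by
    rw [hS]
    refine div_le_div_of_nonneg_right (mul_le_mul_of_nonneg_left ?_ (by positivity)) (by positivity)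
    nlinarith [sq_nonneg (deg H j : ℝ)]
  have k5 : δ ^ 3 * (deg H v ^ 2 + gs H v) / r ^ 4 ≤ S := by
    have e : r ^ 4 = (n : ℝ) ^ 2 := by rw [← c.r_sq]; ring
    rw [hS, e]
    refine div_le_div₀ (by positivity) (mul_le_mul_of_nonneg_left ?_ (by positivity)) (by positivity) ?_
    · nlinarith [sq_nonneg (deg H j : ℝ)]
    · exact mul_le_of_le_one_left (by positivity) (pow_le_one₀ hp.le hp1.le)
  have e1 : L ^ 74 / r + L ^ 31 / r + L ^ 10 / r ≤ L ^ 76 / r / 2 := by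
    rw [← add_div, ← add_div, div_right_comm]
    gcongr
    have := c.pow_le (show 31 ≤ 74 by norm_num)
    have := c.pow_le (show 10 ≤ 74 by norm_num)
    have := c.mul_pow_le (show 74 + 1 ≤ 76 by norm_num) (show (6 : ℝ) ≤ 100 by norm_num)
    linarith
  have key : |(n - 1 - deg H v) * (pr 𝒢 H ⊥ j v - (p + Tht H p R j v))| ≤ 1200 * S + L ^ 76 / r / 2 := by
    rw [abs_le] at h3 h4 h5 ⊢
    constructor <;> linarith [h3.1, h3.2, h4.1, h4.2, h5.1, h5.2]
  rw [abs_mul, abs_of_pos (by linarith)] at key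
  have e2 : p * EC H p δ j v = S / n := by rw [EC, hS]; field_simp
  have e3 : L ^ 76 / r ^ 3 = L ^ 76 / r / n := by rw [← c.r_sq]; field_simp
  have key2 : (n : ℝ) / 2 * |pr 𝒢 H ⊥ j v - (p + Tht H p R j v)| ≤ 1200 * S + L ^ 76 / r / 2 :=
    (mul_le_mul_of_nonneg_right hnh (abs_nonneg _)).trans key
  rw [e2, e3, ← mul_div_assoc, ← add_div, le_div_iff₀ hn]
  linarith

end Fine

lemma abs_log_one_add_sub_le {x : ℝ} (hx : |x| ≤ 1 / 2) : |Real.log (1 + x) - (x - x ^ 2 / 2)| ≤ 2 * |x| ^ 3 := by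
  have h := Real.abs_log_sub_add_sum_range_le (x := -x) (by rw [abs_neg]; linarith) 2
  simp only [Finset.sum_range_succ, Finset.sum_range_zero, abs_neg] at h
  norm_num at h
  have e : Real.log (1 + x) - (x - x ^ 2 / 2) = -x + x ^ 2 / 2 + Real.log (1 + x) := by ring
  rw [e]
  refine h.trans ?_
  rw [div_le_iff₀ (by linarith)]
  nlinarith [pow_nonneg (abs_nonneg x) 3]

section Fine
variable {n : ℕ} {𝒢 : Finset (SimpleGraph (Fin n))} {p δ R L Hm r : ℝ} {k : ℕ}
  {H Q G : SimpleGraph (Fin n)} {j l v : Fin n}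

lemma abs_Tht_add_le (c : Ctx 𝒢 p δ R L Hm r) (a : Adm 𝒢 L Hm k H Q) (j v : Fin n) :
    |Tht H p R j v + omg n p R * (deg H j + deg H v) / n| ≤ L ^ 6 / n := by
  have hn := c.n_pos
  have hr := c.r_pos
  have hL := c.L_pos
  have hL1 := c.L_ge
  have hp := c.p_pos
  have hq := c.q_pos
  have hp1 := c.p_lt
  have hip := c.inv_p_le
  have hR0 := c.R_nonneg a.ne
  have hgj := gs_le a j
  have hgv := gs_le a v
  have gj := gs_nonneg H j
  have gv := gs_nonneg H v
  have m1 := mu_nonneg H 1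
  have hm1 := a.mu_one_le c
  have hj : (0 : ℝ) ≤ deg H j := Nat.cast_nonneg _
  have hv : (0 : ℝ) ≤ deg H v := Nat.cast_nonneg _
  have hj2 := sq_deg_le c a j
  have hv2 := sq_deg_le c a v
  have hρ0 : 0 ≤ R / (p * n) := by positivity
  have hρ3 := c.R_div_le a.ne
  have e : Tht H p R j v + omg n p R * (deg H j + deg H v) / n =
      ((1 - p) * mu n H 1 - 2 * (R / (p * n)) * mu n H 1 -
      (1 - p) / n * (deg H j ^ 2 + deg H v ^ 2 + gs H j + gs H v) +
      (1 - p) / n * ((1 - 2 * p) / p * (deg H j * deg H v))) / n := by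
    rw [Tht, omg]; field_simp; ring
  rw [e, abs_div, abs_of_pos hn]
  refine div_le_div_of_nonneg_right ?_ hn.le
  have b1 : |(1 - p) * mu n H 1| ≤ L ^ 2 := by
    rw [abs_of_nonneg (by positivity)]
    nlinarith
  have b2 : |2 * (R / (p * n)) * mu n H 1| ≤ 2 * L ^ 5 := by
    rw [abs_of_nonneg (by positivity)]
    calc _ ≤ 2 * L ^ 3 * L ^ 2 := by gcongr
      _ = _ := by ring
  have b3 : |(1 - p) / n * (deg H j ^ 2 + deg H v ^ 2 + gs H j + gs H v)| ≤ 4 * L ^ 2 := by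
    rw [abs_of_nonneg (by positivity)]
    calc _ ≤ 1 / n * (L ^ 2 * n + L ^ 2 * n + L ^ 2 * n + L ^ 2 * n) := by gcongr; linarith
      _ = _ := by field_simp; ring
  have b4 : |(1 - p) / n * ((1 - 2 * p) / p * (deg H j * deg H v))| ≤ L ^ 3 := by
    have hp2 : |1 - 2 * p| ≤ 1 := abs_le.2 ⟨by linarith, by linarith⟩
    rw [abs_mul, abs_mul, abs_div (1 - 2 * p), abs_of_pos hp, abs_of_nonneg (by positivity : 0 ≤ (1 - p) / n),
      abs_of_nonneg (mul_nonneg hj hv)]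
    have hjv : (deg H j : ℝ) * deg H v ≤ L ^ 2 * n := by nlinarith [sq_nonneg ((deg H j : ℝ) - deg H v)]
    calc (1 - p) / n * (|1 - 2 * p| / p * (deg H j * deg H v)) ≤ 1 / n * (1 / p * (L ^ 2 * n)) :=
          mul_le_mul (div_le_div_of_nonneg_right (by linarith) hn.le)
            (mul_le_mul (div_le_div_of_nonneg_right hp2 hp.le) hjv (mul_nonneg hj hv) (by positivity))
            (by positivity) (by positivity)
      _ = 1 / p * L ^ 2 := by field_simp
      _ ≤ L * L ^ 2 := by gcongr
      _ = _ := by ring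
  have hfin : L ^ 2 + 2 * L ^ 5 + 4 * L ^ 2 + L ^ 3 ≤ L ^ 6 := by
    have := c.pow_le (show 2 ≤ 5 by norm_num)
    have := c.pow_le (show 3 ≤ 5 by norm_num)
    have := c.mul_pow_le (show 5 + 1 ≤ 6 by norm_num) (show (8 : ℝ) ≤ 100 by norm_num)
    linarith
  rw [abs_le] at b1 b2 b3 b4 ⊢
  constructor <;> linarith [b1.1, b1.2, b2.1, b2.2, b3.1, b3.2, b4.1, b4.2]

/-- The second order approximation of `log (pr j v) - log p`. -/
noncomputable def Lg (H : SimpleGraph (Fin n)) (p R : ℝ) (j v : Fin n) : ℝ :=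
  Tht H p R j v / p - (1 - p) ^ 2 * (deg H j + deg H v) ^ 2 / (2 * p ^ 2 * n ^ 2)

lemma abs_Tht_sq_sub_le (c : Ctx 𝒢 p δ R L Hm r) (a : Adm 𝒢 L Hm k H Q) (j v : Fin n) :
    |Tht H p R j v ^ 2 - (1 - p) ^ 2 * (deg H j + deg H v) ^ 2 / n ^ 2| / (2 * p ^ 2) ≤
      2 * EC H p δ j v + L ^ 24 / r ^ 3 := by
  have hn := c.n_pos
  have hr := c.r_pos
  have hL := c.L_pos
  have hL1 := c.L_ge
  have hp := c.p_pos
  have hq := c.q_pos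
  have hp1 := c.p_lt
  have hip := c.inv_p_le
  have hδ := c.δ_nonneg
  have hR0 := c.R_nonneg a.ne
  have hR := c.R_le a.ne
  have hj : (0 : ℝ) ≤ deg H j := Nat.cast_nonneg _
  have hv : (0 : ℝ) ≤ deg H v := Nat.cast_nonneg _
  have gj := gs_nonneg H j
  have gv := gs_nonneg H v
  have m2 := mu_nonneg H 2
  have hρ0 : 0 ≤ R / (p * n) := by positivity
  have hρ3 := c.R_div_le a.ne
  have hρ : R / (p * n) ≤ L * δ ^ 2 / n := by
    calc R / (p * n) = 1 / p * R / n := by field_simp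
      _ ≤ L * δ ^ 2 / n := by gcongr
  have hT := abs_Tht_add_le c a j v
  set y : ℝ := deg H j + deg H v with hy
  have hy0 : 0 ≤ y := by positivity
  have hy4 : y ≤ 4 * Hm := by linarith [a.deg_le_Hm j, a.deg_le_Hm v, c.Hm_ge]
  have hω := abs_omg_mul_le c a.ne (y := y) (by rwa [abs_of_nonneg hy0])
  set T := Tht H p R j v
  set o := omg n p R with ho
  have i1 : 1 / (2 * p ^ 2) ≤ L ^ 2 / 2 := by
    calc 1 / (2 * p ^ 2) = (1 / p) ^ 2 / 2 := by field_simp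
      _ ≤ L ^ 2 / 2 := by gcongr
  have b1 : |T ^ 2 - (o * y / n) ^ 2| ≤ L ^ 13 / r ^ 3 := by
    have e : T ^ 2 - (o * y / n) ^ 2 = (T + o * y / n) * ((T + o * y / n) - 2 * (o * y / n)) := by ring
    rw [e, abs_mul]
    have q1 : L ^ 6 / n ≤ L ^ 6 / r := by
      rw [← c.r_sq]
      gcongr
      nlinarith [c.r_ge]
    have q2 : |(T + o * y / n) - 2 * (o * y / n)| ≤ L ^ 6 / r + 2 * (4 * L ^ 5 / r) := by
      rw [abs_le] at hT hω ⊢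
      constructor <;> linarith [hT.1, hT.2, hω.1, hω.2]
    calc _ ≤ L ^ 6 / n * (L ^ 6 / r + 2 * (4 * L ^ 5 / r)) := by gcongr
      _ = L ^ 6 * (L ^ 6 + 8 * L ^ 5) / r ^ 3 := by rw [← c.r_sq]; field_simp; ring
      _ ≤ L ^ 6 * L ^ 7 / r ^ 3 := by
        gcongr
        have := c.pow_le (show 5 ≤ 6 by norm_num)
        have := c.mul_pow_le (show 6 + 1 ≤ 7 by norm_num) (show (9 : ℝ) ≤ 100 by norm_num)
        linarith
      _ = _ := by ring
  have b2 : |(o * y / n) ^ 2 - (1 - p) ^ 2 * y ^ 2 / n ^ 2| ≤ 2 * L ^ 4 * δ ^ 2 * y ^ 2 / r ^ 6 := by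
    have e : (o * y / n) ^ 2 - (1 - p) ^ 2 * y ^ 2 / n ^ 2 = R / (p * n) * (R / (p * n) - 2 * (1 - p)) * y ^ 2 / n ^ 2 := by
      rw [ho, omg]; field_simp; ring
    rw [e, abs_div, abs_mul, abs_mul, abs_of_nonneg hρ0, abs_of_nonneg (sq_nonneg y), abs_of_nonneg (sq_nonneg (n : ℝ))]
    have : |R / (p * n) - 2 * (1 - p)| ≤ 2 * L ^ 3 := by
      have : 2 ≤ L ^ 3 := by
        have := c.pow_le (show 1 ≤ 3 by norm_num)
        rw [pow_one] at this
        linarith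
      exact abs_le.2 ⟨by linarith, by linarith⟩
    calc _ ≤ L * δ ^ 2 / n * (2 * L ^ 3) * y ^ 2 / n ^ 2 := by gcongr
      _ = _ := by rw [← c.r_sq]; field_simp
  have h := c.absorb_sq_sq hy0 hy4 6
  norm_num at h
  have b3 : δ ^ 3 * y ^ 2 / r ^ 6 ≤ 2 * EC H p δ j v := by
    have e : r ^ 6 = (n : ℝ) ^ 3 := by rw [← c.r_sq]; ring
    rw [EC, e, ← mul_div_assoc]
    refine div_le_div₀ (by positivity) ?_ (by positivity)
      (mul_le_of_le_one_left (by positivity) (pow_le_one₀ hp.le hp1.le))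
    have : y ^ 2 ≤ 2 * (deg H j ^ 2 + deg H v ^ 2 + gs H j + gs H v + mu n H 2) := by
      nlinarith [sq_nonneg ((deg H j : ℝ) - deg H v)]
    have := mul_le_mul_of_nonneg_left this (pow_nonneg hδ 3)
    linarith
  have b4 : |T ^ 2 - (1 - p) ^ 2 * y ^ 2 / n ^ 2| ≤ L ^ 13 / r ^ 3 + 2 * L ^ 4 * δ ^ 2 * y ^ 2 / r ^ 6 := by
    rw [abs_le] at b1 b2 ⊢
    constructor <;> linarith [b1.1, b1.2, b2.1, b2.2]
  have e5 : L ^ 15 / r ^ 3 + L ^ 22 / r ^ 3 ≤ L ^ 24 / r ^ 3 := by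
    rw [← add_div]
    gcongr
    have := c.pow_le (show 15 ≤ 22 by norm_num)
    have := c.mul_pow_le (show 22 + 1 ≤ 24 by norm_num) (show (2 : ℝ) ≤ 100 by norm_num)
    linarith
  calc _ = |T ^ 2 - (1 - p) ^ 2 * y ^ 2 / n ^ 2| * (1 / (2 * p ^ 2)) := by rw [mul_one_div]
    _ ≤ (L ^ 13 / r ^ 3 + 2 * L ^ 4 * δ ^ 2 * y ^ 2 / r ^ 6) * (L ^ 2 / 2) := by gcongr
    _ = L ^ 15 / r ^ 3 / 2 + L ^ 6 * δ ^ 2 * y ^ 2 / r ^ 6 := by ring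
    _ ≤ _ := by
      have : 0 ≤ L ^ 15 / r ^ 3 := by positivity
      linarith

/-- The logarithms of the edge probabilities to second order. -/
lemma log_pr_fine (c : Ctx 𝒢 p δ R L Hm r) (a : Adm 𝒢 L Hm (k + 7) H ⊥) (hjv : j ≠ v) (hH : ¬ H.Adj j v) :
    |Real.log (pr 𝒢 H ⊥ j v) - Real.log p - Lg H p R j v| ≤ 5000 * EC H p δ j v + L ^ 80 / r ^ 3 := by
  have hn := c.n_pos
  have hr := c.r_pos
  have hL := c.L_pos
  have hL1 := c.L_ge
  have hp := c.p_pos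
  have hip := c.inv_p_le
  have h1 := pr_fine c a hjv hH
  have h2 := pr_crude c a hjv hH (by simp)
  have h3 := abs_Tht_sq_sub_le c a j v
  have h4 := abs_Tht_add_le c a j v
  have hEC := EC_nonneg (H := H) c j v
  have hω := abs_omg_mul_le c a.ne (y := deg H j + deg H v) (by
    rw [abs_of_nonneg (by positivity)]; linarith [a.deg_le_Hm j, a.deg_le_Hm v, c.Hm_ge])
  have h80 := c.Lpow_le (k := 80) (by norm_num)
  set π := pr 𝒢 H ⊥ j v
  set T := Tht H p R j v with hT
  set x := (π - p) / p with hx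
  have hx5 : |x| ≤ L ^ 5 / r := by
    rw [hx, abs_div, abs_of_pos hp]
    calc |π - p| / p = 1 / p * |π - p| := by ring
      _ ≤ L * (L ^ 4 / r) := by gcongr
      _ = _ := by ring
  have hx2 : |x| ≤ 1 / 2 := by
    refine hx5.trans ?_
    rw [div_le_iff₀ hr]
    have := c.mul_pow_le (show 5 + 1 ≤ 80 by norm_num) (show (2 : ℝ) ≤ 100 by norm_num)
    linarith
  have hlog := abs_log_one_add_sub_le hx2
  have e1 : 1 + x = π / p := by rw [hx]; field_simp; ring
  have hπ : 0 < π := by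
    have : 0 < 1 + x := by linarith [(abs_le.1 hx2).1]
    rw [e1] at this
    exact (div_pos_iff_of_pos_right hp).1 this
  rw [e1, Real.log_div hπ.ne' hp.ne'] at hlog
  have k1 : |x - T / p| ≤ 2400 * EC H p δ j v + L ^ 77 / r ^ 3 := by
    have : x - T / p = (π - (p + T)) / p := by rw [hx]; ring
    rw [this, abs_div, abs_of_pos hp]
    calc _ ≤ (2400 * (p * EC H p δ j v) + L ^ 76 / r ^ 3) / p := by gcongr
      _ = 2400 * EC H p δ j v + 1 / p * (L ^ 76 / r ^ 3) := by field_simp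
      _ ≤ 2400 * EC H p δ j v + L * (L ^ 76 / r ^ 3) := by gcongr
      _ = _ := by ring
  have k2 : |x + T / p| ≤ 1 := by
    have q1 : L ^ 6 / n ≤ L ^ 6 / r := by
      rw [← c.r_sq]
      gcongr
      nlinarith [c.r_ge]
    have q2 : |T| ≤ L ^ 6 / r + 4 * L ^ 5 / r := by
      rw [abs_le] at h4 hω ⊢
      constructor <;> linarith [h4.1, h4.2, hω.1, hω.2]
    have q3 : |T / p| ≤ L * (L ^ 6 / r + 4 * L ^ 5 / r) := by
      rw [abs_div, abs_of_pos hp]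
      calc |T| / p = 1 / p * |T| := by ring
        _ ≤ _ := by gcongr
    have q4 : L * (L ^ 6 / r + 4 * L ^ 5 / r) ≤ 1 / 2 := by
      rw [← add_div, ← mul_div_assoc, div_le_iff₀ hr]
      have := c.pow_le (show 6 ≤ 7 by norm_num)
      have := c.mul_pow_le (show 7 + 1 ≤ 80 by norm_num) (show (10 : ℝ) ≤ 100 by norm_num)
      linarith
    exact (abs_add_le _ _).trans (by linarith)
  have k3 : |x ^ 2 / 2 - T ^ 2 / (2 * p ^ 2)| ≤ 2400 * EC H p δ j v + L ^ 77 / r ^ 3 := by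
    have : x ^ 2 / 2 - T ^ 2 / (2 * p ^ 2) = (x - T / p) * ((x + T / p) / 2) := by field_simp; ring
    rw [this, abs_mul, abs_div, abs_two]
    have : 0 ≤ |x - T / p| := abs_nonneg _
    nlinarith
  have k4 : |T ^ 2 / (2 * p ^ 2) - (1 - p) ^ 2 * (deg H j + deg H v) ^ 2 / (2 * p ^ 2 * n ^ 2)| ≤
      2 * EC H p δ j v + L ^ 24 / r ^ 3 := by
    refine le_trans (le_of_eq ?_) h3
    rw [← abs_of_pos (show 0 < 2 * p ^ 2 by positivity), ← abs_div, abs_of_pos (show 0 < 2 * p ^ 2 by positivity)]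
    congr 1
    field_simp
  have k5 : 2 * |x| ^ 3 ≤ 2 * L ^ 15 / r ^ 3 := by
    calc _ ≤ 2 * (L ^ 5 / r) ^ 3 := by gcongr
      _ = _ := by ring
  have k6 : 2 * L ^ 15 / r ^ 3 + L ^ 77 / r ^ 3 + L ^ 77 / r ^ 3 + L ^ 24 / r ^ 3 ≤ L ^ 80 / r ^ 3 := by
    simp only [← add_div]
    gcongr
    have := c.pow_le (show 15 ≤ 77 by norm_num)
    have := c.pow_le (show 24 ≤ 77 by norm_num)
    have := c.mul_pow_le (show 77 + 1 ≤ 80 by norm_num) (show (5 : ℝ) ≤ 100 by norm_num)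
    linarith
  rw [Lg, ← hT]
  rw [abs_le] at hlog k1 k3 k4 ⊢
  constructor <;> linarith [hlog.1, hlog.2, k1.1, k1.2, k3.1, k3.2, k4.1, k4.2]

end Fine

/-- Twice the sum of `h_j h_k` over the edges `jk` of `H`. -/
noncomputable def edgeSum {n : ℕ} (H : SimpleGraph (Fin n)) : ℝ := ∑ j, deg H j * gs H j

/-- The exponent of the main formula. -/
noncomputable def mainExp {n : ℕ} (H : SimpleGraph (Fin n)) (p R : ℝ) : ℝ :=
  (1 - p) / (4 * p) * (mu n H 1 ^ 2 + 2 * mu n H 1 - 2 * mu n H 2)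
    - R / (2 * p ^ 2 * n) * (mu n H 1 ^ 2 + mu n H 1 - mu n H 2)
    - (1 - p ^ 2) / (6 * p ^ 2 * n) * mu n H 3
    - (1 - p) / (p * n ^ 2) * (edgeSum H / 2)

lemma edgeSum_eq {n : ℕ} (H : SimpleGraph (Fin n)) :
    edgeSum H = ∑ j, ∑ k, if H.Adj j k then (deg H j : ℝ) * (deg H k : ℝ) else 0 := by
  unfold edgeSum gs
  refine Finset.sum_congr rfl fun j _ => ?_
  rw [Finset.mul_sum]
  refine Finset.sum_congr rfl fun k _ => ?_
  by_cases h : H.Adj j k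
  · rw [ad_of_adj h, if_pos h, one_mul]
  · rw [ad_of_not_adj h, if_neg h]; ring

section Increment
variable {n : ℕ} {𝒢 : Finset (SimpleGraph (Fin n))} {p δ R L Hm r : ℝ} {k : ℕ}
  {H : SimpleGraph (Fin n)} {j v : Fin n}

lemma sum_mul_ends (f : Fin n → ℝ) (j v : Fin n) :
    ∑ u, f u * (ind (u = j) + ind (u = v)) = f j + f v := by
  simp [ind, mul_add, Finset.sum_add_distrib]

lemma sq_ends (hjv : j ≠ v) (u : Fin n) :
    (ind (u = j) + ind (u = v)) * (ind (u = j) + ind (u = v)) = ind (u = j) + ind (u = v) := by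
  by_cases h1 : u = j
  · subst h1; simp [ind, hjv]
  · by_cases h2 : u = v <;> simp [ind, h1, h2, hjv.symm]

lemma mu_one_sup_edge (hn : (n : ℝ) ≠ 0) (hjv : j ≠ v) (h : ¬ H.Adj j v) :
    mu n (H ⊔ SimpleGraph.edge j v) 1 = mu n H 1 + 2 / n := by
  have : ∑ u, (deg (H ⊔ SimpleGraph.edge j v) u : ℝ) = ∑ u, (deg H u : ℝ) + 2 := by
    have e := sum_mul_ends (fun _ => 1) j v
    simp only [one_mul] at e
    simp only [deg_sup_edge hjv h, add_assoc]
    rw [Finset.sum_add_distrib, e]; norm_num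
  rw [sum_deg hn, sum_deg hn] at this
  field_simp; linarith

lemma mu_two_sup_edge (hn : (n : ℝ) ≠ 0) (hjv : j ≠ v) (h : ¬ H.Adj j v) :
    mu n (H ⊔ SimpleGraph.edge j v) 2 = mu n H 2 + (2 * deg H j + 2 * deg H v + 2) / n := by
  have : ∑ u, (deg (H ⊔ SimpleGraph.edge j v) u : ℝ) ^ 2 =
      ∑ u, (deg H u : ℝ) ^ 2 + (2 * deg H j + 2 * deg H v + 2) := by
    have e := sum_mul_ends (fun u => 2 * (deg H u : ℝ) + 1) j v
    rw [show (2 * deg H j + 2 * deg H v + 2 : ℝ) = 2 * deg H j + 1 + (2 * deg H v + 1) by ring, ← e,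
      ← Finset.sum_add_distrib]
    refine Finset.sum_congr rfl fun u _ => ?_
    rw [deg_sup_edge hjv h]
    linear_combination sq_ends hjv u
  rw [sum_deg_pow hn, sum_deg_pow hn] at this
  field_simp; linarith

lemma mu_three_sup_edge (hn : (n : ℝ) ≠ 0) (hjv : j ≠ v) (h : ¬ H.Adj j v) :
    mu n (H ⊔ SimpleGraph.edge j v) 3 = mu n H 3 +
      (3 * deg H j ^ 2 + 3 * deg H j + 3 * deg H v ^ 2 + 3 * deg H v + 2) / n := by
  have : ∑ u, (deg (H ⊔ SimpleGraph.edge j v) u : ℝ) ^ 3 =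
      ∑ u, (deg H u : ℝ) ^ 3 + (3 * deg H j ^ 2 + 3 * deg H j + 3 * deg H v ^ 2 + 3 * deg H v + 2) := by
    have e := sum_mul_ends (fun u => 3 * (deg H u : ℝ) ^ 2 + 3 * deg H u + 1) j v
    rw [show (3 * deg H j ^ 2 + 3 * deg H j + 3 * deg H v ^ 2 + 3 * deg H v + 2 : ℝ) =
      3 * deg H j ^ 2 + 3 * deg H j + 1 + (3 * deg H v ^ 2 + 3 * deg H v + 1) by ring, ← e,
      ← Finset.sum_add_distrib]
    refine Finset.sum_congr rfl fun u _ => ?_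
    rw [deg_sup_edge hjv h]
    linear_combination (3 * (deg H u : ℝ) + (ind (u = j) + ind (u = v)) + 1) * sq_ends hjv u
  rw [sum_deg_pow hn, sum_deg_pow hn] at this
  field_simp; linarith

lemma edgeSum_sup_edge (hjv : j ≠ v) (h : ¬ H.Adj j v) :
    edgeSum (H ⊔ SimpleGraph.edge j v) =
      edgeSum H + 2 * ((deg H j + 1) * (deg H v + 1) + gs H j + gs H v) := by
  have hgs : ∀ u, gs (H ⊔ SimpleGraph.edge j v) u =
      gs H u + (ad H u j + ad H u v) + (ind (u = j) * (deg H v + 1) + ind (u = v) * (deg H j + 1)) := by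
    intro u
    have e2 := sum_mul_ends (fun w => ad (H ⊔ SimpleGraph.edge j v) u w) j v
    have e3 : ∑ w, (ind (u = j) * ind (w = v) + ind (u = v) * ind (w = j)) * (deg H w : ℝ) =
        ind (u = j) * deg H v + ind (u = v) * deg H j := by
      simp [ind, add_mul, Finset.sum_add_distrib]
    have e4 : gs (H ⊔ SimpleGraph.edge j v) u = gs H u +
        ∑ w, (ind (u = j) * ind (w = v) + ind (u = v) * ind (w = j)) * (deg H w : ℝ) +
        ∑ w, ad (H ⊔ SimpleGraph.edge j v) u w * (ind (w = j) + ind (w = v)) := by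
      unfold gs
      rw [← Finset.sum_add_distrib, ← Finset.sum_add_distrib]
      refine Finset.sum_congr rfl fun w _ => ?_
      rw [deg_sup_edge hjv h, ad_sup_edge hjv h]; ring
    rw [e4, e3, e2, ad_sup_edge hjv h, ad_sup_edge hjv h]
    simp only [ind, if_true, if_neg hjv, if_neg hjv.symm]
    ring
  have hadj : ad H j v = 0 := ad_of_not_adj h
  have hadj' : ad H v j = 0 := by rw [ad_comm]; exact hadj
  have f1 := sum_mul_ends (fun u => gs (H ⊔ SimpleGraph.edge j v) u) j v
  have f2 : ∑ u, (deg H u : ℝ) * (ad H u j + ad H u v) = gs H j + gs H v := by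
    unfold gs
    rw [← Finset.sum_add_distrib]
    refine Finset.sum_congr rfl fun u _ => ?_
    rw [ad_comm H u j, ad_comm H u v]; ring
  have f3 : ∑ u, (deg H u : ℝ) * (ind (u = j) * (deg H v + 1) + ind (u = v) * (deg H j + 1)) =
      deg H j * (deg H v + 1) + deg H v * (deg H j + 1) := by
    simp [ind, mul_add, Finset.sum_add_distrib]
  have f4 : edgeSum (H ⊔ SimpleGraph.edge j v) = edgeSum H + (gs H j + gs H v) +
      (deg H j * (deg H v + 1) + deg H v * (deg H j + 1)) +
      (gs (H ⊔ SimpleGraph.edge j v) j + gs (H ⊔ SimpleGraph.edge j v) v) := by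
    rw [← f1, ← f2, ← f3]
    unfold edgeSum
    rw [← Finset.sum_add_distrib, ← Finset.sum_add_distrib, ← Finset.sum_add_distrib]
    refine Finset.sum_congr rfl fun u _ => ?_
    rw [deg_sup_edge hjv h, hgs]; ring
  rw [f4, hgs, hgs, ad_self, ad_self, hadj, hadj']
  simp only [ind, if_true, if_neg hjv, if_neg hjv.symm]
  ring

lemma mainExp_sup_edge (hn : (n : ℝ) ≠ 0) (hp : p ≠ 0) (hjv : j ≠ v) (h : ¬ H.Adj j v) :
    mainExp (H ⊔ SimpleGraph.edge j v) p R - mainExp H p R - Lg H p R j v =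
      (1 - p) / (p * n ^ 2) - 2 * R / (p ^ 2 * n ^ 3)
        - (1 - p ^ 2) / (6 * p ^ 2 * n ^ 2) * (3 * (deg H j + deg H v) + 2)
        - (1 - p) * (deg H j + deg H v + 1) / (p * n ^ 2) := by
  unfold mainExp Lg Tht
  rw [mu_one_sup_edge hn hjv h, mu_two_sup_edge hn hjv h, mu_three_sup_edge hn hjv h,
    edgeSum_sup_edge hjv h]
  field_simp
  ring

lemma abs_mainExp_sub_le (c : Ctx 𝒢 p δ R L Hm r) (a : Adm 𝒢 L Hm k H ⊥) (hjv : j ≠ v) (h : ¬ H.Adj j v) :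
    |mainExp (H ⊔ SimpleGraph.edge j v) p R - mainExp H p R - Lg H p R j v| ≤ L ^ 5 / r ^ 3 := by
  have hn := c.n_pos
  have hr := c.r_pos
  have hL := c.L_pos
  have hL1 := c.L_ge
  have hp := c.p_pos
  have hp1 := c.p_lt
  have hr1 := c.r_ge
  have hip := c.inv_p_le
  have hj := a.deg_le_Lr c j
  have hv := a.deg_le_Lr c v
  have hne : 𝒢.Nonempty := a.nonempty.mono fam_subset
  have hR0 := c.R_nonneg hne
  have hR : R ≤ (L * r) ^ 2 := (c.R_le hne).trans (pow_le_pow_left₀ c.δ_nonneg c.δ_le 2)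
  have hj0 : (0 : ℝ) ≤ deg H j := Nat.cast_nonneg _
  have hv0 : (0 : ℝ) ≤ deg H v := Nat.cast_nonneg _
  rw [mainExp_sup_edge hn.ne' hp.ne' hjv h, ← c.r_sq]
  have e : (1 - p) / (p * (r ^ 2) ^ 2) - 2 * R / (p ^ 2 * (r ^ 2) ^ 3)
      - (1 - p ^ 2) / (6 * p ^ 2 * (r ^ 2) ^ 2) * (3 * (deg H j + deg H v) + 2)
      - (1 - p) * (deg H j + deg H v + 1) / (p * (r ^ 2) ^ 2) =
      ((1 - p) * (1 / p) / r - 2 * (R / r ^ 2) * (1 / p) ^ 2 / r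
        - (1 - p ^ 2) / 6 * (1 / p) ^ 2 * ((3 * (deg H j + deg H v) + 2) / r)
        - (1 - p) * (1 / p) * ((deg H j + deg H v + 1) / r)) / r ^ 3 := by
    field_simp
  rw [e, abs_div, abs_of_pos (show 0 < r ^ 3 by positivity)]
  refine div_le_div_of_nonneg_right ?_ (by positivity)
  have i0 : 0 ≤ 1 / p := by positivity
  have i2 : (1 / p) ^ 2 ≤ L ^ 2 := by gcongr
  have t1 : (1 - p) * (1 / p) / r ≤ L := by
    rw [div_le_iff₀ hr]
    nlinarith
  have t1' : 0 ≤ (1 - p) * (1 / p) / r := div_nonneg (mul_nonneg (by linarith) i0) hr.le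
  have t2 : 2 * (R / r ^ 2) * (1 / p) ^ 2 / r ≤ 2 * L ^ 4 := by
    have : R / r ^ 2 ≤ L ^ 2 := by rw [div_le_iff₀ (by positivity)]; linarith [hR]
    have h2 : 2 * (R / r ^ 2) * (1 / p) ^ 2 ≤ 2 * L ^ 2 * L ^ 2 := by gcongr
    rw [div_le_iff₀ hr]
    have : 0 < L ^ 4 := by positivity
    nlinarith
  have t2' : 0 ≤ 2 * (R / r ^ 2) * (1 / p) ^ 2 / r := by positivity
  have t3 : (1 - p ^ 2) / 6 * (1 / p) ^ 2 * ((3 * (deg H j + deg H v) + 2) / r) ≤ 1 * L ^ 2 * (7 * L) := by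
    have hb : (3 * (deg H j + deg H v) + 2) / r ≤ 7 * L := by
      rw [div_le_iff₀ hr]; nlinarith
    have ha : (1 - p ^ 2) / 6 ≤ 1 := by nlinarith
    gcongr
  have t3' : 0 ≤ (1 - p ^ 2) / 6 * (1 / p) ^ 2 * ((3 * (deg H j + deg H v) + 2) / r) := by
    have ha : 0 ≤ (1 - p ^ 2) / 6 := by nlinarith
    positivity
  have t4 : (1 - p) * (1 / p) * ((deg H j + deg H v + 1) / r) ≤ 1 * L * (3 * L) := by
    have hb : (deg H j + deg H v + 1) / r ≤ 3 * L := by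
      rw [div_le_iff₀ hr]; nlinarith
    have ha : 1 - p ≤ 1 := by linarith
    gcongr
  have t4' : 0 ≤ (1 - p) * (1 / p) * ((deg H j + deg H v + 1) / r) := by
    have ha : 0 ≤ 1 - p := by linarith
    positivity
  have f : L + (2 * L ^ 4 + 1 * L ^ 2 * (7 * L) + 1 * L * (3 * L)) ≤ L ^ 5 := by
    have := c.pow_le (show 3 ≤ 4 by norm_num)
    have := c.pow_le (show 2 ≤ 4 by norm_num)
    have := c.pow_le (show 1 ≤ 4 by norm_num)
    have := c.mul_pow_le (show 4 + 1 ≤ 5 by norm_num) (show (13 : ℝ) ≤ 100 by norm_num)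
    nlinarith
  rw [abs_le]
  constructor <;> linarith

lemma log_card_step (c : Ctx 𝒢 p δ R L Hm r) (a : Adm 𝒢 L Hm (k + 7) H ⊥) (hjv : j ≠ v)
    (h : ¬ H.Adj j v) :
    |Real.log (fam 𝒢 (H ⊔ SimpleGraph.edge j v) ⊥).card - Real.log (fam 𝒢 H ⊥).card - Real.log p -
      (mainExp (H ⊔ SimpleGraph.edge j v) p R - mainExp H p R)| ≤
      5000 * EC H p δ j v + L ^ 81 / r ^ 3 := by
  have hr := c.r_pos
  have h1 := abs_mainExp_sub_le c a hjv h
  have h2 := log_pr_fine c a hjv h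
  have h3 : (0 : ℝ) < (fam 𝒢 H ⊥).card := by exact_mod_cast a.nonempty.card_pos
  rw [card_fam_sup_edge a.nonempty hjv]
  change |Real.log (pr 𝒢 H ⊥ j v * _) - _ - _ - _| ≤ _
  rw [Real.log_mul (pr_pos c a hjv h (by simp)).ne' h3.ne']
  have h4 : L ^ 80 / r ^ 3 + L ^ 5 / r ^ 3 ≤ L ^ 81 / r ^ 3 := by
    rw [← add_div]
    gcongr
    have := c.pow_le (show 5 ≤ 80 by norm_num)
    have := c.mul_pow_le (show 80 + 1 ≤ 81 by norm_num) (show (2 : ℝ) ≤ 100 by norm_num)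
    linarith
  rw [abs_le] at h1 h2 ⊢
  constructor <;> linarith [h1.1, h1.2, h2.1, h2.2]

end Increment

section Telescope
variable {n : ℕ} {𝒢 : Finset (SimpleGraph (Fin n))} {p δ R L Hm r : ℝ}
  {H K : SimpleGraph (Fin n)} {j v : Fin n}

lemma ad_mono (h : K ≤ H) (u w : Fin n) : ad K u w ≤ ad H u w := by
  by_cases hk : K.Adj u w
  · rw [ad_of_adj hk, ad_of_adj (h hk)]
  · rw [ad_of_not_adj hk]; exact ad_nonneg _ _ _

lemma deg_mono (h : K ≤ H) (u : Fin n) : (deg K u : ℝ) ≤ deg H u := by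
  rw [deg_eq_sum, deg_eq_sum]
  exact Finset.sum_le_sum fun w _ => ad_mono h u w

lemma gs_mono (h : K ≤ H) (u : Fin n) : gs K u ≤ gs H u :=
  Finset.sum_le_sum fun w _ =>
    mul_le_mul (ad_mono h u w) (deg_mono h w) (Nat.cast_nonneg _) (ad_nonneg _ _ _)

lemma EC_mono (hp : 0 < p) (hδ : 0 ≤ δ) (h : K ≤ H) (u w : Fin n) : EC K p δ u w ≤ EC H p δ u w := by
  have h1 := deg_mono h u
  have h2 := deg_mono h w
  have h3 := gs_mono h u
  have h4 := gs_mono h w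
  have h5 : mu n K 2 ≤ mu n H 2 :=
    div_le_div_of_nonneg_right (Finset.sum_le_sum fun x _ =>
      pow_le_pow_left₀ (Nat.cast_nonneg _) (deg_mono h x) 2) (Nat.cast_nonneg _)
  have h6 := pow_le_pow_left₀ (Nat.cast_nonneg _) h1 2
  have h7 := pow_le_pow_left₀ (Nat.cast_nonneg _) h2 2
  unfold EC
  exact div_le_div_of_nonneg_right (mul_le_mul_of_nonneg_left (by linarith) (by positivity))
    (by positivity)

lemma EC_comm (u w : Fin n) : EC H p δ u w = EC H p δ w u := by unfold EC; ring

/-- Half the sum of `W` over the ordered pairs of adjacent vertices. -/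
noncomputable def edgeTot {n : ℕ} (K : SimpleGraph (Fin n)) (W : Fin n → Fin n → ℝ) : ℝ :=
  (∑ u, ∑ w, ad K u w * W u w) / 2

lemma edgeTot_sup_edge (hjv : j ≠ v) (h : ¬ K.Adj j v) {W : Fin n → Fin n → ℝ}
    (hW : W j v = W v j) :
    edgeTot (K ⊔ SimpleGraph.edge j v) W = edgeTot K W + W j v := by
  have : ∑ u, ∑ w, (ind (u = j) * ind (w = v) + ind (u = v) * ind (w = j)) * W u w =
      W j v + W v j := by
    simp [ind, add_mul, Finset.sum_add_distrib]
  unfold edgeTot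
  simp only [ad_sup_edge hjv h]
  rw [show W j v = (W j v + W v j) / 2 by rw [hW]; ring, ← this, ← add_div, ← Finset.sum_add_distrib]
  congr 1
  refine Finset.sum_congr rfl fun u _ => ?_
  rw [← Finset.sum_add_distrib]
  exact Finset.sum_congr rfl fun w _ => by ring

lemma mainExp_bot : mainExp (⊥ : SimpleGraph (Fin n)) p R = 0 := by
  simp [mainExp, mu, edgeSum, deg_bot]

lemma edgeTot_bot (W : Fin n → Fin n → ℝ) : edgeTot (⊥ : SimpleGraph (Fin n)) W = 0 := by
  simp [edgeTot, ad]

lemma telescope (c : Ctx 𝒢 p δ R L Hm r) (hne : 𝒢.Nonempty)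
    (hdeg : ∀ j, (deg H j : ℝ) + 8 ≤ Hm) (hsum : ∑ j, (deg H j : ℝ) + 16 ≤ L ^ 2 * n) (K : SimpleGraph (Fin n)) :
    K ≤ H → (fam 𝒢 K ⊥).Nonempty ∧
      |Real.log (fam 𝒢 K ⊥).card - Real.log 𝒢.card - edgeTot K (fun _ _ => 1) * Real.log p - mainExp K p R| ≤
        edgeTot K (fun u w => 5000 * EC H p δ u w + L ^ 81 / r ^ 3) := by
  induction K using WellFoundedLT.induction with
  | ind K ih =>
    intro hK
    rcases eq_or_ne K ⊥ with rfl | hb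
    · have : fam 𝒢 ⊥ ⊥ = 𝒢 := by ext G; simp [mem_fam]
      rw [this]
      simp only [edgeTot_bot, mainExp_bot]
      exact ⟨hne, by simp⟩
    · obtain ⟨j, v, hjv⟩ : ∃ j v, K.Adj j v := by
        by_contra hcon
        push Not at hcon
        exact hb (by ext u w; simp [hcon u w])
      have hne' : j ≠ v := hjv.ne
      set K₀ := K \ SimpleGraph.edge j v with hK₀
      have hKK : K = K₀ ⊔ SimpleGraph.edge j v := by
        rw [hK₀, sdiff_sup_cancel]
        exact (SimpleGraph.edge_le_iff _).2 (Or.inr hjv)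
      have hn0 : ¬ K₀.Adj j v := by
        rw [hK₀, SimpleGraph.sdiff_adj]
        simp [SimpleGraph.edge_adj, hne']
      have hle : K₀ ≤ K := sdiff_le
      have hlt : K₀ < K := lt_of_le_of_ne hle fun he => hn0 (he ▸ hjv)
      obtain ⟨i1, i2⟩ := ih K₀ hlt (hle.trans hK)
      have hmono := deg_mono (hle.trans hK)
      have hA : Adm 𝒢 L Hm 8 K₀ ⊥ :=
        { nonempty := i1
          deg_le := fun u => by have := hmono u; have := hdeg u; push_cast; linarith
          sum_le := by
            have := Finset.sum_le_sum fun u (_ : u ∈ Finset.univ) => hmono u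
            push_cast; linarith
          degQ_le := fun u => by simp [deg_bot]; norm_num }
      have hA' := Adm.add (k := 7) c hA hne' hn0 (by simp)
      have hs := log_card_step (k := 1) c hA hne' hn0
      have hE := EC_mono c.p_pos c.δ_nonneg (hle.trans hK) j v
      rw [hKK]
      refine ⟨hA'.nonempty, ?_⟩
      rw [edgeTot_sup_edge hne' hn0 rfl, edgeTot_sup_edge hne' hn0 (by rw [EC_comm])]
      rw [abs_le] at i2 hs ⊢
      constructor <;> linarith [i2.1, i2.2, hs.1, hs.2]

lemma edgeTot_one (hn : (n : ℝ) ≠ 0) : edgeTot H (fun _ _ => 1) = n * mu n H 1 / 2 := by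
  rw [← sum_deg hn]
  simp [edgeTot, deg_eq_sum]

lemma sum_edge_le (f : ℝ → ℝ → ℝ) (hf : ∀ x y, 0 ≤ x → 0 ≤ y → f x y ≤ x ^ 2 + y ^ 2) :
    ∑ u, ∑ w, ad H u w * f (deg H u) (deg H w) ≤ 2 * ∑ u, (deg H u : ℝ) ^ 3 := by
  have h1 : ∑ u, ∑ w, ad H u w * (deg H u : ℝ) ^ 2 = ∑ u, (deg H u : ℝ) ^ 3 := by
    refine Finset.sum_congr rfl fun u _ => ?_
    rw [← Finset.sum_mul, ← deg_eq_sum]; ring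
  have h2 : ∑ u, ∑ w, ad H u w * (deg H w : ℝ) ^ 2 = ∑ u, (deg H u : ℝ) ^ 3 := by
    rw [Finset.sum_comm, ← h1]
    exact Finset.sum_congr rfl fun u _ => Finset.sum_congr rfl fun w _ => by rw [ad_comm]
  calc _ ≤ ∑ u, ∑ w, (ad H u w * (deg H u : ℝ) ^ 2 + ad H u w * (deg H w : ℝ) ^ 2) :=
        Finset.sum_le_sum fun u _ => Finset.sum_le_sum fun w _ => by
          rw [← mul_add]
          exact mul_le_mul_of_nonneg_left (hf _ _ (Nat.cast_nonneg _) (Nat.cast_nonneg _)) (ad_nonneg _ _ _)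
    _ = _ := by simp only [Finset.sum_add_distrib, h1, h2]; ring

lemma mu_one_mul_mu_two_le (hn : (n : ℝ) ≠ 0) : mu n H 1 * mu n H 2 ≤ 2 * mu n H 3 := by
  have h0 : (0 : ℝ) ≤ n := Nat.cast_nonneg _
  have h1 : (∑ u, (deg H u : ℝ)) * ∑ w, (deg H w : ℝ) ^ 2 ≤
      ∑ u, ∑ w, ((deg H u : ℝ) ^ 3 + (deg H w : ℝ) ^ 3) := by
    rw [Finset.sum_mul_sum]
    refine Finset.sum_le_sum fun u _ => Finset.sum_le_sum fun w _ => ?_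
    have hx : (0 : ℝ) ≤ deg H u := Nat.cast_nonneg _
    have hy : (0 : ℝ) ≤ deg H w := Nat.cast_nonneg _
    nlinarith [mul_nonneg (add_nonneg hx hy) (sq_nonneg ((deg H u : ℝ) - deg H w)), mul_nonneg hx (sq_nonneg ((deg H u : ℝ) - deg H w)), mul_nonneg hy (sq_nonneg ((deg H u : ℝ) - deg H w)), mul_nonneg hx (sq_nonneg (deg H u : ℝ))]
  have h2 : ∑ u, ∑ w, ((deg H u : ℝ) ^ 3 + (deg H w : ℝ) ^ 3) = n * (2 * (n * mu n H 3)) := by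
    simp only [Finset.sum_add_distrib, sum_deg_pow hn]
    simp [← Finset.mul_sum, sum_deg_pow hn]; ring
  rw [h2, sum_deg hn, sum_deg_pow hn] at h1
  have : 0 < (n : ℝ) ^ 2 := by positivity
  refine le_of_mul_le_mul_left ?_ this
  linarith

lemma edgeTot_EC_le (hn : (n : ℝ) ≠ 0) (hp : 0 < p) (hδ : 0 ≤ δ) :
    edgeTot H (EC H p δ) ≤ 3 * (δ ^ 3 * mu n H 3 / (p ^ 3 * n ^ 2)) := by
  have hg1 : ∑ u, ∑ w, ad H u w * gs H u = edgeSum H := by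
    unfold edgeSum
    refine Finset.sum_congr rfl fun u _ => ?_
    rw [← Finset.sum_mul, ← deg_eq_sum]
  have hg2 : ∑ u, ∑ w, ad H u w * gs H w = edgeSum H := by
    rw [Finset.sum_comm, ← hg1]
    exact Finset.sum_congr rfl fun u _ => Finset.sum_congr rfl fun w _ => by rw [ad_comm]
  have h1 := sum_edge_le (H := H) (fun x y => x ^ 2 + y ^ 2) fun x y _ _ => le_rfl
  have h2 := sum_edge_le (H := H) (fun x y => 2 * (x * y)) fun x y _ _ => by nlinarith [sq_nonneg (x - y)]
  have h2' : ∑ u, ∑ w, ad H u w * (2 * ((deg H u : ℝ) * deg H w)) = 2 * edgeSum H := by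
    simp only [edgeSum, gs, Finset.mul_sum]
    exact Finset.sum_congr rfl fun u _ => Finset.sum_congr rfl fun w _ => by ring
  have h3 : ∑ u, ∑ w, ad H u w * mu n H 2 = n * mu n H 1 * mu n H 2 := by
    simp only [← Finset.sum_mul, ← deg_eq_sum, sum_deg hn]
  have h4 := mu_one_mul_mu_two_le (H := H) hn
  have h5 : (0 : ℝ) ≤ n := Nat.cast_nonneg _
  have key : ∑ u, ∑ w, ad H u w * ((deg H u : ℝ) ^ 2 + deg H w ^ 2 + gs H u + gs H w + mu n H 2) ≤
      6 * (n * mu n H 3) := by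
    have : ∑ u, ∑ w, ad H u w * ((deg H u : ℝ) ^ 2 + deg H w ^ 2 + gs H u + gs H w + mu n H 2) =
        ∑ u, ∑ w, ad H u w * ((deg H u : ℝ) ^ 2 + deg H w ^ 2) + ∑ u, ∑ w, ad H u w * gs H u +
        ∑ u, ∑ w, ad H u w * gs H w + ∑ u, ∑ w, ad H u w * mu n H 2 := by
      simp only [← Finset.sum_add_distrib]
      exact Finset.sum_congr rfl fun u _ => Finset.sum_congr rfl fun w _ => by ring
    rw [this, hg1, hg2, h3]
    rw [sum_deg_pow hn] at h1 h2
    rw [h2'] at h2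
    have := mul_le_mul_of_nonneg_left h4 h5
    linarith
  have e : edgeTot H (EC H p δ) = δ ^ 3 / (p ^ 3 * n ^ 3) * (∑ u, ∑ w, ad H u w *
      ((deg H u : ℝ) ^ 2 + deg H w ^ 2 + gs H u + gs H w + mu n H 2)) / 2 := by
    unfold edgeTot EC
    simp only [Finset.mul_sum]
    congr 1
    exact Finset.sum_congr rfl fun u _ => Finset.sum_congr rfl fun w _ => by ring
  rw [e]
  calc _ ≤ δ ^ 3 / (p ^ 3 * n ^ 3) * (6 * (n * mu n H 3)) / 2 := by gcongr
    _ = _ := by field_simp; ring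

/-- The logarithm of the probability that a fixed copy of `H` is present. -/
lemma abs_log_prob_sub_le (c : Ctx 𝒢 p δ R L Hm r) (hne : 𝒢.Nonempty)
    (hdeg : ∀ j, (deg H j : ℝ) + 8 ≤ Hm) (hsum : ∑ j, (deg H j : ℝ) + 16 ≤ L ^ 2 * n) :
    (fam 𝒢 H ⊥).Nonempty ∧
      |Real.log (fam 𝒢 H ⊥).card - Real.log 𝒢.card - n * mu n H 1 / 2 * Real.log p - mainExp H p R| ≤
        15000 * (δ ^ 3 * mu n H 3 / (p ^ 3 * n ^ 2)) + L ^ 83 / r := by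
  have hn := c.n_pos
  have hr := c.r_pos
  have hL := c.L_pos
  obtain ⟨h1, h2⟩ := telescope c hne hdeg hsum H le_rfl
  refine ⟨h1, ?_⟩
  rw [edgeTot_one hn.ne'] at h2
  refine h2.trans ?_
  have e : edgeTot H (fun u w => 5000 * EC H p δ u w + L ^ 81 / r ^ 3) =
      5000 * edgeTot H (EC H p δ) + L ^ 81 / r ^ 3 * edgeTot H (fun _ _ => 1) := by
    unfold edgeTot
    rw [mul_div_assoc', mul_div_assoc', ← add_div]
    simp only [Finset.mul_sum, ← Finset.sum_add_distrib]
    congr 1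
    exact Finset.sum_congr rfl fun u _ => Finset.sum_congr rfl fun w _ => by ring
  rw [e, edgeTot_one hn.ne', ← sum_deg hn.ne']
  have h3 := edgeTot_EC_le (H := H) hn.ne' c.p_pos c.δ_nonneg
  have h4 : L ^ 81 / r ^ 3 * ((∑ j, (deg H j : ℝ)) / 2) ≤ L ^ 81 / r ^ 3 * (L ^ 2 * r ^ 2) := by
    have h0 : 0 ≤ ∑ j, (deg H j : ℝ) := Finset.sum_nonneg fun _ _ => Nat.cast_nonneg _
    rw [c.r_sq]
    exact mul_le_mul_of_nonneg_left (by linarith) (by positivity)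
  have h5 : L ^ 81 / r ^ 3 * (L ^ 2 * r ^ 2) = L ^ 83 / r := by field_simp
  linarith

end Telescope

section Labellings
variable {n : ℕ} {H G : SimpleGraph (Fin n)} {d : Fin n → ℕ}

/-- The graphs whose degree sequence is a rearrangement of `d`. -/
noncomputable def permFam (n : ℕ) (d : Fin n → ℕ) : Finset (SimpleGraph (Fin n)) :=
  Finset.univ.filter fun G => ∃ σ : Equiv.Perm (Fin n), ∀ v, deg G v = d (σ v)

lemma clos_permFam (d : Fin n → ℕ) : Clos (permFam n d) := by
  intro G hG G' σ h
  simp only [permFam, Finset.mem_filter, Finset.mem_univ, true_and] at hG ⊢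
  obtain ⟨τ, hτ⟩ := hG
  exact ⟨σ.trans τ, fun v => by rw [h, hτ]; rfl⟩

lemma degFinset_subset_permFam (d : Fin n → ℕ) : degFinset n d ⊆ permFam n d := fun G hG => by
  simp only [degFinset, permFam, Finset.mem_filter, Finset.mem_univ, true_and] at hG ⊢
  exact ⟨1, hG⟩

lemma deg_comap (σ : Equiv.Perm (Fin n)) (G : SimpleGraph (Fin n)) (v : Fin n) :
    deg (G.comap σ) v = deg G (σ v) := by
  unfold deg
  refine Finset.card_bij (fun w _ => σ w) (fun w hw => ?_) (fun _ _ _ _ h => σ.injective h) fun w hw => ?_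
  · simpa using hw
  · exact ⟨σ.symm w, by simpa using hw, by simp⟩

lemma card_iso_eq {K : SimpleGraph (Fin n)} (hK : Nonempty (K ≃g H)) :
    (Finset.univ.filter fun σ : Equiv.Perm (Fin n) => H.comap σ.symm = K).card = autCard H := by
  obtain ⟨f⟩ := hK
  unfold autCard
  refine (Finset.card_bij (fun π _ => π.trans f.symm.toEquiv) (fun π hπ => ?_)
    (fun π _ π' _ h => ?_) fun σ hσ => ?_).symm
  · simp only [Finset.mem_filter, Finset.mem_univ, true_and] at hπ ⊢
    ext x y
    simp only [SimpleGraph.comap_adj]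
    rw [← hπ, ← f.map_adj_iff]
    simp only [Equiv.symm_trans_apply, Equiv.apply_symm_apply]
    exact Iff.rfl
  · ext x
    have := congrArg (fun e : Equiv.Perm (Fin n) => f (e x)) h
    simpa using congrArg Fin.val this
  · simp only [Finset.mem_filter, Finset.mem_univ, true_and] at hσ
    refine ⟨σ.trans f.toEquiv, ?_, ?_⟩
    · simp only [Finset.mem_filter, Finset.mem_univ, true_and]
      intro i j
      have h1 : K.Adj (σ i) (σ j) ↔ H.Adj i j := by rw [← hσ]; simp
      rw [← h1, ← f.map_adj_iff]; rfl
    · ext x; simp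

lemma card_embeddings (H G : SimpleGraph (Fin n)) :
    (Finset.univ.filter fun σ : Equiv.Perm (Fin n) => ∀ u v, H.Adj u v → G.Adj (σ u) (σ v)).card =
      copyCount H G * autCard H := by
  unfold copyCount
  rw [Finset.card_eq_sum_card_fiberwise (f := fun σ : Equiv.Perm (Fin n) => H.comap σ.symm)
    (t := Finset.univ.filter fun K : SimpleGraph (Fin n) => K ≤ G ∧ Nonempty (K ≃g H))]
  · refine Finset.sum_const_nat fun K hK => ?_
    simp only [Finset.mem_filter, Finset.mem_univ, true_and] at hK
    rw [← card_iso_eq hK.2, Finset.filter_filter]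
    congr 1
    ext σ
    simp only [Finset.mem_filter, Finset.mem_univ, true_and, and_iff_right_iff_imp]
    rintro rfl u v huv
    exact hK.1 (by simpa using huv)
  · intro σ hσ
    simp only [Finset.coe_filter, Finset.mem_univ, true_and, Set.mem_ofPred_eq] at hσ ⊢
    refine ⟨fun x y hxy => ?_, ⟨⟨σ.symm, by simp⟩⟩⟩
    simpa using hσ _ _ hxy

lemma card_rearrangements {G₀ : SimpleGraph (Fin n)} (h : G₀ ∈ permFam n d) :
    (Finset.univ.filter fun σ : Equiv.Perm (Fin n) => ∀ v, deg G₀ v = d (σ v)).card =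
      (Finset.univ.filter fun σ : Equiv.Perm (Fin n) => ∀ v, d v = d (σ v)).card := by
  simp only [permFam, Finset.mem_filter, Finset.mem_univ, true_and] at h
  obtain ⟨τ, hτ⟩ := h
  refine Finset.card_bij (fun σ _ => τ.symm.trans σ) (fun σ hσ => ?_) (fun σ _ σ' _ h => ?_) fun σ hσ => ?_
  · simp only [Finset.mem_filter, Finset.mem_univ, true_and] at hσ ⊢
    intro v
    rw [Equiv.trans_apply, ← hσ, hτ]; simp
  · ext x
    simpa using congrArg (fun e : Equiv.Perm (Fin n) => (e (τ x) : ℕ)) h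
  · simp only [Finset.mem_filter, Finset.mem_univ, true_and] at hσ
    refine ⟨τ.trans σ, ?_, by ext; simp⟩
    simp only [Finset.mem_filter, Finset.mem_univ, true_and]
    intro v
    rw [hτ, hσ]; rfl

lemma card_comap_eq (σ : Equiv.Perm (Fin n)) :
    ((degFinset n d).filter fun G => ∀ u v, H.Adj u v → G.Adj (σ u) (σ v)).card =
      ((fam (permFam n d) H ⊥).filter fun G => ∀ v, deg G v = d (σ v)).card := by
  refine Finset.card_bij (fun G _ => G.comap σ) (fun G hG => ?_) (fun G _ G' _ h => ?_) fun G hG => ?_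
  · simp only [degFinset, Finset.mem_filter, Finset.mem_univ, true_and] at hG
    have hd : ∀ v, deg (G.comap σ) v = d (σ v) := fun v => by rw [deg_comap, hG.1]
    rw [Finset.mem_filter, mem_fam]
    exact ⟨⟨by simpa [permFam] using ⟨σ, hd⟩, hG.2, by simp⟩, hd⟩
  · ext x y
    have := congrArg (fun K : SimpleGraph (Fin n) => K.Adj (σ.symm x) (σ.symm y)) h
    simpa using this
  · rw [Finset.mem_filter, mem_fam] at hG
    refine ⟨G.comap σ.symm, ?_, by ext; simp⟩
    simp only [degFinset, Finset.mem_filter, Finset.mem_univ, true_and]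
    exact ⟨fun j => by rw [deg_comap, hG.2]; simp, fun u v h => by simpa using hG.1.2.1 u v h⟩

lemma sum_copyCount_mul (d : Fin n → ℕ) (H : SimpleGraph (Fin n)) :
    ∑ G ∈ degFinset n d, copyCount H G * autCard H =
      (fam (permFam n d) H ⊥).card *
        (Finset.univ.filter fun σ : Equiv.Perm (Fin n) => ∀ v, d v = d (σ v)).card := by
  simp only [← card_embeddings]
  have h1 := Finset.sum_card_bipartiteAbove_eq_sum_card_bipartiteBelow (s := degFinset n d)
    (t := (Finset.univ : Finset (Equiv.Perm (Fin n)))) (fun G σ => ∀ u v, H.Adj u v → G.Adj (σ u) (σ v))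
  have h2 := Finset.sum_card_bipartiteAbove_eq_sum_card_bipartiteBelow (s := fam (permFam n d) H ⊥)
    (t := (Finset.univ : Finset (Equiv.Perm (Fin n)))) (fun G σ => ∀ v, deg G v = d (σ v))
  simp only [Finset.bipartiteAbove, Finset.bipartiteBelow] at h1 h2
  rw [h1, Finset.sum_congr rfl fun σ _ => card_comap_eq σ, ← h2]
  exact Finset.sum_const_nat fun G hG => card_rearrangements (mem_fam.1 hG).1

lemma autCard_bot : autCard (⊥ : SimpleGraph (Fin n)) = n.factorial := by
  simp [autCard, Fintype.card_perm]

lemma autCard_pos (H : SimpleGraph (Fin n)) : 0 < autCard H :=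
  Finset.card_pos.2 ⟨1, by simp⟩

lemma copyCount_bot (G : SimpleGraph (Fin n)) : copyCount ⊥ G = 1 := by
  have h := card_embeddings ⊥ G
  have h' : (0 : ℕ) < n.factorial := Nat.factorial_pos n
  rw [autCard_bot] at h
  have h2 : n.factorial = copyCount ⊥ G * n.factorial := by simpa [Fintype.card_perm, -right_eq_mul₀, -mul_eq_right₀] using h
  exact Nat.eq_of_mul_eq_mul_right h' (by linarith)

lemma expCopies_eq (hd : (degFinset n d).Nonempty) (H : SimpleGraph (Fin n)) :
    expCopies n d H = (n.factorial : ℝ) / autCard H *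
      ((fam (permFam n d) H ⊥).card / (permFam n d).card) := by
  have h1 := sum_copyCount_mul d H
  have h2 := sum_copyCount_mul d ⊥
  have hb : fam (permFam n d) ⊥ ⊥ = permFam n d := by ext G; simp [mem_fam]
  simp only [copyCount_bot, autCard_bot, Finset.sum_const, one_mul, smul_eq_mul, hb] at h2
  set c := (Finset.univ.filter fun σ : Equiv.Perm (Fin n) => ∀ v, d v = d (σ v)).card
  have hc : (c : ℝ) ≠ 0 := by
    have : 0 < c := Finset.card_pos.2 ⟨1, by simp⟩
    exact_mod_cast this.ne'
  have hA : (autCard H : ℝ) ≠ 0 := by exact_mod_cast (autCard_pos H).ne'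
  have hD : ((degFinset n d).card : ℝ) ≠ 0 := by exact_mod_cast hd.card_pos.ne'
  have hP : ((permFam n d).card : ℝ) ≠ 0 := by
    exact_mod_cast (hd.mono (degFinset_subset_permFam d)).card_pos.ne'
  have h1' : (∑ G ∈ degFinset n d, (copyCount H G : ℝ)) * autCard H = (fam (permFam n d) H ⊥).card * c := by
    rw [Finset.sum_mul]; exact_mod_cast h1
  have h2' : ((degFinset n d).card : ℝ) * n.factorial = (permFam n d).card * c := by exact_mod_cast h2
  unfold expCopies
  rw [div_mul_div_comm, div_eq_div_iff hD (mul_ne_zero hA hP)]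
  refine mul_right_cancel₀ hc ?_
  linear_combination (permFam n d).card * c * h1' - (fam (permFam n d) H ⊥).card * c * h2'

end Labellings

/-- All the largeness conditions on `n` used in the proof, for `L = n ^ η = s ^ 2`. -/
lemma exists_large (a C₀ b η : ℝ) (ha : 0 < a) (hb : 0 < b) (hη : 0 < η) :
    ∃ N : ℕ, ∀ n : ℕ, N ≤ n → 10 ≤ (n : ℝ) ^ (η / 2) ∧ 2 * C₀ ≤ (n : ℝ) ^ (η / 2) ∧
      3 * a * Real.log n ≤ (n : ℝ) ^ η ∧ 10 * Real.log n ≤ (n : ℝ) ^ η ∧ 8 * C₀ ≤ (n : ℝ) ^ (b / 2) ∧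
      10000 ≤ n := by
  have T : ∀ {x : ℝ}, 0 < x → Filter.Tendsto (fun n : ℕ => (n : ℝ) ^ x) Filter.atTop Filter.atTop :=
    fun hx => (tendsto_rpow_atTop hx).comp tendsto_natCast_atTop_atTop
  have hlog : ∀ {A : ℝ}, 0 < A → ∀ᶠ n : ℕ in Filter.atTop, A * Real.log n ≤ (n : ℝ) ^ η := by
    intro A hA
    have h := tendsto_natCast_atTop_atTop.eventually
      ((isLittleO_log_rpow_atTop hη).bound (show 0 < 1 / A by positivity))
    filter_upwards [h] with n hn
    have h0 : (0 : ℝ) ≤ (n : ℝ) ^ η := Real.rpow_nonneg (Nat.cast_nonneg _) _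
    rw [Real.norm_eq_abs, Real.norm_eq_abs, abs_of_nonneg h0] at hn
    have := (le_abs_self _).trans hn
    calc A * Real.log n ≤ A * (1 / A * (n : ℝ) ^ η) := by gcongr
      _ = _ := by field_simp
  have := (((T (half_pos hη)).eventually_ge_atTop 10).and (((T (half_pos hη)).eventually_ge_atTop (2 * C₀)).and
    ((hlog (show 0 < 3 * a by positivity)).and ((hlog (show (0 : ℝ) < 10 by norm_num)).and
    (((T (half_pos hb)).eventually_ge_atTop (8 * C₀)).and (Filter.eventually_ge_atTop 10000))))))
  exact Filter.eventually_atTop.1 this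

section Regime
variable {n : ℕ} {d : Fin n → ℕ} {G H : SimpleGraph (Fin n)}

lemma lam_mul (hn : 2 ≤ n) (d : Fin n → ℕ) : lam n d * (n - 1) = dbar n d := by
  have : (2 : ℝ) ≤ n := by exact_mod_cast hn
  unfold lam
  rw [div_mul_cancel₀]
  linarith

lemma abs_sub_dbar_le (d : Fin n → ℕ) (v : Fin n) : |(d v : ℝ) - dbar n d| ≤ deltaPar n d :=
  le_ciSup (f := fun j : Fin n => |(d j : ℝ) - dbar n d|) (Set.finite_range _).bddAbove v

lemma pow_three_le_mu (hn : (n : ℝ) ≠ 0) (v : Fin n) : (deg H v : ℝ) ^ 3 ≤ n * mu n H 3 := by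
  rw [← sum_deg_pow hn]
  exact Finset.single_le_sum (f := fun u => (deg H u : ℝ) ^ 3) (fun _ _ => by positivity) (Finset.mem_univ v)

lemma regime {a b C₀ η : ℝ} (ha : 0 < a) (hη : 0 < η) (hη1 : 1200 * η ≤ b) (hb1 : b < 1 / 2)
    (h1 : 10 ≤ (n : ℝ) ^ (η / 2)) (h2 : 2 * C₀ ≤ (n : ℝ) ^ (η / 2))
    (h3 : 3 * a * Real.log n ≤ (n : ℝ) ^ η) (h4 : 10 * Real.log n ≤ (n : ℝ) ^ η)
    (h5 : 8 * C₀ ≤ (n : ℝ) ^ (b / 2)) (h6 : 10000 ≤ n) (hC₀ : 0 < C₀)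
    (hδ : deltaPar n d ≤ C₀ * (n : ℝ) ^ ((1 : ℝ) / 2 + η / 2))
    (hmin : min (dbar n d) ((n : ℝ) - dbar n d - 1) ≥ (n : ℝ) / (3 * a * Real.log n))
    {v : Fin n}
    (hv : (deg H v : ℝ) ≤ C₀ * (n : ℝ) ^ ((1 : ℝ) / 2 + η / 2))
    (hμ : (deltaPar n d) ^ 3 * mu n H 3 / ((lam n d) ^ 3 * (n : ℝ) ^ 2) ≤ C₀ * (n : ℝ) ^ (-b)) :
    Ctx (permFam n d) (lam n d) (deltaPar n d) (Rpar n d) ((n : ℝ) ^ η) (deg H v + 20) (√n) := by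
  have hn : (10000 : ℝ) ≤ n := by exact_mod_cast h6
  have hn0 : (0 : ℝ) < n := by linarith
  have hn1 : (1 : ℝ) ≤ n := by linarith
  have hnd : (n : ℝ) ≠ 0 := hn0.ne'
  have hrsq : √(n : ℝ) ^ 2 = n := Real.sq_sqrt hn0.le
  have hr : 0 < √(n : ℝ) := Real.sqrt_pos.2 hn0
  have hr1 : 100 ≤ √(n : ℝ) := Real.le_sqrt_of_sq_le (by linarith)
  have hlog : 0 < Real.log n := Real.log_pos (by linarith)
  have hlam := lam_mul (show 2 ≤ n by omega) d
  have hge : 1 / (3 * a * Real.log n) ≤ lam n d ∧ 1 / (3 * a * Real.log n) ≤ 1 - lam n d := by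
    have e : 1 / (3 * a * Real.log n) * (n - 1) ≤ n / (3 * a * Real.log n) := by
      rw [div_mul_eq_mul_div, one_mul]
      exact div_le_div_of_nonneg_right (by linarith) (by positivity)
    have hn2 : (0 : ℝ) < n - 1 := by linarith
    refine ⟨le_of_mul_le_mul_right ?_ hn2, le_of_mul_le_mul_right ?_ hn2⟩
    · linarith [hmin.le.trans (min_le_left _ _)]
    · linarith [hmin.le.trans (min_le_right _ _)]
  have hdl : 0 < 1 / (3 * a * Real.log n) := by positivity
  have hp : 0 < lam n d := by linarith
  set s : ℝ := (n : ℝ) ^ (η / 2) with hs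
  have hL : (n : ℝ) ^ η = s ^ 2 := by
    rw [hs, ← Real.rpow_mul_natCast hn0.le]; congr 1; push_cast; ring
  have hrs : (n : ℝ) ^ ((1 : ℝ) / 2 + η / 2) = √(n : ℝ) * s := by
    rw [Real.rpow_add hn0, ← Real.sqrt_eq_rpow]
  have hone : 1 ≤ s ^ 2 * (1 / (3 * a * Real.log n)) := by
    rw [mul_one_div, one_le_div (by positivity), ← hL]; exact h3
  have hCs : C₀ * (√(n : ℝ) * s) ≤ s ^ 2 * √n / 2 := by
    have : 0 < √(n : ℝ) * s := by positivity
    nlinarith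
  have hδ0 : 0 ≤ deltaPar n d := (abs_nonneg _).trans (abs_sub_dbar_le d v)
  rw [hrs] at hδ hv
  have hs2 : 100 ≤ s ^ 2 := by nlinarith
  have hLr : ∀ k : ℕ, ∀ x : ℝ, k * η ≤ x → (s ^ 2) ^ k ≤ (n : ℝ) ^ x := fun k x h => by
    rw [← hL, ← Real.rpow_mul_natCast hn0.le]
    exact Real.rpow_le_rpow_of_exponent_le hn1 (by linarith)
  have hL400 : (s ^ 2) ^ 400 ≤ √(n : ℝ) := by
    rw [Real.sqrt_eq_rpow]
    exact hLr 400 _ (by push_cast; linarith)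
  have hd0 : (0 : ℝ) ≤ deg H v := Nat.cast_nonneg _
  rw [hL]
  refine
    { clos := clos_permFam d
      r_sq := hrsq
      r_pos := hr
      p_pos := hp
      p_lt := by linarith [hge.2]
      one_le_Lp := hone.trans (mul_le_mul_of_nonneg_left hge.1 (by positivity))
      one_le_Lq := hone.trans (mul_le_mul_of_nonneg_left hge.2 (by positivity))
      L_ge := hs2
      δ_nonneg := hδ0
      δ_le := by
        have : 0 < s ^ 2 * √(n : ℝ) := by positivity
        linarith
      Hm_ge := by linarith
      Hm_le := by nlinarith
      δHm := ?_
      L_le := hL400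
      exp_L := by
        rw [← hL]
        refine le_trans (le_of_eq ?_) (Real.exp_le_exp.2 h4)
        rw [← Real.rpow_natCast, Real.rpow_def_of_pos hn0]; congr 1; push_cast; ring
      sum_dev := fun G hG => ?_
      sum_dev_sq := fun G hG => ?_
      dev_le := fun G hG u => ?_ }
  · have k1 : (s ^ 2) ^ 200 * (deltaPar n d * 20) ≤ n / 2 := by
      have i1 : (40 : ℝ) * (s ^ 2) ^ 201 ≤ √n := by
        refine le_trans ?_ hL400
        calc (40 : ℝ) * (s ^ 2) ^ 201 ≤ s ^ 2 * (s ^ 2) ^ 201 := by gcongr; linarith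
          _ = (s ^ 2) ^ 202 := by ring
          _ ≤ _ := pow_le_pow_right₀ (by linarith) (by norm_num)
      have i2 : deltaPar n d ≤ s ^ 2 * √n := by
        have : 0 < s ^ 2 * √(n : ℝ) := by positivity
        linarith
      calc _ ≤ (s ^ 2) ^ 200 * (s ^ 2 * √n * 20) := by gcongr
        _ = (40 * (s ^ 2) ^ 201) * √n / 2 := by ring
        _ ≤ √n * √n / 2 := by gcongr
        _ = n / 2 := by rw [← sq, hrsq]
    have k2 : (s ^ 2) ^ 200 * (deltaPar n d * deg H v) ≤ n / 2 := by
      have i1 : (deltaPar n d * deg H v) ^ 3 ≤ C₀ * (n : ℝ) ^ (-b) * n ^ 3 := by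
        rw [div_le_iff₀ (by positivity)] at hμ
        have hl1 : lam n d ^ 3 ≤ 1 := pow_le_one₀ hp.le (by linarith [hge.2])
        calc _ = deltaPar n d ^ 3 * (deg H v : ℝ) ^ 3 := by ring
          _ ≤ deltaPar n d ^ 3 * (n * mu n H 3) := by gcongr; exact pow_three_le_mu hnd v
          _ = deltaPar n d ^ 3 * mu n H 3 * n := by ring
          _ ≤ C₀ * (n : ℝ) ^ (-b) * (lam n d ^ 3 * n ^ 2) * n := by gcongr
          _ ≤ C₀ * (n : ℝ) ^ (-b) * (1 * n ^ 2) * n := by gcongr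
          _ = _ := by ring
      have i2 := hLr 600 (b / 2) (by push_cast; linarith)
      have i3 : (n : ℝ) ^ (b / 2) * ((n : ℝ) ^ (b / 2) * (n : ℝ) ^ (-b)) = 1 := by
        rw [← Real.rpow_add hn0, ← Real.rpow_add hn0, show b / 2 + (b / 2 + -b) = 0 by ring, Real.rpow_zero]
      refine le_of_pow_le_pow_left₀ three_ne_zero (by positivity) ?_
      calc ((s ^ 2) ^ 200 * (deltaPar n d * deg H v)) ^ 3 = (s ^ 2) ^ 600 * (deltaPar n d * deg H v) ^ 3 := by
            rw [mul_pow, ← pow_mul (s ^ 2)]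
        _ ≤ (n : ℝ) ^ (b / 2) * (C₀ * (n : ℝ) ^ (-b) * n ^ 3) := by gcongr
        _ = 8 * C₀ * ((n : ℝ) ^ (b / 2) * (n : ℝ) ^ (-b)) * (n / 2) ^ 3 := by ring
        _ ≤ (n : ℝ) ^ (b / 2) * ((n : ℝ) ^ (b / 2) * (n : ℝ) ^ (-b)) * (n / 2) ^ 3 := by gcongr
        _ = _ := by rw [i3, one_mul]
    linarith
  all_goals
    simp only [permFam, Finset.mem_filter, Finset.mem_univ, true_and] at hG
    obtain ⟨σ, hσ⟩ := hG
    simp only [hσ, hlam]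
  · rw [Equiv.sum_comp σ (fun v => (d v : ℝ) - dbar n d), Finset.sum_sub_distrib]
    simp [dbar]; field_simp; simp
  · rw [Equiv.sum_comp σ (fun v => ((d v : ℝ) - dbar n d) ^ 2)]
    unfold Rpar; field_simp
  · exact abs_sub_dbar_le d _

end Regime

theorem statement9 (a b C₀ : ℝ) (ha : 0 < a) (hb : 0 < b) (hab : a + b < 1 / 2)
    (hC₀ : 0 < C₀) :
    ∃ ε : ℝ, 0 < ε ∧ ∃ C : ℝ, 0 < C ∧ ∃ N : ℕ, ∀ n : ℕ, N ≤ n →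
      ∀ d : Fin n → ℕ, (degFinset n d).Nonempty →
        deltaPar n d ≤ C₀ * (n : ℝ) ^ ((1 : ℝ) / 2 + ε) →
        min (dbar n d) ((n : ℝ) - dbar n d - 1) ≥ (n : ℝ) / (3 * a * Real.log n) →
        ∀ H : SimpleGraph (Fin n), ∀ m : ℕ,
          (∑ j, deg H j) = 2 * m →
          (m : ℝ) ≤ C₀ * (n : ℝ) ^ ((1 : ℝ) + 2 * ε) →
          (∀ j, (deg H j : ℝ) ≤ C₀ * (n : ℝ) ^ ((1 : ℝ) / 2 + ε)) →
          (deltaPar n d) ^ 3 * mu n H 3 / ((lam n d) ^ 3 * (n : ℝ) ^ 2) ≤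
            C₀ * (n : ℝ) ^ (-b) →
          ∃ E : ℝ, |E| ≤ C * (n : ℝ) ^ (-b) ∧
            expCopies n d H =
              ((Nat.factorial n : ℝ) / (autCard H : ℝ)) * (lam n d) ^ m *
                Real.exp (
                  (1 - lam n d) / (4 * lam n d) *
                      ((mu n H 1) ^ 2 + 2 * mu n H 1 - 2 * mu n H 2)
                  - Rpar n d / (2 * (lam n d) ^ 2 * n) *
                      ((mu n H 1) ^ 2 + mu n H 1 - mu n H 2)
                  - (1 - (lam n d) ^ 2) / (6 * (lam n d) ^ 2 * n) * mu n H 3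
                  - (1 - lam n d) / (lam n d * (n : ℝ) ^ 2) *
                      ((∑ j, ∑ k, if H.Adj j k
                          then (deg H j : ℝ) * (deg H k : ℝ) else 0) / 2)
                  + E) := by
  obtain ⟨η, hη, hηa, hηb⟩ : ∃ η : ℝ, 0 < η ∧ 1200 * η ≤ a ∧ 1200 * η ≤ b :=
    ⟨min a b / 1200, by positivity, by linarith [min_le_left a b], by linarith [min_le_right a b]⟩
  obtain ⟨N, hN⟩ := exists_large a C₀ b η ha hb hη
  refine ⟨η / 2, half_pos hη, 15000 * C₀ + 1, by positivity, N, ?_⟩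
  intro n hNn d hd hδ hmin H m hm hmle hdeg hμ
  obtain ⟨h1, h2, h3, h4, h5, h6⟩ := hN n hNn
  have hn : (10000 : ℝ) ≤ n := by exact_mod_cast h6
  have hn0 : (0 : ℝ) < n := by linarith
  have hn1 : (1 : ℝ) ≤ n := by linarith
  have : Nonempty (Fin n) := ⟨⟨0, by omega⟩⟩
  obtain ⟨v, hv⟩ := Finite.exists_max fun j => deg H j
  have c := regime ha hη hηb (by linarith) h1 h2 h3 h4 h5 h6 hC₀ hδ hmin (hdeg v) hμ
  have hne := hd.mono (degFinset_subset_permFam d)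
  have hsumdeg : ∑ j, (deg H j : ℝ) = 2 * m := by exact_mod_cast hm
  have hsum : ∑ j, (deg H j : ℝ) + 16 ≤ ((n : ℝ) ^ η) ^ 2 * n := by
    rw [hsumdeg]
    have e : (n : ℝ) ^ ((1 : ℝ) + 2 * (η / 2)) = n * (n : ℝ) ^ η := by
      rw [Real.rpow_add hn0, Real.rpow_one]; congr 2; ring
    have e2 : (n : ℝ) ^ η = ((n : ℝ) ^ (η / 2)) ^ 2 := by
      rw [← Real.rpow_mul_natCast hn0.le]; congr 1; push_cast; ring
    have e3 : 4 * C₀ ≤ (n : ℝ) ^ η := by rw [e2]; nlinarith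
    rw [e] at hmle
    have hL := c.L_ge
    have : 0 < (n : ℝ) * (n : ℝ) ^ η := by positivity
    nlinarith
  obtain ⟨hfam, hlog⟩ := abs_log_prob_sub_le c hne
    (fun j => by have : (deg H j : ℝ) ≤ deg H v := by exact_mod_cast hv j
                 linarith) hsum
  have hmu : (n : ℝ) * mu n H 1 / 2 = m := by
    rw [← sum_deg hn0.ne', hsumdeg]; ring
  rw [hmu] at hlog
  have herr : ((n : ℝ) ^ η) ^ 83 / √n ≤ (n : ℝ) ^ (-b) := by
    rw [Real.sqrt_eq_rpow, ← Real.rpow_mul_natCast hn0.le, ← Real.rpow_sub hn0]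
    exact Real.rpow_le_rpow_of_exponent_le hn1 (by push_cast; linarith)
  refine ⟨Real.log (fam (permFam n d) H ⊥).card - Real.log (permFam n d).card - m * Real.log (lam n d) -
    mainExp H (lam n d) (Rpar n d), ?_, ?_⟩
  · refine hlog.trans ?_
    linarith [mul_le_mul_of_nonneg_left hμ (show (0 : ℝ) ≤ 15000 by norm_num)]
  · have hZ : (0 : ℝ) < (fam (permFam n d) H ⊥).card := by exact_mod_cast hfam.card_pos
    have hZ0 : (0 : ℝ) < (permFam n d).card := by exact_mod_cast hne.card_pos
    have hpm : lam n d ^ m = Real.exp (m * Real.log (lam n d)) := by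
      rw [mul_comm, ← Real.rpow_def_of_pos c.p_pos, Real.rpow_natCast]
    rw [expCopies_eq hd, ← edgeSum_eq, mul_assoc, hpm, ← Real.exp_add]
    congr 1
    rw [← Real.exp_log (div_pos hZ hZ0), Real.log_div hZ.ne' hZ0.ne']
    congr 1
    unfold mainExp
    ring

end Stmt9
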